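/- Let (ρ, u, B) be a smooth solution of the isentropic compressible MHD system with Navier-slip boundary conditions on Ω. Then for every 2 ≤ p < ∞ there is a constant C depending only on p, μ, and Ω such that: (i) ‖∇B‖_{L^p} ≤ C‖curl B‖_{L^p}; and (ii) ‖∇F‖_{L^p} + ‖∇²𝒫u‖_{L^p} + ‖∇ω‖_{L^p} ≤ C(‖ρu̇‖_{L^p} + ‖∇u‖_{L^p} + ‖B·∇B‖_{L^p}), where F is the effective viscous flux, ω = curl u, u̇ = u_t + u·∇u, and 𝒫 is the Leray–Helmholtz projection. -/

import Mathlib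

noncomputable section

open MeasureTheory Real Set Filter Topology Bornology

/-- Points of the plane (with an equivalent norm to the Euclidean one). -/
abbrev V2 := Fin 2 → ℝ

namespace MHD

/-- `i`-th partial derivative of a scalar field. -/
def pd (i : Fin 2) (f : V2 → ℝ) (x : V2) : ℝ :=
  fderiv ℝ f x (Pi.single i 1)

/-- Gradient of a scalar field. -/
def grad (f : V2 → ℝ) (x : V2) : V2 := fun i => pd i f x

/-- Divergence of a planar vector field. -/
def div2 (u : V2 → V2) (x : V2) : ℝ := ∑ i, pd i (fun y => u y i) x

/-- (Scalar) curl of a planar vector field. -/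
def curl2 (u : V2 → V2) (x : V2) : ℝ :=
  pd 0 (fun y => u y 1) x - pd 1 (fun y => u y 0) x

/-- Laplacian of a scalar field. -/
def lap (f : V2 → ℝ) (x : V2) : ℝ := ∑ j, pd j (pd j f) x

/-- Euclidean inner product on the plane. -/
def dot (a b : V2) : ℝ := ∑ i, a i * b i

/-- Squared Euclidean norm on the plane. -/
def nsq (a : V2) : ℝ := ∑ i, (a i) ^ 2

/-- Rotation by -90 degrees : `perp (n¹,n²) = (n²,−n¹)`. -/
def perp (v : V2) : V2 := ![v 1, -(v 0)]

/-- Squared Frobenius norm of the spatial gradient of a vector field. -/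
def gnsq (u : V2 → V2) (x : V2) : ℝ := ∑ i, ∑ j, (pd j (fun y => u y i) x) ^ 2

/-- Squared Frobenius norm of the second spatial gradient of a vector field. -/
def g2nsq (u : V2 → V2) (x : V2) : ℝ :=
  ∑ i, ∑ j, ∑ k, (pd k (fun y => pd j (fun z => u z i) y) x) ^ 2

/-- `Lᵖ(Ω)` norm of a scalar field. -/
def LpS (p : ℝ) (Ω : Set V2) (f : V2 → ℝ) : ℝ :=
  (∫ x in Ω, |f x| ^ p) ^ (1 / p)

/-- `Lᵖ(Ω)` norm of a vector field (Euclidean norm pointwise). -/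
def LpV (p : ℝ) (Ω : Set V2) (u : V2 → V2) : ℝ :=
  (∫ x in Ω, (nsq (u x)) ^ (p / 2)) ^ (1 / p)

/-- `Lᵖ(Ω)` norm of the gradient of a vector field. -/
def LpG (p : ℝ) (Ω : Set V2) (u : V2 → V2) : ℝ :=
  (∫ x in Ω, (gnsq u x) ^ (p / 2)) ^ (1 / p)

/-- `Lᵖ(Ω)` norm of the second gradient of a vector field. -/
def LpG2 (p : ℝ) (Ω : Set V2) (u : V2 → V2) : ℝ :=
  (∫ x in Ω, (g2nsq u x) ^ (p / 2)) ^ (1 / p)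

/-- Average of a scalar field over `Ω`. -/
def avg (Ω : Set V2) (f : V2 → ℝ) : ℝ := (∫ x in Ω, f x) / (volume Ω).toReal

/-- Time derivative of a time dependent scalar field. -/
def dt (f : ℝ → V2 → ℝ) (t : ℝ) (x : V2) : ℝ := deriv (fun s => f s x) t

/-- Time derivative of a time dependent vector field. -/
def dtV (u : ℝ → V2 → V2) (t : ℝ) (x : V2) : V2 := fun i => dt (fun s y => u s y i) t x

/-- Material derivative `u̇ = u_t + (u·∇)u` of the velocity field itself. -/
def matD (u : ℝ → V2 → V2) (t : ℝ) (x : V2) : V2 := fun i =>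
  dt (fun s y => u s y i) t x + dot (u t x) (grad (fun y => u t y i) x)

/-- The material derivative `(div u)· = (div u)_t + u·∇ div u`. -/
def divdot (u : ℝ → V2 → V2) (t : ℝ) (x : V2) : ℝ :=
  deriv (fun s => div2 (u s) x) t + dot (u t x) (grad (fun y => div2 (u t) y) x)

/-- Average pressure `P̄` at time `t`. -/
def Pbar (Ω : Set V2) (a γ : ℝ) (ρ : ℝ → V2 → ℝ) (t : ℝ) : ℝ :=
  avg Ω (fun x => a * ρ t x ^ γ)

/-- Effective viscous flux `F = (2μ+λ) div u − (P − P̄) − |B|²/2`. -/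
def Fflux (Ω : Set V2) (a γ μ lam : ℝ) (ρ : ℝ → V2 → ℝ) (u B : ℝ → V2 → V2)
    (t : ℝ) (x : V2) : ℝ :=
  (2 * μ + lam) * div2 (u t) x - (a * ρ t x ^ γ - Pbar Ω a γ ρ t) - nsq (B t x) / 2

/-- Potential energy density `G(ρ)`. -/
def Gpot (a γ ρb : ℝ) (r : ℝ) : ℝ :=
  r * ∫ ξ in ρb..r, (a * ξ ^ γ - a * ρb ^ γ) / ξ ^ 2

/-- Initial total energy `C₀`. -/
def C0 (Ω : Set V2) (a γ : ℝ) (ρ₀ : V2 → ℝ) (u₀ B₀ : V2 → V2) : ℝ :=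
  ∫ x in Ω, (ρ₀ x * nsq (u₀ x) / 2 + nsq (B₀ x) / 2 + Gpot a γ (avg Ω ρ₀) (ρ₀ x))

/-- The time weight `σ(t) = min{1,t}`. -/
def tw (t : ℝ) : ℝ := min 1 t

/-- Smoothness (in time and space) of a time dependent scalar field. -/
def Smooth2 (f : ℝ → V2 → ℝ) : Prop := ContDiff ℝ (⊤ : ℕ∞) (fun p : ℝ × V2 => f p.1 p.2)

/-- Smoothness (in time and space) of a time dependent vector field. -/
def Smooth2V (u : ℝ → V2 → V2) : Prop := ∀ i, Smooth2 (fun t x => u t x i)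

/-- A bounded domain with smooth boundary, given by a smooth defining function `φ`,
with outward unit normal `n` on the boundary. -/
structure SmoothDomain (Ω : Set V2) (n : V2 → V2) : Prop where
  nonempty : Ω.Nonempty
  bounded : IsBounded Ω
  defining : ∃ φ : V2 → ℝ, ContDiff ℝ (⊤ : ℕ∞) φ ∧ Ω = {x | φ x < 0} ∧
      frontier Ω = {x | φ x = 0} ∧
      (∀ x ∈ frontier Ω, grad φ x ≠ 0) ∧
      (∀ x ∈ frontier Ω, n x = (Real.sqrt (nsq (grad φ x)))⁻¹ • grad φ x)

/-- Outward unit normal on the boundary of a convex domain, characterized by the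
supporting hyperplane property. -/
def ConvexOuterNormal (Ω : Set V2) (n : V2 → V2) : Prop :=
  ∀ x ∈ frontier Ω, nsq (n x) = 1 ∧ ∀ y ∈ closure Ω, dot (n x) (y - x) ≤ 0

/-- Membership in `H¹(Ω)` for (a smooth representative of) a vector field. -/
def InH1V (Ω : Set V2) (f : V2 → V2) : Prop :=
  (∀ i, Differentiable ℝ fun x => f x i) ∧
  IntegrableOn (fun x => nsq (f x)) Ω volume ∧ IntegrableOn (fun x => gnsq f x) Ω volume

/-- Classical (pointwise) solution of the isentropic compressible MHD system with
Navier-slip boundary conditions, for times in the set `I`. -/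
structure IsMHDSol (Ω : Set V2) (n : V2 → V2) (a γ μ lam ν : ℝ) (I : Set ℝ)
    (ρ : ℝ → V2 → ℝ) (u B : ℝ → V2 → V2) : Prop where
  mass : ∀ t ∈ I, ∀ x ∈ Ω,
    dt ρ t x + div2 (fun y j => ρ t y * u t y j) x = 0
  momentum : ∀ t ∈ I, ∀ x ∈ Ω, ∀ i,
    dt (fun s y => ρ s y * u s y i) t x
      + (∑ j, pd j (fun y => ρ t y * u t y i * u t y j) x)
      + pd i (fun y => a * ρ t y ^ γ) x
    = μ * lap (fun y => u t y i) x
      + (μ + lam) * pd i (fun y => div2 (u t) y) x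
      + dot (B t x) (grad (fun y => B t y i) x)
      - pd i (fun y => nsq (B t y)) x / 2
  magnetic : ∀ t ∈ I, ∀ x ∈ Ω, ∀ i,
    dt (fun s y => B s y i) t x + dot (u t x) (grad (fun y => B t y i) x)
      - dot (B t x) (grad (fun y => u t y i) x) + B t x i * div2 (u t) x
    = ν * lap (fun y => B t y i) x
  divB : ∀ t ∈ I, ∀ x ∈ Ω, div2 (B t) x = 0
  slipU : ∀ t ∈ I, ∀ x ∈ frontier Ω, dot (u t x) (n x) = 0 ∧ curl2 (u t) x = 0
  slipB : ∀ t ∈ I, ∀ x ∈ frontier Ω, dot (B t x) (n x) = 0 ∧ curl2 (B t) x = 0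


set_option linter.unusedVariables false

section

/-- Smooth functions. -/
abbrev Sm (f : V2 → ℝ) : Prop := ContDiff ℝ (⊤ : ℕ∞) f

lemma Sm.one {f : V2 → ℝ} (hf : Sm f) : ContDiff ℝ 1 f := hf.of_le (by exact_mod_cast le_top)
lemma Sm.two {f : V2 → ℝ} (hf : Sm f) : ContDiff ℝ 2 f := contDiff_infty.1 hf 2
lemma Sm.diff {f : V2 → ℝ} (hf : Sm f) : Differentiable ℝ f := hf.one.differentiable (by norm_num)
lemma Sm.cont {f : V2 → ℝ} (hf : Sm f) : Continuous f := hf.continuous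

lemma C1.diff {f : V2 → ℝ} (hf : ContDiff ℝ 1 f) : Differentiable ℝ f :=
  hf.differentiable (by norm_num)

lemma C1.pd_cont {f : V2 → ℝ} (hf : ContDiff ℝ 1 f) (i : Fin 2) : Continuous (pd i f) := by
  unfold pd
  exact (hf.continuous_fderiv (by norm_num)).clm_apply continuous_const

lemma C2.pd_C1 {f : V2 → ℝ} (hf : ContDiff ℝ 2 f) (i : Fin 2) : ContDiff ℝ 1 (pd i f) := by
  unfold pd
  have : ContDiff ℝ 1 (fderiv ℝ f) := hf.fderiv_right (by norm_num)
  exact this.clm_apply contDiff_const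

lemma Sm.pd {f : V2 → ℝ} (hf : Sm f) (i : Fin 2) : Sm (pd i f) := by
  unfold MHD.pd
  have : ContDiff ℝ (⊤ : ℕ∞) (fderiv ℝ f) := hf.fderiv_right (by exact_mod_cast le_top)
  exact this.clm_apply contDiff_const

lemma pd_add {f g : V2 → ℝ} {x : V2} (i : Fin 2) (hf : DifferentiableAt ℝ f x)
    (hg : DifferentiableAt ℝ g x) : pd i (fun y => f y + g y) x = pd i f x + pd i g x := by
  unfold pd; rw [fderiv_fun_add hf hg]; rfl

lemma pd_sub {f g : V2 → ℝ} {x : V2} (i : Fin 2) (hf : DifferentiableAt ℝ f x)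
    (hg : DifferentiableAt ℝ g x) : pd i (fun y => f y - g y) x = pd i f x - pd i g x := by
  unfold pd; rw [fderiv_fun_sub hf hg]; rfl

lemma pd_neg {f : V2 → ℝ} {x : V2} (i : Fin 2) : pd i (fun y => - f y) x = - pd i f x := by
  unfold pd; rw [fderiv_fun_neg]; rfl

lemma pd_const {c : ℝ} {x : V2} (i : Fin 2) : pd i (fun _ => c) x = 0 := by
  unfold pd; simp

lemma pd_mul {f g : V2 → ℝ} {x : V2} (i : Fin 2) (hf : DifferentiableAt ℝ f x)
    (hg : DifferentiableAt ℝ g x) :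
    pd i (fun y => f y * g y) x = f x * pd i g x + g x * pd i f x := by
  unfold pd; rw [fderiv_fun_mul hf hg]; simp

lemma pd_const_mul {f : V2 → ℝ} {x : V2} (i : Fin 2) (c : ℝ) (hf : DifferentiableAt ℝ f x) :
    pd i (fun y => c * f y) x = c * pd i f x := by
  rw [pd_mul i (differentiableAt_const c) hf, pd_const]; ring

lemma pd_congr {f g : V2 → ℝ} {x : V2} (i : Fin 2) (h : f =ᶠ[𝓝 x] g) : pd i f x = pd i g x := by
  unfold pd; rw [h.fderiv_eq]

lemma pd_congr_on {f g : V2 → ℝ} {Ω : Set V2} (ho : IsOpen Ω) {x : V2} (hx : x ∈ Ω) (i : Fin 2)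
    (h : ∀ y ∈ Ω, f y = g y) : pd i f x = pd i g x :=
  pd_congr i (by filter_upwards [ho.mem_nhds hx] with y hy using h y hy)

lemma pd_comp {f : V2 → ℝ} {g : ℝ → ℝ} {g' : ℝ} {x : V2} (i : Fin 2) (hf : DifferentiableAt ℝ f x)
    (hg : HasDerivAt g g' (f x)) : pd i (fun y => g (f y)) x = g' * pd i f x := by
  unfold pd
  have := (hg.hasFDerivAt.comp x hf.hasFDerivAt).fderiv
  rw [show (fun y => g (f y)) = g ∘ f from rfl, this]; simp [mul_comm]

lemma pd_coord (i j : Fin 2) (x : V2) : pd i (fun y => y j) x = if i = j then 1 else 0 := by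
  unfold pd
  have : HasFDerivAt (fun y : V2 => y j) (ContinuousLinearMap.proj (R := ℝ) (φ := fun _ : Fin 2 => ℝ) j) x :=
    (ContinuousLinearMap.proj (R := ℝ) (φ := fun _ : Fin 2 => ℝ) j).hasFDerivAt
  rw [this.fderiv]; simp [Pi.single_apply, eq_comm]

lemma pd_comm {f : V2 → ℝ} (hf : ContDiff ℝ 2 f) (i j : Fin 2) (x : V2) :
    pd i (pd j f) x = pd j (pd i f) x := by
  have h := (hf.contDiffAt (x := x)).isSymmSndFDerivAt (by simp)
  have key : ∀ a b : V2, fderiv ℝ (fun y => fderiv ℝ f y b) x a = fderiv ℝ (fderiv ℝ f) x a b := by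
    intro a b
    have hd : DifferentiableAt ℝ (fderiv ℝ f) x :=
      (hf.fderiv_right (m := 1) (by norm_num)).differentiable (by norm_num) x
    rw [fderiv_clm_apply hd (differentiableAt_const b)]; simp
  unfold pd
  rw [key, key]; exact h _ _

/-- fderiv applied to a vector via partial derivatives -/
lemma fderiv_apply_eq {f : V2 → ℝ} (x v : V2) :
    fderiv ℝ f x v = v 0 * pd 0 f x + v 1 * pd 1 f x := by
  have : v = v 0 • Pi.single 0 1 + v 1 • Pi.single 1 1 := by
    ext i; fin_cases i <;> simp
  unfold pd
  conv_lhs => rw [this]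
  simp

lemma pd_hasDerivAt {f : V2 → ℝ} (i : Fin 2) (y : Fin 1 → ℝ) (s : ℝ)
    (hf : DifferentiableAt ℝ f (i.insertNth s y : V2)) :
    HasDerivAt (fun r => f (i.insertNth r y : V2)) (pd i f (i.insertNth s y : V2)) s := by
  have h1 : HasDerivAt (fun r : ℝ => (i.insertNth r y : V2)) (Pi.single i 1) s := by
    rw [hasDerivAt_pi]
    intro j
    rcases eq_or_ne j i with rfl | h
    · simpa using hasDerivAt_id' s
    · obtain ⟨k, rfl⟩ := Fin.exists_succAbove_eq h
      simpa using hasDerivAt_const s (y k)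
  exact hf.hasFDerivAt.comp_hasDerivAt s h1

lemma cont_insert (i : Fin 2) (y : Fin 1 → ℝ) : Continuous (fun r : ℝ => (i.insertNth r y : V2)) := by
  refine continuous_pi fun j => ?_
  rcases eq_or_ne j i with rfl | h
  · simpa using continuous_id'
  · obtain ⟨k, rfl⟩ := Fin.exists_succAbove_eq h
    simpa using continuous_const

lemma integral_slice (i : Fin 2) {g : V2 → ℝ} (hg : Integrable g) :
    ∫ x, g x = ∫ y : Fin 1 → ℝ, ∫ s : ℝ, g (i.insertNth s y : V2) := by
  have hm := (volume_preserving_piFinSuccAbove (fun _ : Fin 2 => ℝ) i).symm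
  have e := (MeasurableEquiv.piFinSuccAbove (fun _ : Fin 2 => ℝ) i)
  have h1 : ∫ x, g x = ∫ z : ℝ × (Fin 1 → ℝ),
      g ((MeasurableEquiv.piFinSuccAbove (fun _ : Fin 2 => ℝ) i).symm z) :=
    (hm.integral_comp (MeasurableEquiv.measurableEmbedding _) g).symm
  have h2 : Integrable (fun z : ℝ × (Fin 1 → ℝ) =>
      g ((MeasurableEquiv.piFinSuccAbove (fun _ : Fin 2 => ℝ) i).symm z)) :=
    (hm.integrable_comp_emb (MeasurableEquiv.measurableEmbedding _)).2 hg
  rw [h1]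
  rw [MeasureTheory.Measure.volume_eq_prod, integral_prod_symm _ (by simpa [MeasureTheory.Measure.volume_eq_prod] using h2)]
  rfl

lemma int1D {S : Set ℝ} (ho : IsOpen S) (hc : Convex ℝ S) (hb : IsBounded S) {f f' : ℝ → ℝ}
    (hf : ∀ s, HasDerivAt f (f' s) s) (hf' : Continuous f') (h0 : ∀ s ∈ frontier S, f s = 0) :
    ∫ s in S, f' s = 0 := by
  rcases S.eq_empty_or_nonempty with rfl | hne
  · simp
  have hS : S = Ioo (sInf S) (sSup S) := by
    apply Subset.antisymm
    · intro x hx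
      obtain ⟨ε, hε, hB⟩ := Metric.isOpen_iff.1 ho x hx
      have a1 : x - ε/2 ∈ S := hB (by simp [abs_of_pos hε]; linarith)
      have a2 : x + ε/2 ∈ S := hB (by simp [abs_of_pos hε]; linarith)
      have := csInf_le hb.bddBelow a1
      have := le_csSup hb.bddAbove a2
      constructor <;> linarith
    · exact IsConnected.Ioo_csInf_csSup_subset ⟨hne, hc.isPreconnected⟩ hb.bddBelow hb.bddAbove
  set a := sInf S with ha
  set b := sSup S with hbb
  have hab : a < b := by
    obtain ⟨x, hx⟩ := hne; rw [hS] at hx; exact hx.1.trans hx.2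
  rw [hS] at h0 ⊢
  rw [frontier_Ioo hab] at h0
  rw [← integral_Ioc_eq_integral_Ioo, ← intervalIntegral.integral_of_le hab.le,
    intervalIntegral.integral_eq_sub_of_hasDerivAt (fun s _ => hf s) (hf'.intervalIntegrable _ _),
    h0 a (by simp), h0 b (by simp), sub_zero]

lemma cont_int {Ω : Set V2} (hb : IsBounded Ω) {f : V2 → ℝ} (hf : Continuous f) :
    IntegrableOn f Ω :=
  (hf.continuousOn.integrableOn_compact hb.isCompact_closure).mono_set subset_closure

/-- Integration of a derivative over a convex domain. -/
lemma ibp {Ω : Set V2} (ho : IsOpen Ω) (hc : Convex ℝ Ω) (hb : IsBounded Ω) {f : V2 → ℝ}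
    (hf : ContDiff ℝ 1 f) (h0 : ∀ x ∈ frontier Ω, f x = 0) (i : Fin 2) :
    ∫ x in Ω, pd i f x = 0 := by
  have hi : Integrable (Ω.indicator (pd i f)) :=
    (integrable_indicator_iff ho.measurableSet).2 (cont_int hb (C1.pd_cont hf i))
  rw [← integral_indicator ho.measurableSet, integral_slice i hi]
  have : ∀ y : Fin 1 → ℝ, ∫ s : ℝ, Ω.indicator (pd i f) (i.insertNth s y : V2) = 0 := by
    intro y
    set ι : ℝ → V2 := fun s => (i.insertNth s y : V2) with hι
    have hιc : Continuous ι := cont_insert i y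
    have h1 : (fun s => Ω.indicator (pd i f) (ι s)) = (ι ⁻¹' Ω).indicator (fun s => pd i f (ι s)) := by
      ext s; simp [indicator]; rfl
    change ∫ s : ℝ, Ω.indicator (pd i f) (ι s) = 0
    rw [h1, integral_indicator (ho.preimage hιc).measurableSet]
    refine int1D (f := fun s => f (ι s)) (ho.preimage hιc) ?_ ?_ ?_ ?_ ?_
    · intro s hs t ht a b ha hb' hab
      have := hc hs ht ha hb' hab
      have e : a • ι s + b • ι t = ι (a • s + b • t) := by
        ext j
        rcases eq_or_ne j i with rfl | h
        · simp [hι]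
        · obtain ⟨k, rfl⟩ := Fin.exists_succAbove_eq h
          simp [hι]; rw [← add_mul, hab, one_mul]
      rw [e] at this; exact this
    · obtain ⟨C, hC⟩ := hb.exists_norm_le
      refine (isBounded_iff_forall_norm_le).2 ⟨C, fun s hs => ?_⟩
      have h2 := (norm_le_pi_norm (ι s) i).trans (hC _ hs)
      simpa [hι] using h2
    · intro s
      exact pd_hasDerivAt i y s (C1.diff hf _)
    · exact (C1.pd_cont hf i).comp hιc
    · intro s hs
      apply h0
      have h2 := hιc.frontier_preimage_subset Ω hs
      exact h2
  simp [this]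
end

section

section PI
variable {P Y F : Type} [NormedAddCommGroup P] [NormedSpace ℝ P] [ProperSpace P]
  [NormedAddCommGroup Y] [NormedSpace ℝ Y] [SecondCountableTopology Y] [MeasurableSpace Y] [BorelSpace Y]
  [NormedAddCommGroup F] [NormedSpace ℝ F]

lemma param_hasFDerivAt (μ : Measure Y) [IsFiniteMeasureOnCompacts μ] {U : Set P} {W S : Set Y}
    (hU : IsOpen U) (hW : IsOpen W) (hS : IsCompact S) (hSW : S ⊆ W) {f : Y → ℝ}
    (hf : Continuous f) {k : P × Y → F} (hk : ContDiffOn ℝ (⊤ : ℕ∞) k (U ×ˢ W)) {p : P} (hp : p ∈ U) :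
    HasFDerivAt (fun p => ∫ y in S, f y • k (p, y) ∂μ)
      (∫ y in S, f y • (fderiv ℝ k (p, y)).comp (ContinuousLinearMap.inl ℝ P Y) ∂μ) p := by
  have hUW : IsOpen (U ×ˢ W) := hU.prod hW
  obtain ⟨ε, hε, hB⟩ := Metric.nhds_basis_closedBall.mem_iff.1 (hU.mem_nhds hp)
  have hkc : ContinuousOn k (U ×ˢ W) := hk.continuousOn
  have hk' : ContinuousOn (fderiv ℝ k) (U ×ˢ W) :=
    hk.continuousOn_fderiv_of_isOpen hUW (by exact_mod_cast le_top)
  have hd' : ∀ p ∈ U, ContinuousOn (fun y => fderiv ℝ k (p, y)) S := fun p hp =>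
    hk'.comp (by fun_prop) (fun y hy => ⟨hp, hSW hy⟩)
  have hK : IsCompact (Metric.closedBall p ε ×ˢ S) := (isCompact_closedBall p ε).prod hS
  have hcF : ContinuousOn (fun z : P × Y => f z.2 • (fderiv ℝ k z).comp (ContinuousLinearMap.inl ℝ P Y))
      (Metric.closedBall p ε ×ˢ S) := by
    refine ContinuousOn.fun_smul (by fun_prop) ?_
    refine ContinuousOn.clm_comp ?_ continuousOn_const
    exact hk'.mono (prod_mono hB hSW)
  obtain ⟨C, hC⟩ := hK.exists_bound_of_continuousOn hcF
  have hkS : ∀ p ∈ U, ContinuousOn (fun y => f y • k (p, y)) S := fun p hp =>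
    hf.continuousOn.smul (hkc.comp (by fun_prop) (fun y hy => ⟨hp, hSW hy⟩))
  refine hasFDerivAt_integral_of_dominated_of_fderiv_le (bound := fun _ => C)
    (F' := fun p y => f y • (fderiv ℝ k (p, y)).comp (ContinuousLinearMap.inl ℝ P Y))
    (Metric.closedBall_mem_nhds p hε) ?_ ?_ ?_ ?_ ?_ ?_
  · filter_upwards [hU.mem_nhds hp] with q hq
    exact (hkS q hq).aestronglyMeasurable hS.measurableSet
  · exact (hkS p hp).integrableOn_compact hS
  · exact (hf.continuousOn.smul ((hd' p hp).clm_comp continuousOn_const)).aestronglyMeasurable hS.measurableSet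
  · filter_upwards [ae_restrict_mem hS.measurableSet] with y hy q hq
    exact hC (q, y) ⟨hq, hy⟩
  · have : IsFiniteMeasure (μ.restrict S) := ⟨by simpa using hS.measure_lt_top⟩
    exact integrable_const _
  · filter_upwards [ae_restrict_mem hS.measurableSet] with y hy q hq
    have h1 : HasFDerivAt k (fderiv ℝ k (q, y)) (q, y) :=
      ((hk.contDiffAt (hUW.mem_nhds ⟨hB hq, hSW hy⟩)).differentiableAt (by simp)).hasFDerivAt
    exact (h1.comp q (hasFDerivAt_prodMk_left q y)).const_smul (f y)

end PI

lemma param_contDiffOn_nat {P Y : Type} [NormedAddCommGroup P] [NormedSpace ℝ P] [ProperSpace P]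
    [NormedAddCommGroup Y] [NormedSpace ℝ Y] [SecondCountableTopology Y] [MeasurableSpace Y] [BorelSpace Y]
    (μ : Measure Y) [IsFiniteMeasureOnCompacts μ] {U : Set P} {W S : Set Y}
    (hU : IsOpen U) (hW : IsOpen W) (hS : IsCompact S) (hSW : S ⊆ W) {f : Y → ℝ}
    (hf : Continuous f) (n : ℕ) : ∀ {F : Type} [NormedAddCommGroup F] [NormedSpace ℝ F]
    {k : P × Y → F} (_ : ContDiffOn ℝ (⊤ : ℕ∞) k (U ×ˢ W)),
    ContDiffOn ℝ n (fun p => ∫ y in S, f y • k (p, y) ∂μ) U := by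
  induction n with
  | zero =>
    intro F _ _ k hk
    simp only [CharP.cast_eq_zero, contDiffOn_zero]
    exact fun p hp => (param_hasFDerivAt μ hU hW hS hSW hf hk hp).continuousAt.continuousWithinAt
  | succ n ih =>
    intro F _ _ k hk
    have hk2 : ContDiffOn ℝ (⊤ : ℕ∞)
        (fun z => (fderiv ℝ k z).comp (ContinuousLinearMap.inl ℝ P Y)) (U ×ˢ W) :=
      (hk.fderiv_of_isOpen (hU.prod hW) (by exact_mod_cast le_top)).clm_comp contDiffOn_const
    have := ih hk2
    rw [show ((n + 1 : ℕ) : WithTop ℕ∞) = (n : WithTop ℕ∞) + 1 by push_cast; rfl]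
    rw [contDiffOn_succ_iff_fderiv_of_isOpen hU]
    refine ⟨fun p hp => (param_hasFDerivAt μ hU hW hS hSW hf hk hp).differentiableAt.differentiableWithinAt,
      by simp, ?_⟩
    refine this.congr fun p hp => ?_
    exact (param_hasFDerivAt μ hU hW hS hSW hf hk hp).fderiv

lemma param_contDiffOn {P Y : Type} [NormedAddCommGroup P] [NormedSpace ℝ P] [ProperSpace P]
    [NormedAddCommGroup Y] [NormedSpace ℝ Y] [SecondCountableTopology Y] [MeasurableSpace Y] [BorelSpace Y]
    (μ : Measure Y) [IsFiniteMeasureOnCompacts μ] {U : Set P} {W S : Set Y}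
    (hU : IsOpen U) (hW : IsOpen W) (hS : IsCompact S) (hSW : S ⊆ W) {f : Y → ℝ}
    (hf : Continuous f) {F : Type} [NormedAddCommGroup F] [NormedSpace ℝ F]
    {k : P × Y → F} (hk : ContDiffOn ℝ (⊤ : ℕ∞) k (U ×ˢ W)) :
    ContDiffOn ℝ (⊤ : ℕ∞) (fun p => ∫ y in S, f y • k (p, y) ∂μ) U :=
  contDiffOn_infty.2 fun n => param_contDiffOn_nat μ hU hW hS hSW hf n hk

/-- Directional derivative of a parameter integral. -/
lemma param_lineDeriv {P Y : Type} [NormedAddCommGroup P] [NormedSpace ℝ P] [ProperSpace P]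
    [NormedAddCommGroup Y] [NormedSpace ℝ Y] [SecondCountableTopology Y] [MeasurableSpace Y] [BorelSpace Y]
    (μ : Measure Y) [IsFiniteMeasureOnCompacts μ] {U : Set P} {W S : Set Y}
    (hU : IsOpen U) (hW : IsOpen W) (hS : IsCompact S) (hSW : S ⊆ W) {f : Y → ℝ}
    (hf : Continuous f) {k : P × Y → ℝ} (hk : ContDiffOn ℝ (⊤ : ℕ∞) k (U ×ˢ W)) {p : P} (hp : p ∈ U)
    (v : P) {k' : Y → ℝ} (hk' : ∀ y ∈ S, fderiv ℝ k (p, y) (v, 0) = k' y) :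
    fderiv ℝ (fun p => ∫ y in S, f y • k (p, y) ∂μ) p v = ∫ y in S, f y • k' y ∂μ := by
  rw [(param_hasFDerivAt μ hU hW hS hSW hf hk hp).fderiv]
  have hc : ContinuousOn (fun y => f y • (fderiv ℝ k (p, y)).comp (ContinuousLinearMap.inl ℝ P Y)) S := by
    apply hf.continuousOn.smul (ContinuousOn.clm_comp _ continuousOn_const)
    exact (hk.continuousOn_fderiv_of_isOpen (hU.prod hW) (by exact_mod_cast le_top)).comp
      (by fun_prop) (fun y hy => ⟨hp, hSW hy⟩)
  rw [ContinuousLinearMap.integral_apply (hc.integrableOn_compact hS)]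
  refine setIntegral_congr_fun hS.measurableSet fun y hy => ?_
  simp [← hk' y hy]
end

section

/-- continuous with compact support -/
structure Cc (f : V2 → ℝ) : Prop where
  cont : Continuous f
  supp : HasCompactSupport f

/-- upper half space-time -/
def UT : Set (ℝ × V2) := {z | 0 < z.1}

lemma UT_open : IsOpen UT := isOpen_lt continuous_const continuous_fst

/-- convolution type operator -/
def Hop (K : ℝ → V2 → ℝ) (f : V2 → ℝ) (t : ℝ) (x : V2) : ℝ := ∫ y, f y * K t (x - y)

lemma Hop_eq (K : ℝ → V2 → ℝ) (f : V2 → ℝ) (t : ℝ) (x : V2) :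
    Hop K f t x = ∫ y in tsupport f, f y • K t (x - y) := by
  unfold Hop
  rw [setIntegral_eq_integral_of_forall_compl_eq_zero]
  · rfl
  · intro y hy
    simp [image_eq_zero_of_notMem_tsupport hy]

/-- smooth kernels on positive times -/
def SK (K : ℝ → V2 → ℝ) : Prop := ContDiffOn ℝ (⊤ : ℕ∞) (fun z : ℝ × V2 => K z.1 z.2) UT

lemma SK.shift {K : ℝ → V2 → ℝ} (hK : SK K) :
    ContDiffOn ℝ (⊤ : ℕ∞) (fun z : (ℝ × V2) × V2 => K z.1.1 (z.1.2 - z.2)) (UT ×ˢ univ) := by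
  have h : ContDiff ℝ (⊤ : ℕ∞) (fun z : (ℝ × V2) × V2 => (z.1.1, z.1.2 - z.2)) := by fun_prop
  exact ContDiffOn.comp (g := fun z : ℝ × V2 => K z.1 z.2) hK h.contDiffOn (fun z hz => hz.1)

lemma Hop_smooth {K : ℝ → V2 → ℝ} (hK : SK K) {f : V2 → ℝ} (hf : Cc f) : SK (Hop K f) := by
  have := param_contDiffOn (volume : Measure V2) UT_open isOpen_univ hf.supp (subset_univ _) hf.cont hK.shift
  exact this.congr fun z _ => Hop_eq K f z.1 z.2

lemma Hop_deriv {K K' : ℝ → V2 → ℝ} (hK : SK K) {f : V2 → ℝ} (hf : Cc f) {t : ℝ} (ht : 0 < t) (x : V2)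
    (v : ℝ × V2) (h : ∀ x, HasDerivAt (fun r : ℝ => K (t + r * v.1) (x + r • v.2)) (K' t x) 0) :
    HasDerivAt (fun r : ℝ => Hop K f (t + r * v.1) (x + r • v.2)) (Hop K' f t x) 0 := by
  have hp : (t, x) ∈ UT := ht
  have hd := param_hasFDerivAt (volume : Measure V2) UT_open isOpen_univ hf.supp (subset_univ _) hf.cont hK.shift hp
  have hl := param_lineDeriv (volume : Measure V2) UT_open isOpen_univ hf.supp (subset_univ _) hf.cont hK.shift hp v
    (k' := fun y => K' t (x - y)) (by
      intro y _
      have h1 : HasFDerivAt _ _ (((t, x), y) : (ℝ × V2) × V2) :=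
        ((hK.shift.contDiffAt ((UT_open.prod isOpen_univ).mem_nhds
        (show ((t, x), y) ∈ UT ×ˢ univ from ⟨hp, mem_univ _⟩))).differentiableAt (by simp)).hasFDerivAt
      have h2 : HasDerivAt (fun r : ℝ => ((((t + r * v.1), x + r • v.2), y) : (ℝ × V2) × V2)) (v, 0) 0 := by
        refine HasDerivAt.prodMk (HasDerivAt.prodMk ?_ ?_) (hasDerivAt_const _ _)
        · simpa using ((hasDerivAt_id (0:ℝ)).mul_const v.1).const_add t
        · simpa using ((hasDerivAt_id (0:ℝ)).smul_const v.2).const_add x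
      have h3 := HasFDerivAt.comp_hasDerivAt_of_eq (0:ℝ) h1 h2 (by simp)
      have h4 := h (x - y)
      refine h3.unique (h4.congr_of_eventuallyEq (Eventually.of_forall fun r => ?_))
      simp only [Function.comp]
      congr 1; abel)
  have h2 : HasDerivAt (fun r : ℝ => (((t + r * v.1), x + r • v.2) : ℝ × V2)) v 0 := by
    refine HasDerivAt.prodMk ?_ ?_
    · simpa using ((hasDerivAt_id (0:ℝ)).mul_const v.1).const_add t
    · simpa using ((hasDerivAt_id (0:ℝ)).smul_const v.2).const_add x
  have h3 := HasFDerivAt.comp_hasDerivAt_of_eq (0:ℝ) hd h2 (by simp)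
  rw [← hd.fderiv, hl] at h3
  rw [Hop_eq]
  refine h3.congr_of_eventuallyEq (Eventually.of_forall fun r => ?_)
  simp [Hop_eq, Function.comp]

lemma SK.slice {K : ℝ → V2 → ℝ} (hK : SK K) {t : ℝ} (ht : 0 < t) : Sm (K t) := by
  have : ContDiff ℝ (⊤ : ℕ∞) (fun x : V2 => (t, x)) := by fun_prop
  exact contDiffOn_univ.1 (ContDiffOn.comp (g := fun z : ℝ × V2 => K z.1 z.2) hK this.contDiffOn (fun z _ => ht))

lemma pd_of_line {f : V2 → ℝ} {x : V2} (i : Fin 2) (hf : DifferentiableAt ℝ f x) {c : ℝ}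
    (h : HasDerivAt (fun r : ℝ => f (x + r • Pi.single i 1)) c 0) : pd i f x = c := by
  have h2 : HasDerivAt (fun r : ℝ => (x + r • Pi.single i (1:ℝ) : V2)) (Pi.single i 1) 0 := by
    simpa using ((hasDerivAt_id (0:ℝ)).smul_const (Pi.single i (1:ℝ) : V2)).const_add x
  exact (HasFDerivAt.comp_hasDerivAt_of_eq (0:ℝ) hf.hasFDerivAt h2 (by simp)).unique h

lemma line_of_pd {f : V2 → ℝ} {x : V2} (i : Fin 2) (hf : DifferentiableAt ℝ f x) :
    HasDerivAt (fun r : ℝ => f (x + r • Pi.single i 1)) (pd i f x) 0 := by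
  have h2 : HasDerivAt (fun r : ℝ => (x + r • Pi.single i (1:ℝ) : V2)) (Pi.single i 1) 0 := by
    simpa using ((hasDerivAt_id (0:ℝ)).smul_const (Pi.single i (1:ℝ) : V2)).const_add x
  exact HasFDerivAt.comp_hasDerivAt_of_eq (0:ℝ) hf.hasFDerivAt h2 (by simp)

lemma Hop_pd {K K' : ℝ → V2 → ℝ} (hK : SK K) {f : V2 → ℝ} (hf : Cc f) {t : ℝ} (ht : 0 < t) (x : V2)
    (i : Fin 2) (h : ∀ x, pd i (K t) x = K' t x) : pd i (Hop K f t) x = Hop K' f t x := by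
  refine pd_of_line i ((Hop_smooth hK hf).slice ht).diff.differentiableAt ?_
  have := Hop_deriv hK (K' := K') hf ht x (0, Pi.single i 1) (fun x => by
    have := line_of_pd i (hK.slice ht).diff.differentiableAt (x := x)
    rw [h] at this
    simpa using this)
  simpa using this

lemma Hop_dt {K K' : ℝ → V2 → ℝ} (hK : SK K) {f : V2 → ℝ} (hf : Cc f) {t : ℝ} (ht : 0 < t) (x : V2)
    (h : ∀ x, HasDerivAt (fun s => K s x) (K' t x) t) :
    HasDerivAt (fun s => Hop K f s x) (Hop K' f t x) t := by
  have := Hop_deriv hK (K' := K') hf ht x (1, 0) (fun x => by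
    have h2 : HasDerivAt (fun r : ℝ => t + r) 1 0 := by simpa using (hasDerivAt_id (0:ℝ)).const_add t
    have := HasDerivAt.comp_of_eq (0:ℝ) (h x) h2 (by simp)
    simpa [Function.comp_def] using this)
  simp only [smul_zero, add_zero, mul_one] at this
  have h2 : HasDerivAt (fun r : ℝ => r - t) 1 t := by simpa using (hasDerivAt_id t).sub_const t
  have := HasDerivAt.comp_of_eq t this h2 (by simp)
  simpa [Function.comp_def] using this

/-- heat kernel -/
def hk (t : ℝ) (x : V2) : ℝ := (4 * π * t)⁻¹ * exp (-(x 0 ^ 2 + x 1 ^ 2) / (4 * t))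
def hk1 (i : Fin 2) (t : ℝ) (x : V2) : ℝ := -(x i / (2 * t)) * hk t x
def hk2 (i j : Fin 2) (t : ℝ) (x : V2) : ℝ :=
  (x i * x j / (4 * t ^ 2) - (if i = j then 1 else 0) / (2 * t)) * hk t x

lemma hk_SK : SK hk := by
  intro z hz
  have h0 : z.1 ≠ 0 := ne_of_gt hz
  apply ContDiffAt.contDiffWithinAt
  unfold hk
  have h1 : (4 * π * z.1) ≠ 0 := by positivity
  have h2 : (4 * z.1) ≠ 0 := by positivity
  fun_prop (disch := assumption)

lemma hk1_SK (i : Fin 2) : SK (hk1 i) := by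
  have h1 : ContDiffOn ℝ (⊤ : ℕ∞) (fun z : ℝ × V2 => -(z.2 i / (2 * z.1))) UT := by
    intro z hz
    have h0 : z.1 ≠ 0 := ne_of_gt hz
    apply ContDiffAt.contDiffWithinAt
    have h2 : (2 * z.1) ≠ 0 := by positivity
    fun_prop (disch := assumption)
  exact h1.mul hk_SK

lemma hk2_SK (i j : Fin 2) : SK (hk2 i j) := by
  have h1 : ContDiffOn ℝ (⊤ : ℕ∞) (fun z : ℝ × V2 => (z.2 i * z.2 j / (4 * z.1 ^ 2) - (if i = j then 1 else 0) / (2 * z.1))) UT := by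
    intro z hz
    have h0 : z.1 ≠ 0 := ne_of_gt hz
    apply ContDiffAt.contDiffWithinAt
    have h2 : (2 * z.1) ≠ 0 := by positivity
    have h3 : (4 * z.1 ^ 2) ≠ 0 := by positivity
    fun_prop (disch := assumption)
  exact h1.mul hk_SK

lemma hk_pd {t : ℝ} (ht : 0 < t) (i : Fin 2) (x : V2) : pd i (hk t) x = hk1 i t x := by
  have hdc : ∀ j : Fin 2, DifferentiableAt ℝ (fun y : V2 => y j) x := fun j => by fun_prop
  have hq : pd i (fun y : V2 => -(y 0 ^ 2 + y 1 ^ 2) / (4 * t)) x = -(x i / (2 * t)) := by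
    rw [show (fun y : V2 => -(y 0 ^ 2 + y 1 ^ 2) / (4 * t)) = fun y => (-(4 * t)⁻¹) * (y 0 * y 0 + y 1 * y 1) by
      ext y; field_simp]
    rw [pd_const_mul i _ (by fun_prop), pd_add i (by fun_prop) (by fun_prop), pd_mul i (hdc _) (hdc _),
      pd_mul i (hdc _) (hdc _), pd_coord, pd_coord]
    fin_cases i <;> simp <;> field_simp <;> ring
  unfold hk1 hk
  rw [pd_const_mul i _ (by fun_prop),
    pd_comp i (f := fun y : V2 => -(y 0 ^ 2 + y 1 ^ 2) / (4 * t)) (by fun_prop) (Real.hasDerivAt_exp _), hq]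
  ring

lemma hk1_pd {t : ℝ} (ht : 0 < t) (i j : Fin 2) (x : V2) : pd j (hk1 i t) x = hk2 i j t x := by
  unfold hk1
  rw [pd_mul j (by fun_prop) (hk_SK.slice ht).diff.differentiableAt, hk_pd ht,
    show (fun y : V2 => -(y i / (2 * t))) = fun y => -(2 * t)⁻¹ * y i by ext y; field_simp,
    pd_const_mul j _ (by fun_prop), pd_coord]
  unfold hk2 hk1
  have : (if j = i then (1:ℝ) else 0) = if i = j then 1 else 0 := by simp [eq_comm]
  rw [this]
  field_simp
  ring

lemma hk_dt {t : ℝ} (ht : 0 < t) (x : V2) :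
    HasDerivAt (fun s => hk s x) (hk2 0 0 t x + hk2 1 1 t x) t := by
  have h1 : HasDerivAt (fun s : ℝ => (4 * π * s)⁻¹) (-(4 * π) / (4 * π * t) ^ 2) t := by
    have := ((hasDerivAt_id t).const_mul (4 * π)).inv (by simp; positivity)
    exact this.congr_deriv (by simp)
  have h2 : HasDerivAt (fun s : ℝ => -(x 0 ^ 2 + x 1 ^ 2) / (4 * s)) ((x 0 ^ 2 + x 1 ^ 2) * 4 / (4 * t) ^ 2) t := by
    have := (hasDerivAt_const t (-(x 0 ^ 2 + x 1 ^ 2))).div ((hasDerivAt_id t).const_mul 4) (by simp; positivity)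
    refine this.congr_deriv ?_
    simp
    ring
  have := h1.mul h2.exp
  refine this.congr_deriv ?_
  unfold hk2 hk
  simp
  field_simp
  ring

lemma Hop_hk_pd {f : V2 → ℝ} (hf : Cc f) {t : ℝ} (ht : 0 < t) (i : Fin 2) (x : V2) :
    pd i (Hop hk f t) x = Hop (hk1 i) f t x := Hop_pd hk_SK hf ht x i (hk_pd ht i)

lemma Hop_hk1_pd {f : V2 → ℝ} (hf : Cc f) {t : ℝ} (ht : 0 < t) (i j : Fin 2) (x : V2) :
    pd j (Hop (hk1 i) f t) x = Hop (hk2 i j) f t x := Hop_pd (hk1_SK i) hf ht x j (hk1_pd ht i j)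

lemma Hop_int {K : ℝ → V2 → ℝ} {t : ℝ} (hK : Continuous (K t)) {f : V2 → ℝ} (hf : Cc f) (x : V2) :
    Integrable (fun y => f y * K t (x - y)) := by
  have hfc := hf.cont
  exact (Continuous.integrable_of_hasCompactSupport (by fun_prop) hf.supp.mul_right)

lemma Hop_add {K L : ℝ → V2 → ℝ} {t : ℝ} (hK : Continuous (K t)) (hL : Continuous (L t)) {f : V2 → ℝ}
    (hf : Cc f) (x : V2) : Hop (fun t x => K t x + L t x) f t x = Hop K f t x + Hop L f t x := by
  unfold Hop
  rw [← integral_add (Hop_int hK hf x) (Hop_int hL hf x)]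
  congr 1; ext y; ring

lemma Hop_hk_dt {f : V2 → ℝ} (hf : Cc f) {t : ℝ} (ht : 0 < t) (x : V2) :
    HasDerivAt (fun s => Hop hk f s x) (Hop (hk2 0 0) f t x + Hop (hk2 1 1) f t x) t := by
  rw [← Hop_add ((hk2_SK 0 0).slice ht).cont ((hk2_SK 1 1).slice ht).cont hf]
  exact Hop_dt (K' := fun t x => hk2 0 0 t x + hk2 1 1 t x) hk_SK hf ht x (hk_dt ht)

lemma prod_int {a b : ℝ → ℝ} (ha : Integrable a) (hb : Integrable b) :
    Integrable (fun x : V2 => a (x 0) * b (x 1)) ∧ ∫ x : V2, a (x 0) * b (x 1) = (∫ s, a s) * ∫ s, b s := by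
  constructor
  · have := Integrable.fintype_prod (f := (![a, b] : Fin 2 → ℝ → ℝ)) (μ := fun _ => (volume : Measure ℝ))
      (by intro i; fin_cases i <;> simpa)
    simp only [Fin.prod_univ_two] at this
    exact this
  · have := integral_fintype_prod_volume_eq_prod (𝕜 := ℝ) (ι := Fin 2) (E := fun _ => ℝ) (![a, b] : Fin 2 → ℝ → ℝ)
    simpa [Fin.prod_univ_two] using this

lemma gint (b : ℝ) (hb : 0 < b) : Integrable (fun s : ℝ => exp (-b * s ^ 2)) ∧
    Integrable (fun s : ℝ => s * exp (-b * s ^ 2)) ∧ Integrable (fun s : ℝ => s ^ 2 * exp (-b * s ^ 2)) :=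
  ⟨integrable_exp_neg_mul_sq hb, integrable_mul_exp_neg_mul_sq hb, by
    simpa using integrable_rpow_mul_exp_neg_mul_sq hb (s := 2) (by norm_num)⟩

lemma gval (b : ℝ) (hb : 0 < b) : ∫ s : ℝ, s * exp (-b * s ^ 2) = 0 ∧
    ∫ s : ℝ, s ^ 2 * exp (-b * s ^ 2) = (2 * b)⁻¹ * ∫ s : ℝ, exp (-b * s ^ 2) := by
  obtain ⟨h0, h1, h2⟩ := gint b hb
  have hd : ∀ s : ℝ, HasDerivAt (fun s : ℝ => exp (-b * s ^ 2)) (-2 * b * (s * exp (-b * s ^ 2))) s := by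
    intro s
    have := ((hasDerivAt_pow 2 s).const_mul (-b)).exp
    refine this.congr_deriv ?_
    simp; ring
  constructor
  · have := integral_eq_zero_of_hasDerivAt_of_integrable hd (h1.const_mul _) h0
    rw [integral_const_mul] at this
    have hb' : (-2 * b) ≠ 0 := by simp; positivity
    exact (mul_eq_zero.1 this).resolve_left hb'
  · have hd2 : ∀ s : ℝ, HasDerivAt (fun s : ℝ => s * exp (-b * s ^ 2))
        (exp (-b * s ^ 2) - 2 * b * (s ^ 2 * exp (-b * s ^ 2))) s := by
      intro s
      refine ((hasDerivAt_id s).mul (hd s)).congr_deriv ?_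
      simp; ring
    have := integral_eq_zero_of_hasDerivAt_of_integrable hd2 (h0.sub (h2.const_mul _)) h1
    rw [integral_sub h0 (h2.const_mul _), integral_const_mul] at this
    rw [eq_inv_mul_iff_mul_eq₀ (by positivity)]
    linarith

lemma hk_split {t : ℝ} (ht : 0 < t) (x : V2) :
    hk t x = (4 * π * t)⁻¹ * (exp (-(4 * t)⁻¹ * x 0 ^ 2) * exp (-(4 * t)⁻¹ * x 1 ^ 2)) := by
  unfold hk; rw [← Real.exp_add]; congr 2; field_simp; ring

lemma gmass {t : ℝ} (ht : 0 < t) : (4 * π * t)⁻¹ * ((∫ s : ℝ, exp (-(4 * t)⁻¹ * s ^ 2)) * ∫ s : ℝ, exp (-(4 * t)⁻¹ * s ^ 2)) = 1 := by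
  rw [integral_gaussian, Real.mul_self_sqrt (by positivity)]
  field_simp

lemma hk_mass {t : ℝ} (ht : 0 < t) : Integrable (hk t) ∧ ∫ x, hk t x = 1 := by
  obtain ⟨h0, h1, h2⟩ := gint (4 * t)⁻¹ (by positivity)
  obtain ⟨a, b⟩ := prod_int h0 h0
  have e : hk t = fun x => (4 * π * t)⁻¹ * (exp (-(4 * t)⁻¹ * x 0 ^ 2) * exp (-(4 * t)⁻¹ * x 1 ^ 2)) :=
    funext fun x => hk_split ht x
  constructor
  · rw [e]; exact a.const_mul _
  · simp only [hk_split ht]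
    rw [integral_const_mul, b, gmass ht]

lemma hk_m1 {t : ℝ} (ht : 0 < t) (i : Fin 2) : Integrable (fun x => x i * hk t x) ∧ ∫ x, x i * hk t x = 0 := by
  obtain ⟨h0, h1, h2⟩ := gint (4 * t)⁻¹ (by positivity)
  obtain ⟨v1, v2⟩ := gval (4 * t)⁻¹ (by positivity)
  have hs : ∀ x, x i * hk t x = (4 * π * t)⁻¹ * (x i * (exp (-(4 * t)⁻¹ * x 0 ^ 2) * exp (-(4 * t)⁻¹ * x 1 ^ 2))) := by
    intro x; rw [hk_split ht]; ring
  suffices h : Integrable (fun x : V2 => x i * (exp (-(4 * t)⁻¹ * x 0 ^ 2) * exp (-(4 * t)⁻¹ * x 1 ^ 2))) ∧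
      ∫ x : V2, x i * (exp (-(4 * t)⁻¹ * x 0 ^ 2) * exp (-(4 * t)⁻¹ * x 1 ^ 2)) = 0 by
    refine ⟨?_, ?_⟩
    · simp only [hs]; exact h.1.const_mul _
    · simp only [hs]; rw [integral_const_mul, h.2, mul_zero]
  fin_cases i
  · obtain ⟨a, b⟩ := prod_int h1 h0
    simp only [Fin.zero_eta, ← mul_assoc] at a b ⊢
    exact ⟨a, by rw [b, v1, zero_mul]⟩
  · obtain ⟨a, b⟩ := prod_int h0 h1
    simp only [Fin.mk_one, mul_left_comm] at a b ⊢
    exact ⟨a, by rw [b, v1, mul_zero]⟩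

lemma hk_m2 {t : ℝ} (ht : 0 < t) (i j : Fin 2) : Integrable (fun x => x i * x j * hk t x) ∧
    ∫ x, x i * x j * hk t x = if i = j then 2 * t else 0 := by
  obtain ⟨h0, h1, h2⟩ := gint (4 * t)⁻¹ (by positivity)
  obtain ⟨v1, v2⟩ := gval (4 * t)⁻¹ (by positivity)
  have hg := gmass ht
  set I := ∫ s : ℝ, exp (-(4 * t)⁻¹ * s ^ 2) with hI
  have hs : ∀ x, x i * x j * hk t x = (4 * π * t)⁻¹ * (x i * x j * (exp (-(4 * t)⁻¹ * x 0 ^ 2) * exp (-(4 * t)⁻¹ * x 1 ^ 2))) := by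
    intro x; rw [hk_split ht]; ring
  suffices h : Integrable (fun x : V2 => x i * x j * (exp (-(4 * t)⁻¹ * x 0 ^ 2) * exp (-(4 * t)⁻¹ * x 1 ^ 2))) ∧
      ∫ x : V2, x i * x j * (exp (-(4 * t)⁻¹ * x 0 ^ 2) * exp (-(4 * t)⁻¹ * x 1 ^ 2)) = if i = j then (2 * t) * (I * I) else 0 by
    refine ⟨?_, ?_⟩
    · simp only [hs]; exact h.1.const_mul _
    · simp only [hs]; rw [integral_const_mul, h.2]
      split_ifs
      · rw [mul_left_comm, hg, mul_one]
      · simp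
  have hv : (2 * (4 * t)⁻¹)⁻¹ = 2 * t := by field_simp; norm_num
  rw [hv] at v2
  have e0 : ∀ x : V2, x 0 * x 0 * (exp (-(4 * t)⁻¹ * x 0 ^ 2) * exp (-(4 * t)⁻¹ * x 1 ^ 2))
    = x 0 ^ 2 * exp (-(4 * t)⁻¹ * x 0 ^ 2) * exp (-(4 * t)⁻¹ * x 1 ^ 2) := fun x => by ring
  have e1 : ∀ x : V2, x 1 * x 1 * (exp (-(4 * t)⁻¹ * x 0 ^ 2) * exp (-(4 * t)⁻¹ * x 1 ^ 2))
    = exp (-(4 * t)⁻¹ * x 0 ^ 2) * (x 1 ^ 2 * exp (-(4 * t)⁻¹ * x 1 ^ 2)) := fun x => by ring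
  have e2 : ∀ x : V2, x 0 * x 1 * (exp (-(4 * t)⁻¹ * x 0 ^ 2) * exp (-(4 * t)⁻¹ * x 1 ^ 2))
    = (x 0 * exp (-(4 * t)⁻¹ * x 0 ^ 2)) * (x 1 * exp (-(4 * t)⁻¹ * x 1 ^ 2)) := fun x => by ring
  have e3 : ∀ x : V2, x 1 * x 0 * (exp (-(4 * t)⁻¹ * x 0 ^ 2) * exp (-(4 * t)⁻¹ * x 1 ^ 2))
    = (x 0 * exp (-(4 * t)⁻¹ * x 0 ^ 2)) * (x 1 * exp (-(4 * t)⁻¹ * x 1 ^ 2)) := fun x => by ring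
  fin_cases i <;> fin_cases j
  · simp only [Fin.zero_eta, e0]
    exact ⟨(prod_int h2 h0).1, by rw [(prod_int h2 h0).2, v2, hI]; simp; ring⟩
  · simp only [Fin.zero_eta, Fin.mk_one, e2]
    exact ⟨(prod_int h1 h1).1, by rw [(prod_int h1 h1).2, v1, if_neg (by decide)]; ring⟩
  · simp only [Fin.zero_eta, Fin.mk_one, e3]
    exact ⟨(prod_int h1 h1).1, by rw [(prod_int h1 h1).2, v1, if_neg (by decide)]; ring⟩
  · simp only [Fin.mk_one, e1]
    exact ⟨(prod_int h0 h2).1, by rw [(prod_int h0 h2).2, v2, hI]; simp; ring⟩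

lemma hk_pos {t : ℝ} (ht : 0 < t) (x : V2) : 0 < hk t x := by unfold hk; positivity

lemma int_lin4 {α : Type} [MeasurableSpace α] {ν : Measure α} {f1 f2 f3 f4 : α → ℝ} (h1 : Integrable f1 ν)
    (h2 : Integrable f2 ν) (h3 : Integrable f3 ν) (h4 : Integrable f4 ν) (a b c d : ℝ) :
    ∫ x, (a * f1 x + b * f2 x + c * f3 x + d * f4 x) ∂ν
      = a * (∫ x, f1 x ∂ν) + b * (∫ x, f2 x ∂ν) + c * (∫ x, f3 x ∂ν) + d * ∫ x, f4 x ∂ν := by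
  have e1 := h1.const_mul a
  have e2 := h2.const_mul b
  have e3 := h3.const_mul c
  have e4 := h4.const_mul d
  have e12 : Integrable (fun x => a * f1 x + b * f2 x) ν := e1.add e2
  have e123 : Integrable (fun x => a * f1 x + b * f2 x + c * f3 x) ν := e12.add e3
  rw [integral_add e123 e4, integral_add e12 e3, integral_add e1 e2]
  simp only [integral_const_mul]

/-- key Gaussian identity -/
lemma hk_mul {τ : ℝ} (ht : 0 < τ) (x y z : V2) :
    hk τ (z - y) * hk τ (z - x) = hk (τ / 2) (z - (2:ℝ)⁻¹ • (x + y)) * hk (2 * τ) (x - y) := by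
  unfold hk
  rw [mul_mul_mul_comm, mul_mul_mul_comm _ _ (4 * π * (2 * τ))⁻¹, ← Real.exp_add, ← Real.exp_add]
  congr 1
  · field_simp
  · congr 1
    simp
    field_simp
    ring

lemma hk_kernel {τ : ℝ} (ht : 0 < τ) (i j : Fin 2) (x y : V2) :
    ∫ z, hk1 j τ (z - y) * hk1 i τ (z - x) = - hk2 i j (2 * τ) (x - y) := by
  have ht2 : 0 < τ / 2 := by positivity
  set d := x - y with hd
  have e : ∀ z, hk1 j τ (z - y) * hk1 i τ (z - x) =
      (fun m : V2 => hk (2 * τ) d / (4 * τ ^ 2) * (1 * (m i * m j * hk (τ / 2) m) + (-d i / 2) * (m j * hk (τ / 2) m)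
        + (d j / 2) * (m i * hk (τ / 2) m) + (-(d i * d j / 4)) * hk (τ / 2) m)) (z - (2:ℝ)⁻¹ • (x + y)) := by
    intro z
    have := hk_mul ht x y z
    unfold hk1
    rw [mul_mul_mul_comm, this]
    simp [hd]
    field_simp
    ring
  simp only [e]
  rw [integral_sub_right_eq_self (fun m : V2 => hk (2 * τ) d / (4 * τ ^ 2) * (1 * (m i * m j * hk (τ / 2) m) + (-d i / 2) * (m j * hk (τ / 2) m)
        + (d j / 2) * (m i * hk (τ / 2) m) + (-(d i * d j / 4)) * hk (τ / 2) m))]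
  obtain ⟨i0, v0⟩ := hk_mass ht2
  obtain ⟨i1, v1⟩ := hk_m1 ht2 i
  obtain ⟨j1, w1⟩ := hk_m1 ht2 j
  obtain ⟨i2, v2⟩ := hk_m2 ht2 i j
  rw [integral_const_mul, int_lin4 i2 j1 i1 i0, v0, v1, w1, v2]
  unfold hk2
  split_ifs <;> field_simp <;> ring
end

section

lemma Cc.int {f : V2 → ℝ} (hf : Cc f) : Integrable f := hf.cont.integrable_of_hasCompactSupport hf.supp

lemma Cc.rpow {f : V2 → ℝ} (hf : Cc f) {p : ℝ} (hp : 0 < p) : Cc (fun x => |f x| ^ p) := by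
  refine ⟨(hf.cont.abs).rpow_const fun x => Or.inr hp.le, ?_⟩
  exact hf.supp.comp_left (g := fun r : ℝ => |r| ^ p) (by simp [hp.ne'])

lemma conv_int2 {f k : V2 → ℝ} (hf : Integrable f) (hk : Integrable k) :
    Integrable (fun z : V2 × V2 => f z.2 * k (z.1 - z.2)) ((volume : Measure V2).prod volume) := by
  simpa using hf.convolution_integrand (ContinuousLinearMap.mul ℝ ℝ) hk

/-- swapping a convolution against a bounded function -/
lemma conv_swap {f k b : V2 → ℝ} (hf : Integrable f) (hk : Integrable k) (hb : Continuous b) {M : ℝ}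
    (hM : ∀ x, |b x| ≤ M) :
    Integrable (fun z => (∫ y, f y * k (z - y)) * b z) ∧
    ∫ z, (∫ y, f y * k (z - y)) * b z = ∫ y, f y * ∫ z, k (z - y) * b z := by
  have h := conv_int2 hf hk
  have h2 : Integrable (fun z : V2 × V2 => (f z.2 * k (z.1 - z.2)) * b z.1) ((volume : Measure V2).prod volume) :=
    h.mul_bdd (c := M) (by fun_prop) (Eventually.of_forall fun z => hM _)
  constructor
  · have := h2.integral_prod_left
    simpa only [integral_mul_const] using this
  · simp only [← integral_mul_const, ← integral_const_mul]
    rw [integral_integral_swap (f := fun z y => f y * k (z - y) * b z) h2]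
    simp only [mul_assoc]

lemma conv_mass {f k : V2 → ℝ} (hf : Integrable f) (hk : Integrable k) :
    Integrable (fun z => (∫ y, f y * k (z - y))) ∧
    ∫ z, (∫ y, f y * k (z - y)) = (∫ y, f y) * ∫ z, k z := by
  have := conv_swap hf hk (continuous_const (y := (1:ℝ))) (M := 1) (by simp)
  simp only [mul_one] at this
  refine ⟨this.1, this.2.trans ?_⟩
  have h : ∀ y, ∫ z, k (z - y) = ∫ z, k z := fun y => integral_sub_right_eq_self k y
  simp only [h]
  rw [integral_mul_const]

lemma Hop_pos {f : V2 → ℝ} (hf : Cc f) (h0 : ∀ x, 0 ≤ f x) {x0 : V2} (h1 : f x0 ≠ 0) {t : ℝ} (ht : 0 < t)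
    (x : V2) : 0 < Hop hk f t x := by
  have hc := (hk_SK.slice ht).cont
  have hfc := hf.cont
  unfold Hop
  refine Continuous.integral_pos_of_hasCompactSupport_nonneg_nonzero (x := x0) (by fun_prop)
    hf.supp.mul_right (fun y => mul_nonneg (h0 y) (hk_pos ht _).le) ?_
  exact mul_ne_zero h1 (hk_pos ht _).ne'

lemma Hop_nonneg {f : V2 → ℝ} (h0 : ∀ x, 0 ≤ f x) {t : ℝ} (ht : 0 < t)
    (x : V2) : 0 ≤ Hop hk f t x :=
  integral_nonneg fun y => mul_nonneg (h0 y) (hk_pos ht _).le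

lemma hk_shift {t : ℝ} (ht : 0 < t) (x : V2) : Integrable (fun y => hk t (x - y)) ∧ ∫ y, hk t (x - y) = 1 :=
  ⟨(hk_mass ht).1.comp_sub_left x, by rw [integral_sub_left_eq_self (hk t) volume x]; exact (hk_mass ht).2⟩

lemma tangent {p a m : ℝ} (hp : 1 ≤ p) (ha : 0 ≤ a) (hm : 0 < m) :
    m ^ p + p * m ^ (p - 1) * (a - m) ≤ a ^ p := by
  have h := one_add_mul_self_le_rpow_one_add (s := a / m - 1) (by have := div_nonneg ha hm.le; linarith) hp
  rw [show 1 + (a / m - 1) = a / m by ring, Real.div_rpow ha hm.le, le_div_iff₀ (by positivity)] at h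
  refine le_trans (le_of_eq ?_) h
  rw [Real.rpow_sub_one hm.ne']
  field_simp

lemma jensen_pt {f : V2 → ℝ} (hf : Cc f) (h0 : ∀ x, 0 ≤ f x) {t : ℝ} (ht : 0 < t) {p : ℝ} (hp : 1 ≤ p)
    (x : V2) : Hop hk f t x ^ p ≤ Hop hk (fun y => |f y| ^ p) t x := by
  have hp0 : 0 < p := by linarith
  rcases (Hop_nonneg h0 ht x).eq_or_lt with h | hm
  · rw [← h, Real.zero_rpow hp0.ne']
    exact Hop_nonneg (fun y => by positivity) ht x
  set m := Hop hk f t x with hmd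
  have hc := (hk_SK.slice ht).cont
  have i1 := Hop_int hc hf x
  have i2 := Hop_int hc (hf.rpow hp0) x
  obtain ⟨i3, v3⟩ := hk_shift ht x
  have key : ∫ y, ((m ^ p - p * m ^ (p - 1) * m) * hk t (x - y) + p * m ^ (p - 1) * (f y * hk t (x - y)))
      ≤ ∫ y, |f y| ^ p * hk t (x - y) := by
    refine integral_mono ((i3.const_mul _).add (i1.const_mul _)) i2 fun y => ?_
    have := mul_le_mul_of_nonneg_right (tangent hp (h0 y) hm) (hk_pos ht (x - y)).le
    simp only [abs_of_nonneg (h0 y)]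
    linarith
  rw [integral_add (i3.const_mul _) (i1.const_mul _), integral_const_mul, integral_const_mul, v3] at key
  have e : ∫ y, f y * hk t (x - y) = m := rfl
  rw [e] at key
  have : Hop hk (fun y => |f y| ^ p) t x = ∫ y, |f y| ^ p * hk t (x - y) := rfl
  rw [this]; linarith

lemma jensen {f : V2 → ℝ} (hf : Cc f) (h0 : ∀ x, 0 ≤ f x) {t : ℝ} (ht : 0 < t) {p : ℝ} (hp : 1 ≤ p) :
    Integrable (fun x => Hop hk f t x ^ p) ∧ ∫ x, Hop hk f t x ^ p ≤ ∫ x, |f x| ^ p := by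
  have hp0 : 0 < p := by linarith
  obtain ⟨a, b⟩ := conv_mass (hf.rpow hp0).int (hk_mass ht).1
  rw [(hk_mass ht).2, mul_one] at b
  have hc := ((Hop_smooth hk_SK hf).slice ht).cont
  have hi : Integrable (fun x => Hop hk f t x ^ p) := by
    refine a.mono' ?_ (Eventually.of_forall fun x => ?_)
    · exact (hc.rpow_const fun x => Or.inr hp0.le).aestronglyMeasurable
    · rw [Real.norm_of_nonneg (by have := Hop_nonneg h0 ht x; positivity)]
      exact jensen_pt hf h0 ht hp x
  refine ⟨hi, ?_⟩
  rw [← b]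
  exact integral_mono hi a fun x => jensen_pt hf h0 ht hp x

lemma Hop_small {f : V2 → ℝ} (hf : Cc f) {t : ℝ} (ht : 0 < t) (x : V2) :
    |Hop hk f t x| ≤ (4 * π * t)⁻¹ * ∫ y, |f y| := by
  unfold Hop
  refine (abs_integral_le_integral_abs).trans ?_
  rw [← integral_const_mul]
  refine integral_mono (Hop_int (hk_SK.slice ht).cont hf x).abs (hf.int.abs.const_mul _) fun y => ?_
  simp only [abs_mul, abs_of_pos (hk_pos ht _)]
  rw [mul_comm]
  refine mul_le_mul_of_nonneg_right ?_ (abs_nonneg _)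
  unfold hk
  refine mul_le_of_le_one_right (by positivity) (Real.exp_le_one_iff.2 ?_)
  have : 0 ≤ ((x - y) 0 ^ 2 + (x - y) 1 ^ 2) / (4 * t) := by positivity
  rw [neg_div]; linarith

lemma Hop_conv {f : V2 → ℝ} (hf : Cc f) {ε : ℝ} (hε : 0 < ε) :
    ∃ s0 > 0, ∀ s, 0 < s → s < s0 → ∀ x, |Hop hk f s x - f x| ≤ ε := by
  obtain ⟨M, hM⟩ := hf.supp.exists_bound_of_continuous hf.cont
  have hM0 : 0 ≤ M := (norm_nonneg _).trans (hM 0)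
  obtain ⟨δ, hδ, hu⟩ := Metric.uniformContinuous_iff.1 (hf.supp.uniformContinuous_of_continuous hf.cont) (ε / 2) (by positivity)
  set A := 2 * M / δ ^ 2 with hA
  have hA0 : 0 ≤ A := by positivity
  refine ⟨ε / (8 * (A + 1)), by positivity, fun s hs hs' x => ?_⟩
  obtain ⟨i0, v0⟩ := hk_mass hs
  obtain ⟨i2, v2⟩ := hk_m2 hs 0 0
  obtain ⟨i3, v3⟩ := hk_m2 hs 1 1
  have e1 : Hop hk f s x = ∫ y, f (x - y) * hk s y := by
    have := integral_sub_left_eq_self (fun y => f (x - y) * hk s y) volume x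
    simp only [sub_sub_cancel] at this
    exact this
  have hfi : Integrable (fun y => f (x - y) * hk s y) := by
    have := (Hop_int (K := hk) (hk_SK.slice hs).cont hf x).comp_sub_left x
    simpa using this
  have e2 : Hop hk f s x - f x = ∫ y, (f (x - y) - f x) * hk s y := by
    simp only [sub_mul]
    rw [integral_sub hfi (i0.const_mul _), integral_const_mul, v0, e1, mul_one]
  rw [e2]
  refine (abs_integral_le_integral_abs).trans ?_
  have hpt : ∀ y : V2, |(f (x - y) - f x) * hk s y| ≤
      ε / 2 * hk s y + A * (y 0 * y 0 * hk s y) + A * (y 1 * y 1 * hk s y) + 0 * hk s y := by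
    intro y
    rw [abs_mul, abs_of_pos (hk_pos hs y)]
    suffices h : |f (x - y) - f x| ≤ ε / 2 + A * (y 0 * y 0 + y 1 * y 1) by
      have := mul_le_mul_of_nonneg_right h (hk_pos hs y).le
      linarith
    have hyy : 0 ≤ y 0 * y 0 + y 1 * y 1 := add_nonneg (mul_self_nonneg _) (mul_self_nonneg _)
    by_cases hy : ‖y‖ < δ
    · have := hu (a := x - y) (b := x) (by simpa [dist_eq_norm] using hy)
      rw [Real.dist_eq] at this
      have : 0 ≤ A * (y 0 * y 0 + y 1 * y 1) := mul_nonneg hA0 hyy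
      linarith
    · push Not at hy
      have h2 : δ ^ 2 ≤ y 0 * y 0 + y 1 * y 1 := by
        have : ‖y‖ ^ 2 ≤ y 0 * y 0 + y 1 * y 1 := by
          have hn : ‖y‖ ≤ √(y 0 * y 0 + y 1 * y 1) := by
            refine (pi_norm_le_iff_of_nonneg (by positivity)).2 fun i => ?_
            refine Real.le_sqrt_of_sq_le ?_
            rw [Real.norm_eq_abs, sq_abs]
            fin_cases i <;> simp <;> nlinarith [mul_self_nonneg (y 0), mul_self_nonneg (y 1)]
          calc ‖y‖ ^ 2 ≤ (√(y 0 * y 0 + y 1 * y 1)) ^ 2 := by gcongr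
            _ = _ := Real.sq_sqrt hyy
        refine le_trans ?_ this
        gcongr
      have h3 : |f (x - y) - f x| ≤ 2 * M := by
        have a1 := hM (x - y); have a2 := hM x
        rw [Real.norm_eq_abs] at a1 a2
        rw [abs_le] at *
        constructor <;> linarith
      have h4 : 2 * M ≤ A * (y 0 * y 0 + y 1 * y 1) := by
        have : A * δ ^ 2 = 2 * M := by rw [hA]; field_simp
        rw [← this]; gcongr
      linarith
  have hintg : Integrable (fun y : V2 => ε / 2 * hk s y + A * (y 0 * y 0 * hk s y) + A * (y 1 * y 1 * hk s y) + 0 * hk s y) :=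
    (((i0.const_mul _).add (i2.const_mul _)).add (i3.const_mul _)).add (i0.const_mul _)
  have him : Integrable (fun y => |(f (x - y) - f x) * hk s y|) := by
    have : Integrable (fun y => (f (x - y) - f x) * hk s y) := by
      simp only [sub_mul]; exact hfi.sub (i0.const_mul _)
    exact this.abs
  refine (integral_mono him hintg hpt).trans ?_
  rw [int_lin4 i0 i2 i3 i0, v0, v2, v3]
  simp only [if_true]
  have : s * (8 * (A + 1)) < ε := by rwa [lt_div_iff₀ (by positivity)] at hs'
  nlinarith

lemma hk1_bdd {t : ℝ} (ht : 0 < t) (i : Fin 2) : ∃ M, ∀ x, |hk1 i t x| ≤ M := by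
  refine ⟨(8 * π * t ^ 2)⁻¹ * (1 + 4 * t), fun x => ?_⟩
  unfold hk1 hk
  set a := (x 0 ^ 2 + x 1 ^ 2) / (4 * t) with ha
  have ha0 : 0 ≤ a := by positivity
  have h1 : |x i| ≤ (1 + 4 * t) * (1 + a) := by
    have h2 : x i ^ 2 ≤ 4 * t * a := by
      rw [ha]; field_simp
      fin_cases i <;> simp <;> positivity
    have h3 : |x i| ≤ 1 + x i ^ 2 := by
      rw [← sq_abs]; nlinarith [sq_nonneg (|x i| - 1), abs_nonneg (x i)]
    nlinarith
  have h2 : exp (-(x 0 ^ 2 + x 1 ^ 2) / (4 * t)) ≤ (1 + a)⁻¹ := by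
    rw [neg_div, Real.exp_neg]
    refine inv_anti₀ (by positivity) ?_
    have := Real.add_one_le_exp a
    linarith
  rw [abs_mul, abs_neg, abs_div, abs_of_pos (show 0 < 2 * t by positivity), abs_mul, abs_of_pos (Real.exp_pos _),
    abs_of_pos (show 0 < (4 * π * t)⁻¹ by positivity)]
  calc |x i| / (2 * t) * ((4 * π * t)⁻¹ * exp (-(x 0 ^ 2 + x 1 ^ 2) / (4 * t)))
      ≤ ((1 + 4 * t) * (1 + a)) / (2 * t) * ((4 * π * t)⁻¹ * (1 + a)⁻¹) := by gcongr
    _ = _ := by field_simp; ring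

lemma hk1_int {t : ℝ} (ht : 0 < t) (i : Fin 2) : Integrable (hk1 i t) := by
  have := (hk_m1 ht i).1.const_mul (-(2 * t)⁻¹)
  refine this.congr (Eventually.of_forall fun x => ?_)
  unfold hk1; field_simp

lemma Hop_bdd {K : ℝ → V2 → ℝ} {t : ℝ} (hK : Integrable (K t)) {f : V2 → ℝ} (hf : Cc f) :
    ∃ M, ∀ x, |Hop K f t x| ≤ M := by
  obtain ⟨M, hM⟩ := hf.supp.exists_bound_of_continuous hf.cont
  refine ⟨M * ∫ x, |K t x|, fun x => ?_⟩
  unfold Hop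
  refine (abs_integral_le_integral_abs).trans ?_
  rw [← integral_sub_left_eq_self (fun y => |K t y|) volume x, ← integral_const_mul]
  refine integral_mono_of_nonneg (Eventually.of_forall fun y => abs_nonneg _)
    ((hK.abs.comp_sub_left x).const_mul _) (Eventually.of_forall fun y => ?_)
  simp only [abs_mul]
  exact mul_le_mul_of_nonneg_right (hM y) (abs_nonneg _)

lemma hop_dual {τ : ℝ} (hτ : 0 < τ) (i j : Fin 2) {f g : V2 → ℝ} (hf : Cc f) (hg : Cc g) :
    Integrable (fun z => Hop (hk1 i) g τ z * Hop (hk1 j) f τ z) ∧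
    ∫ z, Hop (hk1 i) g τ z * Hop (hk1 j) f τ z = - ∫ x, g x * Hop (hk2 i j) f (2 * τ) x := by
  obtain ⟨M, hM⟩ := Hop_bdd (hk1_int hτ j) hf
  obtain ⟨M2, hM2⟩ := hk1_bdd hτ i
  obtain ⟨a, b⟩ := conv_swap hg.int (hk1_int hτ i) ((Hop_smooth (hk1_SK j) hf).slice hτ).cont hM
  refine ⟨a, b.trans ?_⟩
  rw [← integral_neg]
  congr 1; ext x
  rw [← mul_neg]
  congr 1
  have hc := ((hk1_SK i).slice hτ).cont
  have := (conv_swap hf.int (hk1_int hτ j) (b := fun z => hk1 i τ (z - x)) (by fun_prop) (fun z => hM2 _)).2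
  have e : ∀ z, hk1 i τ (z - x) * Hop (hk1 j) f τ z = (∫ y, f y * hk1 j τ (z - y)) * hk1 i τ (z - x) := by
    intro z; rw [mul_comm]; rfl
  simp only [e]
  rw [this]
  simp only [hk_kernel hτ]
  unfold Hop
  rw [← integral_neg]
  congr 1; ext y; ring
end

section

/-- conjugate exponents -/
structure PQ (p q : ℝ) : Prop where
  two : 2 ≤ p
  eq : q * (p - 1) = p

lemma PQ.q1 {p q : ℝ} (h : PQ p q) : 1 < q := by
  have h1 := h.two; have h2 := h.eq
  by_contra hh; push Not at hh; nlinarith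
lemma PQ.q2 {p q : ℝ} (h : PQ p q) : q ≤ 2 := by
  have h1 := h.two; have h2 := h.eq
  by_contra hh; push Not at hh; nlinarith

/-- the sum of powers -/
def bE (p q u v : ℝ) : ℝ := u ^ p + v ^ q
def bW (p q u v : ℝ) : ℝ := bE p q u v ^ (1 - 2 / p)
def bK (q : ℝ) : ℝ := 21 / (q * (q - 1))
/-- Bellman function and its derivatives -/
def bB (p q u v : ℝ) : ℝ := u ^ 2 * bW p q u v + bK q * v ^ q
def bBu (p q u v : ℝ) : ℝ := u * bW p q u v * (2 + (p - 2) * u ^ p / bE p q u v)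
def bBv (p q u v : ℝ) : ℝ :=
  ((1 - 2 / p) * q * u ^ 2 * bW p q u v / bE p q u v + bK q * q) * v ^ q / v
def bBuu (p q u v : ℝ) : ℝ := bW p q u v *
  (2 + (p - 2) * (u ^ p / bE p q u v) * (p + 3 - 2 * (u ^ p / bE p q u v)))
def bBuv (p q u v : ℝ) : ℝ := u / v * bW p q u v * (2 * (1 - 2 / p) * q * (v ^ q / bE p q u v) ^ 2)
def bBvv (p q u v : ℝ) : ℝ := (u ^ 2 * bW p q u v * ((1 - 2 / p) * q * (v ^ q / bE p q u v)
    * ((1 - 2 / p) * q * (v ^ q / bE p q u v) + q * (u ^ p / bE p q u v) - 1))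
    + bK q * q * (q - 1) * v ^ q) / v ^ 2

section
variable {p q : ℝ} (h : PQ p q) {U V : ℝ → ℝ} {a b s : ℝ} (hu : 0 < U s) (hv : 0 < V s)
  (hU : HasDerivAt U a s) (hV : HasDerivAt V b s)

lemma bE_pos {u v : ℝ} (hu : 0 < u) (hv : 0 < v) : 0 < bE p q u v := by unfold bE; positivity
lemma bW_pos {u v : ℝ} (hu : 0 < u) (hv : 0 < v) : 0 < bW p q u v := by
  unfold bW; have := bE_pos (p := p) (q := q) hu hv; positivity

lemma pow_d {p : ℝ} {U : ℝ → ℝ} {a s : ℝ} (hu : 0 < U s) (hU : HasDerivAt U a s) :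
    HasDerivAt (fun r => U r ^ p) (p * U s ^ p * a / U s) s := by
  refine (hU.rpow_const (p := p) (Or.inl hu.ne')).congr_deriv ?_
  rw [Real.rpow_sub_one hu.ne']; field_simp

include hu hv hU hV

lemma bE_d : HasDerivAt (fun r => bE p q (U r) (V r)) (p * U s ^ p * a / U s + q * V s ^ q * b / V s) s :=
  (pow_d hu hU).add (pow_d hv hV)

lemma bW_d : HasDerivAt (fun r => bW p q (U r) (V r))
    ((1 - 2 / p) * bW p q (U s) (V s) * (p * U s ^ p * a / U s + q * V s ^ q * b / V s) / bE p q (U s) (V s)) s :=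
  pow_d (bE_pos hu hv) (bE_d hu hv hU hV)

include h

lemma bB_d : HasDerivAt (fun r => bB p q (U r) (V r))
    (bBu p q (U s) (V s) * a + bBv p q (U s) (V s) * b) s := by
  have hp0 : p ≠ 0 := by have := h.two; positivity
  refine (((hU.pow 2).mul (bW_d hu hv hU hV)).add ((pow_d (p := q) hv hV).const_mul (bK q))).congr_deriv ?_
  have hE := bE_pos (p := p) (q := q) hu hv
  unfold bBu bBv
  simp only [Pi.pow_apply]
  generalize bW p q (U s) (V s) = W at *
  generalize bE p q (U s) (V s) = E at *
  generalize U s ^ p = X at *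
  generalize V s ^ q = Y at *
  generalize U s = u at *
  generalize V s = v at *
  field_simp
  ring

lemma bBu_d : HasDerivAt (fun r => bBu p q (U r) (V r))
    (bBuu p q (U s) (V s) * a + bBuv p q (U s) (V s) * b) s := by
  have hp0 : p ≠ 0 := by have := h.two; positivity
  have hE := bE_pos (p := p) (q := q) hu hv
  have h1 := (((pow_d (p := p) hu hU).const_mul (p - 2)).div (bE_d (p := p) (q := q) hu hv hU hV) hE.ne').const_add 2
  refine ((hU.mul (bW_d (p := p) (q := q) hu hv hU hV)).mul h1).congr_deriv ?_
  unfold bBuu bBuv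
  simp only [Pi.mul_apply, Pi.div_apply]
  have hEE : U s ^ p = bE p q (U s) (V s) - V s ^ q := by unfold bE; ring
  generalize bW p q (U s) (V s) = W at *
  generalize bE p q (U s) (V s) = E at *
  generalize U s ^ p = X at *
  generalize V s ^ q = Y at *
  generalize U s = u at *
  generalize V s = v at *
  subst hEE
  field_simp
  ring

lemma bBv_d : HasDerivAt (fun r => bBv p q (U r) (V r))
    (bBuv p q (U s) (V s) * a + bBvv p q (U s) (V s) * b) s := by
  have hp0 : p ≠ 0 := by have := h.two; positivity
  have hE := bE_pos (p := p) (q := q) hu hv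
  have h1 := (((hU.pow 2).const_mul ((1 - 2 / p) * q)).mul (bW_d (p := p) (q := q) hu hv hU hV)).div
    (bE_d (p := p) (q := q) hu hv hU hV) hE.ne'
  have h2 := ((h1.add_const (bK q * q)).mul (pow_d (p := q) hv hV)).div hV hv.ne'
  refine h2.congr_deriv ?_
  unfold bBuv bBvv
  simp only [Pi.mul_apply, Pi.div_apply, Pi.pow_apply]
  have hEE : U s ^ p = bE p q (U s) (V s) - V s ^ q := by unfold bE; ring
  generalize bW p q (U s) (V s) = W at *
  generalize bE p q (U s) (V s) = E at *
  generalize U s ^ p = X at *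
  generalize V s ^ q = Y at *
  generalize U s = u at *
  generalize V s = v at *
  subst hEE
  field_simp
  ring

end

lemma alg_hess {p q r s A Y al be c : ℝ} (hp : 2 ≤ p) (hq1 : 1 < q) (hq2 : q ≤ 2) (hr : 0 ≤ r) (hs : 0 ≤ s)
    (hrs : r + s = 1) (hA : 0 ≤ A) (hY : 0 ≤ Y) (hAY : A * s ≤ Y) (hc0 : 0 ≤ c) (hc1 : c ≤ 1) :
    A * al ^ 2 + Y * be ^ 2 ≤ A * (2 + (p - 2) * r * (p + 3 - 2 * r)) * al ^ 2
      + 2 * (A * (2 * c * q * s ^ 2)) * al * be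
      + (A * (c * q * s * (c * q * s + q * r - 1)) + 21 * Y) * be ^ 2 := by
  have hr1 : r ≤ 1 := by linarith
  have hs1 : s ≤ 1 := by linarith
  have h1 : 0 ≤ A * ((p - 2) * r * (p + 3 - 2 * r)) * al ^ 2 := by
    have : 0 ≤ p - 2 := by linarith
    have : 0 ≤ p + 3 - 2 * r := by linarith
    positivity
  have hcq0 : 0 ≤ c * q := by positivity
  have hcq : c * q ≤ 2 := by nlinarith
  -- the square term
  have h2 : 0 ≤ A * (al + (2 * c * q * s ^ 2) * be) ^ 2 := by positivity
  have h3 : A * (2 * c * q * s ^ 2) ^ 2 ≤ 16 * Y := by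
    have e1 : (2 * c * q * s ^ 2) ^ 2 ≤ 16 * s := by
      have : (2 * c * q * s ^ 2) ^ 2 = 4 * (c * q) ^ 2 * s ^ 3 * s := by ring
      rw [this]
      have : (c * q) ^ 2 ≤ 4 := by nlinarith
      have : s ^ 3 ≤ 1 := pow_le_one₀ hs hs1
      have : 4 * (c * q) ^ 2 * s ^ 3 ≤ 16 := by
        have : (c * q) ^ 2 * s ^ 3 ≤ 4 * 1 := by gcongr
        linarith
      gcongr
    calc A * (2 * c * q * s ^ 2) ^ 2 ≤ A * (16 * s) := by gcongr
      _ = 16 * (A * s) := by ring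
      _ ≤ 16 * Y := by linarith
  have h4 : -(2 * Y) ≤ A * (c * q * s * (c * q * s + q * r - 1)) := by
    have e1 : 0 ≤ c * q * s + q * r := by positivity
    have e2 : 0 ≤ A * s * (c * q) * (c * q * s + q * r) := by positivity
    have e3 : A * s * (c * q) ≤ Y * 2 := by gcongr
    nlinarith
  have hb := sq_nonneg be
  nlinarith [mul_le_mul_of_nonneg_right h3 hb, mul_le_mul_of_nonneg_right h4 hb, mul_nonneg hY hb]

lemma bell_facts {p q : ℝ} (h : PQ p q) {u v : ℝ} (hu : 0 < u) (hv : 0 < v) :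
    u ^ 2 * bW p q u v ≤ bE p q u v ∧ v ^ 2 ≤ bW p q u v * v ^ q := by
  have hp := h.two
  have hp0 : p ≠ 0 := by positivity
  have hE := bE_pos (p := p) (q := q) hu hv
  have ht : 0 ≤ 1 - 2 / p := by
    rw [sub_nonneg, div_le_one (by positivity)]; exact hp
  constructor
  · have h1 : u ^ 2 ≤ bE p q u v ^ (2 / p) := by
      have : u ^ 2 = (u ^ p) ^ (2 / p) := by
        rw [← Real.rpow_mul hu.le, mul_div_cancel₀ _ hp0]; norm_num
      rw [this]
      refine Real.rpow_le_rpow (by positivity) ?_ (by positivity)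
      unfold bE; have : 0 < v ^ q := by positivity
      linarith
    calc u ^ 2 * bW p q u v ≤ bE p q u v ^ (2 / p) * bW p q u v :=
          mul_le_mul_of_nonneg_right h1 (bW_pos hu hv).le
      _ = bE p q u v := by
        unfold bW; rw [← Real.rpow_add hE]; ring_nf; exact Real.rpow_one _
  · have h1 : (v ^ q) ^ (1 - 2 / p) ≤ bW p q u v := by
      refine Real.rpow_le_rpow (by positivity) ?_ ht
      unfold bE; have : 0 < u ^ p := by positivity
      linarith
    have : v ^ 2 = (v ^ q) ^ (1 - 2 / p) * v ^ q := by
      rw [← Real.rpow_mul hv.le, ← Real.rpow_add hv]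
      have : q * (1 - 2 / p) + q = 2 := by
        have := h.eq
        field_simp
        linarith
      rw [this]; norm_num
    rw [this]
    exact mul_le_mul_of_nonneg_right h1 (by positivity)

lemma bell_hess {p q : ℝ} (h : PQ p q) {u v : ℝ} (hu : 0 < u) (hv : 0 < v) (a b : ℝ) :
    bW p q u v * a ^ 2 + v ^ q / v ^ 2 * b ^ 2 ≤
      bBuu p q u v * a ^ 2 + 2 * bBuv p q u v * a * b + bBvv p q u v * b ^ 2 := by
  have hp := h.two
  have hq1 := h.q1
  have hE := bE_pos (p := p) (q := q) hu hv
  have hW := bW_pos (p := p) (q := q) hu hv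
  obtain ⟨f1, f2⟩ := bell_facts h hu hv
  have hX : 0 < u ^ p := by positivity
  have hY : 0 < v ^ q := by positivity
  have hA : u ^ 2 * bW p q u v * (v ^ q / bE p q u v) ≤ v ^ q := by
    rw [mul_div_assoc', div_le_iff₀ hE, mul_comm (v ^ q)]; gcongr
  have key := alg_hess (p := p) (q := q) (r := u ^ p / bE p q u v) (s := v ^ q / bE p q u v)
    (A := u ^ 2 * bW p q u v) (Y := v ^ q) (al := a / u) (be := b / v) (c := 1 - 2 / p) hp hq1 h.q2 (by positivity)
    (by positivity) (by rw [← add_div]; exact div_self hE.ne') (by positivity) hY.le hA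
    (by rw [sub_nonneg, div_le_one (by positivity)]; exact hp) (by have : 0 ≤ 2 / p := by positivity
                                                                   linarith)
  have hK : bK q * q * (q - 1) = 21 := by
    unfold bK; have : q - 1 ≠ 0 := by linarith
    have : q ≠ 0 := by linarith
    field_simp
  unfold bBuu bBuv bBvv
  rw [hK]
  refine le_trans (le_of_eq ?_) (key.trans (le_of_eq ?_))
  · field_simp
  · field_simp

/-- dissipation -/
lemma bell_diss {p q : ℝ} (h : PQ p q) {u v : ℝ} (hu : 0 < u) (hv : 0 < v) (a b : Fin 2 → ℝ) (i j : Fin 2) :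
    2 * |a i| * |b j| ≤ ∑ k, (bBuu p q u v * a k ^ 2 + 2 * bBuv p q u v * a k * b k + bBvv p q u v * b k ^ 2) := by
  have hW := bW_pos (p := p) (q := q) hu hv
  obtain ⟨f1, f2⟩ := bell_facts h hu hv
  have hY : 0 < v ^ q := by positivity
  set D := v ^ q / v ^ 2 with hD
  have hD0 : 0 < D := by positivity
  have hWD : 1 ≤ bW p q u v * D := by
    rw [hD, mul_div_assoc', le_div_iff₀ (by positivity)]; linarith
  set W := bW p q u v
  have h1 : W * a i ^ 2 + D * b j ^ 2 ≤ ∑ k, (W * a k ^ 2 + D * b k ^ 2) := by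
    rw [Finset.sum_add_distrib]
    refine add_le_add ?_ ?_
    · exact Finset.single_le_sum (f := fun k => W * a k ^ 2) (fun k _ => by positivity) (Finset.mem_univ i)
    · exact Finset.single_le_sum (f := fun k => D * b k ^ 2) (fun k _ => by positivity) (Finset.mem_univ j)
  have h2 : ∑ k, (W * a k ^ 2 + D * b k ^ 2) ≤ _ := Finset.sum_le_sum fun k _ => bell_hess h hu hv (a k) (b k)
  refine le_trans ?_ (h1.trans h2)
  rw [← sq_abs (a i), ← sq_abs (b j)]
  have hx := abs_nonneg (a i)
  have hy := abs_nonneg (b j)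
  generalize |a i| = x at *
  generalize |b j| = y at *
  have e : (x * y) ^ 2 ≤ (W * x ^ 2) * (D * y ^ 2) := by
    have := mul_le_mul_of_nonneg_right hWD (show 0 ≤ (x * y) ^ 2 by positivity)
    nlinarith
  have hP : 0 ≤ W * x ^ 2 := by positivity
  have hQ : 0 ≤ D * y ^ 2 := by positivity
  have := sq_nonneg (W * x ^ 2 - D * y ^ 2)
  have h5 : (2 * x * y) ^ 2 ≤ (W * x ^ 2 + D * y ^ 2) ^ 2 := by nlinarith
  exact (le_abs_self _).trans (abs_le_of_sq_le_sq h5 (by positivity))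

lemma bell_up {p q : ℝ} (h : PQ p q) {u v : ℝ} (hu : 0 < u) (hv : 0 < v) :
    0 ≤ bB p q u v ∧ bB p q u v ≤ (1 + bK q) * (u ^ p + v ^ q) := by
  obtain ⟨f1, f2⟩ := bell_facts h hu hv
  have hW := bW_pos (p := p) (q := q) hu hv
  have hq := h.q1
  have hK : 0 ≤ bK q := by unfold bK; have : 0 < q - 1 := by linarith
                           positivity
  have hX : 0 < u ^ p := by positivity
  unfold bB
  refine ⟨by positivity, ?_⟩
  have : bE p q u v = u ^ p + v ^ q := rfl
  nlinarith [mul_nonneg hK hX.le]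
end

section

lemma ibp_cc {f g : V2 → ℝ} (hf : Sm f) (hs : HasCompactSupport f) (hg : Sm g) (i : Fin 2) :
    ∫ x, f x * pd i g x = - ∫ x, pd i f x * g x := by
  have hfc := hf.cont; have hgc := hg.cont; have hfp := (hf.pd i).cont; have hgp := (hg.pd i).cont
  have hs' : HasCompactSupport (pd i f) := hs.fderiv_apply (𝕜 := ℝ) _
  exact integral_mul_fderiv_eq_neg_fderiv_mul_of_integrable
    (Continuous.integrable_of_hasCompactSupport (f := fun x => pd i f x * g x) (by fun_prop) hs'.mul_right)
    (Continuous.integrable_of_hasCompactSupport (f := fun x => f x * pd i g x) (by fun_prop) hs.mul_right)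
    (Continuous.integrable_of_hasCompactSupport (by fun_prop) hs.mul_right)
    (fun x _ => hf.diff x) (fun x _ => hg.diff x)

lemma lap_cc {f g : V2 → ℝ} (hf : Sm f) (hs : HasCompactSupport f) (hg : Sm g) :
    ∫ x, f x * lap g x = ∫ x, lap f x * g x := by
  have hfc := hf.cont; have hgc := hg.cont
  have hs' : ∀ i, HasCompactSupport (pd i f) := fun i => hs.fderiv_apply (𝕜 := ℝ) _
  have hs2 : ∀ i, HasCompactSupport (pd i (pd i f)) := fun i => (hs' i).fderiv_apply (𝕜 := ℝ) _
  have c1 : ∀ i, Continuous (pd i (pd i f)) := fun i => ((hf.pd i).pd i).cont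
  have c2 : ∀ i, Continuous (pd i (pd i g)) := fun i => ((hg.pd i).pd i).cont
  have h1 : ∀ i, ∫ x, f x * pd i (pd i g) x = ∫ x, pd i (pd i f) x * g x := by
    intro i
    rw [ibp_cc hf hs (hg.pd i), ibp_cc (hf.pd i) (hs' i) hg, neg_neg]
  unfold lap
  simp only [Fin.sum_univ_two, mul_add, add_mul]
  have i1 : ∀ i, Integrable (fun x => f x * pd i (pd i g) x) := fun i => by
    have := c2 i
    exact Continuous.integrable_of_hasCompactSupport (by fun_prop) hs.mul_right
  have i2 : ∀ i, Integrable (fun x => pd i (pd i f) x * g x) := fun i => by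
    have := c1 i
    exact Continuous.integrable_of_hasCompactSupport (by fun_prop) (hs2 i).mul_right
  rw [integral_add (i1 0) (i1 1), integral_add (i2 0) (i2 1), h1, h1]

/-- smooth cut-offs -/
lemma exists_cut : ∃ (χ : ℕ → V2 → ℝ) (L : ℕ → ℝ), (∀ n, Sm (χ n)) ∧ (∀ n, HasCompactSupport (χ n)) ∧
    (∀ n x, 0 ≤ χ n x) ∧ (∀ n x, χ n x ≤ 1) ∧ (∀ x, Tendsto (fun n => χ n x) atTop (𝓝 1)) ∧
    (∀ n x, |lap (χ n) x| ≤ L n) ∧ Tendsto L atTop (𝓝 0) := by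
  let c : ContDiffBump (0 : V2) := ⟨1, 2, one_pos, by norm_num⟩
  have hc : Sm c := c.contDiff
  have hcs : HasCompactSupport c := c.hasCompactSupport
  have hl : Continuous (lap c) := by
    unfold lap
    exact continuous_finsetSum _ fun i _ => ((hc.pd i).pd i).cont
  have hls : HasCompactSupport (lap c) := by
    have hs' : ∀ i, HasCompactSupport (pd i c) := fun i => hcs.fderiv_apply (𝕜 := ℝ) _
    have hs2 : ∀ i, HasCompactSupport (pd i (pd i c)) := fun i => (hs' i).fderiv_apply (𝕜 := ℝ) _
    unfold lap
    simp only [Fin.sum_univ_two]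
    exact (hs2 0).add (hs2 1)
  obtain ⟨M, hM⟩ := hls.exists_bound_of_continuous hl
  have hpd : ∀ (f : V2 → ℝ) (r : ℝ) (i : Fin 2), Sm f → pd i (fun x => f (r • x)) = fun x => r * pd i f (r • x) := by
    intro f r i hf
    ext x
    refine pd_of_line i (by have := hf.diff; fun_prop) ?_
    have h2 : HasDerivAt (fun s : ℝ => r • (x + s • Pi.single i (1:ℝ) : V2)) (r • Pi.single i 1) 0 := by
      have := (((hasDerivAt_id (0:ℝ)).smul_const (Pi.single i (1:ℝ) : V2)).const_add x).const_smul r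
      exact this.congr_deriv (by simp)
    have := HasFDerivAt.comp_hasDerivAt_of_eq (0:ℝ) (hf.diff (r • x)).hasFDerivAt h2 (by simp)
    refine this.congr_deriv ?_
    rw [map_smul]; rfl
  have hsm : ∀ r : ℝ, Sm (fun x => c (r • x)) := fun r => hc.comp (contDiff_const_smul r)
  refine ⟨fun n x => c (((n:ℝ) + 1)⁻¹ • x), fun n => (((n:ℝ) + 1)⁻¹) * M, fun n => hsm _, fun n => ?_,
    fun n x => c.nonneg, fun n x => c.le_one, fun x => ?_, fun n x => ?_, ?_⟩
  · exact hcs.comp_homeomorph (Homeomorph.smulOfNeZero (((n:ℝ) + 1)⁻¹) (by positivity))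
  · refine tendsto_const_nhds.congr' ?_
    obtain ⟨N, hN⟩ := exists_nat_gt ‖x‖
    filter_upwards [eventually_ge_atTop N] with n hn
    refine (c.one_of_mem_closedBall ?_).symm
    rw [mem_closedBall_zero_iff, norm_smul, norm_inv, Real.norm_of_nonneg (by positivity)]
    rw [inv_mul_le_iff₀ (by positivity)]
    have : (N:ℝ) ≤ n := by exact_mod_cast hn
    show ‖x‖ ≤ ((n:ℝ) + 1) * 1
    linarith
  · have hn0 : (0:ℝ) ≤ n := by positivity
    have hr : (((n:ℝ) + 1)⁻¹) ≤ 1 := inv_le_one_of_one_le₀ (by linarith)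
    have hr0 : 0 < (((n:ℝ) + 1)⁻¹) := by positivity
    set r := (((n:ℝ) + 1)⁻¹)
    have e : lap (fun x => c (r • x)) x = r * (r * lap c (r • x)) := by
      unfold lap
      rw [Finset.mul_sum, Finset.mul_sum]
      refine Finset.sum_congr rfl fun i _ => ?_
      rw [hpd c r i hc, pd_const_mul i r]
      · rw [hpd (pd i c) r i (hc.pd i)]
      · have := (hc.pd i).diff; fun_prop
    rw [e, abs_mul, abs_mul, abs_of_pos hr0]
    have := hM (r • x)
    rw [Real.norm_eq_abs] at this
    have h3 : r * |lap c (r • x)| ≤ 1 * M := by gcongr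
    rw [one_mul] at h3
    exact mul_le_mul_of_nonneg_left h3 hr0.le
  · have : Tendsto (fun n : ℕ => ((n:ℝ) + 1)⁻¹) atTop (𝓝 0) := by
      simpa using tendsto_one_div_add_atTop_nhds_zero_nat (𝕜 := ℝ)
    simpa using this.mul_const M

section flow
variable {p q : ℝ} (h : PQ p q) {f g : V2 → ℝ} (hf : Cc f) (hg : Cc g)
  (hu : ∀ t > 0, ∀ x, 0 < Hop hk f t x) (hv : ∀ t > 0, ∀ x, 0 < Hop hk g t x)

/-- the Bellman density -/
def bb (p q : ℝ) (f g : V2 → ℝ) (t : ℝ) (x : V2) : ℝ := bB p q (Hop hk f t x) (Hop hk g t x)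
/-- the dissipation -/
def bQ (p q : ℝ) (f g : V2 → ℝ) (t : ℝ) (x : V2) : ℝ :=
  ∑ k, (bBuu p q (Hop hk f t x) (Hop hk g t x) * Hop (hk1 k) f t x ^ 2
   + 2 * bBuv p q (Hop hk f t x) (Hop hk g t x) * Hop (hk1 k) f t x * Hop (hk1 k) g t x
   + bBvv p q (Hop hk f t x) (Hop hk g t x) * Hop (hk1 k) g t x ^ 2)

include hf hg hu hv

lemma bb_SK : SK (bb p q f g) := by
  have h1 : ContDiffOn ℝ (⊤ : ℕ∞) (fun z : ℝ × V2 => Hop hk f z.1 z.2) UT := Hop_smooth hk_SK hf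
  have h2 : ContDiffOn ℝ (⊤ : ℕ∞) (fun z : ℝ × V2 => Hop hk g z.1 z.2) UT := Hop_smooth hk_SK hg
  have n1 : ∀ z ∈ UT, Hop hk f z.1 z.2 ≠ 0 := fun z hz => (hu _ hz _).ne'
  have n2 : ∀ z ∈ UT, Hop hk g z.1 z.2 ≠ 0 := fun z hz => (hv _ hz _).ne'
  have hE : ContDiffOn ℝ (⊤ : ℕ∞) (fun z : ℝ × V2 => bE p q (Hop hk f z.1 z.2) (Hop hk g z.1 z.2)) UT :=
    (h1.rpow_const_of_ne n1).add (h2.rpow_const_of_ne n2)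
  have hW : ContDiffOn ℝ (⊤ : ℕ∞) (fun z : ℝ × V2 => bW p q (Hop hk f z.1 z.2) (Hop hk g z.1 z.2)) UT :=
    hE.rpow_const_of_ne fun z hz => (bE_pos (hu _ hz _) (hv _ hz _)).ne'
  exact ((h1.pow 2).mul hW).add (contDiffOn_const.mul (h2.rpow_const_of_ne n2))

include h

lemma bb_pd {t : ℝ} (ht : 0 < t) (k : Fin 2) (x : V2) : pd k (bb p q f g t) x =
    bBu p q (Hop hk f t x) (Hop hk g t x) * Hop (hk1 k) f t x
    + bBv p q (Hop hk f t x) (Hop hk g t x) * Hop (hk1 k) g t x := by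
  refine pd_of_line k ((bb_SK hf hg hu hv).slice ht).diff.differentiableAt ?_
  have a1 := line_of_pd k ((Hop_smooth hk_SK hf).slice ht).diff.differentiableAt (x := x)
  have a2 := line_of_pd k ((Hop_smooth hk_SK hg).slice ht).diff.differentiableAt (x := x)
  rw [Hop_hk_pd hf ht] at a1
  rw [Hop_hk_pd hg ht] at a2
  have := bB_d h (hu t ht _) (hv t ht _) a1 a2
  simpa [bb] using this

lemma bb_pd2 {t : ℝ} (ht : 0 < t) (k : Fin 2) (x : V2) : pd k (pd k (bb p q f g t)) x =
    (bBu p q (Hop hk f t x) (Hop hk g t x) * Hop (hk2 k k) f t x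
    + bBv p q (Hop hk f t x) (Hop hk g t x) * Hop (hk2 k k) g t x) +
   (bBuu p q (Hop hk f t x) (Hop hk g t x) * Hop (hk1 k) f t x ^ 2
   + 2 * bBuv p q (Hop hk f t x) (Hop hk g t x) * Hop (hk1 k) f t x * Hop (hk1 k) g t x
   + bBvv p q (Hop hk f t x) (Hop hk g t x) * Hop (hk1 k) g t x ^ 2) := by
  refine pd_of_line k (((bb_SK hf hg hu hv).slice ht).pd k).diff.differentiableAt ?_
  simp only [bb_pd h hf hg hu hv ht]
  have a1 := line_of_pd k ((Hop_smooth hk_SK hf).slice ht).diff.differentiableAt (x := x)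
  have a2 := line_of_pd k ((Hop_smooth hk_SK hg).slice ht).diff.differentiableAt (x := x)
  have c1 := line_of_pd k ((Hop_smooth (hk1_SK k) hf).slice ht).diff.differentiableAt (x := x)
  have c2 := line_of_pd k ((Hop_smooth (hk1_SK k) hg).slice ht).diff.differentiableAt (x := x)
  rw [Hop_hk_pd hf ht] at a1
  rw [Hop_hk_pd hg ht] at a2
  rw [Hop_hk1_pd hf ht] at c1
  rw [Hop_hk1_pd hg ht] at c2
  have d1 := bBu_d h (hu t ht _) (hv t ht _) a1 a2
  have d2 := bBv_d h (hu t ht _) (hv t ht _) a1 a2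
  refine ((d1.mul c1).add (d2.mul c2)).congr_deriv ?_
  simp only [zero_smul, add_zero]
  ring

lemma bb_heat {t : ℝ} (ht : 0 < t) (x : V2) :
    HasDerivAt (fun s => bb p q f g s x) (lap (bb p q f g t) x - bQ p q f g t x) t := by
  have a1 := Hop_hk_dt hf ht x
  have a2 := Hop_hk_dt hg ht x
  refine (bB_d h (hu t ht _) (hv t ht _) a1 a2).congr_deriv ?_
  unfold lap bQ
  simp only [Fin.sum_univ_two, bb_pd2 h hf hg hu hv ht]
  ring

lemma bQ_ge {t : ℝ} (ht : 0 < t) (x : V2) (i j : Fin 2) :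
    2 * |Hop (hk1 i) f t x * Hop (hk1 j) g t x| ≤ bQ p q f g t x := by
  have := bell_diss h (hu t ht x) (hv t ht x) (fun k => Hop (hk1 k) f t x) (fun k => Hop (hk1 k) g t x) i j
  rw [abs_mul, ← mul_assoc]
  exact this

lemma bb_bound {t : ℝ} (ht : 0 < t) (hf0 : ∀ x, 0 ≤ f x) (hg0 : ∀ x, 0 ≤ g x) :
    Integrable (bb p q f g t) ∧ ∫ x, bb p q f g t x ≤ (1 + bK q) * ((∫ x, |f x| ^ p) + ∫ x, |g x| ^ q) := by
  have hp := h.two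
  obtain ⟨i1, v1⟩ := jensen hf hf0 ht (show 1 ≤ p by linarith)
  obtain ⟨i2, v2⟩ := jensen hg hg0 ht h.q1.le
  have hK : 0 ≤ bK q := by
    unfold bK; have : 0 < q - 1 := by linarith [h.q1]
    have : 0 < q := by linarith
    positivity
  have hi : Integrable (bb p q f g t) := by
    refine ((i1.add i2).const_mul (1 + bK q)).mono' ((bb_SK hf hg hu hv).slice ht).cont.aestronglyMeasurable
      (Eventually.of_forall fun x => ?_)
    have := bell_up h (hu t ht x) (hv t ht x)
    show ‖bB p q (Hop hk f t x) (Hop hk g t x)‖ ≤ _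
    rw [Real.norm_of_nonneg this.1]
    exact this.2
  refine ⟨hi, (integral_mono hi ((i1.add i2).const_mul (1 + bK q)) fun x => (bell_up h (hu t ht x) (hv t ht x)).2).trans ?_⟩
  simp only [Pi.add_apply]
  rw [integral_const_mul, integral_add i1 i2]
  gcongr

end flow
end

section

lemma SK.time {k : ℝ → V2 → ℝ} (hk : SK k) :
    ContDiffOn ℝ (⊤ : ℕ∞) (fun z : ℝ × V2 => k z.1 z.2) (Ioi (0:ℝ) ×ˢ univ) :=
  hk.mono fun _ hz => hz.1

lemma cut_eq (χ : V2 → ℝ) (k : V2 → ℝ) : ∫ x, χ x * k x = ∫ x in tsupport χ, χ x • k x := by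
  rw [setIntegral_eq_integral_of_forall_compl_eq_zero]
  · rfl
  · intro x hx
    simp [image_eq_zero_of_notMem_tsupport hx]

lemma cut_smooth {χ : V2 → ℝ} (hχ : Cc χ) {k : ℝ → V2 → ℝ} (hk : SK k) :
    ContDiffOn ℝ (⊤ : ℕ∞) (fun t => ∫ x, χ x * k t x) (Ioi 0) := by
  have := param_contDiffOn (volume : Measure V2) isOpen_Ioi isOpen_univ hχ.supp (subset_univ _) hχ.cont hk.time
  exact this.congr fun t _ => cut_eq χ (k t)

lemma SK.dt_cont {k : ℝ → V2 → ℝ} (hk : SK k) {t : ℝ} (ht : 0 < t) {k' : V2 → ℝ}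
    (hd : ∀ x, HasDerivAt (fun s => k s x) (k' x) t) :
    Continuous k' ∧ ∀ x, fderiv ℝ (fun z : ℝ × V2 => k z.1 z.2) (t, x) (1, 0) = k' x := by
  have key : ∀ x, fderiv ℝ (fun z : ℝ × V2 => k z.1 z.2) (t, x) (1, 0) = k' x := by
    intro x
    have h1 : HasFDerivAt (fun z : ℝ × V2 => k z.1 z.2) _ (t, x) :=
      ((hk.contDiffAt (UT_open.mem_nhds (show (t, x) ∈ UT from ht))).differentiableAt (by simp)).hasFDerivAt
    have h2 : HasDerivAt (fun s : ℝ => ((s, x) : ℝ × V2)) (1, 0) t :=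
      (hasDerivAt_id t).prodMk (hasDerivAt_const _ _)
    have h5 := HasFDerivAt.comp_hasDerivAt_of_eq t h1 h2 rfl
    exact h5.unique (hd x)
  refine ⟨?_, key⟩
  have hc := (hk.continuousOn_fderiv_of_isOpen UT_open (by exact_mod_cast le_top))
  have h3 : Continuous (fun x : V2 => fderiv ℝ (fun z : ℝ × V2 => k z.1 z.2) (t, x)) := by
    rw [← continuousOn_univ]
    exact hc.comp (f := fun x : V2 => (t, x)) (by fun_prop) fun x _ => ht
  have h4 : Continuous (fun x : V2 => fderiv ℝ (fun z : ℝ × V2 => k z.1 z.2) (t, x) (1, 0)) :=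
    h3.clm_apply continuous_const
  exact h4.congr key

lemma cut_deriv {χ : V2 → ℝ} (hχ : Cc χ) {k : ℝ → V2 → ℝ} (hk : SK k) {t : ℝ} (ht : 0 < t) {k' : V2 → ℝ}
    (hd : ∀ x, HasDerivAt (fun s => k s x) (k' x) t) :
    HasDerivAt (fun t => ∫ x, χ x * k t x) (∫ x, χ x * k' x) t := by
  have h0 := param_hasFDerivAt (volume : Measure V2) isOpen_Ioi isOpen_univ hχ.supp (subset_univ _) hχ.cont hk.time
    (show t ∈ Ioi (0:ℝ) from ht)
  have h1 := param_lineDeriv (volume : Measure V2) isOpen_Ioi isOpen_univ hχ.supp (subset_univ _) hχ.cont hk.time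
    (show t ∈ Ioi (0:ℝ) from ht) 1 (k' := k') (fun y _ => (hk.dt_cont ht hd).2 y)
  have h2 := h0.hasDerivAt
  rw [← h0.fderiv, h1, ← cut_eq] at h2
  exact h2.congr_of_eventuallyEq (Eventually.of_forall fun s => cut_eq χ (k s))

lemma bell_n {p q : ℝ} (h : PQ p q) {f g : V2 → ℝ} (hf : Cc f) (hg : Cc g)
    (hf0 : ∀ x, 0 ≤ f x) (hg0 : ∀ x, 0 ≤ g x)
    (hu : ∀ t > 0, ∀ x, 0 < Hop hk f t x) (hv : ∀ t > 0, ∀ x, 0 < Hop hk g t x)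
    {χ : V2 → ℝ} (hχ : Sm χ) (hχs : HasCompactSupport χ) (c0 : ∀ x, 0 ≤ χ x) (c1 : ∀ x, χ x ≤ 1) {L : ℝ}
    (hL : ∀ x, |lap χ x| ≤ L) {s T : ℝ} (hs : 0 < s) (hT : s ≤ T) (i j : Fin 2) :
    2 * ∫ t in s..T, |∫ x, χ x * (Hop (hk1 i) f t x * Hop (hk1 j) g t x)| ≤
      ((T - s) * L + 1) * ((1 + bK q) * ((∫ x, |f x| ^ p) + ∫ x, |g x| ^ q)) := by
  set M := (1 + bK q) * ((∫ x, |f x| ^ p) + ∫ x, |g x| ^ q) with hM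
  have hχc : Cc χ := ⟨hχ.cont, hχs⟩
  have hSK := bb_SK (p := p) (q := q) hf hg hu hv
  have hL0 : 0 ≤ L := (abs_nonneg _).trans (hL 0)
  let Φ : ℝ → ℝ := fun t => ∫ x, χ x * bb p q f g t x
  have hΦs : ContDiffOn ℝ (⊤ : ℕ∞) Φ (Ioi 0) := cut_smooth hχc hSK
  have hΦd : ∀ t > 0, HasDerivAt Φ (∫ x, χ x * (lap (bb p q f g t) x - bQ p q f g t x)) t := fun t ht =>
    cut_deriv hχc hSK ht (fun x => bb_heat h hf hg hu hv ht x)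
  have hJs : ContDiffOn ℝ (⊤ : ℕ∞) (fun t => ∫ x, χ x * (Hop (hk1 i) f t x * Hop (hk1 j) g t x)) (Ioi 0) :=
    cut_smooth hχc (k := fun t x => Hop (hk1 i) f t x * Hop (hk1 j) g t x)
      (ContDiffOn.mul (Hop_smooth (hk1_SK i) hf) (Hop_smooth (hk1_SK j) hg))
  have hΦ'c : ContinuousOn (deriv Φ) (Ioi 0) := hΦs.continuousOn_deriv_of_isOpen isOpen_Ioi (by exact_mod_cast le_top)
  have hsub : uIcc s T ⊆ Ioi 0 := by
    rw [uIcc_of_le hT]; exact fun t ht => hs.trans_le ht.1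
  have bbn : ∀ t > 0, ∀ x, 0 ≤ bb p q f g t x := fun t ht x => (bell_up h (hu t ht x) (hv t ht x)).1
  have hpt : ∀ t > 0, 2 * |∫ x, χ x * (Hop (hk1 i) f t x * Hop (hk1 j) g t x)| ≤ L * M - deriv Φ t := by
    intro t ht
    rw [(hΦd t ht).deriv]
    have hbs := hSK.slice ht
    have hc1 := ((Hop_smooth (hk1_SK i) hf).slice ht).cont
    have hc2 := ((Hop_smooth (hk1_SK j) hg).slice ht).cont
    have hχc' := hχ.cont
    have hk'c := (hSK.dt_cont ht (fun x => bb_heat h hf hg hu hv ht x)).1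
    have hlc : Continuous (lap (bb p q f g t)) := by
      unfold lap
      exact continuous_finsetSum _ fun i _ => ((hbs.pd i).pd i).cont
    have i1 : Integrable (fun x => χ x * (lap (bb p q f g t) x - bQ p q f g t x)) :=
      Continuous.integrable_of_hasCompactSupport (hχc'.mul hk'c) hχs.mul_right
    have i2 : Integrable (fun x => χ x * lap (bb p q f g t) x) :=
      Continuous.integrable_of_hasCompactSupport (hχc'.mul hlc) hχs.mul_right
    have i3 : Integrable (fun x => χ x * |Hop (hk1 i) f t x * Hop (hk1 j) g t x|) :=
      Continuous.integrable_of_hasCompactSupport (by fun_prop) hχs.mul_right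
    have e1 : ∫ x, χ x * (lap (bb p q f g t) x - bQ p q f g t x) ≤
        (∫ x, χ x * lap (bb p q f g t) x) - 2 * ∫ x, χ x * |Hop (hk1 i) f t x * Hop (hk1 j) g t x| := by
      rw [← integral_const_mul, ← integral_sub i2 (i3.const_mul 2)]
      refine integral_mono i1 (i2.sub (i3.const_mul 2)) fun x => ?_
      have := mul_le_mul_of_nonneg_left (bQ_ge h hf hg hu hv ht x i j) (c0 x)
      simp only
      linarith
    have e2 : ∫ x, χ x * lap (bb p q f g t) x ≤ L * M := by
      rw [lap_cc hχ hχs hbs]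
      obtain ⟨j1, j2⟩ := bb_bound h hf hg hu hv ht hf0 hg0
      have : ∫ x, lap χ x * bb p q f g t x ≤ ∫ x, L * bb p q f g t x := by
        refine integral_mono ?_ (j1.const_mul L) fun x => mul_le_mul_of_nonneg_right ((le_abs_self _).trans (hL x)) (bbn t ht x)
        refine (j1.const_mul L).mono' ?_ (Eventually.of_forall fun x => ?_)
        · have hlχ : Continuous (lap χ) := by
            unfold lap
            exact continuous_finsetSum _ fun i _ => ((hχ.pd i).pd i).cont
          exact (hlχ.mul hbs.cont).aestronglyMeasurable
        · rw [norm_mul, Real.norm_eq_abs, Real.norm_of_nonneg (bbn t ht x)]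
          exact mul_le_mul_of_nonneg_right (hL x) (bbn t ht x)
      rw [integral_const_mul] at this
      exact this.trans (mul_le_mul_of_nonneg_left j2 hL0)
    have e3 : |∫ x, χ x * (Hop (hk1 i) f t x * Hop (hk1 j) g t x)| ≤ ∫ x, χ x * |Hop (hk1 i) f t x * Hop (hk1 j) g t x| := by
      refine abs_integral_le_integral_abs.trans (le_of_eq ?_)
      congr 1; ext x; rw [abs_mul, abs_of_nonneg (c0 x)]
    linarith
  have I1 : IntervalIntegrable (fun t => |∫ x, χ x * (Hop (hk1 i) f t x * Hop (hk1 j) g t x)|) volume s T :=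
    ((hJs.continuousOn.mono hsub).abs).intervalIntegrable
  have I2 : IntervalIntegrable (deriv Φ) volume s T := (hΦ'c.mono hsub).intervalIntegrable
  have fin : ∫ t in s..T, 2 * |∫ x, χ x * (Hop (hk1 i) f t x * Hop (hk1 j) g t x)| ≤ ∫ t in s..T, (L * M - deriv Φ t) := by
    refine intervalIntegral.integral_mono_on hT (I1.const_mul 2) (intervalIntegrable_const.sub I2) fun t ht => ?_
    exact hpt t (hs.trans_le ht.1)
  rw [intervalIntegral.integral_const_mul, intervalIntegral.integral_sub intervalIntegrable_const I2,
    intervalIntegral.integral_const, intervalIntegral.integral_deriv_eq_sub (fun t ht => (hΦd t (hsub ht)).differentiableAt) I2] at fin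
  have hT0 : 0 < T := hs.trans_le hT
  have f1 : 0 ≤ Φ T := integral_nonneg fun x => mul_nonneg (c0 x) (bbn T hT0 x)
  have f2 : Φ s ≤ M := by
    obtain ⟨j1, j2⟩ := bb_bound h hf hg hu hv hs hf0 hg0
    refine (integral_mono_of_nonneg (Eventually.of_forall fun x => mul_nonneg (c0 x) (bbn s hs x)) j1
      (Eventually.of_forall fun x => mul_le_of_le_one_left (bbn s hs x) (c1 x))).trans j2
  rw [smul_eq_mul] at fin
  linarith [mul_assoc (T - s) L M]

/-- the pairing -/
def pair (i j : Fin 2) (f g : V2 → ℝ) (t : ℝ) : ℝ := ∫ x, f x * Hop (hk2 i j) g (2 * t) x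

lemma hk2_dbl {g : V2 → ℝ} (hg : Cc g) (i j : Fin 2) : SK (fun t x => Hop (hk2 i j) g (2 * t) x) := by
  have h := Hop_smooth (hk2_SK i j) hg
  have h2 : ContDiff ℝ (⊤ : ℕ∞) (fun z : ℝ × V2 => (2 * z.1, z.2)) := by fun_prop
  exact ContDiffOn.comp (g := fun z : ℝ × V2 => Hop (hk2 i j) g z.1 z.2) h h2.contDiffOn
    (fun z hz => by have : 0 < z.1 := hz
                    show 0 < 2 * z.1
                    linarith)

lemma pair_cont {f g : V2 → ℝ} (hf : Cc f) (hg : Cc g) (i j : Fin 2) : ContinuousOn (pair i j f g) (Ioi 0) :=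
  (cut_smooth hf (hk2_dbl hg i j)).continuousOn

lemma bell_pos {p q : ℝ} (h : PQ p q) {f g : V2 → ℝ} (hf : Cc f) (hg : Cc g)
    (hf0 : ∀ x, 0 ≤ f x) (hg0 : ∀ x, 0 ≤ g x) {s T : ℝ} (hs : 0 < s) (hT : s ≤ T) (i j : Fin 2) :
    |∫ t in s..T, pair i j f g t| ≤ (1 + bK q) * ((∫ x, |f x| ^ p) + ∫ x, |g x| ^ q) := by
  have hK : 0 ≤ bK q := by
    unfold bK; have : 0 < q - 1 := by linarith [h.q1]
    have : 0 < q := by linarith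
    positivity
  set M := (1 + bK q) * ((∫ x, |f x| ^ p) + ∫ x, |g x| ^ q) with hM
  have hM0 : 0 ≤ M := by
    have h1 : 0 ≤ ∫ x, |f x| ^ p := integral_nonneg fun x => by positivity
    have h2 : 0 ≤ ∫ x, |g x| ^ q := integral_nonneg fun x => by positivity
    positivity
  by_cases hfz : ∀ x, f x = 0
  · simp [pair, hfz, hM0]
  by_cases hgz : ∀ x, g x = 0
  · simp [pair, hgz, Hop, hM0]
  push Not at hfz hgz
  obtain ⟨x0, hx0⟩ := hfz
  obtain ⟨x1, hx1⟩ := hgz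
  have hu : ∀ t > 0, ∀ x, 0 < Hop hk f t x := fun t ht x => Hop_pos hf hf0 hx0 ht x
  have hv : ∀ t > 0, ∀ x, 0 < Hop hk g t x := fun t ht x => Hop_pos hg hg0 hx1 ht x
  obtain ⟨χ, L, hχ, hχs, c0, c1, hχ1, hL, hL0⟩ := exists_cut
  let J : ℕ → ℝ → ℝ := fun n t => ∫ x, χ n x * (Hop (hk1 i) f t x * Hop (hk1 j) g t x)
  have hJc : ∀ n, ContinuousOn (J n) (Ioi 0) := fun n =>
    (cut_smooth ⟨(hχ n).cont, hχs n⟩ (k := fun t x => Hop (hk1 i) f t x * Hop (hk1 j) g t x)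
      (ContDiffOn.mul (Hop_smooth (hk1_SK i) hf) (Hop_smooth (hk1_SK j) hg))).continuousOn
  have hJl : ∀ t > 0, Tendsto (fun n => J n t) atTop (𝓝 (- pair i j f g t)) := by
    intro t ht
    obtain ⟨a, b⟩ := hop_dual ht i j hg hf
    have : - pair i j f g t = ∫ x, Hop (hk1 i) f t x * Hop (hk1 j) g t x := b.symm
    rw [this]
    refine tendsto_integral_of_dominated_convergence (fun x => |Hop (hk1 i) f t x * Hop (hk1 j) g t x|) ?_ a.abs ?_ ?_
    · intro n
      exact ((hχ n).cont.mul (((Hop_smooth (hk1_SK i) hf).slice ht).cont.mul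
        ((Hop_smooth (hk1_SK j) hg).slice ht).cont)).aestronglyMeasurable
    · intro n
      refine Eventually.of_forall fun x => ?_
      rw [norm_mul, Real.norm_of_nonneg (c0 n x)]
      exact mul_le_of_le_one_left (norm_nonneg _) (c1 n x)
    · refine Eventually.of_forall fun x => ?_
      simpa using (hχ1 x).mul_const (Hop (hk1 i) f t x * Hop (hk1 j) g t x)
  have hsub : Icc s T ⊆ Ioi 0 := fun t ht => hs.trans_le ht.1
  have hio : Ioc s T ⊆ Ioi 0 := fun t ht => hs.trans ht.1
  have fat : ∫⁻ t in Ioc s T, ENNReal.ofReal |pair i j f g t| ≤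
      liminf (fun n => ∫⁻ t in Ioc s T, ENNReal.ofReal |J n t|) atTop := by
    refine le_trans (le_of_eq ?_) (lintegral_liminf_le' ?_)
    · refine setLIntegral_congr_fun measurableSet_Ioc fun t ht => ?_
      have := (ENNReal.continuous_ofReal.tendsto _).comp ((hJl t (hio ht)).abs)
      rw [abs_neg] at this
      exact this.liminf_eq.symm
    · intro n
      exact (ENNReal.measurable_ofReal.comp_aemeasurable
        (((hJc n).mono hio).abs.aemeasurable measurableSet_Ioc))
  have hn : ∀ n, ∫⁻ t in Ioc s T, ENNReal.ofReal |J n t| ≤ ENNReal.ofReal (((T - s) * L n + 1) * M) := by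
    intro n
    rw [← ofReal_integral_eq_lintegral_ofReal]
    · refine ENNReal.ofReal_le_ofReal ?_
      have := bell_n h hf hg hf0 hg0 hu hv (hχ n) (hχs n) (c0 n) (c1 n) (hL n) hs hT i j
      rw [← intervalIntegral.integral_of_le hT]
      have h0 : 0 ≤ ∫ t in s..T, |J n t| := intervalIntegral.integral_nonneg hT fun t _ => abs_nonneg _
      have : 2 * ∫ t in s..T, |J n t| ≤ ((T - s) * L n + 1) * M := this
      linarith
    · exact (((hJc n).mono hsub).abs.integrableOn_compact isCompact_Icc).mono_set Ioc_subset_Icc_self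
    · exact Eventually.of_forall fun t => abs_nonneg _
  have hlim : Tendsto (fun n => ENNReal.ofReal (((T - s) * L n + 1) * M)) atTop (𝓝 (ENNReal.ofReal M)) := by
    refine (ENNReal.continuous_ofReal.tendsto _).comp ?_
    have := ((hL0.const_mul (T - s)).add_const 1).mul_const M
    simpa using this
  have key : ∫⁻ t in Ioc s T, ENNReal.ofReal |pair i j f g t| ≤ ENNReal.ofReal M := by
    refine fat.trans ?_
    rw [← hlim.liminf_eq]
    exact liminf_le_liminf (Eventually.of_forall hn)
  refine (intervalIntegral.abs_integral_le_integral_abs hT).trans ?_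
  rw [intervalIntegral.integral_of_le hT]
  have hpi : IntegrableOn (fun t => |pair i j f g t|) (Ioc s T) :=
    (((pair_cont hf hg i j).mono hsub).abs.integrableOn_compact isCompact_Icc).mono_set Ioc_subset_Icc_self
  rw [← ofReal_integral_eq_lintegral_ofReal hpi (Eventually.of_forall fun t => abs_nonneg _)] at key
  exact (ENNReal.ofReal_le_ofReal_iff hM0).1 key

lemma Hop_sub {K : ℝ → V2 → ℝ} {t : ℝ} (hK : Continuous (K t)) {f g : V2 → ℝ} (hf : Cc f) (hg : Cc g) (x : V2) :
    Hop K (fun y => f y - g y) t x = Hop K f t x - Hop K g t x := by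
  unfold Hop
  rw [← integral_sub (Hop_int hK hf x) (Hop_int hK hg x)]
  congr 1; ext y; ring

lemma Cc.posp {f : V2 → ℝ} (hf : Cc f) : Cc (fun x => max (f x) 0) :=
  ⟨by have := hf.cont; fun_prop, hf.supp.comp_left (g := fun r => max r 0) (by simp)⟩

lemma Cc.neg {f : V2 → ℝ} (hf : Cc f) : Cc (fun x => - f x) :=
  ⟨by have := hf.cont; fun_prop, hf.supp.comp_left (g := fun r => - r) (by simp)⟩

lemma posp_le {f : V2 → ℝ} (hf : Cc f) {p : ℝ} (hp : 0 < p) : ∫ x, |max (f x) 0| ^ p ≤ ∫ x, |f x| ^ p := by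
  refine integral_mono (hf.posp.rpow hp).int (hf.rpow hp).int fun x => ?_
  refine Real.rpow_le_rpow (abs_nonneg _) ?_ hp.le
  rw [abs_of_nonneg (le_max_right _ _)]
  exact max_le (le_abs_self _) (abs_nonneg _)

lemma pair_int {f g : V2 → ℝ} (hf : Cc f) (hg : Cc g) (i j : Fin 2) {t : ℝ} (ht : 0 < t) :
    Integrable (fun x => f x * Hop (hk2 i j) g (2 * t) x) :=
  Continuous.integrable_of_hasCompactSupport (hf.cont.mul ((hk2_dbl hg i j).slice ht).cont) hf.supp.mul_right

lemma bell_main {p q : ℝ} (h : PQ p q) {f g : V2 → ℝ} (hf : Cc f) (hg : Cc g)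
    {s T : ℝ} (hs : 0 < s) (hT : s ≤ T) (i j : Fin 2) :
    |∫ t in s..T, pair i j f g t| ≤ 4 * (1 + bK q) * ((∫ x, |f x| ^ p) + ∫ x, |g x| ^ q) := by
  have hK : 0 ≤ bK q := by
    unfold bK; have : 0 < q - 1 := by linarith [h.q1]
    have : 0 < q := by linarith
    positivity
  have hp : 0 < p := by linarith [h.two]
  have hq : 0 < q := by linarith [h.q1]
  have split : ∀ a : ℝ, a = max a 0 - max (-a) 0 := fun a => by
    rcases le_total a 0 with h | h <;> simp [h]
  have e : ∀ t > 0, pair i j f g t = (pair i j (fun x => max (f x) 0) (fun x => max (g x) 0) t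
     - pair i j (fun x => max (f x) 0) (fun x => max (- g x) 0) t)
     - (pair i j (fun x => max (- f x) 0) (fun x => max (g x) 0) t
     - pair i j (fun x => max (- f x) 0) (fun x => max (- g x) 0) t) := by
    intro t ht
    unfold pair
    have e1 : ∀ x, Hop (hk2 i j) g (2 * t) x = Hop (hk2 i j) (fun x => max (g x) 0) (2 * t) x
        - Hop (hk2 i j) (fun x => max (- g x) 0) (2 * t) x := fun x => by
      rw [← Hop_sub ((hk2_SK i j).slice (by linarith)).cont hg.posp hg.neg.posp]
      congr 1; ext y; exact split _
    rw [← integral_sub (pair_int hf.posp hg.posp i j ht) (pair_int hf.posp hg.neg.posp i j ht),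
      ← integral_sub (pair_int hf.neg.posp hg.posp i j ht) (pair_int hf.neg.posp hg.neg.posp i j ht)]
    refine Eq.trans ?_ (integral_sub ((pair_int hf.posp hg.posp i j ht).sub (pair_int hf.posp hg.neg.posp i j ht))
       ((pair_int hf.neg.posp hg.posp i j ht).sub (pair_int hf.neg.posp hg.neg.posp i j ht)))
    congr 1; ext x
    rw [e1 x]
    conv_lhs => rw [split (f x)]
    ring
  have hsub : uIcc s T ⊆ Ioi 0 := by
    rw [uIcc_of_le hT]; exact fun t ht => hs.trans_le ht.1
  have I : ∀ {f g : V2 → ℝ}, Cc f → Cc g → IntervalIntegrable (pair i j f g) volume s T := fun hf hg =>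
    ((pair_cont hf hg i j).mono hsub).intervalIntegrable
  rw [intervalIntegral.integral_congr (fun t ht => e t (hsub ht)),
    intervalIntegral.integral_sub ((I hf.posp hg.posp).sub (I hf.posp hg.neg.posp))
      ((I hf.neg.posp hg.posp).sub (I hf.neg.posp hg.neg.posp)),
    intervalIntegral.integral_sub (I hf.posp hg.posp) (I hf.posp hg.neg.posp),
    intervalIntegral.integral_sub (I hf.neg.posp hg.posp) (I hf.neg.posp hg.neg.posp)]
  have b1 := bell_pos h hf.posp hg.posp (fun x => le_max_right _ _) (fun x => le_max_right _ _) hs hT i j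
  have b2 := bell_pos h hf.posp hg.neg.posp (fun x => le_max_right _ _) (fun x => le_max_right _ _) hs hT i j
  have b3 := bell_pos h hf.neg.posp hg.posp (fun x => le_max_right _ _) (fun x => le_max_right _ _) hs hT i j
  have b4 := bell_pos h hf.neg.posp hg.neg.posp (fun x => le_max_right _ _) (fun x => le_max_right _ _) hs hT i j
  have c1 := posp_le hf hp
  have c2 := posp_le hf.neg hp
  have c3 := posp_le hg hq
  have c4 := posp_le hg.neg hq
  simp only [abs_neg] at c2 c4
  have mono : ∀ {a b a' b' : ℝ}, a ≤ a' → b ≤ b' → (1 + bK q) * (a + b) ≤ (1 + bK q) * (a' + b') := by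
    intro a b a' b' h1 h2; gcongr
  have d1 := b1.trans (mono c1 c3)
  have d2 := b2.trans (mono c1 c4)
  have d3 := b3.trans (mono c2 c3)
  have d4 := b4.trans (mono c2 c4)
  rw [abs_le] at *
  constructor <;> linarith [d1.1, d2.1, d3.1, d4.1, d1.2, d2.2, d3.2, d4.2]
end

section

/-- signed power -/
def sp (r a : ℝ) : ℝ := (max a 0) ^ r - (max (-a) 0) ^ r

lemma sp_cont {r : ℝ} (hr : 0 ≤ r) : Continuous (sp r) := by
  unfold sp
  exact ((continuous_id.max continuous_const).rpow_const fun x => Or.inr hr).sub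
    ((continuous_neg.max continuous_const).rpow_const fun x => Or.inr hr)

lemma sp_abs {r : ℝ} (hr : 0 < r) (a : ℝ) : |sp r a| = |a| ^ r := by
  unfold sp
  rcases le_total a 0 with h | h
  · rw [max_eq_right h, max_eq_left (by linarith), Real.zero_rpow hr.ne', zero_sub, abs_neg, abs_of_nonpos h]
    exact abs_of_nonneg (Real.rpow_nonneg (by linarith) _)
  · rw [max_eq_left h, max_eq_right (by linarith), Real.zero_rpow hr.ne', sub_zero, abs_of_nonneg h]
    exact abs_of_nonneg (Real.rpow_nonneg h _)

lemma sp_mul {r : ℝ} (hr : 0 < r) (a : ℝ) : sp r a * a = |a| ^ (r + 1) := by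
  unfold sp
  rcases le_total a 0 with h | h
  · rw [max_eq_right h, max_eq_left (by linarith), Real.zero_rpow hr.ne', zero_sub, abs_of_nonpos h,
      Real.rpow_add_one' (by linarith) (by linarith)]
    ring
  · rw [max_eq_left h, max_eq_right (by linarith), Real.zero_rpow hr.ne', sub_zero, abs_of_nonneg h,
      Real.rpow_add_one' h (by linarith)]

lemma sp_zero {r : ℝ} : sp r 0 = 0 := by simp [sp]

lemma rp_add {r : ℝ} (hr : 0 ≤ r) (a b : ℝ) : |a + b| ^ r ≤ 2 ^ r * (|a| ^ r + |b| ^ r) := by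
  have h1 : |a + b| ≤ 2 * max |a| |b| := by
    have := abs_add_le a b
    have := le_max_left |a| |b|
    have := le_max_right |a| |b|
    linarith
  have h0 : 0 ≤ max |a| |b| := (abs_nonneg a).trans (le_max_left _ _)
  refine (Real.rpow_le_rpow (abs_nonneg _) h1 hr).trans ?_
  rw [Real.mul_rpow (by norm_num) h0]
  refine mul_le_mul_of_nonneg_left ?_ (by positivity)
  have ha : 0 ≤ |a| ^ r := by positivity
  have hb : 0 ≤ |b| ^ r := by positivity
  rcases max_cases |a| |b| with h | h <;> rw [h.1] <;> linarith

lemma PQ.eq2 {p q : ℝ} (h : PQ p q) : (q - 1) * p = q := by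
  have := h.eq; linarith

lemma PQ.young {p q : ℝ} (h : PQ p q) {a b : ℝ} (ha : 0 ≤ a) (hb : 0 ≤ b) : a * b ≤ a ^ p + b ^ q := by
  have hp := h.two
  have hq := h.q1
  have hc : p.HolderConjugate q := by
    rw [Real.holderConjugate_iff]
    refine ⟨by linarith, ?_⟩
    field_simp
    linarith [h.eq]
  have h1 := Real.young_inequality_of_nonneg ha hb hc
  have h2 : a ^ p / p ≤ a ^ p := div_le_self (by positivity) (by linarith)
  have h3 : b ^ q / q ≤ b ^ q := div_le_self (by positivity) (by linarith)
  linarith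

/-- continuous radial cut-off -/
def rc (R : ℝ) (x : V2) : ℝ := max 0 (min 1 (R + 1 - ‖x‖))

lemma rc_cont (R : ℝ) : Continuous (rc R) := by unfold rc; fun_prop
lemma rc_nonneg (R : ℝ) (x : V2) : 0 ≤ rc R x := le_max_left _ _
lemma rc_le (R : ℝ) (x : V2) : rc R x ≤ 1 := max_le zero_le_one (min_le_left _ _)
lemma rc_one {R : ℝ} {x : V2} (hx : ‖x‖ ≤ R) : rc R x = 1 := by
  unfold rc; rw [min_eq_left (by linarith)]; norm_num
lemma rc_zero {R : ℝ} {x : V2} (hx : R + 1 ≤ ‖x‖) : rc R x = 0 := by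
  unfold rc; rw [max_eq_left]; exact (min_le_right _ _).trans (by linarith)
lemma rc_supp (R : ℝ) : HasCompactSupport (rc R) := by
  refine HasCompactSupport.intro (isCompact_closedBall (0 : V2) (R + 1)) fun x hx => rc_zero ?_
  simp only [mem_closedBall_zero_iff, not_le] at hx
  exact hx.le

lemma dual_bound {p q : ℝ} (h : PQ p q) {C G R : ℝ} (hC : 1 ≤ C) (hG : 0 ≤ G) {I : V2 → ℝ} (hI : Continuous I)
    (hyp : ∀ f : V2 → ℝ, Cc f → (∀ x, f x ≠ 0 → ‖x‖ ≤ R + 1) → |∫ x, f x * I x| ≤ C * ((∫ x, |f x| ^ p) + G)) :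
    ∫ x in Metric.closedBall 0 R, |I x| ^ q ≤ 4 * C ^ 2 * G := by
  have hp := h.two
  have hq := h.q1
  set lam : ℝ := (2 * C)⁻¹ with hlam
  have hl0 : 0 < lam := by positivity
  have hl1 : lam ≤ 1 := inv_le_one_of_one_le₀ (by linarith)
  have hkc := rc_cont R
  have hsc := sp_cont (show 0 ≤ q - 1 by linarith)
  let f : V2 → ℝ := fun x => rc R x * (lam * sp (q - 1) (I x))
  have hf : Cc f := ⟨by fun_prop, (rc_supp R).mul_right⟩
  have hi0 : Integrable (fun x => rc R x * |I x| ^ q) :=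
    Continuous.integrable_of_hasCompactSupport (hkc.mul (hI.abs.rpow_const fun x => Or.inr (by linarith)))
      (rc_supp R).mul_right
  have h1 := hyp f hf (fun x hx => by
    by_contra hn
    exact hx (by simp [f, rc_zero (not_le.1 hn).le]))
  set A := ∫ x, rc R x * |I x| ^ q with hA
  have hA0 : 0 ≤ A := integral_nonneg fun x => mul_nonneg (rc_nonneg R x) (by positivity)
  have e1 : ∫ x, f x * I x = lam * A := by
    rw [hA, ← integral_const_mul]
    congr 1; ext x
    have := sp_mul (show 0 < q - 1 by linarith) (I x)
    rw [sub_add_cancel] at this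
    rw [← this]; ring
  have e2 : ∫ x, |f x| ^ p ≤ lam ^ 2 * A := by
    rw [hA, ← integral_const_mul]
    refine integral_mono (hf.rpow (by linarith)).int (hi0.const_mul _) fun x => ?_
    simp only [f]
    rw [abs_mul, abs_mul, sp_abs (by linarith), Real.mul_rpow (abs_nonneg _) (by positivity),
      Real.mul_rpow (by positivity) (by positivity), ← Real.rpow_mul (abs_nonneg _), h.eq2,
      abs_of_nonneg (rc_nonneg R x), abs_of_pos hl0]
    have a1 : rc R x ^ p ≤ rc R x := by
      have := Real.rpow_le_rpow_of_exponent_ge' (rc_nonneg R x) (rc_le R x) zero_le_one (show (1:ℝ) ≤ p by linarith)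
      simpa using this
    have a2 : lam ^ p ≤ lam ^ 2 := by
      have := Real.rpow_le_rpow_of_exponent_ge' hl0.le hl1 (by norm_num : (0:ℝ) ≤ 2) hp
      simpa using this
    have a3 : 0 ≤ |I x| ^ q := by positivity
    calc rc R x ^ p * (lam ^ p * |I x| ^ q) ≤ rc R x * (lam ^ 2 * |I x| ^ q) := by
          have := rc_nonneg R x
          gcongr
      _ = _ := by ring
  have e3 : lam * A ≤ C * (lam ^ 2 * A + G) := by
    have := (le_abs_self _).trans h1
    rw [e1] at this
    refine this.trans ?_
    gcongr
  have e4 : C * lam = 1 / 2 := by rw [hlam]; field_simp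
  have e5 : A ≤ 4 * C ^ 2 * G := by
    have : C * (lam ^ 2 * A + G) = lam / 2 * A + C * G := by
      linear_combination (lam * A) * e4
    have h6 : lam * A ≤ 2 * C * G := by linarith
    have h7 : A = 2 * C * (lam * A) := by linear_combination (-2 * A) * e4
    rw [h7]
    calc 2 * C * (lam * A) ≤ 2 * C * (2 * C * G) := by gcongr
      _ = _ := by ring
  refine le_trans ?_ e5
  rw [hA]
  refine le_trans (le_of_eq ?_) (setIntegral_le_integral (s := Metric.closedBall 0 R) hi0
    (Eventually.of_forall fun x => mul_nonneg (rc_nonneg R x) (by positivity)))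
  refine setIntegral_congr_fun measurableSet_closedBall fun x hx => ?_
  rw [rc_one (mem_closedBall_zero_iff.1 hx), one_mul]

/-! time integrals -/
lemma SK.dbl {K : ℝ → V2 → ℝ} (h : SK K) : SK (fun t x => K (2 * t) x) := by
  have h2 : ContDiff ℝ (⊤ : ℕ∞) (fun z : ℝ × V2 => (2 * z.1, z.2)) := by fun_prop
  exact ContDiffOn.comp (g := fun z : ℝ × V2 => K z.1 z.2) h h2.contDiffOn
    (fun z hz => by have : 0 < z.1 := hz
                    show 0 < 2 * z.1
                    linarith)

/-- integral in time -/
def tint (s T : ℝ) (K : ℝ → V2 → ℝ) (x : V2) : ℝ := ∫ τ in s..T, K τ x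

lemma SK.flip {K : ℝ → V2 → ℝ} (h : SK K) :
    ContDiffOn ℝ (⊤ : ℕ∞) (fun z : V2 × ℝ => K z.2 z.1) (univ ×ˢ Ioi (0:ℝ)) := by
  have h2 : ContDiff ℝ (⊤ : ℕ∞) (fun z : V2 × ℝ => (z.2, z.1)) := by fun_prop
  exact ContDiffOn.comp (g := fun z : ℝ × V2 => K z.1 z.2) h h2.contDiffOn (fun z hz => hz.2)

lemma tint_eq {s T : ℝ} (hT : s ≤ T) (K : ℝ → V2 → ℝ) (x : V2) :
    tint s T K x = ∫ τ in Icc s T, (1:ℝ) • K τ x := by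
  unfold tint
  rw [intervalIntegral.integral_of_le hT, integral_Icc_eq_integral_Ioc]
  simp

lemma tint_smooth {s T : ℝ} (hs : 0 < s) (hT : s ≤ T) {K : ℝ → V2 → ℝ} (hK : SK K) : Sm (tint s T K) := by
  have := param_contDiffOn (volume : Measure ℝ) isOpen_univ isOpen_Ioi isCompact_Icc
    (show Icc s T ⊆ Ioi 0 from fun t ht => hs.trans_le ht.1) (f := fun _ => (1:ℝ)) continuous_const hK.flip
  rw [contDiffOn_univ] at this
  exact (funext fun x => tint_eq hT K x) ▸ this

lemma tint_pd {s T : ℝ} (hs : 0 < s) (hT : s ≤ T) {K : ℝ → V2 → ℝ} (hK : SK K) (i : Fin 2) :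
    pd i (tint s T K) = tint s T (fun t => pd i (K t)) := by
  ext x
  rw [tint_eq hT]
  have := param_lineDeriv (volume : Measure ℝ) isOpen_univ isOpen_Ioi isCompact_Icc
    (show Icc s T ⊆ Ioi 0 from fun t ht => hs.trans_le ht.1) (f := fun _ => (1:ℝ)) continuous_const hK.flip
    (mem_univ x) (Pi.single i 1) (k' := fun t => pd i (K t) x) (fun t ht => by
      have ht0 : 0 < t := hs.trans_le ht.1
      have h1 : HasFDerivAt (fun z : V2 × ℝ => K z.2 z.1) _ (x, t) :=
        ((hK.flip.contDiffAt ((isOpen_univ.prod isOpen_Ioi).mem_nhds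
          (show (x, t) ∈ univ ×ˢ Ioi (0:ℝ) from ⟨mem_univ _, ht0⟩))).differentiableAt (by simp)).hasFDerivAt
      have h2 := HasFDerivAt.comp (g := fun z : V2 × ℝ => K z.2 z.1) x h1 (hasFDerivAt_prodMk_left (𝕜 := ℝ) x t)
      have h3 : fderiv ℝ (K t) x = _ := h2.fderiv
      unfold pd
      rw [h3]
      simp)
  rw [← this]
  unfold pd
  rw [show tint s T K = _ from funext fun x => tint_eq hT K x]

lemma tint_pair {s T : ℝ} (hs : 0 < s) (hT : s ≤ T) {K : ℝ → V2 → ℝ} (hK : SK K) {f : V2 → ℝ} (hf : Cc f) :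
    ∫ x, f x * tint s T K x = ∫ t in s..T, ∫ x, f x * K t x := by
  rw [intervalIntegral.integral_of_le hT, ← integral_Icc_eq_integral_Ioc]
  have e1 : ∀ x, f x * tint s T K x = ∫ t in Icc s T, f x * K t x := fun x => by
    rw [integral_const_mul, tint_eq hT]; simp
  have hin : Integrable (fun z : V2 × ℝ => f z.1 * K z.2 z.1) ((volume.restrict (tsupport f)).prod (volume.restrict (Icc s T))) := by
    rw [Measure.prod_restrict]
    refine ContinuousOn.integrableOn_compact (hf.supp.isCompact.prod isCompact_Icc) ?_
    refine ContinuousOn.mul (hf.cont.comp continuous_fst).continuousOn ?_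
    exact hK.flip.continuousOn.mono (fun z hz => ⟨mem_univ _, hs.trans_le hz.2.1⟩)
  calc ∫ x, f x * tint s T K x = ∫ x in tsupport f, f x * tint s T K x := by
        have := cut_eq f (tint s T K); simpa using this
    _ = ∫ x in tsupport f, ∫ t in Icc s T, f x * K t x := by simp only [e1]
    _ = ∫ t in Icc s T, ∫ x in tsupport f, f x * K t x := integral_integral_swap hin
    _ = _ := by
        congr 1; ext t
        have := cut_eq f (K t); simpa using this.symm
end

section

lemma pairK {p q : ℝ} (h : PQ p q) {R : ℝ} {m K : V2 → ℝ} (hm : Integrable m) (hm0 : ∀ z, 0 ≤ m z)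
    (hKm : ∀ z, ‖z‖ ≤ 2 * R → |K z| ≤ m z) {f g : V2 → ℝ} (hf : Cc f) (hg : Cc g)
    (sf : ∀ x, f x ≠ 0 → ‖x‖ ≤ R) (sg : ∀ x, g x ≠ 0 → ‖x‖ ≤ R) :
    |∫ x, f x * ∫ y, g y * K (x - y)| ≤ ((∫ x, |f x| ^ p) + ∫ x, |g x| ^ q) * ∫ z, m z := by
  have hp : 0 < p := by linarith [h.two]
  have hq : 0 < q := by linarith [h.q1]
  obtain ⟨a, b⟩ := conv_mass (hg.rpow hq).int hm
  have hfi := (hf.rpow hp).int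
  refine abs_integral_le_integral_abs.trans ?_
  have hpt : ∀ x, |f x * ∫ y, g y * K (x - y)| ≤ |f x| ^ p * (∫ z, m z) + ∫ y, |g y| ^ q * m (x - y) := by
    intro x
    have hI0 : 0 ≤ ∫ z, m z := integral_nonneg hm0
    have hI1 : 0 ≤ ∫ y, |g y| ^ q * m (x - y) := integral_nonneg fun y => mul_nonneg (by positivity) (hm0 _)
    by_cases hx : f x = 0
    · rw [hx]; simp only [zero_mul, abs_zero, Real.zero_rpow hp.ne']; linarith
    have hxR := sf x hx
    have hmi : Integrable (fun y => m (x - y)) := hm.comp_sub_left x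
    have hgi : Integrable (fun y => |g y| ^ q * m (x - y)) := by
      obtain ⟨M, hM⟩ := (hg.rpow hq).supp.exists_bound_of_continuous (hg.rpow hq).cont
      exact hmi.bdd_mul (c := M) (hg.rpow hq).cont.aestronglyMeasurable (Eventually.of_forall hM)
    rw [← integral_const_mul, ← integral_sub_left_eq_self m volume x, ← integral_const_mul,
      ← integral_add (hmi.const_mul _) hgi]
    refine abs_integral_le_integral_abs.trans ?_
    refine integral_mono_of_nonneg (Eventually.of_forall fun y => abs_nonneg _) ((hmi.const_mul _).add hgi)
      (Eventually.of_forall fun y => ?_)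
    simp only [Pi.add_apply]
    rw [← add_mul]
    by_cases hy : g y = 0
    · rw [hy]; simp only [zero_mul, mul_zero, abs_zero]
      exact mul_nonneg (by positivity) (hm0 _)
    have hyR := sg y hy
    rw [abs_mul, abs_mul, ← mul_assoc]
    have h1 := h.young (abs_nonneg (f x)) (abs_nonneg (g y))
    have h2 := hKm (x - y) (by have := norm_sub_le x y; linarith)
    gcongr
  refine (integral_mono_of_nonneg (Eventually.of_forall fun y => abs_nonneg _)
    ((hfi.mul_const _).add a) (Eventually.of_forall hpt)).trans (le_of_eq ?_)
  simp only [Pi.add_apply]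
  rw [integral_add (hfi.mul_const _) a, b, integral_mul_const]
  ring

lemma hk1_L1 {t : ℝ} (ht : 0 < t) (j : Fin 2) : ∫ x, |hk1 j t x| ≤ (√t)⁻¹ := by
  have hs : 0 < √t := Real.sqrt_pos.2 ht
  have hss : √t * √t = t := Real.mul_self_sqrt ht.le
  obtain ⟨i0, v0⟩ := hk_mass ht
  obtain ⟨i2, v2⟩ := hk_m2 ht j j
  have hpt : ∀ x, |hk1 j t x| ≤ (4 * √t)⁻¹ * hk t x + (4 * t * √t)⁻¹ * (x j * x j * hk t x) := by
    intro x
    have hp := hk_pos ht x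
    unfold hk1
    rw [abs_mul, abs_neg, abs_div, abs_of_pos hp, abs_of_pos (show 0 < 2 * t by positivity)]
    have e : (4 * √t)⁻¹ * hk t x + (4 * t * √t)⁻¹ * (x j * x j * hk t x) - |x j| / (2 * t) * hk t x
      = (4 * t * √t)⁻¹ * (√t - |x j|) ^ 2 * hk t x := by
      have : |x j| * |x j| = x j * x j := abs_mul_abs_self _
      rw [sub_sq, pow_two |x j|, this]
      field_simp
      linear_combination (-2) * hss
    have : 0 ≤ (4 * t * √t)⁻¹ * (√t - |x j|) ^ 2 * hk t x := by positivity
    linarith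
  refine (integral_mono (hk1_int ht j).abs ((i0.const_mul _).add (i2.const_mul _)) hpt).trans ?_
  simp only [Pi.add_apply]
  rw [integral_add (i0.const_mul _) (i2.const_mul _), integral_const_mul, integral_const_mul, v0, v2, if_pos rfl]
  have : (4 * √t)⁻¹ * 1 + (4 * t * √t)⁻¹ * (2 * t) = 3 / 4 * (√t)⁻¹ := by field_simp; ring
  rw [this]
  have : 0 < (√t)⁻¹ := by positivity
  linarith

lemma hk1_sup {t R : ℝ} (ht : 0 < t) (j : Fin 2) {x : V2} (hx : ‖x‖ ≤ 2 * R) : |hk1 j t x| ≤ R / t ^ 2 := by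
  have hxj : |x j| ≤ 2 * R := (norm_le_pi_norm x j).trans hx
  have hR : 0 ≤ 2 * R := (abs_nonneg _).trans hxj
  unfold hk1
  rw [abs_mul, abs_neg, abs_div, abs_of_pos (hk_pos ht x), abs_of_pos (show 0 < 2 * t by positivity)]
  have h1 : hk t x ≤ (4 * π * t)⁻¹ := by
    unfold hk
    refine mul_le_of_le_one_right (by positivity) (Real.exp_le_one_iff.2 ?_)
    have : 0 ≤ (x 0 ^ 2 + x 1 ^ 2) / (4 * t) := by positivity
    rw [neg_div]; linarith
  have h2 : (4 * π * t)⁻¹ ≤ t⁻¹ := by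
    apply inv_anti₀ ht
    nlinarith [Real.pi_gt_three]
  calc |x j| / (2 * t) * hk t x ≤ (2 * R) / (2 * t) * t⁻¹ := by
        have := (hk_pos ht x).le
        gcongr
        exact h1.trans h2
    _ = R / t ^ 2 := by field_simp

lemma tb_alg {r A x : ℝ} (hr : 0 < r) (hA : 0 ≤ A) (h1 : x ≤ A / r) (h2 : x ≤ A / r ^ 4) :
    x ≤ 8 * A * (1 / (2 * r) / (1 + r) ^ 2) := by
  have e : 8 * A * (1 / (2 * r) / (1 + r) ^ 2) = A * 4 / (r * (1 + r) ^ 2) := by field_simp; ring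
  rw [e]
  rcases le_total r 1 with h | h
  · refine h1.trans ?_
    rw [div_le_div_iff₀ hr (by positivity)]
    have : (1 + r) ^ 2 ≤ 4 := by nlinarith
    have h3 : A * r * (1 + r) ^ 2 ≤ A * r * 4 := by gcongr
    linarith
  · refine h2.trans ?_
    rw [div_le_div_iff₀ (by positivity) (by positivity)]
    have : r * (1 + r) ^ 2 ≤ 4 * r ^ 4 := by
      have : (1 + r) ^ 2 ≤ 4 * r ^ 2 := by nlinarith
      have h5 : r * (1 + r) ^ 2 ≤ r * (4 * r ^ 2) := by gcongr
      have h6 : r ^ 3 ≤ r ^ 4 := pow_le_pow_right₀ h (by norm_num)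
      nlinarith
    have h3 : A * (r * (1 + r) ^ 2) ≤ A * (4 * r ^ 4) := by gcongr
    linarith

lemma tb_int {s T : ℝ} (hs : 0 < s) (hT : s ≤ T) :
    IntervalIntegrable (fun t => 1 / (2 * √t) / (1 + √t) ^ 2) volume s T ∧
    ∫ t in s..T, 1 / (2 * √t) / (1 + √t) ^ 2 ≤ 1 := by
  have hsub : uIcc s T ⊆ Ioi 0 := by
    rw [uIcc_of_le hT]; exact fun t ht => hs.trans_le ht.1
  have hd : ∀ t ∈ uIcc s T, HasDerivAt (fun t => - (1 + √t)⁻¹) (1 / (2 * √t) / (1 + √t) ^ 2) t := by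
    intro t ht
    have ht0 : 0 < t := hsub ht
    have h1 : 0 < 1 + √t := by positivity
    have := (((Real.hasDerivAt_sqrt ht0.ne').const_add 1).inv h1.ne').neg
    refine this.congr_deriv ?_
    rw [neg_div, neg_neg]
  have hi : IntervalIntegrable (fun t => 1 / (2 * √t) / (1 + √t) ^ 2) volume s T := by
    refine ContinuousOn.intervalIntegrable fun t ht => ?_
    have ht0 : 0 < t := hsub ht
    have hs0 : 0 < √t := Real.sqrt_pos.2 ht0
    have h1 : 0 < 1 + √t := by positivity
    refine ContinuousAt.continuousWithinAt ?_
    refine ContinuousAt.div (ContinuousAt.div continuousAt_const (by fun_prop) (by positivity)) (by fun_prop) (by positivity)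
  refine ⟨hi, ?_⟩
  rw [intervalIntegral.integral_eq_sub_of_hasDerivAt hd hi]
  have h1 : (1 + √s)⁻¹ ≤ 1 := inv_le_one_of_one_le₀ (by linarith [Real.sqrt_nonneg s])
  have h2 : 0 < (1 + √T)⁻¹ := by have := Real.sqrt_nonneg T; positivity
  linarith

lemma pair1_main {p q : ℝ} (h : PQ p q) {R : ℝ} (hR : 0 < R) : ∃ C : ℝ, 1 ≤ C ∧ ∀ {f g : V2 → ℝ}, Cc f → Cc g →
    (∀ x, f x ≠ 0 → ‖x‖ ≤ R) → (∀ x, g x ≠ 0 → ‖x‖ ≤ R) → ∀ {s T : ℝ}, 0 < s → s ≤ T → ∀ j : Fin 2,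
    |∫ t in s..T, ∫ x, f x * Hop (hk1 j) g (2 * t) x| ≤ C * ((∫ x, |f x| ^ p) + ∫ x, |g x| ^ q) := by
  set V := (volume (Metric.closedBall (0 : V2) (2 * R))).toReal with hV
  have hV0 : 0 ≤ V := ENNReal.toReal_nonneg
  refine ⟨8 * (1 + R * V), by nlinarith [mul_nonneg hR.le hV0], ?_⟩
  intro f g hf hg sf sg s T hs hT j
  set M := (∫ x, |f x| ^ p) + ∫ x, |g x| ^ q with hM
  have hM0 : 0 ≤ M := by
    have h1 : 0 ≤ ∫ x, |f x| ^ p := integral_nonneg fun x => by positivity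
    have h2 : 0 ≤ ∫ x, |g x| ^ q := integral_nonneg fun x => by positivity
    positivity
  have hA0 : 0 ≤ M * (1 + R * V) := by positivity
  have hb : ∀ t > 0, |∫ x, f x * Hop (hk1 j) g (2 * t) x| ≤ 8 * (M * (1 + R * V)) * (1 / (2 * √t) / (1 + √t) ^ 2) := by
    intro t ht
    have ht2 : 0 < 2 * t := by linarith
    have hr : 0 < √t := Real.sqrt_pos.2 ht
    refine tb_alg hr hA0 ?_ ?_
    · have := pairK h (R := R) (K := hk1 j (2 * t)) (hk1_int ht2 j).abs (fun z => abs_nonneg _) (fun z _ => le_rfl) hf hg sf sg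
      refine this.trans ?_
      have h1 := hk1_L1 ht2 j
      have h2 : (√(2 * t))⁻¹ ≤ (√t)⁻¹ := inv_anti₀ hr (Real.sqrt_le_sqrt (by linarith))
      rw [mul_div_assoc]
      refine mul_le_mul_of_nonneg_left ?_ hM0
      refine (h1.trans h2).trans ?_
      rw [inv_eq_one_div]
      gcongr
      nlinarith [mul_nonneg hR.le hV0]
    · have hmi : Integrable ((Metric.closedBall (0:V2) (2 * R)).indicator fun _ => R / (2 * t) ^ 2) := by
        rw [integrable_indicator_iff measurableSet_closedBall]
        exact integrableOn_const (measure_closedBall_lt_top.ne)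
      have := pairK h (R := R) (K := hk1 j (2 * t)) hmi (fun z => indicator_nonneg (fun _ _ => by positivity) _) (fun z hz => by
        rw [indicator_of_mem (mem_closedBall_zero_iff.2 hz)]
        exact hk1_sup ht2 j hz) hf hg sf sg
      refine this.trans ?_
      rw [integral_indicator measurableSet_closedBall, setIntegral_const, smul_eq_mul, mul_div_assoc]
      refine mul_le_mul_of_nonneg_left ?_ hM0
      have e : √t ^ 4 = t ^ 2 := by
        rw [show (4:ℕ) = 2 * 2 from rfl, pow_mul, Real.sq_sqrt ht.le]
      rw [e]
      show V * _ ≤ _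
      rw [mul_pow, ← mul_div_assoc, div_le_div_iff₀ (by positivity) (by positivity)]
      have : V * R * t ^ 2 ≤ (1 + R * V) * t ^ 2 := by gcongr; linarith
      have h4 : 0 ≤ (1 + R * V) * t ^ 2 := by positivity
      linarith
  obtain ⟨i1, v1⟩ := tb_int hs hT
  have hsub : uIcc s T ⊆ Ioi 0 := by
    rw [uIcc_of_le hT]; exact fun t ht => hs.trans_le ht.1
  refine (intervalIntegral.abs_integral_le_integral_abs hT).trans ?_
  have hc : ContinuousOn (fun t => ∫ x, f x * Hop (hk1 j) g (2 * t) x) (Ioi 0) :=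
    (cut_smooth hf (Hop_smooth (hk1_SK j) hg).dbl).continuousOn
  refine (intervalIntegral.integral_mono_on hT ((hc.mono hsub).abs.intervalIntegrable) (i1.const_mul _)
    (fun t ht => hb t (hs.trans_le ht.1))).trans ?_
  rw [intervalIntegral.integral_const_mul]
  calc 8 * (M * (1 + R * V)) * ∫ t in s..T, 1 / (2 * √t) / (1 + √t) ^ 2 ≤ 8 * (M * (1 + R * V)) * 1 := by gcongr
    _ = _ := by ring

lemma hk2_symm (i j : Fin 2) : hk2 i j = hk2 j i := by
  ext t x
  unfold hk2
  rw [mul_comm (x i)]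
  simp only [eq_comm]

/-- Helmholtz decomposition with estimates -/
theorem helm {p q : ℝ} (h : PQ p q) {R : ℝ} (hR : 0 < R) : ∃ C : ℝ, 0 < C ∧ ∀ h0 h1 : V2 → ℝ, Cc h0 → Cc h1 →
    (∀ x, h0 x ≠ 0 → ‖x‖ ≤ R) → (∀ x, h1 x ≠ 0 → ‖x‖ ≤ R) → ∀ ε > 0, ∃ ζ η : V2 → ℝ, Sm ζ ∧ Sm η ∧
    (∀ x, |h0 x - (pd 0 ζ x - pd 1 η x)| ≤ ε) ∧ (∀ x, |h1 x - (pd 1 ζ x + pd 0 η x)| ≤ ε) ∧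
    (∀ i, ∫ x in Metric.closedBall 0 R, |pd i ζ x| ^ q ≤ C * ((∫ x, |h0 x| ^ q) + ∫ x, |h1 x| ^ q)) ∧
    (∫ x in Metric.closedBall 0 R, |ζ x| ^ q ≤ C * ((∫ x, |h0 x| ^ q) + ∫ x, |h1 x| ^ q)) := by
  have hq := h.q1
  have hK : 0 ≤ bK q := by
    unfold bK; have : 0 < q - 1 := by linarith [h.q1]
    have : 0 < q := by linarith
    positivity
  obtain ⟨C1, hC1, hp1⟩ := pair1_main h (show 0 < R + 1 by linarith)
  set C2 := 4 * (1 + bK q) with hC2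
  set C3 := C1 + C2 with hC3
  have hC31 : 1 ≤ C3 := by rw [hC3, hC2]; linarith
  have hnn : ∀ g : V2 → ℝ, 0 ≤ ∫ x, |g x| ^ q := fun g => integral_nonneg fun x => by positivity
  have B1 : ∀ {g : V2 → ℝ}, Cc g → (∀ x, g x ≠ 0 → ‖x‖ ≤ R) → ∀ {s T : ℝ}, 0 < s → s ≤ T → ∀ j : Fin 2,
      ∫ x in Metric.closedBall 0 R, |tint s T (fun t x => Hop (hk1 j) g (2 * t) x) x| ^ q ≤ 4 * C3 ^ 2 * ∫ x, |g x| ^ q := by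
    intro g hg sg s T hs hT j
    have hSK := (Hop_smooth (hk1_SK j) hg).dbl
    refine dual_bound h hC31 (hnn g) (tint_smooth hs hT hSK).cont fun f hf sf => ?_
    rw [tint_pair hs hT hSK hf]
    refine (hp1 hf hg sf (fun x hx => (sg x hx).trans (by linarith)) hs hT j).trans ?_
    refine mul_le_mul_of_nonneg_right (by rw [hC3, hC2]; linarith) ?_
    have := hnn g
    have : 0 ≤ ∫ x, |f x| ^ p := integral_nonneg fun x => by positivity
    positivity
  have B2 : ∀ {g : V2 → ℝ}, Cc g → ∀ {s T : ℝ}, 0 < s → s ≤ T → ∀ i j : Fin 2,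
      ∫ x in Metric.closedBall 0 R, |tint s T (fun t x => Hop (hk2 i j) g (2 * t) x) x| ^ q ≤ 4 * C3 ^ 2 * ∫ x, |g x| ^ q := by
    intro g hg s T hs hT i j
    have hSK := (Hop_smooth (hk2_SK i j) hg).dbl
    refine dual_bound h hC31 (hnn g) (tint_smooth hs hT hSK).cont fun f hf sf => ?_
    rw [tint_pair hs hT hSK hf]
    refine (bell_main h hf hg hs hT i j).trans ?_
    refine mul_le_mul_of_nonneg_right (by rw [hC3, hC2]; linarith) ?_
    have := hnn g
    have : 0 ≤ ∫ x, |f x| ^ p := integral_nonneg fun x => by positivity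
    positivity
  refine ⟨2 ^ q * 2 ^ q * (4 * C3 ^ 2), by positivity, ?_⟩
  intro h0 h1 c0 c1 s0 s1 ε hε
  obtain ⟨a0, ha0, ka0⟩ := Hop_conv c0 (half_pos hε)
  obtain ⟨a1, ha1, ka1⟩ := Hop_conv c1 (half_pos hε)
  set s : ℝ := min a0 a1 / 4 with hs
  have hmin : 0 < min a0 a1 := lt_min ha0 ha1
  have hs0 : 0 < s := by positivity
  set E := (∫ y, |h0 y|) + ∫ y, |h1 y| with hE
  have hE0 : 0 ≤ ∫ y, |h0 y| := integral_nonneg fun x => abs_nonneg _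
  have hE1 : 0 ≤ ∫ y, |h1 y| := integral_nonneg fun x => abs_nonneg _
  set T : ℝ := s + E / ε with hTdef
  have hT : s ≤ T := by
    have : 0 ≤ E / ε := by positivity
    linarith
  have hT0 : 0 < T := hs0.trans_le hT
  have small : ∀ {g : V2 → ℝ}, Cc g → (∫ y, |g y|) ≤ E → ∀ x, |Hop hk g (2 * T) x| ≤ ε / 2 := by
    intro g hg hgE x
    refine (Hop_small hg (by linarith) x).trans ?_
    rw [inv_mul_le_iff₀ (by positivity)]
    have h4 : E ≤ T * ε := by
      have : E / ε ≤ T := by linarith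
      rwa [div_le_iff₀ hε] at this
    have : T * ε ≤ 4 * π * (2 * T) * (ε / 2) := by
      have : 0 < T * ε := by positivity
      nlinarith [Real.pi_gt_three]
    linarith
  -- time integrals
  have S1 : ∀ {g : V2 → ℝ}, Cc g → ∀ j, Sm (tint s T (fun t x => Hop (hk1 j) g (2 * t) x)) := fun hg j =>
    tint_smooth hs0 hT (Hop_smooth (hk1_SK j) hg).dbl
  have P1 : ∀ {g : V2 → ℝ}, Cc g → ∀ j i x, pd i (tint s T (fun t x => Hop (hk1 j) g (2 * t) x)) x
      = tint s T (fun t x => Hop (hk2 j i) g (2 * t) x) x := by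
    intro g hg j i x
    rw [tint_pd hs0 hT (Hop_smooth (hk1_SK j) hg).dbl]
    unfold tint
    refine intervalIntegral.integral_congr fun t ht => ?_
    rw [uIcc_of_le hT] at ht
    exact Hop_hk1_pd hg (show 0 < 2 * t by linarith [ht.1]) j i x
  have Heat : ∀ {g : V2 → ℝ}, Cc g → ∀ x, -2 * (tint s T (fun t x => Hop (hk2 0 0) g (2 * t) x) x
      + tint s T (fun t x => Hop (hk2 1 1) g (2 * t) x) x) = Hop hk g (2 * s) x - Hop hk g (2 * T) x := by
    intro g hg x
    have hsub : uIcc s T ⊆ Ioi 0 := by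
      rw [uIcc_of_le hT]; exact fun t ht => hs0.trans_le ht.1
    have ci : ∀ i j, IntervalIntegrable (fun t => Hop (hk2 i j) g (2 * t) x) volume s T := fun i j => by
      refine ContinuousOn.intervalIntegrable ?_
      have := (Hop_smooth (hk2_SK i j) hg).dbl.continuousOn
      exact this.comp (f := fun t : ℝ => (t, x)) (by fun_prop) (fun t ht => hsub ht)
    have hd : ∀ t ∈ uIcc s T, HasDerivAt (fun t => Hop hk g (2 * t) x)
        (2 * (Hop (hk2 0 0) g (2 * t) x + Hop (hk2 1 1) g (2 * t) x)) t := by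
      intro t ht
      have ht0 : 0 < t := hsub ht
      have h1 := Hop_hk_dt hg (show 0 < 2 * t by linarith) x
      have h2 : HasDerivAt (fun t : ℝ => 2 * t) 2 t := by simpa using (hasDerivAt_id t).const_mul 2
      have := HasDerivAt.comp t h1 h2
      exact this.congr_deriv (by ring)
    have := intervalIntegral.integral_eq_sub_of_hasDerivAt hd (((ci 0 0).add (ci 1 1)).const_mul 2)
    rw [intervalIntegral.integral_const_mul, intervalIntegral.integral_add (ci 0 0) (ci 1 1)] at this
    unfold tint
    linarith
  set Z : (V2 → ℝ) → Fin 2 → V2 → ℝ := fun g j => tint s T (fun t x => Hop (hk1 j) g (2 * t) x) with hZ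
  set W : (V2 → ℝ) → Fin 2 → Fin 2 → V2 → ℝ := fun g i j => tint s T (fun t x => Hop (hk2 i j) g (2 * t) x) with hW
  have Wsymm : ∀ g, W g 0 1 = W g 1 0 := fun g => by simp only [hW, hk2_symm 0 1]
  have zs : Sm (fun x => -2 * (Z h0 0 x + Z h1 1 x)) := contDiff_const.mul ((S1 c0 0).add (S1 c1 1))
  have es : Sm (fun x => -2 * (Z h1 0 x - Z h0 1 x)) := contDiff_const.mul ((S1 c1 0).sub (S1 c0 1))
  have dz : ∀ i x, pd i (fun x => -2 * (Z h0 0 x + Z h1 1 x)) x = -2 * (W h0 0 i x + W h1 1 i x) := by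
    intro i x
    have d0 := (S1 c0 0).diff x
    have d1 := (S1 c1 1).diff x
    have e0 : pd i (Z h0 0) x = W h0 0 i x := P1 c0 0 i x
    have e1 : pd i (Z h1 1) x = W h1 1 i x := P1 c1 1 i x
    rw [pd_const_mul (f := fun x => Z h0 0 x + Z h1 1 x) i _ (d0.add d1),
      pd_add (f := Z h0 0) (g := Z h1 1) i d0 d1, e0, e1]
  have de : ∀ i x, pd i (fun x => -2 * (Z h1 0 x - Z h0 1 x)) x = -2 * (W h1 0 i x - W h0 1 i x) := by
    intro i x
    have d0 := (S1 c1 0).diff x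
    have d1 := (S1 c0 1).diff x
    have e0 : pd i (Z h1 0) x = W h1 0 i x := P1 c1 0 i x
    have e1 : pd i (Z h0 1) x = W h0 1 i x := P1 c0 1 i x
    rw [pd_const_mul (f := fun x => Z h1 0 x - Z h0 1 x) i _ (d0.sub d1),
      pd_sub (f := Z h1 0) (g := Z h0 1) i d0 d1, e0, e1]
  have comb : ∀ {a b : V2 → ℝ}, Continuous a → Continuous b → ∀ {A B : ℝ},
      ∫ x in Metric.closedBall 0 R, |a x| ^ q ≤ 4 * C3 ^ 2 * A → ∫ x in Metric.closedBall 0 R, |b x| ^ q ≤ 4 * C3 ^ 2 * B →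
      ∫ x in Metric.closedBall 0 R, |-2 * (a x + b x)| ^ q ≤ 2 ^ q * 2 ^ q * (4 * C3 ^ 2) * (A + B) := by
    intro a b ha hb A B hA hB
    have ci : ∀ {a : V2 → ℝ}, Continuous a → IntegrableOn (fun x => |a x| ^ q) (Metric.closedBall 0 R) := fun ha =>
      cont_int Metric.isBounded_closedBall (ha.abs.rpow_const fun x => Or.inr (by linarith))
    calc ∫ x in Metric.closedBall 0 R, |-2 * (a x + b x)| ^ q
        ≤ ∫ x in Metric.closedBall 0 R, 2 ^ q * 2 ^ q * (|a x| ^ q + |b x| ^ q) := by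
          refine integral_mono (ci (by fun_prop)) (((ci ha).add (ci hb)).const_mul _) fun x => ?_
          simp only [Pi.add_apply]
          rw [abs_mul, abs_neg, abs_two, Real.mul_rpow (by norm_num) (abs_nonneg _), mul_assoc]
          exact mul_le_mul_of_nonneg_left (rp_add (by linarith) _ _) (by positivity)
      _ = 2 ^ q * 2 ^ q * ((∫ x in Metric.closedBall 0 R, |a x| ^ q) + ∫ x in Metric.closedBall 0 R, |b x| ^ q) := by
          rw [integral_const_mul, integral_add (ci ha) (ci hb)]
      _ ≤ 2 ^ q * 2 ^ q * (4 * C3 ^ 2 * A + 4 * C3 ^ 2 * B) := by gcongr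
      _ = _ := by ring
  have wc : ∀ {g : V2 → ℝ}, Cc g → ∀ i j, Continuous (W g i j) := fun hg i j =>
    (tint_smooth hs0 hT (Hop_smooth (hk2_SK i j) hg).dbl).cont
  have s_lt0 : 2 * s < a0 := by have := min_le_left a0 a1; rw [hs]; linarith
  have s_lt1 : 2 * s < a1 := by have := min_le_right a0 a1; rw [hs]; linarith
  have near : ∀ {a b c d : ℝ}, d = b - c → |b - a| ≤ ε / 2 → |c| ≤ ε / 2 → |a - d| ≤ ε := by
    intro a b c d hd h1 h2
    rw [abs_le] at *
    constructor <;> linarith [h1.1, h1.2, h2.1, h2.2]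
  refine ⟨_, _, zs, es, fun x => ?_, fun x => ?_, fun i => ?_, ?_⟩
  · rw [dz, de]
    refine near ?_ (ka0 (2 * s) (by linarith) s_lt0 x) (small c0 (by linarith) x)
    rw [← Heat c0 x, Wsymm h1]
    simp only [hW]; ring
  · rw [dz, de]
    refine near ?_ (ka1 (2 * s) (by linarith) s_lt1 x) (small c1 (by linarith) x)
    rw [← Heat c1 x, Wsymm h0]
    simp only [hW]; ring
  · simp only [dz]
    exact comb (wc c0 0 i) (wc c1 1 i) (B2 c0 hs0 hT 0 i) (B2 c1 hs0 hT 1 i)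
  · exact comb (S1 c0 0).cont (S1 c1 1).cont (B1 c0 s0 hs0 hT 0) (B1 c1 s1 hs0 hT 1)
end

section

lemma Sm.mul {f g : V2 → ℝ} (hf : Sm f) (hg : Sm g) : Sm (fun x => f x * g x) := ContDiff.mul hf hg
lemma Sm.add {f g : V2 → ℝ} (hf : Sm f) (hg : Sm g) : Sm (fun x => f x + g x) := ContDiff.add hf hg
lemma Sm.sub {f g : V2 → ℝ} (hf : Sm f) (hg : Sm g) : Sm (fun x => f x - g x) := ContDiff.sub hf hg
lemma Sm.neg {f : V2 → ℝ} (hf : Sm f) : Sm (fun x => -f x) := ContDiff.neg hf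
lemma Sm.con (c : ℝ) : Sm (fun _ => c) := contDiff_const

/-- A bounded convex domain with smooth defining function. -/
structure Dom (Ω : Set V2) (φ : V2 → ℝ) : Prop where
  ne : Ω.Nonempty
  cv : Convex ℝ Ω
  bd : IsBounded Ω
  sm : Sm φ
  eq : Ω = {x | φ x < 0}
  fr : frontier Ω = {x | φ x = 0}
  gr : ∀ x, φ x = 0 → 0 < (pd 0 φ x) ^ 2 + (pd 1 φ x) ^ 2

variable {Ω : Set V2} {φ : V2 → ℝ}

lemma Dom.op (D : Dom Ω φ) : IsOpen Ω := by
  rw [D.eq]; exact isOpen_lt D.sm.cont continuous_const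

lemma Dom.mem (D : Dom Ω φ) {x : V2} : x ∈ Ω ↔ φ x < 0 := by
  have := D.eq
  constructor
  · intro h; rw [this] at h; exact h
  · intro h; rw [this]; exact h

lemma Dom.memf (D : Dom Ω φ) {x : V2} : x ∈ frontier Ω ↔ φ x = 0 := by rw [D.fr]; rfl

lemma Dom.memc (D : Dom Ω φ) {x : V2} : x ∈ closure Ω ↔ φ x ≤ 0 := by
  rw [closure_eq_self_union_frontier, mem_union, D.mem, D.memf, le_iff_lt_or_eq]

lemma Dom.cpt (D : Dom Ω φ) : IsCompact (closure Ω) := D.bd.isCompact_closure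

lemma Dom.collar (D : Dom Ω φ) {Q : V2 → Prop} (hQ : ∀ b, φ b = 0 → ∀ᶠ y in 𝓝 b, Q y) :
    ∃ δ > 0, ∀ y, -δ < φ y → φ y ≤ 0 → Q y := by
  set U := interior {y | Q y} with hU
  have hc : IsCompact (closure Ω \ U) := D.cpt.diff isOpen_interior
  rcases (closure Ω \ U).eq_empty_or_nonempty with he | hne
  · refine ⟨1, one_pos, fun y _ hy => ?_⟩
    by_contra hn
    have : y ∈ closure Ω \ U := ⟨D.memc.2 hy, fun h => hn (interior_subset h)⟩
    rw [he] at this; exact this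
  · obtain ⟨z, hz, hmax⟩ := hc.exists_isMaxOn hne D.sm.cont.continuousOn
    have hz0 : φ z < 0 := by
      rcases lt_or_eq_of_le (D.memc.1 hz.1) with h | h
      · exact h
      · exact absurd (mem_interior_iff_mem_nhds.2 (hQ z h)) hz.2
    refine ⟨-φ z, by linarith, fun y hy1 hy => ?_⟩
    by_contra hn
    have hm : y ∈ closure Ω \ U := ⟨D.memc.2 hy, fun h => hn (interior_subset h)⟩
    have := hmax hm
    simp only [mem_ofPred_eq] at this
    linarith

lemma Dom.collar2 (D : Dom Ω φ) {Q : V2 × V2 → Prop} (hQ : ∀ b c, φ b = 0 → φ c = 0 → ∀ᶠ y in 𝓝 (b, c), Q y) :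
    ∃ δ > 0, ∀ y z, -δ < φ y → φ y ≤ 0 → -δ < φ z → φ z ≤ 0 → Q (y, z) := by
  set U := interior {y | Q y} with hU
  have hc : IsCompact ((closure Ω ×ˢ closure Ω) \ U) := (D.cpt.prod D.cpt).diff isOpen_interior
  have hcont : Continuous (fun y : V2 × V2 => min (φ y.1) (φ y.2)) := by
    have := D.sm.cont; fun_prop
  rcases ((closure Ω ×ˢ closure Ω) \ U).eq_empty_or_nonempty with he | hne
  · refine ⟨1, one_pos, fun y z _ hy _ hz => ?_⟩
    by_contra hn
    have : (y, z) ∈ (closure Ω ×ˢ closure Ω) \ U := ⟨⟨D.memc.2 hy, D.memc.2 hz⟩, fun h => hn (interior_subset h)⟩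
    rw [he] at this; exact this
  · obtain ⟨w, hw, hmax⟩ := hc.exists_isMaxOn hne hcont.continuousOn
    have hw0 : min (φ w.1) (φ w.2) < 0 := by
      rcases lt_or_eq_of_le (D.memc.1 hw.1.1) with h | h
      · exact (min_le_left _ _).trans_lt h
      rcases lt_or_eq_of_le (D.memc.1 hw.1.2) with h' | h'
      · exact (min_le_right _ _).trans_lt h'
      · exact absurd (mem_interior_iff_mem_nhds.2 (hQ w.1 w.2 h h')) hw.2
    refine ⟨-min (φ w.1) (φ w.2), by linarith, fun y z hy1 hy hz1 hz => ?_⟩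
    by_contra hn
    have hm : (y, z) ∈ (closure Ω ×ˢ closure Ω) \ U := ⟨⟨D.memc.2 hy, D.memc.2 hz⟩, fun h => hn (interior_subset h)⟩
    have := hmax hm
    simp only [mem_ofPred_eq] at this
    have h2 : min (φ w.1) (φ w.2) < min (φ y) (φ z) := lt_min (by linarith) (by linarith)
    linarith

def rN (φ : V2 → ℝ) (i : Fin 2) (y : V2) : ℝ := pd i φ y / ((pd 0 φ y) ^ 2 + (pd 1 φ y) ^ 2 + φ y ^ 2)
def psi (φ : V2 → ℝ) (i : Fin 2) (y : V2) : ℝ := y i - 2 * (φ y * rN φ i y)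
def Psi (φ : V2 → ℝ) (y : V2) : V2 := fun i => psi φ i y

lemma Dom.den (D : Dom Ω φ) (y : V2) : 0 < (pd 0 φ y) ^ 2 + (pd 1 φ y) ^ 2 + φ y ^ 2 := by
  by_cases h : φ y = 0
  · have := D.gr y h; positivity
  · positivity

lemma Dom.rN_sm (D : Dom Ω φ) (i : Fin 2) : Sm (rN φ i) := by
  unfold rN
  refine ContDiff.div (D.sm.pd i) ?_ fun y => (D.den y).ne'
  exact (((D.sm.pd 0).pow 2).add ((D.sm.pd 1).pow 2)).add (D.sm.pow 2)

lemma sm_coord (i : Fin 2) : Sm (fun y : V2 => y i) := contDiff_apply ℝ ℝ i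

lemma Dom.psi_sm (D : Dom Ω φ) (i : Fin 2) : Sm (psi φ i) :=
  (sm_coord i).sub (contDiff_const.mul (D.sm.mul (D.rN_sm i)))

lemma Dom.Psi_sm (D : Dom Ω φ) : ContDiff ℝ (⊤ : ℕ∞) (Psi φ) := contDiff_pi.2 fun i => D.psi_sm i

lemma Dom.Psi_bd (D : Dom Ω φ) {b : V2} (hb : φ b = 0) : Psi φ b = b := by
  ext i; simp [Psi, psi, hb]

lemma Dom.psi_pd (D : Dom Ω φ) {b : V2} (hb : φ b = 0) (i j : Fin 2) :
    pd j (psi φ i) b = (if j = i then 1 else 0) - 2 * (pd j φ b * rN φ i b) := by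
  have d1 : DifferentiableAt ℝ (fun y : V2 => y i) b := (sm_coord i).diff b
  have d2 : DifferentiableAt ℝ (fun y => φ y * rN φ i y) b := (D.sm.mul (D.rN_sm i)).diff b
  have d3 : DifferentiableAt ℝ (fun y => 2 * (φ y * rN φ i y)) b := d2.const_mul 2
  have := pd_sub j d1 d3
  rw [pd_coord, pd_const_mul j 2 d2, pd_mul j (D.sm.diff b) ((D.rN_sm i).diff b), hb] at this
  rw [show pd j (psi φ i) b = _ from this]
  ring

/-- matrix entries -/
def Mx (φ : V2 → ℝ) (k j : Fin 2) (x : V2) : ℝ := pd j (psi φ k) x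

lemma Dom.Mx_sm (D : Dom Ω φ) (k j : Fin 2) : Sm (Mx φ k j) := (D.psi_sm k).pd j

lemma Dom.Mx_bd (D : Dom Ω φ) {b : V2} (hb : φ b = 0) : Mx φ 0 0 b + Mx φ 1 1 b = 0 ∧ Mx φ 0 1 b - Mx φ 1 0 b = 0 ∧
    Mx φ 0 0 b * Mx φ 1 1 b - Mx φ 0 1 b * Mx φ 1 0 b = -1 := by
  have hd := D.gr b hb
  unfold Mx
  simp only [D.psi_pd hb, rN, hb]
  simp
  refine ⟨?_, ?_, ?_⟩
  · field_simp; ring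
  · ring
  · field_simp; ring

lemma Dom.Psi_der (D : Dom Ω φ) (x : V2) : HasStrictFDerivAt (Psi φ) (fderiv ℝ (Psi φ) x) x :=
  (D.Psi_sm.contDiffAt).hasStrictFDerivAt (by simp)

lemma Dom.Psi_fd (D : Dom Ω φ) (x v : V2) (i : Fin 2) : fderiv ℝ (Psi φ) x v i = fderiv ℝ (psi φ i) x v := by
  have h := (D.Psi_der x).hasFDerivAt
  have := (hasFDerivAt_pi'.1 h i).fderiv
  rw [show fderiv ℝ (psi φ i) x = _ from this]
  rfl

lemma Dom.Psi_det (D : Dom Ω φ) (x : V2) : (fderiv ℝ (Psi φ) x).det = Mx φ 0 0 x * Mx φ 1 1 x - Mx φ 0 1 x * Mx φ 1 0 x := by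
  have : (fderiv ℝ (Psi φ) x).det = LinearMap.det (fderiv ℝ (Psi φ) x : V2 →ₗ[ℝ] V2) := rfl
  rw [this, ← LinearMap.det_toMatrix', Matrix.det_fin_two]
  have e : ∀ i j, LinearMap.toMatrix' (fderiv ℝ (Psi φ) x : V2 →ₗ[ℝ] V2) i j = Mx φ i j x := by
    intro i j
    rw [LinearMap.toMatrix'_apply]
    have := D.Psi_fd x (Pi.single j 1) i
    unfold Mx pd
    rw [← this]
    congr 1
  simp only [e]

lemma Dom.pd_Psi (D : Dom Ω φ) {ζ : V2 → ℝ} (hz : Sm ζ) (j : Fin 2) (x : V2) :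
    pd j (fun y => ζ (Psi φ y)) x = pd 0 ζ (Psi φ x) * Mx φ 0 j x + pd 1 ζ (Psi φ x) * Mx φ 1 j x := by
  have h1 := (hz.diff (Psi φ x)).hasFDerivAt
  have h2 := (D.Psi_der x).hasFDerivAt
  have h3 := (HasFDerivAt.comp (g := ζ) x h1 h2).fderiv
  unfold pd
  rw [show fderiv ℝ (fun y => ζ (Psi φ y)) x = _ from h3]
  rw [ContinuousLinearMap.comp_apply, fderiv_apply_eq]
  rw [D.Psi_fd, D.Psi_fd]
  unfold Mx pd
  ring

theorem Dom.reflect (D : Dom Ω φ) {R : ℝ} (hR : ∀ x ∈ closure Ω, ‖x‖ < R) {ε : ℝ} (hε : 0 < ε) : ∃ δ > 0,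
    (∀ x, -δ < φ x → φ x < 0 → 0 < φ (Psi φ x) ∧ ‖Psi φ x‖ ≤ R ∧ |Mx φ 0 0 x + Mx φ 1 1 x| ≤ ε ∧ |Mx φ 0 1 x - Mx φ 1 0 x| ≤ ε) ∧
    ∀ f : V2 → ℝ, Continuous f → (∀ x, 0 ≤ f x) →
      ∫ x in {x | -δ < φ x ∧ φ x < 0}, f (Psi φ x) ≤ 2 * ∫ x in Metric.closedBall 0 R, f x := by
  have hPc : Continuous (Psi φ) := D.Psi_sm.continuous
  have hM : ∀ k j, Continuous (Mx φ k j) := fun k j => (D.Mx_sm k j).cont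
  -- sign
  have q1 : ∀ b, φ b = 0 → ∀ᶠ y in 𝓝 b, φ y < 0 → 0 < φ (Psi φ y) := by
    intro b hb
    have hst : HasStrictFDerivAt φ (fderiv ℝ φ b) b := (D.sm.contDiffAt).hasStrictFDerivAt (by simp)
    have hn := D.gr b hb
    set m := ‖(fun i => rN φ i b : V2)‖ + 1 with hm
    have hm0 : 0 < m := by positivity
    have hlo := hst.isLittleO.def (show 0 < 1 / (8 * m) by positivity)
    have ht : Tendsto (fun y => (Psi φ y, y)) (𝓝 b) (𝓝 (b, b)) := by
      have : Continuous (fun y => (Psi φ y, y)) := by fun_prop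
      have := this.tendsto b
      rwa [D.Psi_bd hb] at this
    have e1 := ht.eventually hlo
    have hNc : Continuous (fun y => (fun i => rN φ i y : V2)) := continuous_pi fun i => (D.rN_sm i).cont
    have e2 : ∀ᶠ y in 𝓝 b, ‖(fun i => rN φ i y : V2)‖ < m :=
      (hNc.norm.tendsto b).eventually (gt_mem_nhds (by rw [hm]; linarith))
    have e3 : ∀ᶠ y in 𝓝 b, 3 / 4 < fderiv ℝ φ b (fun i => rN φ i y) := by
      have hc : Continuous (fun y => fderiv ℝ φ b (fun i => rN φ i y)) := (fderiv ℝ φ b).continuous.comp hNc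
      refine (hc.tendsto b).eventually (lt_mem_nhds ?_)
      rw [fderiv_apply_eq]
      simp only [rN, hb]
      have : pd 0 φ b / (pd 0 φ b ^ 2 + pd 1 φ b ^ 2 + 0 ^ 2) * pd 0 φ b + pd 1 φ b / (pd 0 φ b ^ 2 + pd 1 φ b ^ 2 + 0 ^ 2) * pd 1 φ b = 1 := by
        field_simp; ring_nf
      first
        | (rw [this]; norm_num)
        | (rw [show (1:ℝ) = _ from this.symm] ; norm_num; linarith)
    filter_upwards [e1, e2, e3] with y h1 h2 h3 hy
    have hd : Psi φ y - y = (-2 * φ y) • (fun i => rN φ i y : V2) := by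
      ext i; simp [Psi, psi]; ring
    rw [hd, map_smul, norm_smul, smul_eq_mul, Real.norm_eq_abs, Real.norm_eq_abs] at h1
    have hpos : 0 < -2 * φ y := by linarith
    rw [abs_of_pos hpos] at h1
    have h4 : 1 / (8 * m) * (-2 * φ y * ‖(fun i => rN φ i y : V2)‖) ≤ -φ y / 4 := by
      calc _ ≤ 1 / (8 * m) * (-2 * φ y * m) := by gcongr
        _ = _ := by field_simp; ring
    have h5 := (abs_le.1 (h1.trans h4)).1
    nlinarith
  obtain ⟨δ1, hδ1, k1⟩ := D.collar q1
  obtain ⟨δ2, hδ2, k2⟩ := D.collar (Q := fun y => ‖Psi φ y‖ < R) fun b hb => by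
    refine (hPc.norm.tendsto b).eventually (gt_mem_nhds ?_)
    rw [D.Psi_bd hb]; exact hR b (D.memc.2 hb.le)
  obtain ⟨δ3, hδ3, k3⟩ := D.collar (Q := fun y => |Mx φ 0 0 y + Mx φ 1 1 y| < ε) fun b hb => by
    refine ((((hM 0 0).add (hM 1 1)).abs).tendsto b).eventually (gt_mem_nhds ?_)
    simp only [Pi.add_apply]
    rw [(D.Mx_bd hb).1]; simpa
  obtain ⟨δ4, hδ4, k4⟩ := D.collar (Q := fun y => |Mx φ 0 1 y - Mx φ 1 0 y| < ε) fun b hb => by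
    refine ((((hM 0 1).sub (hM 1 0)).abs).tendsto b).eventually (gt_mem_nhds ?_)
    simp only [Pi.sub_apply]
    rw [(D.Mx_bd hb).2.1]; simpa
  obtain ⟨δ5, hδ5, k5⟩ := D.collar (Q := fun y => Mx φ 0 0 y * Mx φ 1 1 y - Mx φ 0 1 y * Mx φ 1 0 y < -(1/2)) fun b hb => by
    refine ((((hM 0 0).mul (hM 1 1)).sub ((hM 0 1).mul (hM 1 0))).tendsto b).eventually (gt_mem_nhds ?_)
    simp only [Pi.sub_apply, Pi.mul_apply]
    rw [(D.Mx_bd hb).2.2]; norm_num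
  obtain ⟨δ6, hδ6, k6⟩ := D.collar2 (Q := fun y => Psi φ y.1 = Psi φ y.2 → y.1 = y.2) fun b c hb hc => by
    by_cases hbc : b = c
    · subst hbc
      have hdet : (fderiv ℝ (Psi φ) b).det ≠ 0 := by
        rw [D.Psi_det, (D.Mx_bd hb).2.2]; norm_num
      have hs : HasStrictFDerivAt (Psi φ) (((fderiv ℝ (Psi φ) b).toContinuousLinearEquivOfDetNeZero hdet : V2 ≃L[ℝ] V2) : V2 →L[ℝ] V2) b := by
        rw [ContinuousLinearMap.coe_toContinuousLinearEquivOfDetNeZero]; exact D.Psi_der b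
      have := hs.eventually_left_inverse
      rw [nhds_prod_eq]
      filter_upwards [this.prod_mk this] with y hy h
      rw [← hy.1, ← hy.2, h]
    · have hcont : Continuous (fun y : V2 × V2 => Psi φ y.1 - Psi φ y.2) := by fun_prop
      have : (fun y : V2 × V2 => Psi φ y.1 - Psi φ y.2) (b, c) ≠ 0 := by
        simp only [D.Psi_bd hb, D.Psi_bd hc]; exact sub_ne_zero.2 hbc
      filter_upwards [hcont.continuousAt.eventually_ne this] with y hy h
      exact absurd (sub_eq_zero.2 h) hy
  set δ := min (min (min δ1 δ2) (min δ3 δ4)) (min δ5 δ6) with hδ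
  have l1 : δ ≤ δ1 := by simp [hδ]
  have l2 : δ ≤ δ2 := by simp [hδ]
  have l3 : δ ≤ δ3 := by simp [hδ]
  have l4 : δ ≤ δ4 := by simp [hδ]
  have l5 : δ ≤ δ5 := by simp [hδ]
  have l6 : δ ≤ δ6 := by simp [hδ]
  have hδ0 : 0 < δ := by simp [hδ, *]
  refine ⟨δ, hδ0, fun x hx hx' => ⟨k1 x (by linarith) hx'.le hx', (k2 x (by linarith) hx'.le).le,
    (k3 x (by linarith) hx'.le).le, (k4 x (by linarith) hx'.le).le⟩, fun f hf f0 => ?_⟩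
  set K := {x | -δ < φ x ∧ φ x < 0} with hK
  have hKo : IsOpen K := (isOpen_lt continuous_const D.sm.cont).inter (isOpen_lt D.sm.cont continuous_const)
  have hKΩ : K ⊆ Ω := fun x hx => D.mem.2 hx.2
  have hKb : IsBounded K := D.bd.subset hKΩ
  have hinj : InjOn (Psi φ) K := fun x hx y hy h =>
    k6 x y (by linarith [hx.1]) hx.2.le (by linarith [hy.1]) hy.2.le h
  have hdet : ∀ x, (fderiv ℝ (Psi φ) x).det = Mx φ 0 0 x * Mx φ 1 1 x - Mx φ 0 1 x * Mx φ 1 0 x := D.Psi_det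
  have hdc : Continuous (fun x => (fderiv ℝ (Psi φ) x).det) := by
    simp only [hdet]
    exact ((hM 0 0).mul (hM 1 1)).sub ((hM 0 1).mul (hM 1 0))
  have hcv := integral_image_eq_integral_abs_det_fderiv_smul volume hKo.measurableSet
    (fun x hx => ((D.Psi_der x).hasFDerivAt).hasFDerivWithinAt) hinj f
  have him : Psi φ '' K ⊆ Metric.closedBall 0 R := by
    rintro _ ⟨x, hx, rfl⟩
    rw [mem_closedBall_zero_iff]
    exact (k2 x (by linarith [hx.1]) hx.2.le).le
  have h1 : ∫ x in Psi φ '' K, f x ≤ ∫ x in Metric.closedBall 0 R, f x :=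
    setIntegral_mono_set (cont_int Metric.isBounded_closedBall hf) (Eventually.of_forall f0) him.eventuallyLE
  have h2 : ∫ x in K, f (Psi φ x) ≤ ∫ x in K, 2 * (|(fderiv ℝ (Psi φ) x).det| • f (Psi φ x)) := by
    refine setIntegral_mono_on (cont_int hKb (hf.comp hPc)) (cont_int hKb ?_) hKo.measurableSet fun x hx => ?_
    · exact continuous_const.mul (hdc.abs.smul (hf.comp hPc))
    · have h5 := k5 x (by linarith [hx.1]) hx.2.le
      rw [hdet, abs_of_neg (by linarith), smul_eq_mul]
      have := f0 (Psi φ x)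
      nlinarith
  rw [integral_const_mul, ← hcv] at h2
  linarith
end

section

lemma PQ.yE {p q : ℝ} (h : PQ p q) {η : ℝ} (hη : 0 < η) : ∃ C > 0, ∀ a b : ℝ, 0 ≤ a → 0 ≤ b →
    a * b ≤ C * a ^ p + η * b ^ q := by
  have hq := h.q1
  set τ := η ^ (1 / q) with hτ
  have hτ0 : 0 < τ := by positivity
  have hτq : τ ^ q = η := by
    rw [hτ, ← Real.rpow_mul hη.le, one_div_mul_cancel (by linarith), Real.rpow_one]
  refine ⟨(τ⁻¹) ^ p, by positivity, fun a b ha hb => ?_⟩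
  have := h.young (a := τ⁻¹ * a) (b := τ * b) (by positivity) (by positivity)
  rw [Real.mul_rpow (by positivity) ha, Real.mul_rpow hτ0.le hb, hτq] at this
  calc a * b = τ⁻¹ * a * (τ * b) := by field_simp
    _ ≤ _ := this

lemma pow_split {p a : ℝ} (hp : 2 ≤ p) (ha : 0 ≤ a) : a ^ (p - 2) * a ^ 2 = a ^ p := by
  have := Real.rpow_add' (x := a) ha (y := p - 2) (z := 2) (by simp; linarith)
  rw [show p - 2 + 2 = p by ring] at this
  rw [this]; norm_cast

lemma yG {p : ℝ} (hp : 2 ≤ p) {η : ℝ} (hη : 0 < η) : ∃ C > 0, ∀ a g : ℝ, 0 ≤ a → 0 ≤ g →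
    a ^ (p - 2) * g ^ 2 ≤ η * a ^ p + C * g ^ p := by
  refine ⟨((√η)⁻¹) ^ (p - 2), by positivity, fun a g ha hg => ?_⟩
  have hs : 0 < √η := by positivity
  have h1 : 0 ≤ a ^ (p - 2) := by positivity
  have h2 : 0 ≤ ((√η)⁻¹) ^ (p - 2) * g ^ p := by positivity
  have h3 : 0 ≤ η * a ^ p := by positivity
  by_cases hc : g ≤ √η * a
  · have : g ^ 2 ≤ η * a ^ 2 := by
      have := pow_le_pow_left₀ hg hc 2
      rwa [mul_pow, Real.sq_sqrt hη.le] at this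
    have h4 : a ^ (p - 2) * g ^ 2 ≤ a ^ (p - 2) * (η * a ^ 2) := by gcongr
    rw [show a ^ (p - 2) * (η * a ^ 2) = η * (a ^ (p - 2) * a ^ 2) by ring, pow_split hp ha] at h4
    linarith
  · push Not at hc
    have : a ≤ (√η)⁻¹ * g := by
      rw [← div_eq_inv_mul, le_div_iff₀ hs]; linarith
    have h5 : a ^ (p - 2) ≤ ((√η)⁻¹ * g) ^ (p - 2) := Real.rpow_le_rpow ha this (by linarith)
    rw [Real.mul_rpow (by positivity) hg] at h5
    have h6 : a ^ (p - 2) * g ^ 2 ≤ (√η)⁻¹ ^ (p - 2) * g ^ (p - 2) * g ^ 2 := by gcongr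
    rw [mul_assoc, pow_split hp hg] at h6
    linarith

lemma sp_one (a : ℝ) : sp 1 a = a := by
  unfold sp
  rcases le_total 0 a with h | h
  · simp [h]
  · simp [h]

lemma sp_hasDeriv {r : ℝ} (hr : 1 ≤ r) (a : ℝ) : HasDerivAt (sp r) (r * |a| ^ (r - 1)) a := by
  rcases hr.eq_or_lt with h1 | h1
  · subst h1
    have : sp 1 = id := by ext a; exact sp_one a
    rw [this]; simpa using hasDerivAt_id a
  rcases lt_trichotomy a 0 with h | h | h
  · have e : sp r =ᶠ[𝓝 a] fun x => -((-x) ^ r) := by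
      filter_upwards [gt_mem_nhds h] with x hx
      unfold sp
      rw [max_eq_right hx.le, max_eq_left (by linarith), Real.zero_rpow (by linarith)]; ring
    refine HasDerivAt.congr_of_eventuallyEq ?_ e
    have := ((hasDerivAt_neg a).rpow_const (p := r) (Or.inr hr)).neg
    refine this.congr_deriv ?_
    rw [abs_of_neg h]; ring
  · subst h
    have hb := hasDerivAt_abs_rpow 0 h1
    rw [hasDerivAt_iff_isLittleO] at hb ⊢
    have hz : (0:ℝ) ^ (r - 1) = 0 := Real.zero_rpow (by linarith)
    have hz' : (0:ℝ) ^ r = 0 := Real.zero_rpow (by linarith)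
    simp only [sub_zero, abs_zero, hz, hz', mul_zero, smul_zero, sp_zero] at hb ⊢
    refine Asymptotics.IsBigO.trans_isLittleO ?_ hb
    refine Asymptotics.IsBigO.of_bound 1 (Eventually.of_forall fun x => ?_)
    rw [Real.norm_eq_abs, Real.norm_eq_abs, sp_abs (by linarith), abs_of_nonneg (show 0 ≤ |x| ^ r by positivity), one_mul]
  · have e : sp r =ᶠ[𝓝 a] fun x => x ^ r := by
      filter_upwards [lt_mem_nhds h] with x hx
      unfold sp
      rw [max_eq_left hx.le, max_eq_right (by linarith), Real.zero_rpow (by linarith)]; ring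
    refine HasDerivAt.congr_of_eventuallyEq ?_ e
    have := Real.hasDerivAt_rpow_const (x := a) (p := r) (Or.inr hr)
    refine this.congr_deriv ?_
    rw [abs_of_pos h]

lemma sp_C1 {r : ℝ} (hr : 1 ≤ r) : ContDiff ℝ 1 (sp r) := by
  rw [contDiff_one_iff_deriv]
  refine ⟨fun a => (sp_hasDeriv hr a).differentiableAt, ?_⟩
  have : deriv (sp r) = fun a => r * |a| ^ (r - 1) := funext fun a => (sp_hasDeriv hr a).deriv
  rw [this]
  exact continuous_const.mul (continuous_abs.rpow_const fun x => Or.inr (by linarith))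

lemma abs_C1 {p : ℝ} (hp : 2 ≤ p) : ContDiff ℝ 1 (fun a : ℝ => |a| ^ p) := by
  rw [contDiff_one_iff_deriv]
  refine ⟨fun a => (hasDerivAt_abs_rpow a (by linarith)).differentiableAt, ?_⟩
  have : deriv (fun a : ℝ => |a| ^ p) = fun a => p * |a| ^ (p - 2) * a :=
    funext fun a => (hasDerivAt_abs_rpow a (by linarith)).deriv
  rw [this]
  exact (continuous_const.mul (continuous_abs.rpow_const fun x => Or.inr (by linarith))).mul continuous_id

/-- p-th power integral -/
def S (p : ℝ) (Ω : Set V2) (a : V2 → ℝ) : ℝ := ∫ x in Ω, |a x| ^ p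

lemma S_nonneg (p : ℝ) (Ω : Set V2) (a : V2 → ℝ) : 0 ≤ S p Ω a := integral_nonneg fun x => by positivity

lemma rp_cont {p : ℝ} (hp : 0 ≤ p) {f : V2 → ℝ} (hf : Continuous f) : Continuous (fun x => |f x| ^ p) :=
  hf.abs.rpow_const fun x => Or.inr hp

def Weak (Ω : Set V2) (w G0 G1 H : V2 → ℝ) : Prop := ∀ ξ : V2 → ℝ, ContDiff ℝ 1 ξ → (∀ x ∈ frontier Ω, ξ x = 0) →
  ∫ x in Ω, (pd 0 w x * pd 0 ξ x + pd 1 w x * pd 1 ξ x) = ∫ x in Ω, (G0 x * pd 0 ξ x + G1 x * pd 1 ξ x + H x * ξ x)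

variable {Ω : Set V2} {φ : V2 → ℝ}

lemma Dom.exR (D : Dom Ω φ) : ∃ R > 0, ∀ x ∈ closure Ω, ‖x‖ < R := by
  obtain ⟨R, hR⟩ := D.cpt.isBounded.exists_norm_le
  exact ⟨|R| + 1, by positivity, fun x hx => by have := hR x hx; have := le_abs_self R; linarith⟩

set_option maxHeartbeats 1000000 in
theorem Dom.lower (D : Dom Ω φ) {p : ℝ} (hp : 2 ≤ p) : ∃ C > 0, ∀ w G0 G1 H : V2 → ℝ, Sm w → Continuous G0 → Continuous G1 →
    Continuous H → (∀ x ∈ frontier Ω, w x = 0) → Weak Ω w G0 G1 H → S p Ω w ≤ C * (S p Ω G0 + S p Ω G1 + S p Ω H) := by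
  obtain ⟨R, hR0, hR⟩ := D.exR
  set c := (p * R) ^ 2 with hc
  have hc0 : 0 < c := by positivity
  have hPQ : PQ p (p / (p - 1)) := ⟨hp, div_mul_cancel₀ _ (by linarith)⟩
  have hp1 : 0 < p - 1 := by linarith
  obtain ⟨C1, hC1, y1⟩ := yG hp (show 0 < 1 / (8 * c) by positivity)
  obtain ⟨C2, hC2, y2⟩ := hPQ.yE (show 0 < 1 / (16 * c) by positivity)
  refine ⟨4 * c * (C1 + 2 * C2), by positivity, ?_⟩
  intro w G0 G1 H hw h0 h1 hH hw0 hW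
  have ci : ∀ {f : V2 → ℝ}, Continuous f → IntegrableOn f Ω := fun hf => cont_int D.bd hf
  have wc := hw.cont
  have d0 := (hw.pd 0).cont
  have d1 := (hw.pd 1).cont
  have hms := D.op.measurableSet
  -- weights
  have cw : Continuous (fun x => |w x| ^ (p - 2)) := rp_cont (by linarith) wc
  have cw1 : Continuous (fun x => |w x| ^ (p - 1)) := rp_cont (by linarith) wc
  have cp : Continuous (fun x => |w x| ^ p) := rp_cont (by linarith) wc
  set J := ∫ x in Ω, |w x| ^ (p - 2) * (pd 0 w x ^ 2 + pd 1 w x ^ 2) with hJ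
  -- Poincare
  have hP : S p Ω w ≤ c * J := by
    have hf : ContDiff ℝ 1 (fun x => x 0 * |w x| ^ p) := (sm_coord 0).one.mul ((abs_C1 hp).comp hw.one)
    have hib := ibp D.op D.cv D.bd hf (fun x hx => by
      simp only [hw0 x hx, abs_zero, Real.zero_rpow (show p ≠ 0 by linarith), mul_zero]) 0
    have e : ∀ x, pd 0 (fun x => x 0 * |w x| ^ p) x = |w x| ^ p + x 0 * (p * |w x| ^ (p - 2) * w x * pd 0 w x) := by
      intro x
      have q := pd_comp (f := w) 0 (hw.diff x) (hasDerivAt_abs_rpow (w x) (show 1 < p by linarith))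
      have := pd_mul (f := fun x : V2 => x 0) (g := fun x => |w x| ^ p) 0 ((sm_coord 0).diff x)
        (((abs_C1 hp).comp hw.one).differentiable (by norm_num) x)
      rw [this, pd_coord, q]
      simp; ring
    simp only [e] at hib
    have cB : Continuous (fun x : V2 => x 0 * (p * |w x| ^ (p - 2) * w x * pd 0 w x)) := by fun_prop
    rw [integral_add (ci cp) (ci cB)] at hib
    have hb : -∫ x in Ω, (x 0 * (p * |w x| ^ (p - 2) * w x * pd 0 w x)) ≤ S p Ω w / 2 + c / 2 * J := by
      rw [← integral_neg]
      unfold S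
      rw [hJ, ← integral_const_mul, ← integral_div, ← integral_add (ci (by fun_prop)) (ci (by fun_prop))]
      refine setIntegral_mono_on (ci (by fun_prop)) (ci (by fun_prop)) hms fun x hx => ?_
      have hx0 : |x 0| ≤ R := ((norm_le_pi_norm x 0)).trans (hR x (subset_closure hx)).le
      have hx2 : x 0 ^ 2 ≤ R ^ 2 := by rw [← sq_abs]; exact pow_le_pow_left₀ (abs_nonneg _) hx0 2
      rw [← pow_split hp (abs_nonneg (w x)), sq_abs]
      have hn : 0 ≤ |w x| ^ (p - 2) := by positivity
      have : 0 ≤ |w x| ^ (p - 2) * ((w x + p * x 0 * pd 0 w x) ^ 2 + p ^ 2 * (R ^ 2 - x 0 ^ 2) * pd 0 w x ^ 2 + c * pd 1 w x ^ 2) := by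
        have : 0 ≤ R ^ 2 - x 0 ^ 2 := by linarith
        positivity
      rw [hc] at this ⊢
      nlinarith [this]
    unfold S at *
    linarith
  -- energy
  have hf : ContDiff ℝ 1 (fun x => sp (p - 1) (w x)) := (sp_C1 (by linarith)).comp hw.one
  have hen := hW _ hf (fun x hx => by simp only [hw0 x hx, sp_zero])
  have e : ∀ i x, pd i (fun x => sp (p - 1) (w x)) x = (p - 1) * |w x| ^ (p - 2) * pd i w x := by
    intro i x
    have q := pd_comp (f := w) i (hw.diff x) (sp_hasDeriv (show 1 ≤ p - 1 by linarith) (w x))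
    rw [q, show p - 1 - 1 = p - 2 by ring]
  simp only [e] at hen
  have cs : Continuous (fun x => sp (p - 1) (w x)) := hf.continuous
  have hE : (p - 1) * J ≤ (p - 1) / 2 * J + (p - 1) * (1 / (8 * c) * S p Ω w + C1 * (S p Ω G0 + S p Ω G1)) +
      (p - 1) * (2 * C2 * S p Ω H + 1 / (8 * c) * S p Ω w) := by
    have e1 : (p - 1) * J = ∫ x in Ω, (pd 0 w x * ((p - 1) * |w x| ^ (p - 2) * pd 0 w x) + pd 1 w x * ((p - 1) * |w x| ^ (p - 2) * pd 1 w x)) := by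
      rw [hJ, ← integral_const_mul]; congr 1; ext x; ring
    rw [e1, hen, ← sub_nonneg]
    have e2 : (p - 1) / 2 * J + (p - 1) * (1 / (8 * c) * S p Ω w + C1 * (S p Ω G0 + S p Ω G1)) +
      (p - 1) * (2 * C2 * S p Ω H + 1 / (8 * c) * S p Ω w) = ∫ x in Ω, ((p - 1) / 2 * (|w x| ^ (p - 2) * (pd 0 w x ^ 2 + pd 1 w x ^ 2)) + (p - 1) * (1 / (8 * c) * |w x| ^ p + C1 * (|G0 x| ^ p + |G1 x| ^ p)) + (p - 1) * (2 * C2 * |H x| ^ p + 1 / (8 * c) * |w x| ^ p)) := by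
      have k0 := ci (rp_cont (show 0 ≤ p by linarith) h0)
      have k1 := ci (rp_cont (show 0 ≤ p by linarith) h1)
      have kH := ci (rp_cont (show 0 ≤ p by linarith) hH)
      have kw := ci cp
      have kJ : IntegrableOn (fun x => |w x| ^ (p - 2) * (pd 0 w x ^ 2 + pd 1 w x ^ 2)) Ω := ci (by fun_prop)
      have i1 := (kw.const_mul (1 / (8 * c))).add ((k0.add k1).const_mul C1)
      have i2 := (kH.const_mul (2 * C2)).add (kw.const_mul (1 / (8 * c)))
      have := integral_add ((kJ.const_mul ((p - 1) / 2)).add (i1.const_mul (p - 1))) (i2.const_mul (p - 1))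
      refine Eq.trans ?_ this.symm
      rw [integral_add' (kJ.const_mul ((p - 1) / 2)) (i1.const_mul (p - 1))]
      rw [integral_const_mul, integral_const_mul, integral_const_mul,
        integral_add' (kw.const_mul (1 / (8 * c))) ((k0.add k1).const_mul C1), integral_add' (kH.const_mul (2 * C2)) (kw.const_mul (1 / (8 * c))),
        integral_const_mul, integral_const_mul, integral_const_mul, integral_add' k0 k1]
      rfl
    have r0 := rp_cont (show 0 ≤ p by linarith) h0
    have r1 := rp_cont (show 0 ≤ p by linarith) h1
    have rH := rp_cont (show 0 ≤ p by linarith) hH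
    rw [e2, sub_nonneg]
    refine setIntegral_mono_on (ci (by fun_prop)) (ci (by fun_prop)) hms fun x hx => ?_
    have hn : 0 ≤ |w x| ^ (p - 2) := by positivity
    have a0 := y1 |w x| |G0 x| (abs_nonneg _) (abs_nonneg _)
    have a1 := y1 |w x| |G1 x| (abs_nonneg _) (abs_nonneg _)
    have aH := y2 |H x| (|w x| ^ (p - 1)) (abs_nonneg _) (by positivity)
    rw [← Real.rpow_mul (abs_nonneg _), mul_div_cancel₀ _ hp1.ne'] at aH
    rw [sq_abs] at a0 a1
    have bH : H x * sp (p - 1) (w x) ≤ |H x| * |w x| ^ (p - 1) := by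
      rw [← sp_abs (by linarith), ← abs_mul]; exact le_abs_self _
    have hpp : 0 ≤ |w x| ^ p := by positivity
    have hHp : 0 ≤ |H x| ^ p := by positivity
    have t0 : G0 x * ((p - 1) * |w x| ^ (p - 2) * pd 0 w x) ≤ (p - 1) / 2 * (|w x| ^ (p - 2) * pd 0 w x ^ 2 + |w x| ^ (p - 2) * G0 x ^ 2) := by
      have : 0 ≤ (p - 1) / 2 * (|w x| ^ (p - 2) * (G0 x - pd 0 w x) ^ 2) := by positivity
      nlinarith
    have t1 : G1 x * ((p - 1) * |w x| ^ (p - 2) * pd 1 w x) ≤ (p - 1) / 2 * (|w x| ^ (p - 2) * pd 1 w x ^ 2 + |w x| ^ (p - 2) * G1 x ^ 2) := by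
      have : 0 ≤ (p - 1) / 2 * (|w x| ^ (p - 2) * (G1 x - pd 1 w x) ^ 2) := by positivity
      nlinarith
    have a01 : (p - 1) / 2 * (|w x| ^ (p - 2) * G0 x ^ 2 + |w x| ^ (p - 2) * G1 x ^ 2) ≤ (p - 1) / 2 * (2 * (1 / (8 * c) * |w x| ^ p) + C1 * (|G0 x| ^ p + |G1 x| ^ p)) := by
      exact mul_le_mul_of_nonneg_left (by linarith) (by linarith)
    have aG : 0 ≤ (p - 1) / 2 * (C1 * (|G0 x| ^ p + |G1 x| ^ p)) := by positivity
    have aHH : |H x| * |w x| ^ (p - 1) ≤ (p - 1) * (2 * C2 * |H x| ^ p + 1 / (8 * c) * |w x| ^ p) := by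
      have e3 : 1 / (8 * c) * |w x| ^ p = 2 * (1 / (16 * c) * |w x| ^ p) := by ring
      have e6 : 0 ≤ 1 / (16 * c) * |w x| ^ p := by positivity
      have e4 : 0 ≤ (p - 2) * (2 * C2 * |H x| ^ p + 1 / (8 * c) * |w x| ^ p) := by
        have : 0 ≤ p - 2 := by linarith
        positivity
      have e5 : 0 ≤ C2 * |H x| ^ p := by positivity
      rw [e3] at e4 ⊢
      linarith
    linarith
  have hE2 : J ≤ 1 / (2 * c) * S p Ω w + 2 * (C1 * (S p Ω G0 + S p Ω G1) + 2 * C2 * S p Ω H) := by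
    have : (p - 1) * J ≤ (p - 1) * (1 / 2 * J + (1 / (8 * c) * S p Ω w + C1 * (S p Ω G0 + S p Ω G1)) + (2 * C2 * S p Ω H + 1 / (8 * c) * S p Ω w)) := by
      linarith
    have := le_of_mul_le_mul_left this hp1
    have e : 1 / (2 * c) * S p Ω w = 4 * (1 / (8 * c) * S p Ω w) := by ring
    rw [e]; linarith
  have n0 := S_nonneg p Ω G0
  have n1 := S_nonneg p Ω G1
  have nH := S_nonneg p Ω H
  have : c * J ≤ S p Ω w / 2 + 2 * c * (C1 * (S p Ω G0 + S p Ω G1) + 2 * C2 * S p Ω H) := by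
    have := mul_le_mul_of_nonneg_left hE2 hc0.le
    have e : c * (1 / (2 * c) * S p Ω w) = S p Ω w / 2 := by field_simp
    rw [mul_add, e] at this
    linarith
  have f : S p Ω w ≤ 4 * c * (C1 * (S p Ω G0 + S p Ω G1) + 2 * C2 * S p Ω H) := by linarith
  refine f.trans ?_
  rw [mul_assoc (4 * c)]
  refine mul_le_mul_of_nonneg_left ?_ (by positivity)
  have g1 : 0 ≤ C2 * (S p Ω G0 + S p Ω G1) := by positivity
  have g2 : 0 ≤ C1 * S p Ω H := by positivity
  linarith
end

section

variable {Ω : Set V2} {φ : V2 → ℝ}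

lemma Sm.pdmul {f g : V2 → ℝ} (hf : Sm f) (hg : Sm g) (i : Fin 2) (x : V2) :
    MHD.pd i (fun y => f y * g y) x = MHD.pd i f x * g x + f x * MHD.pd i g x := by
  rw [pd_mul i (hf.diff x) (hg.diff x)]; ring

lemma Sm.pdsub {f g : V2 → ℝ} (hf : Sm f) (hg : Sm g) (i : Fin 2) (x : V2) :
    MHD.pd i (fun y => f y - g y) x = MHD.pd i f x - MHD.pd i g x := pd_sub i (hf.diff x) (hg.diff x)

lemma Sm.pdadd {f g : V2 → ℝ} (hf : Sm f) (hg : Sm g) (i : Fin 2) (x : V2) :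
    MHD.pd i (fun y => f y + g y) x = MHD.pd i f x + MHD.pd i g x := pd_add i (hf.diff x) (hg.diff x)

lemma Dom.perp0 (D : Dom Ω φ) {w η : V2 → ℝ} (hw : Sm w) (hη : Sm η) (h0 : ∀ x ∈ frontier Ω, w x = 0) :
    ∫ x in Ω, (pd 1 w x * pd 0 η x - pd 0 w x * pd 1 η x) = 0 := by
  have a := ibp D.op D.cv D.bd (hw.mul (hη.pd 0)).one (fun x hx => by simp [h0 x hx]) 1
  have b := ibp D.op D.cv D.bd (hw.mul (hη.pd 1)).one (fun x hx => by simp [h0 x hx]) 0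
  have ia := cont_int D.bd ((hw.mul (hη.pd 0)).pd 1).cont
  have ib := cont_int D.bd ((hw.mul (hη.pd 1)).pd 0).cont
  have : ∫ x in Ω, (pd 1 w x * pd 0 η x - pd 0 w x * pd 1 η x)
      = (∫ x in Ω, pd 1 (fun x => w x * pd 0 η x) x) - ∫ x in Ω, pd 0 (fun x => w x * pd 1 η x) x := by
    rw [← integral_sub ia ib]
    congr 1; ext x
    rw [hw.pdmul (hη.pd 0), hw.pdmul (hη.pd 1), pd_comm hη.two 0 1]; ring
  rw [this, a, b, sub_zero]

lemma Dom.ident3 (D : Dom Ω φ) {w χ Z : V2 → ℝ} (hw : Sm w) (hχ : Sm χ) (hZ : Sm Z) (h0 : ∀ x ∈ frontier Ω, w x = 0) :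
    ∫ x in Ω, ((pd 0 w x * pd 0 (fun y => χ y * Z y) x + pd 1 w x * pd 1 (fun y => χ y * Z y) x) -
      ((pd 0 (fun y => χ y * w y) x * pd 0 Z x + pd 1 (fun y => χ y * w y) x * pd 1 Z x)
        - 2 * w x * (pd 0 χ x * pd 0 Z x + pd 1 χ x * pd 1 Z x) - w x * Z x * (pd 0 (pd 0 χ) x + pd 1 (pd 1 χ) x))) = 0 := by
  have s : ∀ j, Sm (fun x => w x * Z x * pd j χ x) := fun j => (hw.mul hZ).mul (hχ.pd j)
  have a := fun j => ibp D.op D.cv D.bd (s j).one (fun x hx => by simp [h0 x hx]) j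
  have ii := fun j => cont_int D.bd ((s j).pd j).cont
  have := integral_add (ii 0) (ii 1)
  rw [a 0, a 1, add_zero] at this
  rw [← this]
  congr 1; ext x
  rw [(hw.mul hZ).pdmul (hχ.pd 0), (hw.mul hZ).pdmul (hχ.pd 1), hw.pdmul hZ, hw.pdmul hZ, hχ.pdmul hZ, hχ.pdmul hZ,
    hχ.pdmul hw, hχ.pdmul hw]
  ring

/-- the reduced integrand -/
def Qf (w G0 G1 H h0 h1 ζ η χ Z E : V2 → ℝ) (x : V2) : ℝ :=
  pd 0 w x * (h0 x - (pd 0 ζ x - pd 1 η x)) + pd 1 w x * (h1 x - (pd 1 ζ x + pd 0 η x))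
  + (G0 x * pd 0 (fun y => ζ y - χ y * Z y) x + G1 x * pd 1 (fun y => ζ y - χ y * Z y) x + H x * (ζ x - χ x * Z x))
  + (pd 0 (fun y => χ y * w y) x * (pd 0 Z x + pd 1 E x) + pd 1 (fun y => χ y * w y) x * (pd 1 Z x - pd 0 E x))
  - 2 * w x * (pd 0 χ x * pd 0 Z x + pd 1 χ x * pd 1 Z x) - w x * Z x * (pd 0 (pd 0 χ) x + pd 1 (pd 1 χ) x)

lemma Dom.identQ (D : Dom Ω φ) {w G0 G1 H h0 h1 ζ η χ Z E : V2 → ℝ} (hw : Sm w) (cG0 : Continuous G0) (cG1 : Continuous G1)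
    (cH : Continuous H) (c0 : Continuous h0) (c1 : Continuous h1) (hζ : Sm ζ) (hη : Sm η) (hχ : Sm χ) (hZ : Sm Z) (hE : Sm E)
    (hw0 : ∀ x ∈ frontier Ω, w x = 0) (hW : Weak Ω w G0 G1 H) (hb : ∀ x ∈ frontier Ω, ζ x - χ x * Z x = 0) :
    IntegrableOn (Qf w G0 G1 H h0 h1 ζ η χ Z E) Ω ∧
    ∫ x in Ω, (pd 0 w x * h0 x + pd 1 w x * h1 x) = ∫ x in Ω, Qf w G0 G1 H h0 h1 ζ η χ Z E x := by
  have hξ : Sm (fun y => ζ y - χ y * Z y) := hζ.sub (hχ.mul hZ)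
  have hχw : Sm (fun y => χ y * w y) := hχ.mul hw
  have hχZ : Sm (fun y => χ y * Z y) := hχ.mul hZ
  have w0 := fun i => (hw.pd i).cont
  have z0 := fun i => (hζ.pd i).cont
  have e0 := fun i => (hη.pd i).cont
  have x0 := fun i => (hξ.pd i).cont
  have Z0 := fun i => (hZ.pd i).cont
  have E0 := fun i => (hE.pd i).cont
  have k0 := fun i => (hχ.pd i).cont
  have kk := fun i j => ((hχ.pd i).pd j).cont
  have cw0 := fun i => (hχw.pd i).cont
  have cz0 := fun i => (hχZ.pd i).cont
  have wc := hw.cont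
  have zc := hζ.cont
  have kc := hχ.cont
  have Zc := hZ.cont
  have a0 := w0 0
  have a1 := w0 1
  have b0 := z0 0
  have b1 := z0 1
  have d0 := e0 0
  have d1 := e0 1
  have f0 := x0 0
  have f1 := x0 1
  have g0 := Z0 0
  have g1 := Z0 1
  have l0 := E0 0
  have l1 := E0 1
  have m0 := k0 0
  have m1 := k0 1
  have n0 := kk 0 0
  have n1 := kk 1 1
  have o0 := cw0 0
  have o1 := cw0 1
  have p0 := cz0 0
  have p1 := cz0 1
  have iQ : IntegrableOn (Qf w G0 G1 H h0 h1 ζ η χ Z E) Ω := by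
    refine cont_int D.bd ?_
    unfold Qf
    fun_prop
  refine ⟨iQ, ?_⟩
  have I1 := D.perp0 hw hη hw0
  have I2 := hW _ hξ.one hb
  have I3 := D.ident3 hw hχ hZ hw0
  have I4 := D.perp0 hχw hE (fun x hx => by simp [hw0 x hx])
  have j1 : IntegrableOn (fun x => pd 1 w x * pd 0 η x - pd 0 w x * pd 1 η x) Ω := cont_int D.bd (by fun_prop)
  have j2 : IntegrableOn (fun x => pd 0 w x * pd 0 (fun y => ζ y - χ y * Z y) x + pd 1 w x * pd 1 (fun y => ζ y - χ y * Z y) x) Ω :=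
    cont_int D.bd (by fun_prop)
  have j2' : IntegrableOn (fun x => G0 x * pd 0 (fun y => ζ y - χ y * Z y) x + G1 x * pd 1 (fun y => ζ y - χ y * Z y) x + H x * (ζ x - χ x * Z x)) Ω :=
    cont_int D.bd (by fun_prop)
  have j3 : IntegrableOn (fun x => ((pd 0 w x * pd 0 (fun y => χ y * Z y) x + pd 1 w x * pd 1 (fun y => χ y * Z y) x) -
      ((pd 0 (fun y => χ y * w y) x * pd 0 Z x + pd 1 (fun y => χ y * w y) x * pd 1 Z x)
        - 2 * w x * (pd 0 χ x * pd 0 Z x + pd 1 χ x * pd 1 Z x) - w x * Z x * (pd 0 (pd 0 χ) x + pd 1 (pd 1 χ) x)))) Ω := by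
    refine cont_int D.bd ?_; fun_prop
  have j4 : IntegrableOn (fun x => pd 1 (fun y => χ y * w y) x * pd 0 E x - pd 0 (fun y => χ y * w y) x * pd 1 E x) Ω := cont_int D.bd (by fun_prop)
  have jh : IntegrableOn (fun x => pd 0 w x * h0 x + pd 1 w x * h1 x) Ω := cont_int D.bd (by fun_prop)
  rw [← sub_eq_zero, ← integral_sub jh iQ]
  have key : ∀ x, (pd 0 w x * h0 x + pd 1 w x * h1 x) - Qf w G0 G1 H h0 h1 ζ η χ Z E x =
      (((pd 1 w x * pd 0 η x - pd 0 w x * pd 1 η x) +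
       ((pd 0 w x * pd 0 (fun y => ζ y - χ y * Z y) x + pd 1 w x * pd 1 (fun y => ζ y - χ y * Z y) x) -
        (G0 x * pd 0 (fun y => ζ y - χ y * Z y) x + G1 x * pd 1 (fun y => ζ y - χ y * Z y) x + H x * (ζ x - χ x * Z x)))) +
       ((pd 0 w x * pd 0 (fun y => χ y * Z y) x + pd 1 w x * pd 1 (fun y => χ y * Z y) x) -
      ((pd 0 (fun y => χ y * w y) x * pd 0 Z x + pd 1 (fun y => χ y * w y) x * pd 1 Z x)
        - 2 * w x * (pd 0 χ x * pd 0 Z x + pd 1 χ x * pd 1 Z x) - w x * Z x * (pd 0 (pd 0 χ) x + pd 1 (pd 1 χ) x)))) +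
       (pd 1 (fun y => χ y * w y) x * pd 0 E x - pd 0 (fun y => χ y * w y) x * pd 1 E x) := by
    intro x
    unfold Qf
    rw [hζ.pdsub hχZ, hζ.pdsub hχZ]
    ring
  simp only [key]
  have t1 := integral_add ((j1.add (j2.sub j2')).add j3) j4
  have t2 := integral_add (j1.add (j2.sub j2')) j3
  have t3 := integral_add j1 (j2.sub j2')
  have t4 := integral_sub j2 j2'
  refine t1.trans ?_
  rw [I4, add_zero]
  refine t2.trans ?_
  rw [I3, add_zero]
  refine t3.trans ?_
  rw [I1, zero_add]
  refine t4.trans ?_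
  rw [I2, sub_self]

set_option maxHeartbeats 1000000 in
lemma ptw {w0 w1 r0 r1 G0 G1 H X0 X1 X c0 c1 T0 T1 w k0 k1 Z0 Z1 Z L ε e m y z : ℝ}
    (hr0 : |r0| ≤ ε) (hr1 : |r1| ≤ ε) (hX0 : |X0| ≤ z + 2 * m * y) (hX1 : |X1| ≤ z + 2 * m * y) (hX : |X| ≤ z + 2 * m * y)
    (hc0 : |c0| ≤ |w0| + m * |w|) (hc1 : |c1| ≤ |w1| + m * |w|) (hT0 : |T0| ≤ e * y + 2 * m * ε) (hT1 : |T1| ≤ e * y + 2 * m * ε)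
    (hk0 : |k0| ≤ m) (hk1 : |k1| ≤ m) (hL : |L| ≤ m) (hZ0 : |Z0| ≤ m * y) (hZ1 : |Z1| ≤ m * y) (hZ : |Z| ≤ y)
    (hm : 1 ≤ m) (he : e ≤ 1) (he0 : 0 ≤ e) (hy : 0 ≤ y) (hz : 0 ≤ z) :
    |w0 * r0 + w1 * r1 + (G0 * X0 + G1 * X1 + H * X) + (c0 * T0 + c1 * T1) - 2 * w * (k0 * Z0 + k1 * Z1) - w * Z * L| ≤
    ε * (3 * m * (|w0| + |w1|) + 4 * m ^ 2 * (|G0| + |G1| + |H| + |w|)) + e * ((|w0| + |w1|) * y)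
     + 9 * m ^ 2 * ((|G0| + |G1| + |H| + |w|) * (z + y)) := by
  have m3 : 1 ≤ m ^ 2 := one_le_pow₀ hm
  have m2 : m ≤ m ^ 2 := le_self_pow₀ hm (by norm_num)
  have hε : 0 ≤ ε := (abs_nonneg _).trans hr0
  have ml : ∀ {a b A B : ℝ}, |a| ≤ A → |b| ≤ B → |a * b| ≤ A * B := fun h1 h2 => by
    rw [abs_mul]; exact mul_le_mul h1 h2 (abs_nonneg _) ((abs_nonneg _).trans h1)
  have t1 := ml le_rfl hr0 (a := w0)
  have t2 := ml le_rfl hr1 (a := w1)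
  have t3 := ml le_rfl hX0 (a := G0)
  have t4 := ml le_rfl hX1 (a := G1)
  have t5 := ml le_rfl hX (a := H)
  have t6 := ml hc0 hT0
  have t7 := ml hc1 hT1
  have t8 := ml le_rfl (ml hk0 hZ0) (a := w)
  have t9 := ml le_rfl (ml hk1 hZ1) (a := w)
  have t10 := ml (ml le_rfl hZ (a := w)) hL
  have tri : |w0 * r0 + w1 * r1 + (G0 * X0 + G1 * X1 + H * X) + (c0 * T0 + c1 * T1) - 2 * w * (k0 * Z0 + k1 * Z1) - w * Z * L| ≤
      |w0 * r0| + |w1 * r1| + (|G0 * X0| + |G1 * X1| + |H * X|) + (|c0 * T0| + |c1 * T1|) + 2 * |w * (k0 * Z0)| + 2 * |w * (k1 * Z1)| + |w * Z * L| := by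
    have l := fun a : ℝ => le_abs_self a
    have l' := fun a : ℝ => neg_abs_le a
    rw [abs_le]
    constructor
    · linarith [l' (w0 * r0), l' (w1 * r1), l' (G0 * X0), l' (G1 * X1), l' (H * X), l' (c0 * T0), l' (c1 * T1), l (w * (k0 * Z0)), l (w * (k1 * Z1)), l (w * Z * L)]
    · linarith [l (w0 * r0), l (w1 * r1), l (G0 * X0), l (G1 * X1), l (H * X), l (c0 * T0), l (c1 * T1), l' (w * (k0 * Z0)), l' (w * (k1 * Z1)), l' (w * Z * L)]
  refine tri.trans ?_
  generalize hW : |w0| + |w1| = W at *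
  have hW0 : 0 ≤ W := by rw [← hW]; positivity
  have hg1 : 0 ≤ |G0| + |G1| + |H| := by positivity
  generalize hG : |G0| + |G1| + |H| = g at *
  have ha : 0 ≤ |w| := abs_nonneg w
  generalize |w| = a at *
  have s1 : |w0 * r0| + |w1 * r1| ≤ W * ε := by rw [← hW]; linarith
  have s2 : |G0 * X0| + |G1 * X1| + |H * X| ≤ g * (z + 2 * m * y) := by rw [← hG]; linarith
  have s3 : |c0 * T0| + |c1 * T1| ≤ (W + 2 * m * a) * (e * y + 2 * m * ε) := by rw [← hW]; linarith
  have p1 : W * ε ≤ m * (W * ε) := le_mul_of_one_le_left (by positivity) hm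
  have p2 : g * z ≤ m ^ 2 * (g * z) := le_mul_of_one_le_left (by positivity) m3
  have p3 : m * (g * y) ≤ m ^ 2 * (g * y) := mul_le_mul_of_nonneg_right m2 (by positivity)
  have p4 : m * (a * y) ≤ m ^ 2 * (a * y) := mul_le_mul_of_nonneg_right m2 (by positivity)
  have p5 : m * (a * (e * y)) ≤ m * (a * y) := by
    have : e * y ≤ y := mul_le_of_le_one_left hy he
    gcongr
  have p6 : 0 ≤ m ^ 2 * (a * z) := by positivity
  have p7 : 0 ≤ m ^ 2 * (ε * g) := by positivity
  have p8 : 0 ≤ m ^ 2 * (g * y) := by positivity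
  have p9 : 0 ≤ m ^ 2 * (g * z) := by positivity
  have p10 : 0 ≤ m ^ 2 * (a * y) := by positivity
  have fin : W*ε+g*(z+2*m*y)+(W+2*m*a)*(e*y+2*m*ε)+2*(a*(m*(m*y)))+2*(a*(m*(m*y)))+a*y*m ≤
      ε * (3 * m * W + 4 * m ^ 2 * (g + a)) + e * (W * y) + 9 * m ^ 2 * ((g + a) * (z + y)) := by
    linarith
  linarith
end

section
variable {Ω : Set V2} {φ : V2 → ℝ}

lemma Dom.cutoff (D : Dom Ω φ) {δ : ℝ} (hδ : 0 < δ) : ∃ χ : V2 → ℝ, Sm χ ∧ (∀ x, φ x = 0 → χ x = 1) ∧ (∀ x, |χ x| ≤ 1) ∧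
    ∀ x, φ x ≤ -δ → χ =ᶠ[𝓝 x] fun _ => 0 := by
  refine ⟨fun x => Real.smoothTransition (1 + 2 / δ * φ x), ?_, fun x hx => ?_, fun x => ?_, fun x hx => ?_⟩
  · have h1 : ContDiff ℝ (⊤ : ℕ∞) Real.smoothTransition := Real.smoothTransition.contDiff
    have h2 : ContDiff ℝ (⊤ : ℕ∞) (fun x => 1 + 2 / δ * φ x) := contDiff_const.add (contDiff_const.mul D.sm)
    exact h1.comp h2
  · simp [hx]
  · rw [abs_le]; constructor
    · linarith [Real.smoothTransition.nonneg (1 + 2 / δ * φ x)]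
    · exact Real.smoothTransition.le_one _
  · have : ∀ᶠ y in 𝓝 x, φ y < -(δ / 2) := (D.sm.cont.tendsto x).eventually (gt_mem_nhds (by linarith))
    filter_upwards [this] with y hy
    refine Real.smoothTransition.zero_of_nonpos ?_
    have : 2 / δ * φ y ≤ 2 / δ * (-(δ / 2)) := by gcongr
    have e : 2 / δ * (-(δ / 2)) = -1 := by field_simp
    linarith

lemma pd_ev {f : V2 → ℝ} {x : V2} (h : f =ᶠ[𝓝 x] fun _ => 0) (i : Fin 2) : pd i f =ᶠ[𝓝 x] fun _ => 0 := by
  filter_upwards [h.eventually_nhds] with y hy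
  unfold pd
  rw [Filter.EventuallyEq.fderiv_eq hy]; simp

lemma Dom.bdd (D : Dom Ω φ) {f : V2 → ℝ} (hf : Continuous f) : ∃ m, ∀ x ∈ Ω, |f x| ≤ m := by
  obtain ⟨m, hm⟩ := D.cpt.exists_bound_of_continuousOn hf.continuousOn
  exact ⟨m, fun x hx => by simpa using hm x (subset_closure hx)⟩

lemma rp3 {r a b c : ℝ} (hr : 0 ≤ r) (ha : 0 ≤ a) (hb : 0 ≤ b) (hc : 0 ≤ c) : (a + b + c) ^ r ≤ 4 ^ r * (a ^ r + b ^ r + c ^ r) := by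
  have h1 := rp_add hr (a + b) c
  have h2 := rp_add hr a b
  rw [abs_of_nonneg (by positivity), abs_of_nonneg (by positivity), abs_of_nonneg hc] at h1
  rw [abs_of_nonneg (by positivity), abs_of_nonneg ha, abs_of_nonneg hb] at h2
  have e : (4:ℝ) ^ r = 2 ^ r * 2 ^ r := by rw [← Real.mul_rpow (by norm_num) (by norm_num)]; norm_num
  have k1 : (1:ℝ) ≤ 2 ^ r := Real.one_le_rpow (by norm_num) hr
  rw [e]
  have k2 : 0 ≤ c ^ r := by positivity
  have k3 : c ^ r ≤ 2 ^ r * c ^ r := le_mul_of_one_le_left k2 k1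
  calc _ ≤ _ := h1
    _ ≤ 2 ^ r * (2 ^ r * (a ^ r + b ^ r) + 2 ^ r * c ^ r) := by gcongr
    _ = _ := by ring

lemma rp2 {r a b : ℝ} (hr : 0 ≤ r) (ha : 0 ≤ a) (hb : 0 ≤ b) : (a + b) ^ r ≤ 2 ^ r * (a ^ r + b ^ r) := by
  have h2 := rp_add hr a b
  rwa [abs_of_nonneg (by positivity), abs_of_nonneg ha, abs_of_nonneg hb] at h2

lemma rp4 {r a b c d : ℝ} (hr : 0 ≤ r) (ha : 0 ≤ a) (hb : 0 ≤ b) (hc : 0 ≤ c) (hd : 0 ≤ d) :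
    (a + b + c + d) ^ r ≤ 4 ^ r * (a ^ r + b ^ r + c ^ r + d ^ r) := by
  have h1 := rp2 hr (add_nonneg ha hb) (add_nonneg hc hd)
  have h2 := rp2 hr ha hb
  have h3 := rp2 hr hc hd
  have e : (4:ℝ) ^ r = 2 ^ r * 2 ^ r := by rw [← Real.mul_rpow (by norm_num) (by norm_num)]; norm_num
  rw [e]
  calc _ = ((a + b) + (c + d)) ^ r := by ring_nf
    _ ≤ _ := h1
    _ ≤ 2 ^ r * (2 ^ r * (a ^ r + b ^ r) + 2 ^ r * (c ^ r + d ^ r)) := by gcongr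
    _ = _ := by ring

/-- pointwise bound of the reduced integrand in the collar -/
lemma Dom.ptK (D : Dom Ω φ) {w G0 G1 H h0 h1 ζ η χ : V2 → ℝ} (hw : Sm w) (hζ : Sm ζ) (hη : Sm η) (hχ : Sm χ) {x : V2} {m e ε : ℝ}
    (hm : 1 ≤ m) (he : e ≤ 1) (he0 : 0 ≤ e) (hε : 0 < ε)
    (hM : ∀ k j, |Mx φ k j x| ≤ m) (h1χ : |χ x| ≤ 1) (hkχ : ∀ j, |pd j χ x| ≤ m) (hL : |pd 0 (pd 0 χ) x + pd 1 (pd 1 χ) x| ≤ m)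
    (he1 : |Mx φ 0 0 x + Mx φ 1 1 x| ≤ e) (he2 : |Mx φ 0 1 x - Mx φ 1 0 x| ≤ e)
    (z0 : ∀ x, |h0 x - (pd 0 ζ x - pd 1 η x)| ≤ ε) (z1 : ∀ x, |h1 x - (pd 1 ζ x + pd 0 η x)| ≤ ε)
    (hh0 : h0 (Psi φ x) = 0) (hh1 : h1 (Psi φ x) = 0) :
    |Qf w G0 G1 H h0 h1 ζ η χ (fun y => ζ (Psi φ y)) (fun y => η (Psi φ y)) x| ≤
     ε * (3 * m * (|pd 0 w x| + |pd 1 w x|) + 4 * m ^ 2 * (|G0 x| + |G1 x| + |H x| + |w x|))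
     + e * ((|pd 0 w x| + |pd 1 w x|) * (|pd 0 ζ (Psi φ x)| + |pd 1 ζ (Psi φ x)| + |ζ (Psi φ x)|))
     + 9 * m ^ 2 * ((|G0 x| + |G1 x| + |H x| + |w x|) * ((|pd 0 ζ x| + |pd 1 ζ x| + |ζ x|) + (|pd 0 ζ (Psi φ x)| + |pd 1 ζ (Psi φ x)| + |ζ (Psi φ x)|))) := by
  have hZ : Sm (fun y => ζ (Psi φ y)) := ContDiff.comp hζ D.Psi_sm
  have hE : Sm (fun y => η (Psi φ y)) := ContDiff.comp hη D.Psi_sm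
  have r0 := z0 (Psi φ x)
  have r1 := z1 (Psi φ x)
  rw [hh0] at r0; rw [hh1] at r1
  have ml : ∀ {a b A B : ℝ}, |a| ≤ A → |b| ≤ B → |a * b| ≤ A * B := fun h1 h2 => by
    rw [abs_mul]; exact mul_le_mul h1 h2 (abs_nonneg _) ((abs_nonneg _).trans h1)
  have y0 : 0 ≤ |pd 0 ζ (Psi φ x)| + |pd 1 ζ (Psi φ x)| + |ζ (Psi φ x)| := by positivity
  set y := |pd 0 ζ (Psi φ x)| + |pd 1 ζ (Psi φ x)| + |ζ (Psi φ x)| with hy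
  have zz0 : 0 ≤ |pd 0 ζ x| + |pd 1 ζ x| + |ζ x| := by positivity
  have mm := fun k j => abs_nonneg (Mx φ k j x)
  have hZj : ∀ j, |pd j (fun y => ζ (Psi φ y)) x| ≤ m * y := by
    intro j
    rw [D.pd_Psi hζ]
    have a1 := ml (le_refl |pd 0 ζ (Psi φ x)|) (hM 0 j)
    have a2 := ml (le_refl |pd 1 ζ (Psi φ x)|) (hM 1 j)
    refine (abs_add_le _ _).trans ?_
    have : 0 ≤ m * |ζ (Psi φ x)| := by positivity
    rw [hy]; linarith
  have hZy : |ζ (Psi φ x)| ≤ y := by rw [hy]; linarith [abs_nonneg (pd 0 ζ (Psi φ x)), abs_nonneg (pd 1 ζ (Psi φ x))]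
  have hχZ : ∀ j, |pd j (fun y => χ y * ζ (Psi φ y)) x| ≤ 2 * m * y := by
    intro j
    rw [hχ.pdmul hZ]
    refine (abs_add_le _ _).trans ?_
    have a1 := ml (hkχ j) hZy
    have a2 := ml h1χ (hZj j)
    rw [abs_mul] at a1 a2 ⊢
    rw [abs_mul]
    linarith
  have hmy : y ≤ 2 * m * y := by
    have := mul_le_mul_of_nonneg_right hm y0
    have : 0 ≤ m * y := by positivity
    linarith
  have hX : ∀ j, |pd j (fun y => ζ y - χ y * ζ (Psi φ y)) x| ≤ |pd j ζ x| + 2 * m * y := by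
    intro j
    rw [hζ.pdsub (hχ.mul hZ)]
    exact (abs_sub _ _).trans (add_le_add le_rfl (hχZ j))
  have hc : ∀ j, |pd j (fun y => χ y * w y) x| ≤ |pd j w x| + m * |w x| := by
    intro j
    rw [hχ.pdmul hw]
    refine (abs_add_le _ _).trans ?_
    have a1 := ml (hkχ j) (le_refl |w x|)
    have a2 := ml h1χ (le_refl |pd j w x|)
    rw [abs_mul] at a1 a2 ⊢
    rw [abs_mul]
    linarith
  have z0' := abs_nonneg (pd 0 ζ x)
  have z1' := abs_nonneg (pd 1 ζ x)
  have z2' := abs_nonneg (ζ x)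
  have he2' : |Mx φ 1 0 x - Mx φ 0 1 x| ≤ e := by rw [abs_sub_comm]; exact he2
  have r0' : |pd 1 η (Psi φ x) - pd 0 ζ (Psi φ x)| ≤ ε := by
    convert r0 using 2; ring
  have r1' : |pd 0 η (Psi φ x) + pd 1 ζ (Psi φ x)| ≤ ε := by
    rw [← abs_neg]; convert r1 using 2; ring
  have tri4 : ∀ a b c d : ℝ, |a + b + c + d| ≤ |a| + |b| + |c| + |d| := fun a b c d =>
    (abs_add_le _ _).trans (add_le_add ((abs_add_le _ _).trans (add_le_add (abs_add_le _ _) le_rfl)) le_rfl)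
  have T0 : |pd 0 (fun y => ζ (Psi φ y)) x + pd 1 (fun y => η (Psi φ y)) x| ≤ e * y + 2 * m * ε := by
    rw [D.pd_Psi hζ, D.pd_Psi hη]
    have : pd 0 ζ (Psi φ x) * Mx φ 0 0 x + pd 1 ζ (Psi φ x) * Mx φ 1 0 x + (pd 0 η (Psi φ x) * Mx φ 0 1 x + pd 1 η (Psi φ x) * Mx φ 1 1 x)
       = pd 0 ζ (Psi φ x) * (Mx φ 0 0 x + Mx φ 1 1 x) + pd 1 ζ (Psi φ x) * (Mx φ 1 0 x - Mx φ 0 1 x)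
        + (pd 0 η (Psi φ x) + pd 1 ζ (Psi φ x)) * Mx φ 0 1 x + (pd 1 η (Psi φ x) - pd 0 ζ (Psi φ x)) * Mx φ 1 1 x := by ring
    rw [this]
    refine (tri4 _ _ _ _).trans ?_
    have a1 := ml (le_refl |pd 0 ζ (Psi φ x)|) he1
    have a2 := ml (le_refl |pd 1 ζ (Psi φ x)|) he2'
    have a3 := ml r1' (hM 0 1)
    have a4 := ml r0' (hM 1 1)
    have : 0 ≤ e * |ζ (Psi φ x)| := by positivity
    rw [hy]; linarith
  have T1 : |pd 1 (fun y => ζ (Psi φ y)) x - pd 0 (fun y => η (Psi φ y)) x| ≤ e * y + 2 * m * ε := by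
    rw [D.pd_Psi hζ, D.pd_Psi hη]
    have : pd 0 ζ (Psi φ x) * Mx φ 0 1 x + pd 1 ζ (Psi φ x) * Mx φ 1 1 x - (pd 0 η (Psi φ x) * Mx φ 0 0 x + pd 1 η (Psi φ x) * Mx φ 1 0 x)
       = pd 1 ζ (Psi φ x) * (Mx φ 0 0 x + Mx φ 1 1 x) + pd 0 ζ (Psi φ x) * (Mx φ 0 1 x - Mx φ 1 0 x)
        + (pd 0 η (Psi φ x) + pd 1 ζ (Psi φ x)) * (-Mx φ 0 0 x) + (pd 1 η (Psi φ x) - pd 0 ζ (Psi φ x)) * (-Mx φ 1 0 x) := by ring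
    rw [this]
    refine (tri4 _ _ _ _).trans ?_
    have a1 := ml (le_refl |pd 1 ζ (Psi φ x)|) he1
    have a2 := ml (le_refl |pd 0 ζ (Psi φ x)|) he2
    have a3 := ml r1' ((abs_neg (Mx φ 0 0 x)).trans_le (hM 0 0))
    have a4 := ml r0' ((abs_neg (Mx φ 1 0 x)).trans_le (hM 1 0))
    have : 0 ≤ e * |ζ (Psi φ x)| := by positivity
    rw [hy]; linarith
  unfold Qf
  refine ptw (z0 x) (z1 x) ((hX 0).trans ?_) ((hX 1).trans ?_) ?_ (hc 0) (hc 1) T0 T1 (hkχ 0) (hkχ 1) hL (hZj 0) (hZj 1) hZy hm he he0 y0 zz0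
  · linarith
  · linarith
  · refine (abs_sub _ _).trans ?_
    have := ml h1χ hZy
    linarith

/-- pointwise bound away from the collar -/
lemma Dom.ptO (D : Dom Ω φ) {w G0 G1 H h0 h1 ζ η χ Z E : V2 → ℝ} (hw : Sm w) (hζ : Sm ζ) (hχ : Sm χ) (hZ : Sm Z) {x : V2} {m ε : ℝ}
    (hm : 1 ≤ m) (hε : 0 < ε) (hχ0 : χ =ᶠ[𝓝 x] fun _ => 0)
    (z0 : ∀ x, |h0 x - (pd 0 ζ x - pd 1 η x)| ≤ ε) (z1 : ∀ x, |h1 x - (pd 1 ζ x + pd 0 η x)| ≤ ε) :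
    |Qf w G0 G1 H h0 h1 ζ η χ Z E x| ≤
     ε * (3 * m * (|pd 0 w x| + |pd 1 w x|) + 4 * m ^ 2 * (|G0 x| + |G1 x| + |H x| + |w x|))
     + 9 * m ^ 2 * ((|G0 x| + |G1 x| + |H x| + |w x|) * ((|pd 0 ζ x| + |pd 1 ζ x| + |ζ x|))) := by
  have e0 := hχ0.eq_of_nhds
  have e1 := fun j => (pd_ev hχ0 j).eq_of_nhds
  have e2 := fun j k => (pd_ev (pd_ev hχ0 j) k).eq_of_nhds
  have zz0 : 0 ≤ |pd 0 ζ x| + |pd 1 ζ x| + |ζ x| := by positivity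
  have z0' := abs_nonneg (pd 0 ζ x)
  have z1' := abs_nonneg (pd 1 ζ x)
  have z2' := abs_nonneg (ζ x)
  have a1 := abs_nonneg (w x)
  have a2 := abs_nonneg (pd 0 w x)
  have a3 := abs_nonneg (pd 1 w x)
  have h := ptw (w0 := pd 0 w x) (w1 := pd 1 w x) (r0 := _) (r1 := _) (G0 := G0 x) (G1 := G1 x) (H := H x) (X0 := pd 0 ζ x) (X1 := pd 1 ζ x)
    (X := ζ x) (c0 := 0) (c1 := 0) (T0 := 0) (T1 := 0) (w := w x) (k0 := 0) (k1 := 0) (Z0 := 0) (Z1 := 0) (Z := 0) (L := 0) (ε := ε) (e := 0)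
    (m := m) (y := 0) (z := |pd 0 ζ x| + |pd 1 ζ x| + |ζ x|) (z0 x) (z1 x)
    (by linarith) (by linarith) (by linarith) (by rw [abs_zero]; positivity) (by rw [abs_zero]; positivity) (by rw [abs_zero]; positivity)
    (by rw [abs_zero]; positivity) (by rw [abs_zero]; positivity) (by rw [abs_zero]; positivity) (by rw [abs_zero]; positivity) (by simp) (by simp) (by simp) hm
    (by norm_num) le_rfl le_rfl zz0
  unfold Qf
  rw [hζ.pdsub (hχ.mul hZ), hζ.pdsub (hχ.mul hZ), hχ.pdmul hZ, hχ.pdmul hZ, hχ.pdmul hw, hχ.pdmul hw, e2, e2, e1, e1, e0]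
  simp only [zero_mul, mul_zero, sub_zero, add_zero] at h ⊢
  exact h
end

section
variable {Ω : Set V2} {φ : V2 → ℝ}

set_option maxHeartbeats 2000000 in
lemma Dom.B1 (D : Dom Ω φ) {p q : ℝ} (h : PQ p q) {θ : ℝ} (hθ : 0 < θ) : ∃ C > 0, ∀ w G0 G1 H : V2 → ℝ, Sm w → Continuous G0 →
    Continuous G1 → Continuous H → (∀ x ∈ frontier Ω, w x = 0) → Weak Ω w G0 G1 H → ∀ h0 h1, Cc h0 → Cc h1 →
    (∀ x, 0 ≤ φ x → h0 x = 0) → (∀ x, 0 ≤ φ x → h1 x = 0) →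
    ∫ x in Ω, (pd 0 w x * h0 x + pd 1 w x * h1 x) ≤ θ * (S p Ω (pd 0 w) + S p Ω (pd 1 w) + ((∫ x, |h0 x| ^ q) + ∫ x, |h1 x| ^ q))
      + C * (S p Ω G0 + S p Ω G1 + S p Ω H + S p Ω w) := by
  have hp := h.two
  have hq := h.q1
  have hp0 : 0 ≤ p := by linarith
  have hq0 : 0 ≤ q := by linarith
  obtain ⟨R, hR0, hR⟩ := D.exR
  obtain ⟨Ch, hCh, helmC⟩ := helm h hR0
  set J := 3 * 4 ^ q * Ch with hJ
  have hJ0 : 0 < J := by positivity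
  set e := min 1 (min (θ / 2 ^ p) (θ / (4 * J))) with he
  have e0 : 0 < e := by positivity
  have e1 : e ≤ 1 := min_le_left _ _
  have e2 : e * 2 ^ p ≤ θ := by
    rw [← le_div_iff₀ (by positivity)]; exact (min_le_right _ _).trans (min_le_left _ _)
  have e3 : e * (4 * J) ≤ θ := by
    rw [← le_div_iff₀ (by positivity)]; exact (min_le_right _ _).trans (min_le_right _ _)
  obtain ⟨δ, hδ, hK, hcv⟩ := D.reflect hR e0
  obtain ⟨χ, hχ, χ1, χb, χ0⟩ := D.cutoff hδ
  have hKm : MeasurableSet {x | -δ < φ x ∧ φ x < 0} := by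
    have := D.sm.cont
    exact ((isOpen_lt continuous_const this).inter (isOpen_lt this continuous_const)).measurableSet
  set K := {x | -δ < φ x ∧ φ x < 0} with hKdef
  have hKΩ : K ⊆ Ω := fun x hx => D.mem.2 hx.2
  obtain ⟨m1, hm1⟩ := D.bdd (D.Mx_sm 0 0).cont
  obtain ⟨m2, hm2⟩ := D.bdd (D.Mx_sm 0 1).cont
  obtain ⟨m3, hm3⟩ := D.bdd (D.Mx_sm 1 0).cont
  obtain ⟨m4, hm4⟩ := D.bdd (D.Mx_sm 1 1).cont
  obtain ⟨m5, hm5⟩ := D.bdd (hχ.pd 0).cont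
  obtain ⟨m6, hm6⟩ := D.bdd (hχ.pd 1).cont
  obtain ⟨m7, hm7⟩ := D.bdd (((hχ.pd 0).pd 0).cont.add ((hχ.pd 1).pd 1).cont)
  obtain ⟨m, hm, b1, b2, b3, b4, b5, b6, b7⟩ : ∃ m, 1 ≤ m ∧ m1 ≤ m ∧ m2 ≤ m ∧ m3 ≤ m ∧ m4 ≤ m ∧ m5 ≤ m ∧ m6 ≤ m ∧ m7 ≤ m := by
    refine ⟨1 + |m1| + |m2| + |m3| + |m4| + |m5| + |m6| + |m7|, ?_⟩
    have := abs_nonneg m1; have := abs_nonneg m2; have := abs_nonneg m3; have := abs_nonneg m4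
    have := abs_nonneg m5; have := abs_nonneg m6; have := abs_nonneg m7
    have := le_abs_self m1; have := le_abs_self m2; have := le_abs_self m3; have := le_abs_self m4
    have := le_abs_self m5; have := le_abs_self m6; have := le_abs_self m7
    refine ⟨?_, ?_, ?_, ?_, ?_, ?_, ?_, ?_⟩ <;> linarith
  set η0 := θ / (2 * (9 * m ^ 2 * 2 ^ q * 3 * J)) with hη0
  have hη00 : 0 < η0 := by positivity
  have e4 : 9 * m ^ 2 * (η0 * (2 ^ q * (3 * J))) = θ / 2 := by
    rw [hη0]; field_simp
  obtain ⟨Cη, hCη, young⟩ := h.yE hη00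
  refine ⟨9 * m ^ 2 * Cη * 4 ^ p, by positivity, fun w G0 G1 H hw cG0 cG1 cH hw0 hW h0 h1 c0 c1 v0 v1 => ?_⟩
  set A := S p Ω (pd 0 w) + S p Ω (pd 1 w) with hA
  set N := (∫ x, |h0 x| ^ q) + ∫ x, |h1 x| ^ q with hN
  have hN0 : 0 ≤ N := add_nonneg (integral_nonneg fun x => by positivity) (integral_nonneg fun x => by positivity)
  have hA0 : 0 ≤ A := add_nonneg (S_nonneg _ _ _) (S_nonneg _ _ _)
  set Y := ∫ x in Ω, (3 * m * (|pd 0 w x| + |pd 1 w x|) + 4 * m ^ 2 * (|G0 x| + |G1 x| + |H x| + |w x|)) with hY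
  have a0 := (hw.pd 0).cont
  have a1 := (hw.pd 1).cont
  have a2 := hw.cont
  suffices hs : ∀ ε > 0, ∫ x in Ω, (pd 0 w x * h0 x + pd 1 w x * h1 x) ≤ θ * (A + N) + 9 * m ^ 2 * Cη * 4 ^ p * (S p Ω G0 + S p Ω G1 + S p Ω H + S p Ω w) + ε * Y by
    have tl : Tendsto (fun ε : ℝ => θ * (A + N) + 9 * m ^ 2 * Cη * 4 ^ p * (S p Ω G0 + S p Ω G1 + S p Ω H + S p Ω w) + ε * Y) (𝓝[>] 0)
        (𝓝 (θ * (A + N) + 9 * m ^ 2 * Cη * 4 ^ p * (S p Ω G0 + S p Ω G1 + S p Ω H + S p Ω w) + 0 * Y)) := by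
      refine Tendsto.mono_left ?_ nhdsWithin_le_nhds
      exact (by fun_prop : Continuous (fun ε : ℝ => θ * (A + N) + 9 * m ^ 2 * Cη * 4 ^ p * (S p Ω G0 + S p Ω G1 + S p Ω H + S p Ω w) + ε * Y)).tendsto 0
    have := ge_of_tendsto tl (eventually_mem_nhdsWithin.mono fun ε hε => hs ε hε)
    simpa using this
  intro ε hε
  have hsupp : ∀ {f : V2 → ℝ}, (∀ x, 0 ≤ φ x → f x = 0) → ∀ x, f x ≠ 0 → ‖x‖ ≤ R := by
    intro f hf x hx
    by_contra hn
    refine hx (hf x ?_)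
    by_contra hh; push Not at hh
    exact hn (hR x (D.memc.2 hh.le)).le
  obtain ⟨ζ, η, hζ, hη, z0, z1, B0, B1⟩ := helmC h0 h1 c0 c1 (hsupp v0) (hsupp v1) ε hε
  have hZ : Sm (fun y => ζ (Psi φ y)) := ContDiff.comp hζ D.Psi_sm
  have hE : Sm (fun y => η (Psi φ y)) := ContDiff.comp hη D.Psi_sm
  obtain ⟨iQ, hQ⟩ := D.identQ (Z := fun y => ζ (Psi φ y)) (E := fun y => η (Psi φ y)) hw cG0 cG1 cH c0.cont c1.cont hζ hη hχ hZ hE hw0 hW (fun x hx => by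
    have hx' := D.memf.1 hx
    rw [χ1 x hx', D.Psi_bd hx']; ring)
  rw [hQ]
  set z : V2 → ℝ := fun x => |pd 0 ζ x| + |pd 1 ζ x| + |ζ x| with hz
  have d0 := (hζ.pd 0).cont
  have d1 := (hζ.pd 1).cont
  have d2 := hζ.cont
  have zc : Continuous z := by fun_prop
  have z0' : ∀ x, 0 ≤ z x := fun x => by simp only [hz]; positivity
  have zqc : Continuous (fun x => z x ^ q) := zc.rpow_const fun x => Or.inr hq0
  set y : V2 → ℝ := fun x => z (Psi φ x) with hy
  have hPc : Continuous (Psi φ) := D.Psi_sm.continuous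
  have yc : Continuous y := zc.comp hPc
  have y0' : ∀ x, 0 ≤ y x := fun x => z0' _
  have yqc : Continuous (fun x => y x ^ q) := yc.rpow_const fun x => Or.inr hq0
  set g : V2 → ℝ := fun x => |G0 x| + |G1 x| + |H x| + |w x| with hg
  have gc : Continuous g := by fun_prop
  have g0' : ∀ x, 0 ≤ g x := fun x => by simp only [hg]; positivity
  set W : V2 → ℝ := fun x => |pd 0 w x| + |pd 1 w x| with hWd
  have Wc : Continuous W := by fun_prop
  have W0' : ∀ x, 0 ≤ W x := fun x => by simp only [hWd]; positivity
  have hball : ∫ x in Metric.closedBall 0 R, z x ^ q ≤ J * N := by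
    have cb : ∀ {f : V2 → ℝ}, Continuous f → IntegrableOn f (Metric.closedBall 0 R) := fun hf =>
      hf.continuousOn.integrableOn_compact (isCompact_closedBall _ _)
    have i0 := cb (rp_cont hq0 d0)
    have i1 := cb (rp_cont hq0 d1)
    have i2 := cb (rp_cont hq0 d2)
    have l : ∫ x in Metric.closedBall 0 R, z x ^ q ≤ ∫ x in Metric.closedBall 0 R, 4 ^ q * (|pd 0 ζ x| ^ q + |pd 1 ζ x| ^ q + |ζ x| ^ q) := by
      refine integral_mono (cb zqc) (((i0.add i1).add i2).const_mul _) fun x => ?_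
      exact rp3 hq0 (abs_nonneg _) (abs_nonneg _) (abs_nonneg _)
    refine l.trans ?_
    rw [integral_const_mul]
    have s1 := integral_add (i0.add i1) i2
    have s2 := integral_add i0 i1
    simp only [Pi.add_apply] at s1 s2
    rw [s1, s2]
    have t0 := B0 0
    have t1 := B0 1
    have : (∫ x in Metric.closedBall 0 R, |pd 0 ζ x| ^ q) + (∫ x in Metric.closedBall 0 R, |pd 1 ζ x| ^ q) + ∫ x in Metric.closedBall 0 R, |ζ x| ^ q ≤ 3 * (Ch * N) := by
      linarith
    calc _ ≤ 4 ^ q * (3 * (Ch * N)) := by gcongr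
      _ = _ := by rw [hJ]; ring
  have hyK : ∫ x in K, y x ^ q ≤ 2 * (J * N) := by
    refine (hcv (fun x => z x ^ q) zqc fun x => Real.rpow_nonneg (z0' x) _).trans ?_
    linarith
  have hzΩ : ∫ x in Ω, z x ^ q ≤ J * N := by
    refine le_trans ?_ hball
    refine setIntegral_mono_set (zqc.continuousOn.integrableOn_compact (isCompact_closedBall _ _)) (ae_of_all _ fun x => Real.rpow_nonneg (z0' x) _) ?_
    refine HasSubset.Subset.eventuallyLE fun x hx => ?_
    simpa using (hR x (subset_closure hx)).le
  -- pointwise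
  have ptA : ∀ x ∈ Ω, Qf w G0 G1 H h0 h1 ζ η χ (fun y => ζ (Psi φ y)) (fun y => η (Psi φ y)) x ≤
      ε * (3 * m * W x + 4 * m ^ 2 * g x) + e * W x ^ p + e * K.indicator (fun x => y x ^ q) x
        + 9 * m ^ 2 * (Cη * g x ^ p) + 9 * m ^ 2 * (η0 * (2 ^ q * (z x ^ q + K.indicator (fun x => y x ^ q) x))) := by
    intro x hx
    have hxφ := D.mem.1 hx
    by_cases hxK : x ∈ K
    · obtain ⟨k1, k2, k3, k4⟩ := hK x hxK.1 hxK.2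
      have main := D.ptK (G0 := G0) (G1 := G1) (H := H) hw hζ hη hχ (x := x) hm e1 e0.le hε (fun k j => by
          fin_cases k <;> fin_cases j
          · exact (hm1 x hx).trans b1
          · exact (hm2 x hx).trans b2
          · exact (hm3 x hx).trans b3
          · exact (hm4 x hx).trans b4) (χb x) (fun j => by
          fin_cases j
          · exact (hm5 x hx).trans b5
          · exact (hm6 x hx).trans b6) ((hm7 x hx).trans b7) k3 k4 z0 z1 (v0 _ k1.le) (v1 _ k1.le)
      rw [indicator_of_mem hxK]
      have main2 := (le_abs_self _).trans main
      change _ ≤ ε * (3 * m * W x + 4 * m ^ 2 * g x) + e * (W x * y x) + 9 * m ^ 2 * (g x * (z x + y x)) at main2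
      have y1 := h.young (W0' x) (y0' x)
      have y2 := young (g x) (z x + y x) (g0' x) (add_nonneg (z0' x) (y0' x))
      have y3 := rp2 hq0 (z0' x) (y0' x)
      have y4 : e * (W x * y x) ≤ e * (W x ^ p + y x ^ q) := by gcongr
      have y5 : 9 * m ^ 2 * (g x * (z x + y x)) ≤ 9 * m ^ 2 * (Cη * g x ^ p + η0 * (2 ^ q * (z x ^ q + y x ^ q))) := by
        refine mul_le_mul_of_nonneg_left (y2.trans ?_) (by positivity)
        gcongr
      linarith
    · have hφ : φ x ≤ -δ := by
        by_contra hh; push Not at hh; exact hxK ⟨hh, hxφ⟩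
      have main := D.ptO (G0 := G0) (G1 := G1) (H := H) (E := fun y => η (Psi φ y)) hw hζ hχ hZ hm hε (χ0 x hφ) z0 z1
      rw [indicator_of_notMem hxK]
      have main2 := (le_abs_self _).trans main
      change _ ≤ ε * (3 * m * W x + 4 * m ^ 2 * g x) + 9 * m ^ 2 * (g x * z x) at main2
      have y2 := young (g x) (z x) (g0' x) (z0' x)
      have y6 : (1:ℝ) ≤ 2 ^ q := Real.one_le_rpow (by norm_num) hq0
      have y7 : z x ^ q ≤ 2 ^ q * z x ^ q := le_mul_of_one_le_left (Real.rpow_nonneg (z0' x) _) y6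
      have y5 : 9 * m ^ 2 * (g x * z x) ≤ 9 * m ^ 2 * (Cη * g x ^ p + η0 * (2 ^ q * (z x ^ q + 0))) := by
        refine mul_le_mul_of_nonneg_left (y2.trans ?_) (by positivity)
        rw [add_zero]
        gcongr
      have y8 : 0 ≤ e * W x ^ p := mul_nonneg e0.le (Real.rpow_nonneg (W0' x) _)
      linarith
  have iY : IntegrableOn (fun x => 3 * m * W x + 4 * m ^ 2 * g x) Ω := cont_int D.bd (by fun_prop)
  have iW : IntegrableOn (fun x => W x ^ p) Ω := cont_int D.bd (Wc.rpow_const fun x => Or.inr hp0)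
  have ig : IntegrableOn (fun x => g x ^ p) Ω := cont_int D.bd (gc.rpow_const fun x => Or.inr hp0)
  have iz : IntegrableOn (fun x => z x ^ q) Ω := cont_int D.bd zqc
  have iy : IntegrableOn (fun x => y x ^ q) Ω := cont_int D.bd yqc
  have iyK : IntegrableOn (K.indicator fun x => y x ^ q) Ω := iy.indicator hKm
  have E1 : ∫ x in Ω, K.indicator (fun x => y x ^ q) x = ∫ x in K, y x ^ q := by
    rw [setIntegral_indicator hKm, inter_eq_right.2 hKΩ]
  have j1 := iY.const_mul ε
  have j2 := iW.const_mul e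
  have j3 := iyK.const_mul e
  have j4 := (ig.const_mul Cη).const_mul (9 * m ^ 2)
  have j5 := (((iz.add iyK).const_mul (2 ^ q)).const_mul η0).const_mul (9 * m ^ 2)
  have big := setIntegral_mono_on iQ ((((j1.add j2).add j3).add j4).add j5) D.op.measurableSet ptA
  have k1 := integral_add (((j1.add j2).add j3).add j4) j5
  have k2 := integral_add ((j1.add j2).add j3) j4
  have k3 := integral_add (j1.add j2) j3
  have k4 := integral_add j1 j2
  have k5 := integral_add iz iyK
  simp only [Pi.add_apply] at big k1 k2 k3 k4 k5
  rw [k1, k2, k3, k4] at big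
  simp only [integral_const_mul] at big
  rw [k5, E1] at big
  have hWi : ∫ x in Ω, W x ^ p ≤ 2 ^ p * A := by
    have i0 := cont_int D.bd (rp_cont hp0 a0)
    have i1 := cont_int D.bd (rp_cont hp0 a1)
    have := integral_mono iW ((i0.add i1).const_mul (2 ^ p)) fun x => rp2 hp0 (abs_nonneg (pd 0 w x)) (abs_nonneg (pd 1 w x))
    refine this.trans_eq ?_
    simp only [Pi.add_apply]
    rw [integral_const_mul]
    congr 1
    exact integral_add i0 i1
  have hgi : ∫ x in Ω, g x ^ p ≤ 4 ^ p * (S p Ω G0 + S p Ω G1 + S p Ω H + S p Ω w) := by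
    have i0 := cont_int D.bd (rp_cont hp0 cG0)
    have i1 := cont_int D.bd (rp_cont hp0 cG1)
    have i2 := cont_int D.bd (rp_cont hp0 cH)
    have i3 := cont_int D.bd (rp_cont hp0 a2)
    have := integral_mono ig ((((i0.add i1).add i2).add i3).const_mul (4 ^ p)) fun x => rp4 hp0 (abs_nonneg (G0 x)) (abs_nonneg (G1 x)) (abs_nonneg (H x)) (abs_nonneg (w x))
    refine this.trans_eq ?_
    have s1 := integral_add ((i0.add i1).add i2) i3
    have s2 := integral_add (i0.add i1) i2
    have s3 := integral_add i0 i1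
    simp only [Pi.add_apply] at s1 s2 s3 ⊢
    rw [integral_const_mul, s1, s2, s3]
    rfl
  refine big.trans ?_
  have f1 : e * ∫ x in Ω, W x ^ p ≤ θ * A := by
    calc _ ≤ e * (2 ^ p * A) := by gcongr
      _ = (e * 2 ^ p) * A := by ring
      _ ≤ _ := by gcongr
  have f2 : e * ∫ x in K, y x ^ q ≤ θ / 2 * N := by
    calc _ ≤ e * (2 * (J * N)) := by gcongr
      _ = (e * (4 * J)) / 2 * N := by ring
      _ ≤ _ := by gcongr
  have f3 : 9 * m ^ 2 * (Cη * ∫ x in Ω, g x ^ p) ≤ 9 * m ^ 2 * Cη * 4 ^ p * (S p Ω G0 + S p Ω G1 + S p Ω H + S p Ω w) := by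
    calc _ ≤ 9 * m ^ 2 * (Cη * (4 ^ p * (S p Ω G0 + S p Ω G1 + S p Ω H + S p Ω w))) := by gcongr
      _ = _ := by ring
  have f4 : 9 * m ^ 2 * (η0 * (2 ^ q * ((∫ x in Ω, z x ^ q) + ∫ x in K, y x ^ q))) ≤ θ / 2 * N := by
    calc _ ≤ 9 * m ^ 2 * (η0 * (2 ^ q * (J * N + 2 * (J * N)))) := by gcongr
      _ = (9 * m ^ 2 * (η0 * (2 ^ q * (3 * J)))) * N := by ring
      _ = _ := by rw [e4]
  linarith
end

section
variable {Ω : Set V2} {φ : V2 → ℝ}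

set_option maxHeartbeats 1000000 in
theorem Dom.thmB (D : Dom Ω φ) {p : ℝ} (hp : 2 ≤ p) : ∃ C > 0, ∀ w G0 G1 H : V2 → ℝ, Sm w → Continuous G0 → Continuous G1 →
    Continuous H → (∀ x ∈ frontier Ω, w x = 0) → Weak Ω w G0 G1 H →
    S p Ω w + S p Ω (pd 0 w) + S p Ω (pd 1 w) ≤ C * (S p Ω G0 + S p Ω G1 + S p Ω H) := by
  obtain ⟨C1, hC1, lower⟩ := D.lower hp
  have h : PQ p (p / (p - 1)) := ⟨hp, div_mul_cancel₀ _ (by linarith)⟩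
  obtain ⟨C2, hC2, b1⟩ := D.B1 h (θ := 1 / 4) (by norm_num)
  generalize p / (p - 1) = q at h b1
  have hq := h.q1
  have hp0 : 0 ≤ p := by linarith
  have hq0 : 0 ≤ q := by linarith
  refine ⟨C1 + 2 * C2 * (1 + C1), by positivity, fun w G0 G1 H hw cG0 cG1 cH hw0 hW => ?_⟩
  have L := lower w G0 G1 H hw cG0 cG1 cH hw0 hW
  have a : ∀ i, Continuous (pd i w) := fun i => (hw.pd i).cont
  have φc := D.sm.cont
  set κ : ℕ → V2 → ℝ := fun n x => min 1 (n * max (-φ x) 0) with hκ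
  have κc : ∀ n, Continuous (κ n) := fun n => by simp only [hκ]; fun_prop
  have κ0 : ∀ n x, 0 ≤ κ n x := fun n x => by simp only [hκ]; positivity
  have κ1 : ∀ n x, κ n x ≤ 1 := fun n x => min_le_left _ _
  have κz : ∀ n x, 0 ≤ φ x → κ n x = 0 := fun n x hx => by
    simp only [hκ]; rw [max_eq_right (by linarith)]; simp
  have κe : ∀ x ∈ Ω, Tendsto (fun n => κ n x) atTop (𝓝 1) := by
    intro x hx
    have hx' := D.mem.1 hx
    obtain ⟨N, hN⟩ := exists_nat_gt (1 / (-φ x))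
    refine tendsto_const_nhds.congr' ?_
    filter_upwards [eventually_ge_atTop N] with n hn
    simp only [hκ]
    rw [max_eq_left (by linarith), min_eq_left]
    have h1 : (N : ℝ) ≤ n := by exact_mod_cast hn
    have h2 : 1 / (-φ x) ≤ n := by linarith
    rwa [div_le_iff₀ (by linarith)] at h2
  set hh : ℕ → Fin 2 → V2 → ℝ := fun n i x => κ n x * sp (p - 1) (pd i w x) with hhh
  have hhz : ∀ n i x, 0 ≤ φ x → hh n i x = 0 := fun n i x hx => by simp only [hhh]; rw [κz n x hx, zero_mul]
  have hCc : ∀ n i, Cc (hh n i) := by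
    intro n i
    refine ⟨(κc n).mul ((sp_cont (by linarith)).comp (a i)), ?_⟩
    refine HasCompactSupport.intro D.cpt fun x hx => hhz n i x ?_
    by_contra hn; push Not at hn
    exact hx (D.memc.2 hn.le)
  have hNi : ∀ n i, ∫ x, |hh n i x| ^ q ≤ S p Ω (pd i w) := by
    intro n i
    have iw := cont_int D.bd (rp_cont hp0 (a i))
    unfold S
    rw [← integral_indicator D.op.measurableSet]
    refine integral_mono_of_nonneg (ae_of_all _ fun x => by positivity) (iw.integrable_indicator D.op.measurableSet) (ae_of_all _ fun x => ?_)
    by_cases hx : x ∈ Ω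
    · rw [indicator_of_mem hx]
      simp only [hhh]
      rw [abs_mul, sp_abs (by linarith), abs_of_nonneg (κ0 n x), Real.mul_rpow (κ0 n x) (by positivity), ← Real.rpow_mul (abs_nonneg _),
        show (p - 1) * q = p by linarith [h.eq]]
      have : κ n x ^ q ≤ 1 := Real.rpow_le_one (κ0 n x) (κ1 n x) hq0
      exact mul_le_of_le_one_left (by positivity) this
    · rw [indicator_of_notMem hx]
      have : 0 ≤ φ x := by
        by_contra hn; push Not at hn; exact hx (D.mem.2 hn)
      simp only [hhz n i x this, abs_zero]
      rw [Real.zero_rpow (by linarith)]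
  set A := S p Ω (pd 0 w) + S p Ω (pd 1 w) with hA
  have step : ∀ n, ∫ x in Ω, κ n x * (|pd 0 w x| ^ p + |pd 1 w x| ^ p) ≤ 1 / 2 * A + C2 * (S p Ω G0 + S p Ω G1 + S p Ω H + S p Ω w) := by
    intro n
    have := b1 w G0 G1 H hw cG0 cG1 cH hw0 hW (hh n 0) (hh n 1) (hCc n 0) (hCc n 1) (hhz n 0) (hhz n 1)
    have e : ∀ x, pd 0 w x * hh n 0 x + pd 1 w x * hh n 1 x = κ n x * (|pd 0 w x| ^ p + |pd 1 w x| ^ p) := by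
      intro x
      have e0 := sp_mul (r := p - 1) (by linarith) (pd 0 w x)
      have e1 := sp_mul (r := p - 1) (by linarith) (pd 1 w x)
      rw [sub_add_cancel] at e0 e1
      rw [← e0, ← e1]
      simp only [hhh]; ring
    simp only [e] at this
    have n0 := hNi n 0
    have n1 := hNi n 1
    linarith
  have ii := (cont_int D.bd (rp_cont hp0 (a 0))).add (cont_int D.bd (rp_cont hp0 (a 1)))
  have lim : Tendsto (fun n => ∫ x in Ω, κ n x * (|pd 0 w x| ^ p + |pd 1 w x| ^ p)) atTop (𝓝 (∫ x in Ω, (|pd 0 w x| ^ p + |pd 1 w x| ^ p))) := by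
    refine tendsto_integral_of_dominated_convergence (fun x => |pd 0 w x| ^ p + |pd 1 w x| ^ p) (fun n => ?_) ii (fun n => ae_of_all _ fun x => ?_) ?_
    · exact ((κc n).mul ((rp_cont hp0 (a 0)).add (rp_cont hp0 (a 1)))).aestronglyMeasurable
    · have : 0 ≤ |pd 0 w x| ^ p + |pd 1 w x| ^ p := by positivity
      rw [Real.norm_eq_abs, abs_mul, abs_of_nonneg (κ0 n x), abs_of_nonneg this]
      exact mul_le_of_le_one_left this (κ1 n x)
    · filter_upwards [ae_restrict_mem D.op.measurableSet] with x hx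
      simpa using (κe x hx).mul_const (|pd 0 w x| ^ p + |pd 1 w x| ^ p)
  have fin := le_of_tendsto' lim step
  have eA : ∫ x in Ω, (|pd 0 w x| ^ p + |pd 1 w x| ^ p) = A :=
    integral_add (cont_int D.bd (rp_cont hp0 (a 0))) (cont_int D.bd (rp_cont hp0 (a 1)))
  rw [eA] at fin
  have : C2 * S p Ω w ≤ C2 * (C1 * (S p Ω G0 + S p Ω G1 + S p Ω H)) := by gcongr
  linarith
end

section
variable {Ω : Set V2} {φ : V2 → ℝ}

/-- uniform control of a family of functions in `L^p` -/
structure Bd (p : ℝ) (Ω : Set V2) {ι : Type} (N : ι → ℝ) (a : ι → V2 → ℝ) : Prop where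
  cont : ∀ i, Continuous (a i)
  bd : ∃ C ≥ 0, ∀ i, S p Ω (a i) ≤ C * N i

variable {ι : Type} {p : ℝ} {N : ι → ℝ} {a b : ι → V2 → ℝ}

lemma Bd.mono {N' : ι → ℝ} (h : Bd p Ω N a) (hN : ∀ i, N i ≤ N' i) : Bd p Ω N' a := by
  obtain ⟨C, hC, h1⟩ := h.bd
  exact ⟨h.cont, C, hC, fun i => (h1 i).trans (mul_le_mul_of_nonneg_left (hN i) hC)⟩

lemma Bd.congr (D : Dom Ω φ) (h : Bd p Ω N a) (hc : ∀ i, Continuous (b i)) (he : ∀ i, ∀ x ∈ Ω, b i x = a i x) : Bd p Ω N b := by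
  obtain ⟨C, hC, h1⟩ := h.bd
  refine ⟨hc, C, hC, fun i => le_trans (le_of_eq ?_) (h1 i)⟩
  exact setIntegral_congr_fun D.op.measurableSet fun x hx => by simp only [he i x hx]

lemma Bd.dom (D : Dom Ω φ) (hp : 0 ≤ p) (h : Bd p Ω N a) {m : ℝ} (hm : 0 ≤ m) (hc : ∀ i, Continuous (b i)) (he : ∀ i, ∀ x ∈ Ω, |b i x| ≤ m * |a i x|) : Bd p Ω N b := by
  obtain ⟨C, hC, h1⟩ := h.bd
  refine ⟨hc, m ^ p * C, by positivity, fun i => ?_⟩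
  have ia := cont_int D.bd (rp_cont hp (h.cont i))
  have ib := cont_int D.bd (rp_cont hp (hc i))
  have : S p Ω (b i) ≤ m ^ p * S p Ω (a i) := by
    unfold S
    rw [← integral_const_mul]
    refine setIntegral_mono_on ib (ia.const_mul _) D.op.measurableSet fun x hx => ?_
    rw [← Real.mul_rpow hm (abs_nonneg _)]
    exact Real.rpow_le_rpow (abs_nonneg _) (he i x hx) hp
  refine this.trans ?_
  rw [mul_assoc]
  exact mul_le_mul_of_nonneg_left (h1 i) (by positivity)

lemma Bd.mul (D : Dom Ω φ) (hp : 0 ≤ p) {g : V2 → ℝ} (hg : Continuous g) (h : Bd p Ω N a) : Bd p Ω N (fun i x => g x * a i x) := by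
  obtain ⟨m, hm⟩ := D.bdd hg
  refine h.dom D hp (m := |m|) (abs_nonneg _) (fun i => hg.mul (h.cont i)) fun i x hx => ?_
  rw [abs_mul]
  exact mul_le_mul_of_nonneg_right ((hm x hx).trans (le_abs_self _)) (abs_nonneg _)

lemma Bd.add (D : Dom Ω φ) (hp : 0 ≤ p) (h : Bd p Ω N a) (h' : Bd p Ω N b) : Bd p Ω N (fun i x => a i x + b i x) := by
  obtain ⟨C, hC, h1⟩ := h.bd
  obtain ⟨C', hC', h1'⟩ := h'.bd
  refine ⟨fun i => (h.cont i).add (h'.cont i), 2 ^ p * (C + C'), by positivity, fun i => ?_⟩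
  have ia := cont_int D.bd (rp_cont hp (h.cont i))
  have ib := cont_int D.bd (rp_cont hp (h'.cont i))
  have : S p Ω (fun x => a i x + b i x) ≤ 2 ^ p * (S p Ω (a i) + S p Ω (b i)) := by
    have e := integral_add ia ib
    unfold S
    rw [← e, ← integral_const_mul]
    refine setIntegral_mono_on (cont_int D.bd (rp_cont hp ((h.cont i).add (h'.cont i)))) ((ia.add ib).const_mul _) D.op.measurableSet fun x hx => ?_
    exact rp_add hp _ _
  refine this.trans ?_
  rw [mul_assoc]
  refine mul_le_mul_of_nonneg_left ?_ (by positivity)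
  linarith [h1 i, h1' i]

lemma Bd.neg (h : Bd p Ω N a) : Bd p Ω N (fun i x => -a i x) := by
  obtain ⟨C, hC, h1⟩ := h.bd
  refine ⟨fun i => (h.cont i).neg, C, hC, fun i => ?_⟩
  simpa [S] using h1 i

lemma Bd.sub (D : Dom Ω φ) (hp : 0 ≤ p) (h : Bd p Ω N a) (h' : Bd p Ω N b) : Bd p Ω N (fun i x => a i x - b i x) := by
  simpa only [sub_eq_add_neg] using h.add D hp h'.neg

lemma Bd.zero (hN : ∀ i, 0 ≤ N i) (hp : 0 < p) : Bd p Ω N (fun i x => 0) :=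
  ⟨fun i => continuous_const, 0, le_rfl, fun i => by simp [S, Real.zero_rpow hp.ne']⟩

/-- division by a positive weight -/
lemma Bd.of_den (D : Dom Ω φ) (hp : 0 ≤ p) (h : Bd p Ω N a) {d : V2 → ℝ} {c : ℝ} (hc : 0 < c) (hd : ∀ x ∈ Ω, c ≤ d x)
    (hb : ∀ i, Continuous (b i)) (he : ∀ i, ∀ x ∈ Ω, d x * b i x = a i x) : Bd p Ω N b := by
  refine h.dom D hp (m := 1 / c) (by positivity) hb fun i x hx => ?_
  rw [← he i x hx, abs_mul, abs_of_pos (hc.trans_le (hd x hx))]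
  have := mul_le_mul_of_nonneg_right (hd x hx) (abs_nonneg (b i x))
  rw [one_div, ← div_eq_inv_mul, le_div_iff₀ hc]
  linarith

/-- the Laplacian -/
def L (f : V2 → ℝ) (x : V2) : ℝ := pd 0 (pd 0 f) x + pd 1 (pd 1 f) x

lemma Sm.L {f : V2 → ℝ} (h : Sm f) : Sm (L f) := ((h.pd 0).pd 0).add ((h.pd 1).pd 1)

lemma Dom.strong (D : Dom Ω φ) {w G0 G1 H : V2 → ℝ} (hw : Sm w) (h0 : Sm G0) (h1 : Sm G1) (hH : Continuous H)
    (he : ∀ x ∈ Ω, L w x = pd 0 G0 x + pd 1 G1 x - H x) : Weak Ω w G0 G1 H := by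
  intro ξ hξ hb
  have r0 : ContDiff ℝ 1 (fun x => pd 0 w x - G0 x) := ((hw.pd 0).sub h0).one
  have r1 : ContDiff ℝ 1 (fun x => pd 1 w x - G1 x) := ((hw.pd 1).sub h1).one
  have i0 := ibp D.op D.cv D.bd (hξ.mul r0) (fun x hx => by rw [hb x hx, zero_mul]) 0
  have i1 := ibp D.op D.cv D.bd (hξ.mul r1) (fun x hx => by rw [hb x hx, zero_mul]) 1
  have a0 := (hw.pd 0).cont
  have a1 := (hw.pd 1).cont
  have b0 := h0.cont
  have b1 := h1.cont
  have c0 := C1.pd_cont hξ 0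
  have c1 := C1.pd_cont hξ 1
  have c2 := hξ.continuous
  have j0 : IntegrableOn (fun x => pd 0 (fun x => ξ x * (pd 0 w x - G0 x)) x) Ω := cont_int D.bd (C1.pd_cont (hξ.mul r0) 0)
  have j1 : IntegrableOn (fun x => pd 1 (fun x => ξ x * (pd 1 w x - G1 x)) x) Ω := cont_int D.bd (C1.pd_cont (hξ.mul r1) 1)
  have k0 : IntegrableOn (fun x => pd 0 w x * pd 0 ξ x + pd 1 w x * pd 1 ξ x) Ω := cont_int D.bd (by fun_prop)
  have k1 : IntegrableOn (fun x => G0 x * pd 0 ξ x + G1 x * pd 1 ξ x + H x * ξ x) Ω := cont_int D.bd (by fun_prop)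
  rw [← sub_eq_zero, ← integral_sub k0 k1]
  have s := integral_add j0 j1
  rw [i0, i1, add_zero] at s
  rw [← s]
  refine setIntegral_congr_fun D.op.measurableSet fun x hx => ?_
  have e := he x hx
  unfold L at e
  rw [pd_mul _ (C1.diff hξ x) (C1.diff r0 x), pd_mul _ (C1.diff hξ x) (C1.diff r1 x), pd_sub _ ((hw.pd 0).diff x) (h0.diff x), pd_sub _ ((hw.pd 1).diff x) (h1.diff x)]
  have : H x = pd 0 G0 x + pd 1 G1 x - (pd 0 (pd 0 w) x + pd 1 (pd 1 w) x) := by linarith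
  rw [this]; ring

lemma Dom.bdB (D : Dom Ω φ) (hp : 2 ≤ p) {w G0 G1 H : ι → V2 → ℝ} (hw : ∀ i, Sm (w i)) (h0 : ∀ i, Sm (G0 i)) (h1 : ∀ i, Sm (G1 i))
    (hw0 : ∀ i, ∀ x ∈ frontier Ω, w i x = 0) (B0 : Bd p Ω N G0) (B1 : Bd p Ω N G1) (B2 : Bd p Ω N H)
    (he : ∀ i, ∀ x ∈ Ω, L (w i) x = pd 0 (G0 i) x + pd 1 (G1 i) x - H i x) :
    Bd p Ω N w ∧ ∀ j, Bd p Ω N (fun i => pd j (w i)) := by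
  obtain ⟨C, hC, hB⟩ := D.thmB hp
  obtain ⟨C0, hC0, b0⟩ := B0.bd
  obtain ⟨C1, hC1, b1⟩ := B1.bd
  obtain ⟨C2, hC2, b2⟩ := B2.bd
  have key : ∀ i, S p Ω (w i) + S p Ω (pd 0 (w i)) + S p Ω (pd 1 (w i)) ≤ C * (C0 + C1 + C2) * N i := by
    intro i
    refine (hB (w i) (G0 i) (G1 i) (H i) (hw i) (B0.cont i) (B1.cont i) (B2.cont i) (hw0 i) (D.strong (hw i) (h0 i) (h1 i) (B2.cont i) (he i))).trans ?_
    rw [mul_assoc]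
    refine mul_le_mul_of_nonneg_left ?_ hC.le
    linarith [b0 i, b1 i, b2 i]
  have n := fun i => S_nonneg p Ω (w i)
  have n0 := fun i => S_nonneg p Ω (pd 0 (w i))
  have n1 := fun i => S_nonneg p Ω (pd 1 (w i))
  refine ⟨⟨fun i => (hw i).cont, _, by positivity, fun i => le_trans ?_ (key i)⟩, fun j => ⟨fun i => ((hw i).pd j).cont, _, by positivity, fun i => le_trans ?_ (key i)⟩⟩
  · linarith [n i, n0 i, n1 i]
  · have := n i; have := n0 i; have := n1 i
    fin_cases j <;> simp only [Fin.zero_eta, Fin.mk_one] <;> linarith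
end

section
variable {Ω : Set V2} {φ : V2 → ℝ}

lemma pd_affine {a : V2 → ℝ} (ha : Sm a) (x0 : V2) (t : ℝ) (i : Fin 2) (x : V2) :
    pd i (fun x => a (x0 + t • (x - x0))) x = t * pd i a (x0 + t • (x - x0)) := by
  have h1 : HasFDerivAt (fun x : V2 => x0 + t • (x - x0)) (t • ContinuousLinearMap.id ℝ V2) x :=
    (((hasFDerivAt_id x).sub_const x0).const_smul t).const_add x0
  have h2 := HasFDerivAt.comp (g := a) x (ha.diff (x0 + t • (x - x0))).hasFDerivAt h1
  unfold pd
  have h3 : fderiv ℝ (fun x => a (x0 + t • (x - x0))) x = _ := h2.fderiv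
  rw [h3]; simp

lemma sm_affine {a : V2 → ℝ} (ha : Sm a) (x0 : V2) (t : ℝ) : Sm (fun x => a (x0 + t • (x - x0))) := by
  have : ContDiff ℝ (⊤ : ℕ∞) (fun x : V2 => x0 + t • (x - x0)) := by fun_prop
  exact ContDiff.comp (g := a) ha this

lemma poincare (ho : IsOpen Ω) (hc : Convex ℝ Ω) {x0 : V2} (hx0 : x0 ∈ Ω) {a b : V2 → ℝ} (ha : Sm a) (hb : Sm b)
    (hab : ∀ x ∈ Ω, pd 1 a x = pd 0 b x) : ∃ ψ, Sm ψ ∧ ∀ x ∈ Ω, pd 0 ψ x = a x ∧ pd 1 ψ x = b x := by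
  set k : V2 × ℝ → ℝ := fun z => a (x0 + z.2 • (z.1 - x0)) * (z.1 0 - x0 0) + b (x0 + z.2 • (z.1 - x0)) * (z.1 1 - x0 1) with hk
  have kc : ContDiff ℝ (⊤ : ℕ∞) k := by
    have l : ContDiff ℝ (⊤ : ℕ∞) (fun z : V2 × ℝ => x0 + z.2 • (z.1 - x0)) := by fun_prop
    have l1 : ContDiff ℝ (⊤ : ℕ∞) (fun z : V2 × ℝ => a (x0 + z.2 • (z.1 - x0))) := ContDiff.comp (g := a) ha l
    have l2 : ContDiff ℝ (⊤ : ℕ∞) (fun z : V2 × ℝ => b (x0 + z.2 • (z.1 - x0))) := ContDiff.comp (g := b) hb l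
    have l3 : ∀ i, ContDiff ℝ (⊤ : ℕ∞) (fun z : V2 × ℝ => z.1 i - x0 i) := by intro i; fun_prop
    exact (l1.mul (l3 0)).add (l2.mul (l3 1))
  have smt := param_contDiffOn (volume : Measure ℝ) (U := (univ : Set V2)) (W := univ) isOpen_univ isOpen_univ (isCompact_Icc (a := (0:ℝ)) (b := 1))
    (subset_univ _) (f := fun _ => 1) continuous_const (k := k) kc.contDiffOn
  rw [contDiffOn_univ] at smt
  refine ⟨_, smt, fun x hx => ?_⟩
  have slice : ∀ (i : Fin 2) (t : ℝ), fderiv ℝ k (x, t) (Pi.single i 1, 0) = pd i (fun x => k (x, t)) x := by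
    intro i t
    have h1 : HasFDerivAt (fun x : V2 => (x, t)) (ContinuousLinearMap.inl ℝ V2 ℝ) x := hasFDerivAt_prodMk_left x t
    have h2 := HasFDerivAt.comp (g := k) x ((kc.differentiable (by simp)) (x, t)).hasFDerivAt h1
    unfold pd
    have h3 : fderiv ℝ (fun x => k (x, t)) x = _ := h2.fderiv
    rw [h3]; simp
  have hin : ∀ t ∈ Icc (0:ℝ) 1, x0 + t • (x - x0) ∈ Ω := fun t ht => hc.add_smul_sub_mem hx0 hx ht
  have coord : ∀ i j : Fin 2, pd i (fun x : V2 => x j - x0 j) x = if i = j then 1 else 0 := by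
    intro i j
    rw [pd_sub _ ((sm_coord j).diff x) (by fun_prop), pd_coord, pd_const, sub_zero]
  have smc : ∀ j : Fin 2, Sm (fun x : V2 => x j - x0 j) := fun j => (sm_coord j).sub (Sm.con _)
  have pdk : ∀ (i : Fin 2) (t : ℝ), pd i (fun x => k (x, t)) x = t * pd i a (x0 + t • (x - x0)) * (x 0 - x0 0) + t * pd i b (x0 + t • (x - x0)) * (x 1 - x0 1)
      + (a (x0 + t • (x - x0)) * (if i = 0 then 1 else 0) + b (x0 + t • (x - x0)) * (if i = 1 then 1 else 0)) := by
    intro i t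
    simp only [hk]
    rw [((sm_affine ha x0 t).mul (smc 0)).pdadd ((sm_affine hb x0 t).mul (smc 1)), (sm_affine ha x0 t).pdmul (smc 0), (sm_affine hb x0 t).pdmul (smc 1),
      pd_affine ha, pd_affine hb, coord, coord]
    ring
  have dline : ∀ {c : V2 → ℝ}, Sm c → ∀ t : ℝ, HasDerivAt (fun t => c (x0 + t • (x - x0))) ((x 0 - x0 0) * pd 0 c (x0 + t • (x - x0)) + (x 1 - x0 1) * pd 1 c (x0 + t • (x - x0))) t := by
    intro c hcs t
    have h1 : HasDerivAt (fun t : ℝ => x0 + t • (x - x0)) (x - x0) t := by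
      simpa using ((hasDerivAt_id t).smul_const (x - x0)).const_add x0
    have := HasFDerivAt.comp_hasDerivAt (l := c) t (hcs.diff (x0 + t • (x - x0))).hasFDerivAt h1
    rw [fderiv_apply_eq] at this
    exact this
  have ftc : ∀ {c : V2 → ℝ}, Sm c → ∫ t in Icc (0:ℝ) 1, (c (x0 + t • (x - x0)) + t * ((x 0 - x0 0) * pd 0 c (x0 + t • (x - x0)) + (x 1 - x0 1) * pd 1 c (x0 + t • (x - x0)))) = c x := by
    intro c hcs
    rw [integral_Icc_eq_integral_Ioc, ← intervalIntegral.integral_of_le zero_le_one]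
    have d : ∀ t ∈ uIcc (0:ℝ) 1, HasDerivAt (fun t => t * c (x0 + t • (x - x0))) (c (x0 + t • (x - x0)) + t * ((x 0 - x0 0) * pd 0 c (x0 + t • (x - x0)) + (x 1 - x0 1) * pd 1 c (x0 + t • (x - x0)))) t := by
      intro t _
      have := (hasDerivAt_id t).mul (dline hcs t)
      simp only [id, one_mul] at this
      exact this
    rw [intervalIntegral.integral_eq_sub_of_hasDerivAt d]
    · simp
    · have c0 := hcs.cont
      have c1 := (hcs.pd 0).cont
      have c2 := (hcs.pd 1).cont
      refine Continuous.intervalIntegrable ?_ _ _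
      have : Continuous (fun t : ℝ => x0 + t • (x - x0)) := by fun_prop
      have e1 := c0.comp this
      have e2 := c1.comp this
      have e3 := c2.comp this
      simp only [Function.comp_def] at e1 e2 e3
      fun_prop
  constructor
  · have := param_lineDeriv (volume : Measure ℝ) (U := (univ : Set V2)) (W := univ) isOpen_univ isOpen_univ (isCompact_Icc (a := (0:ℝ)) (b := 1))
      (subset_univ _) (f := fun _ => 1) continuous_const (k := k) kc.contDiffOn (mem_univ x) (Pi.single 0 1)
      (k' := fun t => (a (x0 + t • (x - x0)) + t * ((x 0 - x0 0) * pd 0 a (x0 + t • (x - x0)) + (x 1 - x0 1) * pd 1 a (x0 + t • (x - x0))))) (fun t ht => by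
        rw [slice, pdk, ← hab _ (hin t ht)]; simp; ring)
    refine this.trans ?_
    simp only [one_smul]
    exact ftc ha
  · have := param_lineDeriv (volume : Measure ℝ) (U := (univ : Set V2)) (W := univ) isOpen_univ isOpen_univ (isCompact_Icc (a := (0:ℝ)) (b := 1))
      (subset_univ _) (f := fun _ => 1) continuous_const (k := k) kc.contDiffOn (mem_univ x) (Pi.single 1 1)
      (k' := fun t => (b (x0 + t • (x - x0)) + t * ((x 0 - x0 0) * pd 0 b (x0 + t • (x - x0)) + (x 1 - x0 1) * pd 1 b (x0 + t • (x - x0))))) (fun t ht => by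
        rw [slice, pdk, hab _ (hin t ht)]; simp; ring)
    refine this.trans ?_
    simp only [one_smul]
    exact ftc hb
end

section
variable {Ω : Set V2} {φ : V2 → ℝ}

lemma fderiv_zero_of_pd {h : V2 → ℝ} {x : V2} (h0 : pd 0 h x = 0) (h1 : pd 1 h x = 0) : fderiv ℝ h x = 0 := by
  ext v
  rw [fderiv_apply_eq, h0, h1]; simp

lemma retract_deriv {ψ : V2 → ℝ} (hφ : Sm φ) (hψ : Sm ψ) {P : V2 → V2} {x : V2}
    (hO : (fun y => P y - P x) =O[𝓝 x] fun y => y - x) (h0 : ∀ᶠ y in 𝓝 x, φ (P y) = 0)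
    (hg : 0 < (pd 0 φ (P x)) ^ 2 + (pd 1 φ (P x)) ^ 2)
    (ht : pd 0 ψ (P x) * pd 1 φ (P x) = pd 1 ψ (P x) * pd 0 φ (P x)) : HasFDerivAt (fun y => ψ (P y)) (0 : V2 →L[ℝ] ℝ) x := by
  obtain ⟨l, hl⟩ : ∃ l, l * ((pd 0 φ (P x)) ^ 2 + (pd 1 φ (P x)) ^ 2) = pd 0 ψ (P x) * pd 0 φ (P x) + pd 1 ψ (P x) * pd 1 φ (P x) :=
    ⟨_, div_mul_cancel₀ _ hg.ne'⟩
  have sm : Sm (fun y => ψ y - l * φ y) := hψ.sub ((Sm.con l).mul hφ)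
  have e : ∀ i, pd i (fun y => ψ y - l * φ y) (P x) = pd i ψ (P x) - l * pd i φ (P x) := by
    intro i
    rw [hψ.pdsub ((Sm.con l).mul hφ), pd_const_mul _ _ (hφ.diff _)]
  have z : fderiv ℝ (fun y => ψ y - l * φ y) (P x) = 0 := by
    apply fderiv_zero_of_pd
    · rw [e]
      have : (pd 0 ψ (P x) - l * pd 0 φ (P x)) * ((pd 0 φ (P x)) ^ 2 + (pd 1 φ (P x)) ^ 2) = 0 := by
        linear_combination (-pd 0 φ (P x)) * hl + pd 1 φ (P x) * ht
      exact (mul_eq_zero.1 this).resolve_right hg.ne'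
    · rw [e]
      have : (pd 1 ψ (P x) - l * pd 1 φ (P x)) * ((pd 0 φ (P x)) ^ 2 + (pd 1 φ (P x)) ^ 2) = 0 := by
        linear_combination (-pd 1 φ (P x)) * hl - pd 0 φ (P x) * ht
      exact (mul_eq_zero.1 this).resolve_right hg.ne'
  have d := (sm.diff (P x)).hasFDerivAt
  rw [z, hasFDerivAt_iff_isLittleO] at d
  have tP : Tendsto P (𝓝 x) (𝓝 (P x)) := by
    rw [← tendsto_sub_nhds_zero_iff]
    refine hO.trans_tendsto ?_
    rw [tendsto_sub_nhds_zero_iff]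
    exact tendsto_id
  have d2 := (d.comp_tendsto tP).trans_isBigO hO
  rw [hasFDerivAt_iff_isLittleO]
  refine d2.congr' ?_ EventuallyEq.rfl
  filter_upwards [h0] with y hy
  have := h0.self_of_nhds
  simp [hy, this]

lemma Dom.const_fr (D : Dom Ω φ) {ψ : V2 → ℝ} (hψ : Sm ψ) (ht : ∀ x ∈ frontier Ω, pd 0 ψ x * pd 1 φ x = pd 1 ψ x * pd 0 φ x) :
    ∃ c, ∀ x ∈ frontier Ω, ψ x = c := by
  obtain ⟨x0, hx0⟩ := D.ne
  let e : V2 ≃ₜ V2 := Homeomorph.addLeft x0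
  set s : Set V2 := e ⁻¹' Ω with hs
  have he : ∀ v, e v = x0 + v := fun v => rfl
  have so : IsOpen s := D.op.preimage e.continuous
  have s0 : (0:V2) ∈ s := by simp [hs, he, hx0]
  have sn : s ∈ 𝓝 (0:V2) := so.mem_nhds s0
  have sc : Convex ℝ s := by
    have := D.cv.translate_preimage_right x0
    exact this
  have sb : IsBounded s := by
    have : s = (fun v => -x0 + v) '' Ω := by
      ext v; simp [hs, he]
    rw [this]
    exact (isometry_add_left (-x0)).lipschitz.isBounded_image D.bd
  have sf : frontier s = e ⁻¹' frontier Ω := (e.preimage_frontier Ω).symm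
  obtain ⟨K, hK⟩ := sc.lipschitz_gauge sn
  have ab := absorbent_nhds_zero (𝕜 := ℝ) sn
  have gp : ∀ v : V2, v ≠ 0 → 0 < gauge s v := fun v hv =>
    (gauge_pos ab ((NormedSpace.isVonNBounded_iff ℝ).2 sb)).2 hv
  let P : V2 → V2 := fun v => x0 + (gauge s v)⁻¹ • v
  have Pf : ∀ v, v ≠ 0 → P v ∈ frontier Ω := by
    intro v hv
    have : (gauge s v)⁻¹ • v ∈ frontier s := by
      rw [← gauge_eq_one_iff_mem_frontier sc sn, gauge_smul_of_nonneg (inv_nonneg.2 (gp v hv).le), smul_eq_mul, inv_mul_cancel₀ (gp v hv).ne']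
    rw [sf] at this
    exact this
  have PO : ∀ x, x ≠ 0 → (fun y => P y - P x) =O[𝓝 x] fun y => y - x := by
    intro x hx
    have gx := gp x hx
    have ev : ∀ᶠ y in 𝓝 x, gauge s x / 2 < gauge s y := hK.continuous.continuousAt.eventually (lt_mem_nhds (by linarith))
    refine Asymptotics.IsBigO.of_bound (2 / gauge s x + (K : ℝ) * (2 / gauge s x) * (gauge s x)⁻¹ * ‖x‖) ?_
    filter_upwards [ev] with y hy
    have gy : 0 < gauge s y := by linarith
    have iy : (gauge s y)⁻¹ ≤ 2 / gauge s x := by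
      rw [inv_le_comm₀ gy (by positivity)]
      simpa using hy.le
    have l := hK.dist_le_mul x y
    rw [Real.dist_eq, dist_comm, dist_eq_norm] at l
    have eq : P y - P x = (gauge s y)⁻¹ • (y - x) + ((gauge s x - gauge s y) * (gauge s y)⁻¹ * (gauge s x)⁻¹) • x := by
      have : (gauge s x - gauge s y) * (gauge s y)⁻¹ * (gauge s x)⁻¹ = (gauge s y)⁻¹ - (gauge s x)⁻¹ := by
        field_simp
      rw [this]
      simp only [P, smul_sub, sub_smul]
      abel
    rw [eq]
    refine (norm_add_le _ _).trans ?_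
    rw [norm_smul, norm_smul, norm_mul, norm_mul, Real.norm_eq_abs, Real.norm_eq_abs, Real.norm_eq_abs, abs_of_pos (inv_pos.2 gy), abs_of_pos (inv_pos.2 gx), add_mul]
    refine add_le_add (mul_le_mul_of_nonneg_right iy (norm_nonneg _)) ?_
    calc |gauge s x - gauge s y| * (gauge s y)⁻¹ * (gauge s x)⁻¹ * ‖x‖ ≤ ((K:ℝ) * ‖y - x‖) * (2 / gauge s x) * (gauge s x)⁻¹ * ‖x‖ := by
          gcongr
      _ = _ := by ring
  have hd : ∀ x ∈ ({0}ᶜ : Set V2), HasFDerivAt (fun y => ψ (P y)) (0 : V2 →L[ℝ] ℝ) x := by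
    intro x hx
    have hx : x ≠ 0 := hx
    have z : ∀ y, y ≠ 0 → φ (P y) = 0 := fun y hy => by
      have := Pf y hy
      rw [D.fr] at this
      exact this
    refine retract_deriv D.sm hψ (PO x hx) ?_ (D.gr _ (z x hx)) (ht _ (Pf x hx))
    filter_upwards [isOpen_compl_singleton.mem_nhds hx] with y hy
    exact z y hy
  have pc : IsPreconnected ({0}ᶜ : Set V2) := (isConnected_compl_singleton_of_one_lt_rank (by simp) 0).isPreconnected
  obtain ⟨c, hc⟩ := (isOpen_compl_singleton (x := (0:V2))).exists_is_const_of_fderiv_eq_zero pc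
    (fun x hx => (hd x hx).differentiableAt.differentiableWithinAt) (fun x hx => (hd x hx).fderiv)
  refine ⟨c, fun x hx => ?_⟩
  have hv : x - x0 ∈ frontier s := by rw [sf]; simpa [he] using hx
  have g1 := (gauge_eq_one_iff_mem_frontier sc sn).2 hv
  have nz : x - x0 ≠ 0 := by
    intro h
    rw [h, gauge_zero] at g1
    norm_num at g1
  have := hc (x - x0) nz
  simpa [P, g1] using this
end

section
variable {Ω : Set V2} {φ : V2 → ℝ} {ι : Type} {p : ℝ} {N : ι → ℝ}

lemma L_add {f g : V2 → ℝ} (hf : Sm f) (hg : Sm g) (x : V2) : L (fun y => f y + g y) x = L f x + L g x := by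
  have e : ∀ i, pd i (fun y => f y + g y) = fun y => pd i f y + pd i g y := fun i => funext fun y => hf.pdadd hg i y
  unfold L
  rw [e, e, (hf.pd 0).pdadd (hg.pd 0), (hf.pd 1).pdadd (hg.pd 1)]; ring

lemma L_mul {f g : V2 → ℝ} (hf : Sm f) (hg : Sm g) (x : V2) :
    L (fun y => f y * g y) x = f x * L g x + 2 * (pd 0 f x * pd 0 g x + pd 1 f x * pd 1 g x) + g x * L f x := by
  have e : ∀ i, pd i (fun y => f y * g y) = fun y => pd i f y * g y + f y * pd i g y := fun i => funext fun y => hf.pdmul hg i y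
  unfold L
  rw [e, e, ((hf.pd 0).mul hg).pdadd (hf.mul (hg.pd 0)), ((hf.pd 1).mul hg).pdadd (hf.mul (hg.pd 1)),
    (hf.pd 0).pdmul hg, (hf.pd 1).pdmul hg, hf.pdmul (hg.pd 0), hf.pdmul (hg.pd 1)]; ring

set_option maxHeartbeats 1000000 in
/-- Dirichlet estimate for combinations with fixed smooth coefficients -/
lemma Dom.comb (D : Dom Ω φ) (hp : 2 ≤ p) {c0 c1 : V2 → ℝ} (hc0 : Sm c0) (hc1 : Sm c1)
    {y0 y1 q00 q01 q10 q11 : ι → V2 → ℝ} (sy0 : ∀ i, Sm (y0 i)) (sy1 : ∀ i, Sm (y1 i))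
    (s00 : ∀ i, Sm (q00 i)) (s01 : ∀ i, Sm (q01 i)) (s10 : ∀ i, Sm (q10 i)) (s11 : ∀ i, Sm (q11 i))
    (by0 : Bd p Ω N y0) (by1 : Bd p Ω N y1) (b00 : Bd p Ω N q00) (b01 : Bd p Ω N q01) (b10 : Bd p Ω N q10) (b11 : Bd p Ω N q11)
    (e0 : ∀ i, ∀ x ∈ Ω, L (y0 i) x = pd 0 (q00 i) x + pd 1 (q01 i) x)
    (e1 : ∀ i, ∀ x ∈ Ω, L (y1 i) x = pd 0 (q10 i) x + pd 1 (q11 i) x)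
    (hfr : ∀ i, ∀ x ∈ frontier Ω, c0 x * y0 i x + c1 x * y1 i x = 0) :
    Bd p Ω N (fun i x => c0 x * y0 i x + c1 x * y1 i x) ∧ ∀ j, Bd p Ω N (fun i => pd j (fun x => c0 x * y0 i x + c1 x * y1 i x)) := by
  have hp0 : 0 ≤ p := by linarith
  have k2 : Sm (fun _ : V2 => (2:ℝ)) := Sm.con 2
  have m0 : ∀ j, Sm (fun x => 2 * pd j c0 x) := fun j => k2.mul (hc0.pd j)
  have m1 : ∀ j, Sm (fun x => 2 * pd j c1 x) := fun j => k2.mul (hc1.pd j)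
  have sG : ∀ (j : Fin 2) {q r : ι → V2 → ℝ}, (∀ i, Sm (q i)) → (∀ i, Sm (r i)) → ∀ i, Sm (fun x => (2 * pd j c0 x) * y0 i x + (2 * pd j c1 x) * y1 i x + c0 x * q i x + c1 x * r i x) := by
    intro j q r hq hr i
    exact ((((m0 j).mul (sy0 i)).add ((m1 j).mul (sy1 i))).add (hc0.mul (hq i))).add (hc1.mul (hr i))
  have bG : ∀ (j : Fin 2) {q r : ι → V2 → ℝ}, Bd p Ω N q → Bd p Ω N r → Bd p Ω N (fun i x => (2 * pd j c0 x) * y0 i x + (2 * pd j c1 x) * y1 i x + c0 x * q i x + c1 x * r i x) := by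
    intro j q r hq hr
    exact (((by0.mul D hp0 (m0 j).cont).add D hp0 (by1.mul D hp0 (m1 j).cont)).add D hp0 (hq.mul D hp0 hc0.cont)).add D hp0 (hr.mul D hp0 hc1.cont)
  have pG : ∀ (j : Fin 2) {q r : ι → V2 → ℝ}, (∀ i, Sm (q i)) → (∀ i, Sm (r i)) → ∀ i x, pd j (fun x => (2 * pd j c0 x) * y0 i x + (2 * pd j c1 x) * y1 i x + c0 x * q i x + c1 x * r i x) x
      = 2 * pd j (pd j c0) x * y0 i x + 2 * pd j c0 x * pd j (y0 i) x + (2 * pd j (pd j c1) x * y1 i x + 2 * pd j c1 x * pd j (y1 i) x)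
        + (pd j c0 x * q i x + c0 x * pd j (q i) x) + (pd j c1 x * r i x + c1 x * pd j (r i) x) := by
    intro j q r hq hr i x
    rw [((((m0 j).mul (sy0 i)).add ((m1 j).mul (sy1 i))).add (hc0.mul (hq i))).pdadd (hc1.mul (hr i)),
      (((m0 j).mul (sy0 i)).add ((m1 j).mul (sy1 i))).pdadd (hc0.mul (hq i)), ((m0 j).mul (sy0 i)).pdadd ((m1 j).mul (sy1 i)),
      (m0 j).pdmul (sy0 i), (m1 j).pdmul (sy1 i), hc0.pdmul (hq i), hc1.pdmul (hr i), pd_const_mul j 2 ((hc0.pd j).diff x), pd_const_mul j 2 ((hc1.pd j).diff x)]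
  have BH : Bd p Ω N (fun i x => L c0 x * y0 i x + L c1 x * y1 i x + pd 0 c0 x * q00 i x + pd 1 c0 x * q01 i x + pd 0 c1 x * q10 i x + pd 1 c1 x * q11 i x) :=
    (((((by0.mul D hp0 hc0.L.cont).add D hp0 (by1.mul D hp0 hc1.L.cont)).add D hp0 (b00.mul D hp0 (hc0.pd 0).cont)).add D hp0 (b01.mul D hp0 (hc0.pd 1).cont)).add D hp0
      (b10.mul D hp0 (hc1.pd 0).cont)).add D hp0 (b11.mul D hp0 (hc1.pd 1).cont)
  refine D.bdB hp (fun i => (hc0.mul (sy0 i)).add (hc1.mul (sy1 i))) (sG 0 s00 s10) (sG 1 s01 s11) hfr (bG 0 b00 b10) (bG 1 b01 b11) BH ?_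
  intro i x hx
  rw [pG 0 s00 s10, pG 1 s01 s11, L_add (hc0.mul (sy0 i)) (hc1.mul (sy1 i)), L_mul hc0 (sy0 i), L_mul hc1 (sy1 i), e0 i x hx, e1 i x hx]
  unfold L
  ring

/-- interior estimate with the weight `φ` -/
lemma Dom.loc (D : Dom Ω φ) (hp : 2 ≤ p) (hN : ∀ i, 0 ≤ N i) {y q0 q1 : ι → V2 → ℝ} (sy : ∀ i, Sm (y i)) (s0 : ∀ i, Sm (q0 i)) (s1 : ∀ i, Sm (q1 i))
    (hy : Bd p Ω N y) (b0 : Bd p Ω N q0) (b1 : Bd p Ω N q1) (e : ∀ i, ∀ x ∈ Ω, L (y i) x = pd 0 (q0 i) x + pd 1 (q1 i) x) (j : Fin 2) :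
    Bd p Ω N (fun i x => φ x * pd j (y i) x) := by
  have hp0 : 0 ≤ p := by linarith
  have h := (D.comb hp D.sm (Sm.con 0) sy sy s0 s1 s0 s1 hy hy b0 b1 b0 b1 e e (fun i x hx => by
    rw [D.fr] at hx
    have : φ x = 0 := hx
    rw [this]; ring)).2 j
  refine (h.sub D hp0 (hy.mul D hp0 (D.sm.pd j).cont)).congr D (fun i => D.sm.cont.mul ((sy i).pd j).cont) fun i x hx => ?_
  rw [(D.sm.mul (sy i)).pdadd ((Sm.con 0).mul (sy i)), D.sm.pdmul (sy i), pd_const_mul _ _ ((sy i).diff x)]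
  ring

/-- smooth pairs with vanishing divergence in `Ω` and prescribed curl -/
structure Pair (Ω : Set V2) (Y0 Y1 g : V2 → ℝ) : Prop where
  s0 : Sm Y0
  s1 : Sm Y1
  sg : Sm g
  dv : ∀ x ∈ Ω, pd 0 Y0 x + pd 1 Y1 x = 0
  cu : ∀ x ∈ Ω, pd 0 Y1 x - pd 1 Y0 x = g x

variable {Y0 Y1 g : V2 → ℝ}

lemma Pair.l0 (D : Dom Ω φ) (P : Pair Ω Y0 Y1 g) {x : V2} (hx : x ∈ Ω) : L Y0 x = - pd 1 g x := by
  have h1 := pd_congr_on D.op hx 0 P.dv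
  have h2 := pd_congr_on D.op hx 1 P.cu
  rw [pd_const, (P.s0.pd 0).pdadd (P.s1.pd 1)] at h1
  rw [(P.s1.pd 0).pdsub (P.s0.pd 1), pd_comm P.s1.two] at h2
  unfold L; linarith

lemma Pair.l1 (D : Dom Ω φ) (P : Pair Ω Y0 Y1 g) {x : V2} (hx : x ∈ Ω) : L Y1 x = pd 0 g x := by
  have h1 := pd_congr_on D.op hx 1 P.dv
  have h2 := pd_congr_on D.op hx 0 P.cu
  rw [pd_const, (P.s0.pd 0).pdadd (P.s1.pd 1), pd_comm P.s0.two] at h1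
  rw [(P.s1.pd 0).pdsub (P.s0.pd 1)] at h2
  unfold L; linarith

lemma Pair.pd (D : Dom Ω φ) (P : Pair Ω Y0 Y1 g) (k : Fin 2) : Pair Ω (pd k Y0) (pd k Y1) (pd k g) := by
  refine ⟨P.s0.pd k, P.s1.pd k, P.sg.pd k, fun x hx => ?_, fun x hx => ?_⟩
  · have h1 := pd_congr_on D.op hx k P.dv
    rw [pd_const, (P.s0.pd 0).pdadd (P.s1.pd 1)] at h1
    rw [pd_comm P.s0.two, pd_comm P.s1.two 1 k]; exact h1
  · have h1 := pd_congr_on D.op hx k P.cu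
    rw [(P.s1.pd 0).pdsub (P.s0.pd 1)] at h1
    rw [pd_comm P.s1.two 0 k, pd_comm P.s0.two 1 k]; exact h1
end

section
variable {Ω : Set V2} {φ : V2 → ℝ} {ι : Type} {p : ℝ} {N : ι → ℝ}

/-- squared length of the gradient of the defining function -/
def gq (φ : V2 → ℝ) (x : V2) : ℝ := (pd 0 φ x) ^ 2 + (pd 1 φ x) ^ 2

lemma Dom.gq_cont (D : Dom Ω φ) : Continuous (gq φ) := ((D.sm.pd 0).cont.pow 2).add ((D.sm.pd 1).cont.pow 2)

lemma Dom.den2 (D : Dom Ω φ) : ∃ c > 0, ∀ x ∈ Ω, c ≤ φ x * φ x + gq φ x := by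
  have hc : Continuous (fun x => φ x * φ x + gq φ x) := (D.sm.cont.mul D.sm.cont).add D.gq_cont
  have hcl : IsCompact (closure Ω) := D.bd.isCompact_closure
  obtain ⟨y, hy, hm⟩ := hcl.exists_isMinOn (D.ne.mono subset_closure) hc.continuousOn
  refine ⟨φ y * φ y + gq φ y, ?_, fun x hx => hm (subset_closure hx)⟩
  by_cases h : φ y = 0
  · have := D.gr y h
    rw [h]; unfold gq; linarith
  · have h1 : 0 < φ y * φ y := mul_self_pos.2 h
    have : 0 ≤ gq φ y := by unfold gq; positivity
    linarith

lemma Dom.fin (D : Dom Ω φ) (hp : 2 ≤ p) {b : ι → V2 → ℝ} (hb : ∀ i, Continuous (b i)) (h1 : Bd p Ω N (fun i x => φ x * b i x))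
    (h2 : Bd p Ω N (fun i x => gq φ x * b i x)) : Bd p Ω N b := by
  have hp0 : 0 ≤ p := by linarith
  obtain ⟨c, hc, hd⟩ := D.den2
  refine ((h1.mul D hp0 D.sm.cont).add D hp0 h2).of_den D hp0 hc hd hb fun i x hx => by ring

/-- recovering all first derivatives -/
lemma Dom.grad_of (D : Dom Ω φ) (hp : 2 ≤ p) (hN : ∀ i, 0 ≤ N i) {Y0 Y1 g : ι → V2 → ℝ} (P : ∀ i, Pair Ω (Y0 i) (Y1 i) (g i))
    (b0 : Bd p Ω N Y0) (b1 : Bd p Ω N Y1) (bg : Bd p Ω N g)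
    (ha : ∀ j, Bd p Ω N (fun i x => pd 0 φ x * pd j (Y0 i) x + pd 1 φ x * pd j (Y1 i) x)) (j : Fin 2) :
    Bd p Ω N (fun i => pd j (Y0 i)) ∧ Bd p Ω N (fun i => pd j (Y1 i)) := by
  have hp0 : 0 ≤ p := by linarith
  have hz : Bd p Ω N (fun i x => 0) := Bd.zero hN (by linarith)
  have sz : ∀ i : ι, Sm (fun _ : V2 => (0:ℝ)) := fun i => Sm.con 0
  have l0 := fun j => D.loc hp hN (fun i => (P i).s0) sz (fun i => (P i).sg.neg) b0 hz bg.neg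
    (fun i x hx => by rw [(P i).l0 D hx, pd_const, pd_neg]; ring) j
  have l1 := fun j => D.loc hp hN (fun i => (P i).s1) (fun i => (P i).sg) sz b1 bg hz
    (fun i x hx => by rw [(P i).l1 D hx, pd_const]; ring) j
  have c0 := (D.sm.pd 0).cont
  have c1 := (D.sm.pd 1).cont
  have cg := D.gq_cont
  have d0 := fun j i => ((P i).s0.pd j).cont
  have d1 := fun j i => ((P i).s1.pd j).cont
  have A1 : Bd p Ω N (fun i x => (pd 0 φ x * pd 0 (Y0 i) x + pd 1 φ x * pd 0 (Y1 i) x) - pd 1 φ x * g i x) := (ha 0).sub D hp0 (bg.mul D hp0 c1)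
  have eA : Bd p Ω N (fun i => pd 0 (Y0 i)) := by
    refine D.fin hp (d0 0) (l0 0) ?_
    refine ((A1.mul D hp0 c0).sub D hp0 ((ha 1).mul D hp0 c1)).congr D (fun i => cg.mul (d0 0 i)) fun i x hx => ?_
    have h1 := (P i).dv x hx
    have h2 := (P i).cu x hx
    unfold gq
    linear_combination (pd 1 φ x ^ 2) * h1 - pd 0 φ x * pd 1 φ x * h2
  have eB : Bd p Ω N (fun i => pd 1 (Y0 i)) := by
    refine D.fin hp (d0 1) (l0 1) ?_
    refine ((A1.mul D hp0 c1).add D hp0 ((ha 1).mul D hp0 c0)).congr D (fun i => cg.mul (d0 1 i)) fun i x hx => ?_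
    have h1 := (P i).dv x hx
    have h2 := (P i).cu x hx
    unfold gq
    linear_combination (-pd 0 φ x * pd 1 φ x) * h1 - pd 1 φ x ^ 2 * h2
  have e2 : Bd p Ω N (fun i => pd 0 (Y1 i)) := by
    refine (bg.add D hp0 eB).congr D (d1 0) fun i x hx => ?_
    have h2 := (P i).cu x hx
    linarith
  have e3 : Bd p Ω N (fun i => pd 1 (Y1 i)) := by
    refine eA.neg.congr D (d1 1) fun i x hx => ?_
    have h2 := (P i).dv x hx
    linarith
  fin_cases j
  · exact ⟨eA, e2⟩
  · exact ⟨eB, e3⟩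

/-- admissible vector fields -/
structure Adm (Ω : Set V2) (φ : V2 → ℝ) : Type where
  X0 : V2 → ℝ
  X1 : V2 → ℝ
  f : V2 → ℝ
  pr : Pair Ω X0 X1 f
  tg : ∀ x ∈ frontier Ω, pd 0 φ x * X0 x + pd 1 φ x * X1 x = 0

lemma Adm.pot (D : Dom Ω φ) (A : Adm Ω φ) : ∃ w, Sm w ∧ (∀ x ∈ frontier Ω, w x = 0) ∧ ∀ x ∈ Ω, pd 0 w x = -A.X1 x ∧ pd 1 w x = A.X0 x := by
  obtain ⟨x0, hx0⟩ := D.ne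
  obtain ⟨ψ, sψ, hψ⟩ := poincare D.op D.cv hx0 A.pr.s1.neg A.pr.s0 (fun x hx => by
    have := A.pr.dv x hx
    rw [pd_neg]; linarith)
  have e0 : EqOn (pd 0 ψ) (fun x => -A.X1 x) (closure Ω) := (show EqOn (pd 0 ψ) (fun x => -A.X1 x) Ω from fun x hx => (hψ x hx).1).closure (sψ.pd 0).cont A.pr.s1.neg.cont
  have e1 : EqOn (pd 1 ψ) A.X0 (closure Ω) := (show EqOn (pd 1 ψ) A.X0 Ω from fun x hx => (hψ x hx).2).closure (sψ.pd 1).cont A.pr.s0.cont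
  obtain ⟨c, hc⟩ := D.const_fr sψ (fun x hx => by
    have h := A.tg x hx
    rw [e0 (frontier_subset_closure hx), e1 (frontier_subset_closure hx)]
    linarith)
  refine ⟨fun x => ψ x - c, sψ.sub (Sm.con c), fun x hx => by simp only [hc x hx, sub_self], fun x hx => ?_⟩
  rw [sψ.pdsub (Sm.con c), sψ.pdsub (Sm.con c), pd_const, pd_const, sub_zero, sub_zero]
  exact hψ x hx

lemma Dom.base (D : Dom Ω φ) (hp : 2 ≤ p) {N : Adm Ω φ → ℝ} (hN : ∀ i, 0 ≤ N i) (hf : Bd p Ω N Adm.f) :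
    Bd p Ω N Adm.X0 ∧ Bd p Ω N Adm.X1 := by
  have hz : Bd p Ω N (fun i x => 0) := Bd.zero hN (by linarith)
  have sz : ∀ i : Adm Ω φ, Sm (fun _ : V2 => (0:ℝ)) := fun i => Sm.con 0
  choose w sw fw ew using fun A : Adm Ω φ => A.pot D
  have h := (D.bdB hp sw sz sz fw hz hz hf (fun A x hx => by
    have h0 := pd_congr_on D.op hx 0 (fun y hy => (ew A y hy).1)
    have h1 := pd_congr_on D.op hx 1 (fun y hy => (ew A y hy).2)
    have := A.pr.cu x hx
    rw [pd_neg] at h0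
    unfold L
    rw [h0, h1, pd_const, pd_const]; linarith)).2
  refine ⟨(h 1).congr D (fun A => A.pr.s0.cont) fun A x hx => (ew A x hx).2.symm, (h 0).neg.congr D (fun A => A.pr.s1.cont) fun A x hx => ?_⟩
  rw [(ew A x hx).1, neg_neg]

/-- normal component -/
def Adm.v (A : Adm Ω φ) (x : V2) : ℝ := pd 0 φ x * A.X0 x + pd 1 φ x * A.X1 x

lemma Adm.sv (D : Dom Ω φ) (A : Adm Ω φ) : Sm A.v := ((D.sm.pd 0).mul A.pr.s0).add ((D.sm.pd 1).mul A.pr.s1)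

lemma Adm.pdv (D : Dom Ω φ) (A : Adm Ω φ) (j : Fin 2) (x : V2) : pd j A.v x =
    (pd j (pd 0 φ) x * A.X0 x + pd 0 φ x * pd j A.X0 x) + (pd j (pd 1 φ) x * A.X1 x + pd 1 φ x * pd j A.X1 x) := by
  have e : A.v = fun x => pd 0 φ x * A.X0 x + pd 1 φ x * A.X1 x := rfl
  rw [e, ((D.sm.pd 0).mul A.pr.s0).pdadd ((D.sm.pd 1).mul A.pr.s1), (D.sm.pd 0).pdmul A.pr.s0, (D.sm.pd 1).pdmul A.pr.s1]

lemma Dom.normal (D : Dom Ω φ) (hp : 2 ≤ p) {N : Adm Ω φ → ℝ} (hN : ∀ i, 0 ≤ N i) (hf : Bd p Ω N Adm.f) :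
    Bd p Ω N Adm.v ∧ ∀ j, Bd p Ω N (fun A => pd j A.v) := by
  obtain ⟨b0, b1⟩ := D.base hp hN hf
  have hz : Bd p Ω N (fun i x => 0) := Bd.zero hN (by linarith)
  have sz : ∀ i : Adm Ω φ, Sm (fun _ : V2 => (0:ℝ)) := fun i => Sm.con 0
  exact D.comb hp (D.sm.pd 0) (D.sm.pd 1) (fun A => A.pr.s0) (fun A => A.pr.s1) sz (fun A => A.pr.sg.neg) (fun A => A.pr.sg) sz
    b0 b1 hz hf.neg hf hz (fun A x hx => by rw [A.pr.l0 D hx, pd_const, pd_neg]; ring) (fun A x hx => by rw [A.pr.l1 D hx, pd_const]; ring)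
    (fun A => A.tg)

/-- first order div-curl estimate -/
lemma Dom.first (D : Dom Ω φ) (hp : 2 ≤ p) {N : Adm Ω φ → ℝ} (hN : ∀ i, 0 ≤ N i) (hf : Bd p Ω N Adm.f) (j : Fin 2) :
    Bd p Ω N (fun A => pd j A.X0) ∧ Bd p Ω N (fun A => pd j A.X1) := by
  have hp0 : 0 ≤ p := by linarith
  obtain ⟨b0, b1⟩ := D.base hp hN hf
  obtain ⟨n, dn⟩ := D.normal hp hN hf
  refine D.grad_of hp hN (fun A => A.pr) b0 b1 hf (fun j => ?_) j
  refine (((dn j).sub D hp0 (b0.mul D hp0 ((D.sm.pd 0).pd j).cont)).sub D hp0 (b1.mul D hp0 ((D.sm.pd 1).pd j).cont)).congr D (fun A => ?_) fun A x hx => ?_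
  · exact ((D.sm.pd 0).cont.mul (A.pr.s0.pd j).cont).add ((D.sm.pd 1).cont.mul (A.pr.s1.pd j).cont)
  · rw [A.pdv D]; ring
end

section
variable {Ω : Set V2} {φ : V2 → ℝ} {ι : Type} {p : ℝ} {N : ι → ℝ}

lemma Dom.tang (D : Dom Ω φ) {v : V2 → ℝ} (hv : Sm v) (h0 : ∀ x ∈ frontier Ω, v x = 0) {x : V2} (hx : x ∈ frontier Ω) :
    (-pd 1 φ x) * pd 0 v x + pd 0 φ x * pd 1 v x = 0 := by
  have hφx : φ x = 0 := by rw [D.fr] at hx; exact hx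
  have ex : IsLocalExtrOn v {y | φ y = φ x} x := by
    left
    refine eventually_nhdsWithin_of_forall fun y hy => ?_
    have hy : φ y = φ x := hy
    have : y ∈ frontier Ω := by rw [D.fr]; exact hy.trans hφx
    simp only [h0 x hx, h0 y this, le_refl]
  obtain ⟨a, b, hab, hs⟩ := ex.exists_multipliers_of_hasStrictFDerivAt_1d
    (D.sm.contDiffAt.hasStrictFDerivAt (by simp)) (hv.contDiffAt.hasStrictFDerivAt (by simp))
  have e : ∀ i, a * pd i φ x + b * pd i v x = 0 := by
    intro i
    have := congrArg (fun l : V2 →L[ℝ] ℝ => l (Pi.single i 1)) hs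
    simpa [pd] using this
  have g := D.gr x hφx
  have hb : b ≠ 0 := by
    intro hb
    have ha : a ≠ 0 := fun ha => hab (by rw [ha, hb]; rfl)
    have h0 := e 0
    have h1 := e 1
    rw [hb, zero_mul, add_zero] at h0 h1
    rw [(mul_eq_zero.1 h0).resolve_left ha, (mul_eq_zero.1 h1).resolve_left ha] at g
    norm_num at g
  have : b * ((-pd 1 φ x) * pd 0 v x + pd 0 φ x * pd 1 v x) = 0 := by
    linear_combination (-pd 1 φ x) * e 0 + pd 0 φ x * e 1
  exact (mul_eq_zero.1 this).resolve_left hb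

lemma L_pd {f : V2 → ℝ} (hf : Sm f) (k : Fin 2) (x : V2) : L (pd k f) x = pd k (L f) x := by
  have e : L f = fun y => pd 0 (pd 0 f) y + pd 1 (pd 1 f) y := rfl
  have h : ∀ j, pd j (pd k f) = pd k (pd j f) := fun j => funext fun y => pd_comm hf.two j k y
  rw [e, ((hf.pd 0).pd 0).pdadd ((hf.pd 1).pd 1)]
  unfold L
  rw [h, h, pd_comm (hf.pd 0).two, pd_comm (hf.pd 1).two 1 k]

/-- smooth representative of the Laplacian of the normal component -/
def Adm.R (A : Adm Ω φ) (x : V2) : ℝ :=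
  pd 0 φ x * (-pd 1 A.f x) + (2 * pd 0 (pd 0 φ) x) * pd 0 A.X0 x + (2 * pd 1 (pd 0 φ) x) * pd 1 A.X0 x + L (pd 0 φ) x * A.X0 x
  + (pd 1 φ x * pd 0 A.f x + (2 * pd 0 (pd 1 φ) x) * pd 0 A.X1 x + (2 * pd 1 (pd 1 φ) x) * pd 1 A.X1 x + L (pd 1 φ) x * A.X1 x)

lemma Adm.sR (D : Dom Ω φ) (A : Adm Ω φ) : Sm A.R := by
  have k2 : Sm (fun _ : V2 => (2:ℝ)) := Sm.con 2
  have a := fun i => D.sm.pd i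
  have b := fun i j => k2.mul ((D.sm.pd i).pd j)
  have c := fun i => (D.sm.pd i).L
  exact (((((a 0).mul (A.pr.sg.pd 1).neg).add ((b 0 0).mul (A.pr.s0.pd 0))).add ((b 0 1).mul (A.pr.s0.pd 1))).add ((c 0).mul A.pr.s0)).add
    (((((a 1).mul (A.pr.sg.pd 0)).add ((b 1 0).mul (A.pr.s1.pd 0))).add ((b 1 1).mul (A.pr.s1.pd 1))).add ((c 1).mul A.pr.s1))

lemma Adm.eR (D : Dom Ω φ) (A : Adm Ω φ) {x : V2} (hx : x ∈ Ω) : L A.v x = A.R x := by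
  have e : A.v = fun x => pd 0 φ x * A.X0 x + pd 1 φ x * A.X1 x := rfl
  rw [e, L_add ((D.sm.pd 0).mul A.pr.s0) ((D.sm.pd 1).mul A.pr.s1), L_mul (D.sm.pd 0) A.pr.s0, L_mul (D.sm.pd 1) A.pr.s1, A.pr.l0 D hx, A.pr.l1 D hx]
  unfold Adm.R
  ring

lemma Dom.bR (D : Dom Ω φ) (hp : 2 ≤ p) {N : Adm Ω φ → ℝ} (hN : ∀ i, 0 ≤ N i) (hf : Bd p Ω N Adm.f)
    (hdf : ∀ j, Bd p Ω N (fun A => pd j A.f)) : Bd p Ω N Adm.R := by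
  have hp0 : 0 ≤ p := by linarith
  obtain ⟨b0, b1⟩ := D.base hp hN hf
  have d := D.first hp hN hf
  have k2 : Sm (fun _ : V2 => (2:ℝ)) := Sm.con 2
  have a := fun i => (D.sm.pd i).cont
  have b := fun i j => (k2.mul ((D.sm.pd i).pd j)).cont
  have c := fun i => (D.sm.pd i).L.cont
  exact (((((hdf 1).neg.mul D hp0 (a 0)).add D hp0 ((d 0).1.mul D hp0 (b 0 0))).add D hp0 ((d 1).1.mul D hp0 (b 0 1))).add D hp0 (b0.mul D hp0 (c 0))).add D hp0
    (((((hdf 0).mul D hp0 (a 1)).add D hp0 ((d 0).2.mul D hp0 (b 1 0))).add D hp0 ((d 1).2.mul D hp0 (b 1 1))).add D hp0 (b1.mul D hp0 (c 1)))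

lemma Dom.normal2 (D : Dom Ω φ) (hp : 2 ≤ p) {N : Adm Ω φ → ℝ} (hN : ∀ i, 0 ≤ N i) (hf : Bd p Ω N Adm.f)
    (hdf : ∀ j, Bd p Ω N (fun A => pd j A.f)) (j k : Fin 2) : Bd p Ω N (fun A => pd j (pd k A.v)) := by
  have hp0 : 0 ≤ p := by linarith
  have hz : Bd p Ω N (fun i x => 0) := Bd.zero hN (by linarith)
  have sz : ∀ i : Adm Ω φ, Sm (fun _ : V2 => (0:ℝ)) := fun i => Sm.con 0
  obtain ⟨n, dn⟩ := D.normal hp hN hf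
  have bR := D.bR hp hN hf hdf
  have sv := fun A : Adm Ω φ => A.sv D
  have sR := fun A : Adm Ω φ => A.sR D
  have eL : ∀ (A : Adm Ω φ) (k : Fin 2), ∀ x ∈ Ω, L (pd k A.v) x = pd k A.R x := by
    intro A k x hx
    rw [L_pd (sv A)]
    exact pd_congr_on D.op hx k fun y hy => A.eR D hy
  have e0 : ∀ A : Adm Ω φ, ∀ x ∈ Ω, L (pd 0 A.v) x = pd 0 A.R x + pd 1 (fun _ => 0) x := fun A x hx => by rw [eL A 0 x hx, pd_const, add_zero]
  have e1 : ∀ A : Adm Ω φ, ∀ x ∈ Ω, L (pd 1 A.v) x = pd 0 (fun _ => 0) x + pd 1 A.R x := fun A x hx => by rw [eL A 1 x hx, pd_const, zero_add]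
  have W := (D.comb hp (D.sm.pd 1).neg (D.sm.pd 0) (fun A => (sv A).pd 0) (fun A => (sv A).pd 1) sR sz sz sR (dn 0) (dn 1) bR hz hz bR e0 e1
    (fun A x hx => D.tang (sv A) A.tg hx)).2
  have K : ∀ j, Bd p Ω N (fun A x => (-pd 1 φ x) * pd j (pd 0 A.v) x + pd 0 φ x * pd j (pd 1 A.v) x) := by
    intro j
    refine (((W j).sub D hp0 ((dn 0).mul D hp0 ((D.sm.pd 1).neg.pd j).cont)).sub D hp0 ((dn 1).mul D hp0 ((D.sm.pd 0).pd j).cont)).congr D (fun A => ?_) fun A x hx => ?_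
    · exact ((D.sm.pd 1).neg.cont.mul (((sv A).pd 0).pd j).cont).add ((D.sm.pd 0).cont.mul (((sv A).pd 1).pd j).cont)
    · rw [((D.sm.pd 1).neg.mul ((sv A).pd 0)).pdadd ((D.sm.pd 0).mul ((sv A).pd 1)), (D.sm.pd 1).neg.pdmul ((sv A).pd 0), (D.sm.pd 0).pdmul ((sv A).pd 1)]
      ring
  have l0 := fun j => D.loc hp hN (fun A => (sv A).pd 0) sR sz (dn 0) bR hz e0 j
  have l1 := fun j => D.loc hp hN (fun A => (sv A).pd 1) sz sR (dn 1) hz bR e1 j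
  have c0 := (D.sm.pd 0).cont
  have c1 := (D.sm.pd 1).cont
  have cg := D.gq_cont
  have cd := fun (A : Adm Ω φ) j k => (((sv A).pd k).pd j).cont
  have h00 : Bd p Ω N (fun A => pd 0 (pd 0 A.v)) := by
    refine D.fin hp (fun A => cd A 0 0) (l0 0) ?_
    refine (((bR.mul D hp0 (c0.mul c0)).sub D hp0 ((K 1).mul D hp0 c0)).sub D hp0 ((K 0).mul D hp0 c1)).congr D (fun A => cg.mul (cd A 0 0)) fun A x hx => ?_
    rw [← A.eR D hx, pd_comm (sv A).two 1 0]
    unfold gq L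
    simp only [Pi.mul_apply]
    ring
  have h11 : Bd p Ω N (fun A => pd 1 (pd 1 A.v)) := by
    refine (bR.sub D hp0 h00).congr D (fun A => cd A 1 1) fun A x hx => ?_
    rw [← A.eR D hx]
    unfold L; ring
  have h01 : Bd p Ω N (fun A => pd 0 (pd 1 A.v)) := by
    refine D.fin hp (fun A => cd A 0 1) (l1 0) ?_
    refine ((((K 0).mul D hp0 c0).sub D hp0 ((K 1).mul D hp0 c1)).add D hp0 (bR.mul D hp0 (c0.mul c1))).congr D (fun A => cg.mul (cd A 0 1)) fun A x hx => ?_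
    rw [← A.eR D hx, pd_comm (sv A).two 1 0]
    unfold gq L
    simp only [Pi.mul_apply]
    ring
  have h10 : Bd p Ω N (fun A => pd 1 (pd 0 A.v)) := h01.congr D (fun A => cd A 1 0) fun A x hx => pd_comm (sv A).two 1 0 x
  fin_cases j <;> fin_cases k
  · exact h00
  · exact h01
  · exact h10
  · exact h11

lemma Adm.pdv2 (D : Dom Ω φ) (A : Adm Ω φ) (j k : Fin 2) (x : V2) : pd j (pd k A.v) x =
    (pd j (pd k (pd 0 φ)) x * A.X0 x + pd k (pd 0 φ) x * pd j A.X0 x + (pd j (pd 0 φ) x * pd k A.X0 x + pd 0 φ x * pd j (pd k A.X0) x))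
    + (pd j (pd k (pd 1 φ)) x * A.X1 x + pd k (pd 1 φ) x * pd j A.X1 x + (pd j (pd 1 φ) x * pd k A.X1 x + pd 1 φ x * pd j (pd k A.X1) x)) := by
  have e : pd k A.v = fun x => (pd k (pd 0 φ) x * A.X0 x + pd 0 φ x * pd k A.X0 x) + (pd k (pd 1 φ) x * A.X1 x + pd 1 φ x * pd k A.X1 x) := funext fun x => A.pdv D k x
  have a0 := ((D.sm.pd 0).pd k).mul A.pr.s0
  have a1 := (D.sm.pd 0).mul (A.pr.s0.pd k)
  have a2 := ((D.sm.pd 1).pd k).mul A.pr.s1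
  have a3 := (D.sm.pd 1).mul (A.pr.s1.pd k)
  rw [e, (a0.add a1).pdadd (a2.add a3), a0.pdadd a1, a2.pdadd a3, ((D.sm.pd 0).pd k).pdmul A.pr.s0, (D.sm.pd 0).pdmul (A.pr.s0.pd k),
    ((D.sm.pd 1).pd k).pdmul A.pr.s1, (D.sm.pd 1).pdmul (A.pr.s1.pd k)]

/-- second order div-curl estimate -/
lemma Dom.second (D : Dom Ω φ) (hp : 2 ≤ p) {N : Adm Ω φ → ℝ} (hN : ∀ i, 0 ≤ N i) (hf : Bd p Ω N Adm.f)
    (hdf : ∀ j, Bd p Ω N (fun A => pd j A.f)) (j k : Fin 2) :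
    Bd p Ω N (fun A => pd j (pd k A.X0)) ∧ Bd p Ω N (fun A => pd j (pd k A.X1)) := by
  have hp0 : 0 ≤ p := by linarith
  obtain ⟨b0, b1⟩ := D.base hp hN hf
  have d := D.first hp hN hf
  refine D.grad_of hp hN (fun A => A.pr.pd D k) (d k).1 (d k).2 (hdf k) (fun j => ?_) j
  have n2 := D.normal2 hp hN hf hdf j k
  have u0 := b0.mul D hp0 (((D.sm.pd 0).pd k).pd j).cont
  have u1 := b1.mul D hp0 (((D.sm.pd 1).pd k).pd j).cont
  have u2 := (d j).1.mul D hp0 ((D.sm.pd 0).pd k).cont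
  have u3 := (d j).2.mul D hp0 ((D.sm.pd 1).pd k).cont
  have u4 := (d k).1.mul D hp0 ((D.sm.pd 0).pd j).cont
  have u5 := (d k).2.mul D hp0 ((D.sm.pd 1).pd j).cont
  refine ((((((n2.sub D hp0 u0).sub D hp0 u1).sub D hp0 u2).sub D hp0 u3).sub D hp0 u4).sub D hp0 u5).congr D (fun A => ?_) fun A x hx => ?_
  · exact ((D.sm.pd 0).cont.mul ((A.pr.s0.pd k).pd j).cont).add ((D.sm.pd 1).cont.mul ((A.pr.s1.pd k).pd j).cont)
  · rw [A.pdv2 D]; ring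
end

section
variable {Ω : Set V2} {φ : V2 → ℝ} {ι : Type} {p : ℝ} {N : ι → ℝ}

lemma Bd.of_le (h : ∀ i, 0 ≤ N i) {a : ι → V2 → ℝ} (hc : ∀ i, Continuous (a i)) (hl : ∀ i, S p Ω (a i) ≤ N i) : Bd p Ω N a :=
  ⟨hc, 1, zero_le_one, fun i => by rw [one_mul]; exact hl i⟩

/-- the data entering the velocity estimate -/
structure Cfg (Ω : Set V2) (φ : V2 → ℝ) (μ : ℝ) : Type where
  W : Fin 2 → V2 → ℝ
  E : Fin 2 → V2 → ℝ
  U : Fin 2 → V2 → ℝ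
  om : V2 → ℝ
  sW : ∀ i, Sm (W i)
  sE : ∀ i, Sm (E i)
  sU : ∀ i, Sm (U i)
  so : Sm om
  hom : ∀ x, om x = pd 0 (U 1) x - pd 1 (U 0) x
  bo : ∀ x ∈ frontier Ω, om x = 0
  eq : ∀ x ∈ Ω, μ * L om x = pd 0 (fun y => W 1 y - E 1 y) x - pd 1 (fun y => W 0 y - E 0 y) x
  A : Adm Ω φ
  hA : A.f = om

/-- total size of the data -/
def Cfg.nn {μ : ℝ} (p : ℝ) (c : Cfg Ω φ μ) : ℝ :=
  (S p Ω (c.W 0) + S p Ω (c.W 1)) + (S p Ω (c.E 0) + S p Ω (c.E 1))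
  + (S p Ω (pd 0 (c.U 0)) + S p Ω (pd 1 (c.U 0)) + (S p Ω (pd 0 (c.U 1)) + S p Ω (pd 1 (c.U 1))))

lemma Dom.cfg (D : Dom Ω φ) (hp : 2 ≤ p) {μ : ℝ} (hμ : 0 < μ) : ∃ K ≥ 0, ∀ c : Cfg Ω φ μ,
    (∀ j, S p Ω (pd j c.om) ≤ K * c.nn p) ∧ S p Ω (fun x => c.W 0 x - c.E 0 x + μ * pd 1 c.om x) ≤ K * c.nn p ∧
    S p Ω (fun x => c.W 1 x - c.E 1 x - μ * pd 0 c.om x) ≤ K * c.nn p ∧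
    ∀ j k, S p Ω (pd j (pd k c.A.X0)) ≤ K * c.nn p ∧ S p Ω (pd j (pd k c.A.X1)) ≤ K * c.nn p := by
  have hp0 : 0 ≤ p := by linarith
  have hS := fun a => S_nonneg p Ω a
  have hN : ∀ c : Cfg Ω φ μ, 0 ≤ c.nn p := fun c => by
    unfold Cfg.nn
    linarith [hS (c.W 0), hS (c.W 1), hS (c.E 0), hS (c.E 1), hS (pd 0 (c.U 0)), hS (pd 1 (c.U 0)), hS (pd 0 (c.U 1)), hS (pd 1 (c.U 1))]
  have bW : ∀ i, Bd p Ω (Cfg.nn (Ω := Ω) (φ := φ) (μ := μ) p) (fun c => c.W i) := fun i => Bd.of_le hN (fun c => (c.sW i).cont) fun c => by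
    unfold Cfg.nn
    have := hS (c.W 0); have := hS (c.W 1)
    fin_cases i <;> simp only [Fin.zero_eta, Fin.mk_one] <;>
    linarith [hS (c.E 0), hS (c.E 1), hS (pd 0 (c.U 0)), hS (pd 1 (c.U 0)), hS (pd 0 (c.U 1)), hS (pd 1 (c.U 1))]
  have bE : ∀ i, Bd p Ω (Cfg.nn (Ω := Ω) (φ := φ) (μ := μ) p) (fun c => c.E i) := fun i => Bd.of_le hN (fun c => (c.sE i).cont) fun c => by
    unfold Cfg.nn
    have := hS (c.E 0); have := hS (c.E 1)
    fin_cases i <;> simp only [Fin.zero_eta, Fin.mk_one] <;>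
    linarith [hS (c.W 0), hS (c.W 1), hS (pd 0 (c.U 0)), hS (pd 1 (c.U 0)), hS (pd 0 (c.U 1)), hS (pd 1 (c.U 1))]
  have b01 : Bd p Ω (Cfg.nn (Ω := Ω) (φ := φ) (μ := μ) p) (fun c => pd 0 (c.U 1)) := Bd.of_le hN (fun c => ((c.sU 1).pd 0).cont) fun c => by
    unfold Cfg.nn
    linarith [hS (c.W 0), hS (c.W 1), hS (c.E 0), hS (c.E 1), hS (pd 0 (c.U 0)), hS (pd 1 (c.U 0)), hS (pd 0 (c.U 1)), hS (pd 1 (c.U 1))]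
  have b10 : Bd p Ω (Cfg.nn (Ω := Ω) (φ := φ) (μ := μ) p) (fun c => pd 1 (c.U 0)) := Bd.of_le hN (fun c => ((c.sU 0).pd 1).cont) fun c => by
    unfold Cfg.nn
    linarith [hS (c.W 0), hS (c.W 1), hS (c.E 0), hS (c.E 1), hS (pd 0 (c.U 0)), hS (pd 1 (c.U 0)), hS (pd 0 (c.U 1)), hS (pd 1 (c.U 1))]
  have bo : Bd p Ω (Cfg.nn (Ω := Ω) (φ := φ) (μ := μ) p) (fun c => c.om) := (b01.sub D hp0 b10).congr D (fun c => c.so.cont) fun c x hx => c.hom x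
  have bg : ∀ i, Bd p Ω (Cfg.nn (Ω := Ω) (φ := φ) (μ := μ) p) (fun c x => c.W i x - c.E i x) := fun i => (bW i).sub D hp0 (bE i)
  have sg : ∀ i (c : Cfg Ω φ μ), Sm (fun x => c.W i x - c.E i x) := fun i c => (c.sW i).sub (c.sE i)
  have bdo := (D.bdB hp (N := Cfg.nn (Ω := Ω) (φ := φ) (μ := μ) p) (w := fun c => c.om) (G0 := fun c x => μ⁻¹ * (c.W 1 x - c.E 1 x)) (G1 := fun c x => (-μ⁻¹) * (c.W 0 x - c.E 0 x))
    (H := fun c x => 0) (fun c => c.so) (fun c => (Sm.con _).mul (sg 1 c)) (fun c => (Sm.con _).mul (sg 0 c)) (fun c => c.bo)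
    ((bg 1).mul D hp0 continuous_const) ((bg 0).mul D hp0 continuous_const) (Bd.zero hN (by linarith)) (fun c x hx => by
      have h := c.eq x hx
      rw [pd_const_mul _ _ ((sg 1 c).diff x), pd_const_mul _ _ ((sg 0 c).diff x)]
      have : L c.om x = μ⁻¹ * (μ * L c.om x) := by field_simp
      rw [this, h]; ring)).2
  have bz0 : Bd p Ω (Cfg.nn (Ω := Ω) (φ := φ) (μ := μ) p) (fun c x => c.W 0 x - c.E 0 x + μ * pd 1 c.om x) := (bg 0).add D hp0 ((bdo 1).mul D hp0 continuous_const)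
  have bz1 : Bd p Ω (Cfg.nn (Ω := Ω) (φ := φ) (μ := μ) p) (fun c x => c.W 1 x - c.E 1 x - μ * pd 0 c.om x) := (bg 1).sub D hp0 ((bdo 0).mul D hp0 continuous_const)
  have hM : ∀ A : Adm Ω φ, 0 ≤ S p Ω A.f + S p Ω (pd 0 A.f) + S p Ω (pd 1 A.f) := fun A => by linarith [hS A.f, hS (pd 0 A.f), hS (pd 1 A.f)]
  have sec := fun j k => D.second hp hM (Bd.of_le hM (fun A => A.pr.sg.cont) fun A => by linarith [hS A.f, hS (pd 0 A.f), hS (pd 1 A.f)])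
    (fun j => Bd.of_le hM (fun A => (A.pr.sg.pd j).cont) fun A => by
      have := hS (pd 0 A.f); have := hS (pd 1 A.f)
      fin_cases j <;> simp only [Fin.zero_eta, Fin.mk_one] <;> linarith [hS A.f]) j k
  obtain ⟨Ko, hKo, ho⟩ := bo.bd
  obtain ⟨K0, hK0, h0⟩ := (bdo 0).bd
  obtain ⟨K1, hK1, h1⟩ := (bdo 1).bd
  obtain ⟨K2, hK2, h2⟩ := bz0.bd
  obtain ⟨K3, hK3, h3⟩ := bz1.bd
  choose C hC hCb using fun j k => (sec j k).1.bd
  choose C' hC' hCb' using fun j k => (sec j k).2.bd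
  set T := (C 0 0 + C 0 1 + C 1 0 + C 1 1) + (C' 0 0 + C' 0 1 + C' 1 0 + C' 1 1) with hT
  have hT0 : 0 ≤ T := by
    linarith [hC 0 0, hC 0 1, hC 1 0, hC 1 1, hC' 0 0, hC' 0 1, hC' 1 0, hC' 1 1]
  have hT1 : ∀ j k, C j k ≤ T := by
    intro j k
    have := hC 0 0; have := hC 0 1; have := hC 1 0; have := hC 1 1
    fin_cases j <;> fin_cases k <;> simp only [Fin.zero_eta, Fin.mk_one] <;> linarith [hC' 0 0, hC' 0 1, hC' 1 0, hC' 1 1]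
  have hT2 : ∀ j k, C' j k ≤ T := by
    intro j k
    have := hC' 0 0; have := hC' 0 1; have := hC' 1 0; have := hC' 1 1
    fin_cases j <;> fin_cases k <;> simp only [Fin.zero_eta, Fin.mk_one] <;> linarith [hC 0 0, hC 0 1, hC 1 0, hC 1 1]
  have hTK : 0 ≤ T * (Ko + K0 + K1) := by positivity
  refine ⟨K0 + K1 + K2 + K3 + T * (Ko + K0 + K1), by linarith, fun c => ?_⟩
  have nn := hN c
  have up : ∀ {a b : ℝ}, a ≤ b * c.nn p → b ≤ K0 + K1 + K2 + K3 + T * (Ko + K0 + K1) → a ≤ (K0 + K1 + K2 + K3 + T * (Ko + K0 + K1)) * c.nn p :=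
    fun h h' => h.trans (mul_le_mul_of_nonneg_right h' nn)
  have M : S p Ω c.A.f + S p Ω (pd 0 c.A.f) + S p Ω (pd 1 c.A.f) ≤ (Ko + K0 + K1) * c.nn p := by
    rw [c.hA]
    have := ho c; have := h0 c; have := h1 c
    linarith
  refine ⟨fun j => ?_, up (h2 c) (by linarith), up (h3 c) (by linarith), fun j k => ⟨?_, ?_⟩⟩
  · fin_cases j
    · exact up (h0 c) (by linarith)
    · exact up (h1 c) (by linarith)
  · refine up (b := T * (Ko + K0 + K1)) ((hCb j k c.A).trans ?_) (by linarith)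
    rw [mul_assoc]
    exact mul_le_mul (hT1 j k) M (hM _) hT0
  · refine up (b := T * (Ko + K0 + K1)) ((hCb' j k c.A).trans ?_) (by linarith)
    rw [mul_assoc]
    exact mul_le_mul (hT2 j k) M (hM _) hT0

lemma Dom.first_est (D : Dom Ω φ) (hp : 2 ≤ p) : ∃ K ≥ 0, ∀ A : Adm Ω φ, S p Ω (pd 0 A.X0) + S p Ω (pd 1 A.X0) + (S p Ω (pd 0 A.X1) + S p Ω (pd 1 A.X1)) ≤ K * S p Ω A.f := by
  have hM : ∀ A : Adm Ω φ, 0 ≤ S p Ω A.f := fun A => S_nonneg _ _ _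
  have f := fun j => D.first hp hM (Bd.of_le hM (fun A => A.pr.sg.cont) fun A => le_rfl) j
  obtain ⟨a, ha, h1⟩ := (f 0).1.bd
  obtain ⟨b, hb, h2⟩ := (f 1).1.bd
  obtain ⟨c, hc, h3⟩ := (f 0).2.bd
  obtain ⟨d, hd, h4⟩ := (f 1).2.bd
  exact ⟨a + b + (c + d), by positivity, fun A => by linarith [h1 A, h2 A, h3 A, h4 A]⟩

lemma sqrp (hp : 2 ≤ p) (y : ℝ) : (y ^ 2) ^ (p / 2) = |y| ^ p := by
  rw [← sq_abs, ← Real.rpow_natCast, ← Real.rpow_mul (abs_nonneg _)]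
  congr 1; push_cast; ring

lemma S_le_of (D : Dom Ω φ) (hp : 2 ≤ p) {a n : V2 → ℝ} (ha : Continuous a) (hn : Continuous n) (h : ∀ x, (a x) ^ 2 ≤ n x) : S p Ω a ≤ ∫ x in Ω, n x ^ (p / 2) := by
  refine setIntegral_mono_on (cont_int D.bd (rp_cont (by linarith) ha)) (cont_int D.bd (hn.rpow_const fun x => Or.inr (by linarith))) D.op.measurableSet fun x hx => ?_
  rw [← sqrp hp]
  exact Real.rpow_le_rpow (sq_nonneg _) (h x) (by linarith)

lemma int_le2 (D : Dom Ω φ) (hp : 2 ≤ p) {a b : V2 → ℝ} (ha : Continuous a) (hb : Continuous b) :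
    ∫ x in Ω, (a x ^ 2 + b x ^ 2) ^ (p / 2) ≤ 2 ^ p * (S p Ω a + S p Ω b) := by
  have hp0 : 0 ≤ p := by linarith
  have ia := cont_int D.bd (rp_cont hp0 ha)
  have ib := cont_int D.bd (rp_cont hp0 hb)
  have e := integral_add ia ib
  unfold S
  rw [← e, ← integral_const_mul]
  refine setIntegral_mono_on (cont_int D.bd (Continuous.rpow_const (by fun_prop) fun x => Or.inr (by linarith))) ((ia.add ib).const_mul _) D.op.measurableSet fun x hx => ?_
  have := rp2 (r := p / 2) (by linarith) (sq_nonneg (a x)) (sq_nonneg (b x))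
  rw [sqrp hp, sqrp hp] at this
  refine this.trans ?_
  refine mul_le_mul_of_nonneg_right (Real.rpow_le_rpow_of_exponent_le (by norm_num) (by linarith)) (by positivity)

lemma int_add_le (D : Dom Ω φ) (hp : 2 ≤ p) {m n : V2 → ℝ} (hm : Continuous m) (hn : Continuous n) (m0 : ∀ x, 0 ≤ m x) (n0 : ∀ x, 0 ≤ n x) :
    ∫ x in Ω, (m x + n x) ^ (p / 2) ≤ 2 ^ p * ((∫ x in Ω, m x ^ (p / 2)) + ∫ x in Ω, n x ^ (p / 2)) := by
  have ia := cont_int D.bd (hm.rpow_const (p := p / 2) fun x => Or.inr (by linarith))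
  have ib := cont_int D.bd (hn.rpow_const (p := p / 2) fun x => Or.inr (by linarith))
  have e := integral_add ia ib
  rw [← e, ← integral_const_mul]
  refine setIntegral_mono_on (cont_int D.bd (Continuous.rpow_const (by fun_prop) fun x => Or.inr (by linarith))) ((ia.add ib).const_mul _) D.op.measurableSet fun x hx => ?_
  have := rp2 (r := p / 2) (by linarith) (m0 x) (n0 x)
  refine this.trans ?_
  refine mul_le_mul_of_nonneg_right (Real.rpow_le_rpow_of_exponent_le (by norm_num) (by linarith)) ?_
  have := m0 x; have := n0 x; positivity

lemma root_le (hp : 2 ≤ p) {I K J1 J2 J3 : ℝ} (hI : 0 ≤ I) (hK : 0 ≤ K) (h1 : 0 ≤ J1) (h2 : 0 ≤ J2) (h3 : 0 ≤ J3) (h : I ≤ K * (J1 + J2 + J3)) :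
    I ^ (1 / p) ≤ K ^ (1 / p) * (J1 ^ (1 / p) + J2 ^ (1 / p) + J3 ^ (1 / p)) := by
  have q0 : 0 ≤ 1 / p := by positivity
  have q1 : 1 / p ≤ 1 := by rw [div_le_one (by linarith)]; linarith
  refine (Real.rpow_le_rpow hI h q0).trans ?_
  rw [Real.mul_rpow hK (by positivity)]
  refine mul_le_mul_of_nonneg_left ?_ (by positivity)
  exact (Real.rpow_add_le_add_rpow (by positivity) h3 q0 q1).trans (add_le_add (Real.rpow_add_le_add_rpow h1 h2 q0 q1) le_rfl)
end

section
variable {Ω : Set V2} {φ : V2 → ℝ} {p : ℝ}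

lemma Smooth2.slice {f : ℝ → V2 → ℝ} (h : Smooth2 f) (t : ℝ) : Sm (f t) := by
  have : ContDiff ℝ (⊤ : ℕ∞) (fun x : V2 => (t, x)) := by fun_prop
  exact ContDiff.comp (g := fun p : ℝ × V2 => f p.1 p.2) h this

lemma Smooth2.hasDt {f : ℝ → V2 → ℝ} (h : Smooth2 f) (t : ℝ) (x : V2) :
    HasDerivAt (fun s => f s x) (fderiv ℝ (fun p : ℝ × V2 => f p.1 p.2) (t, x) (1, 0)) t := by
  have h1 : HasDerivAt (fun s : ℝ => (s, x)) ((1 : ℝ), (0 : V2)) t := (hasDerivAt_id t).prodMk (hasDerivAt_const t x)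
  exact HasFDerivAt.comp_hasDerivAt (l := fun p : ℝ × V2 => f p.1 p.2) t ((h.differentiable (by simp)) (t, x)).hasFDerivAt h1

lemma Smooth2.sdt {f : ℝ → V2 → ℝ} (h : Smooth2 f) (t : ℝ) : Sm (fun x => dt f t x) := by
  have e : (fun x => dt f t x) = fun x => fderiv ℝ (fun p : ℝ × V2 => f p.1 p.2) (t, x) (1, 0) := funext fun x => (h.hasDt t x).deriv
  rw [e]
  have h1 : ContDiff ℝ (⊤ : ℕ∞) (fun x : V2 => (t, x)) := by fun_prop
  have h2 : ContDiff ℝ (⊤ : ℕ∞) (fderiv ℝ (fun p : ℝ × V2 => f p.1 p.2)) := h.fderiv_right (by simp)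
  exact (ContDiff.comp (g := fderiv ℝ (fun p : ℝ × V2 => f p.1 p.2)) h2 h1).clm_apply contDiff_const

lemma dt_mul {f g : ℝ → V2 → ℝ} (hf : Smooth2 f) (hg : Smooth2 g) (t : ℝ) (x : V2) :
    dt (fun s y => f s y * g s y) t x = dt f t x * g t x + f t x * dt g t x := by
  have a := hf.hasDt t x
  have b := hg.hasDt t x
  have c := a.mul b
  have ea : dt f t x = _ := a.deriv
  have eb : dt g t x = _ := b.deriv
  rw [ea, eb]
  exact c.deriv

lemma mixed (ho : IsOpen Ω) {F Z0 Z1 : V2 → ℝ} (hF : ∀ x ∈ Ω, DifferentiableAt ℝ F x) (h0 : Sm Z0) (h1 : Sm Z1)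
    (e0 : ∀ x ∈ Ω, pd 0 F x = Z0 x) (e1 : ∀ x ∈ Ω, pd 1 F x = Z1 x) {x : V2} (hx : x ∈ Ω) : pd 1 Z0 x = pd 0 Z1 x := by
  have ev : ∀ᶠ y in 𝓝 x, HasFDerivAt F (Z0 y • (ContinuousLinearMap.proj 0 : V2 →L[ℝ] ℝ) + Z1 y • (ContinuousLinearMap.proj 1 : V2 →L[ℝ] ℝ)) y := by
    filter_upwards [ho.mem_nhds hx] with y hy
    have := (hF y hy).hasFDerivAt
    have e : (Z0 y • (ContinuousLinearMap.proj 0 : V2 →L[ℝ] ℝ) + Z1 y • (ContinuousLinearMap.proj 1 : V2 →L[ℝ] ℝ)) = fderiv ℝ F y := by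
      refine ContinuousLinearMap.ext fun v => ?_
      rw [fderiv_apply_eq, e0 y hy, e1 y hy]
      simp; ring
    rw [e]; exact this
  have d := ((h0.diff x).hasFDerivAt.smul_const (ContinuousLinearMap.proj 0 : V2 →L[ℝ] ℝ)).add
    ((h1.diff x).hasFDerivAt.smul_const (ContinuousLinearMap.proj 1 : V2 →L[ℝ] ℝ))
  have := second_derivative_symmetric_of_eventually ev d (Pi.single 0 1) (Pi.single 1 1)
  simp at this
  unfold pd
  linarith

section sol
variable {n : V2 → V2} {a γ μ lam ν T : ℝ} {ρ : ℝ → V2 → ℝ} {u B : ℝ → V2 → V2}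

lemma Sm.dot {X : V2 → V2} (hX : ∀ i, Sm (fun y => X y i)) {f : V2 → ℝ} (hf : Sm f) : Sm (fun x => dot (X x) (grad f x)) := by
  have e : (fun x => MHD.dot (X x) (grad f x)) = fun x => X x 0 * MHD.pd 0 f x + X x 1 * MHD.pd 1 f x := by
    funext x; simp [MHD.dot, grad, Fin.sum_univ_two]
  rw [e]
  exact ((hX 0).mul (hf.pd 0)).add ((hX 1).mul (hf.pd 1))

lemma sW (hρ : Smooth2 ρ) (hu : Smooth2V u) (t : ℝ) (i : Fin 2) : Sm (fun x => ρ t x * matD u t x i) := by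
  refine (hρ.slice t).mul ?_
  exact ((hu i).sdt t).add (Sm.dot (fun j => (hu j).slice t) ((hu i).slice t))

lemma sdiv (hu : Smooth2V u) (t : ℝ) : Sm (fun x => div2 (u t) x) := by
  have e : (fun x => div2 (u t) x) = fun x => pd 0 (fun y => u t y 0) x + pd 1 (fun y => u t y 1) x := by
    funext x; simp [div2, Fin.sum_univ_two]
  rw [e]
  exact (((hu 0).slice t).pd 0).add (((hu 1).slice t).pd 1)

lemma scurl (hu : Smooth2V u) (t : ℝ) : Sm (curl2 (u t)) := (((hu 1).slice t).pd 0).sub (((hu 0).slice t).pd 1)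

lemma snsq (hB : Smooth2V B) (t : ℝ) : Sm (fun x => nsq (B t x)) := by
  have e : (fun x => nsq (B t x)) = fun x => B t x 0 * B t x 0 + B t x 1 * B t x 1 := by
    funext x; simp [nsq, Fin.sum_univ_two]; ring
  rw [e]
  exact (((hB 0).slice t).mul ((hB 0).slice t)).add (((hB 1).slice t).mul ((hB 1).slice t))

lemma dP (hγ : 1 < γ) (hρ : Smooth2 ρ) (t : ℝ) (x : V2) : DifferentiableAt ℝ (fun y => a * ρ t y ^ γ) x :=
  ((hρ.slice t).diff x |>.rpow_const (Or.inr hγ.le)).const_mul a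

lemma pdF (hγ : 1 < γ) (hρ : Smooth2 ρ) (hu : Smooth2V u) (hB : Smooth2V B) (t : ℝ) (x : V2) (i : Fin 2) :
    pd i (Fflux Ω a γ μ lam ρ u B t) x = (2 * μ + lam) * pd i (fun y => div2 (u t) y) x - pd i (fun y => a * ρ t y ^ γ) x - pd i (fun y => nsq (B t y)) x / 2
    ∧ DifferentiableAt ℝ (Fflux Ω a γ μ lam ρ u B t) x := by
  have e : Fflux Ω a γ μ lam ρ u B t = fun x => ((2 * μ + lam) * div2 (u t) x - (a * ρ t x ^ γ - Pbar Ω a γ ρ t)) - (1 / 2) * nsq (B t x) := by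
    funext x; unfold Fflux; ring
  have d1 := (sdiv hu t).diff x
  have d2 := dP (a := a) hγ hρ t x
  have d3 := (snsq hB t).diff x
  have d4 : DifferentiableAt ℝ (fun x => a * ρ t x ^ γ - Pbar Ω a γ ρ t) x := d2.sub_const _
  have d5 : DifferentiableAt ℝ (fun x => (2 * μ + lam) * div2 (u t) x) x := d1.const_mul _
  have d6 : DifferentiableAt ℝ (fun x => (1 / 2 : ℝ) * nsq (B t x)) x := d3.const_mul _
  have d7 : DifferentiableAt ℝ (fun x => (2 * μ + lam) * div2 (u t) x - (a * ρ t x ^ γ - Pbar Ω a γ ρ t)) x := d5.sub d4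
  rw [e]
  refine ⟨?_, d7.sub d6⟩
  rw [pd_sub i d7 d6, pd_sub i d5 d4, pd_sub i d2 (by fun_prop), pd_const_mul i _ d1, pd_const_mul i _ d3, pd_const]
  ring

lemma momentum' (hρ : Smooth2 ρ) (hu : Smooth2V u) (hs : IsMHDSol Ω n a γ μ lam ν (Ioc 0 T) ρ u B) {t : ℝ} (ht : t ∈ Ioc 0 T) {x : V2} (hx : x ∈ Ω) (i : Fin 2) :
    ρ t x * matD u t x i + pd i (fun y => a * ρ t y ^ γ) x = μ * lap (fun y => u t y i) x
      + (μ + lam) * pd i (fun y => div2 (u t) y) x + dot (B t x) (grad (fun y => B t y i) x) - pd i (fun y => nsq (B t y)) x / 2 := by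
  rw [← hs.momentum t ht x hx i]
  have m := hs.mass t ht x hx
  have r := hρ.slice t
  have s := fun j => (hu j).slice t
  have pm : ∀ j, pd j (fun y => ρ t y * u t y i * u t y j) x = u t x i * pd j (fun y => ρ t y * u t y j) x + ρ t x * u t x j * pd j (fun y => u t y i) x := by
    intro j
    rw [(r.mul (s i)).pdmul (s j), r.pdmul (s i), r.pdmul (s j)]; ring
  simp only [div2, Fin.sum_univ_two] at m
  rw [Fin.sum_univ_two, pm, pm, dt_mul hρ (hu i)]
  simp only [matD, dot, grad, Fin.sum_univ_two]
  linear_combination (-u t x i) * m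

lemma gradF (hγ : 1 < γ) (hρ : Smooth2 ρ) (hu : Smooth2V u) (hB : Smooth2V B) (hs : IsMHDSol Ω n a γ μ lam ν (Ioc 0 T) ρ u B)
    {t : ℝ} (ht : t ∈ Ioc 0 T) {x : V2} (hx : x ∈ Ω) :
    pd 0 (Fflux Ω a γ μ lam ρ u B t) x = ρ t x * matD u t x 0 - dot (B t x) (grad (fun y => B t y 0) x) + μ * pd 1 (curl2 (u t)) x ∧
    pd 1 (Fflux Ω a γ μ lam ρ u B t) x = ρ t x * matD u t x 1 - dot (B t x) (grad (fun y => B t y 1) x) - μ * pd 0 (curl2 (u t)) x := by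
  have m := fun i => momentum' hρ hu hs ht hx i
  have f := fun i => (pdF (Ω := Ω) (a := a) (μ := μ) (lam := lam) hγ hρ hu hB t x i).1
  have s := fun j => (hu j).slice t
  have ec : curl2 (u t) = fun x => pd 0 (fun y => u t y 1) x - pd 1 (fun y => u t y 0) x := rfl
  have ed : (fun x => div2 (u t) x) = fun x => pd 0 (fun y => u t y 0) x + pd 1 (fun y => u t y 1) x := by
    funext x; simp [div2, Fin.sum_univ_two]
  have c : ∀ i, pd i (curl2 (u t)) x = pd i (pd 0 (fun y => u t y 1)) x - pd i (pd 1 (fun y => u t y 0)) x := fun i => by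
    rw [ec, ((s 1).pd 0).pdsub ((s 0).pd 1)]
  have d : ∀ i, pd i (fun x => div2 (u t) x) x = pd i (pd 0 (fun y => u t y 0)) x + pd i (pd 1 (fun y => u t y 1)) x := fun i => by
    rw [ed, ((s 0).pd 0).pdadd ((s 1).pd 1)]
  have k0 := pd_comm (s 0).two 0 1 x
  have k1 := pd_comm (s 1).two 0 1 x
  have m0 := m 0
  have m1 := m 1
  simp only [lap, Fin.sum_univ_two] at m0 m1
  rw [f, f, c, c]
  rw [d] at *
  rw [d] at *
  constructor
  · linear_combination μ * k1 - m0
  · linear_combination (-m1) - μ * k0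

lemma omega_eq (D : Dom Ω φ) (hγ : 1 < γ) (hρ : Smooth2 ρ) (hu : Smooth2V u) (hB : Smooth2V B) (hs : IsMHDSol Ω n a γ μ lam ν (Ioc 0 T) ρ u B)
    {t : ℝ} (ht : t ∈ Ioc 0 T) {x : V2} (hx : x ∈ Ω) :
    μ * L (curl2 (u t)) x = pd 0 (fun y => ρ t y * matD u t y 1 - dot (B t y) (grad (fun z => B t z 1) y)) x
      - pd 1 (fun y => ρ t y * matD u t y 0 - dot (B t y) (grad (fun z => B t z 0) y)) x := by
  have sE := fun i => Sm.dot (fun j => (hB j).slice t) ((hB i).slice t)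
  have sg := fun i => (sW hρ hu t i).sub (sE i)
  have so := fun j => (Sm.con μ).mul ((scurl hu t).pd j)
  have := mixed D.op (fun x hx => (pdF (Ω := Ω) (a := a) (μ := μ) (lam := lam) hγ hρ hu hB t x 0).2) ((sg 0).add (so 1)) ((sg 1).sub (so 0))
    (fun x hx => (gradF hγ hρ hu hB hs ht hx).1) (fun x hx => (gradF hγ hρ hu hB hs ht hx).2) hx
  rw [(sg 0).pdadd (so 1), (sg 1).pdsub (so 0), pd_const_mul _ _ (((scurl hu t).pd 1).diff x), pd_const_mul _ _ (((scurl hu t).pd 0).diff x)] at this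
  unfold L
  linear_combination this

end sol
end

section
variable {Ω : Set V2} {φ : V2 → ℝ} {p : ℝ}

lemma nsq_two (w : V2) : nsq w = w 0 ^ 2 + w 1 ^ 2 := by simp [nsq, Fin.sum_univ_two]

lemma SmoothDomain.dom {n : V2 → V2} (h : SmoothDomain Ω n) (hc : Convex ℝ Ω) : ∃ φ, Dom Ω φ ∧
    ∀ x ∈ frontier Ω, ∀ w : V2, dot w (n x) = 0 → pd 0 φ x * w 0 + pd 1 φ x * w 1 = 0 := by
  obtain ⟨φ, sm, he, hf, hg, hn⟩ := h.defining
  have gr : ∀ x, φ x = 0 → 0 < (pd 0 φ x) ^ 2 + (pd 1 φ x) ^ 2 := by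
    intro x hx
    have hx : x ∈ frontier Ω := by rw [hf]; exact hx
    by_contra hcon
    have a0 := sq_nonneg (pd 0 φ x)
    have a1 := sq_nonneg (pd 1 φ x)
    have b0 : pd 0 φ x = 0 := by
      have : pd 0 φ x ^ 2 = 0 := by linarith
      exact pow_eq_zero_iff (two_ne_zero) |>.1 this
    have b1 : pd 1 φ x = 0 := by
      have : pd 1 φ x ^ 2 = 0 := by linarith
      exact pow_eq_zero_iff (two_ne_zero) |>.1 this
    refine hg x hx (funext fun i => ?_)
    fin_cases i
    · exact b0
    · exact b1
  refine ⟨φ, ⟨h.nonempty, hc, h.bounded, sm, he, hf, gr⟩, fun x hx w hw => ?_⟩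
  have g := gr x (by rw [hf] at hx; exact hx)
  have hs : 0 < Real.sqrt (nsq (grad φ x)) := by
    rw [Real.sqrt_pos, nsq_two]; exact g
  rw [hn x hx] at hw
  simp only [dot, Fin.sum_univ_two, Pi.smul_apply, smul_eq_mul, grad] at hw
  have : (Real.sqrt (nsq (grad φ x)))⁻¹ * (pd 0 φ x * w 0 + pd 1 φ x * w 1) = 0 := by
    linear_combination hw
  exact (mul_eq_zero.1 this).resolve_left (inv_pos.2 hs).ne'

lemma gnsq_eq (X : V2 → V2) (x : V2) : gnsq X x = (pd 0 (fun y => X y 0) x ^ 2 + pd 1 (fun y => X y 0) x ^ 2) + (pd 0 (fun y => X y 1) x ^ 2 + pd 1 (fun y => X y 1) x ^ 2) := by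
  simp [gnsq, Fin.sum_univ_two]

lemma gnsq_int (D : Dom Ω φ) (hp : 2 ≤ p) {a b c d : V2 → ℝ} (ha : Continuous a) (hb : Continuous b) (hc : Continuous c) (hd : Continuous d) :
    ∫ x in Ω, ((a x ^ 2 + b x ^ 2) + (c x ^ 2 + d x ^ 2)) ^ (p / 2) ≤ 2 ^ p * 2 ^ p * (S p Ω a + S p Ω b + (S p Ω c + S p Ω d)) := by
  refine (int_add_le D hp (by fun_prop) (by fun_prop) (fun x => by positivity) (fun x => by positivity)).trans ?_
  rw [mul_assoc]
  refine mul_le_mul_of_nonneg_left ?_ (by positivity)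
  have h1 := int_le2 D hp ha hb
  have h2 := int_le2 D hp hc hd
  linarith

lemma g2nsq_eq (X : V2 → V2) (x : V2) : g2nsq X x =
    ((pd 0 (pd 0 (fun y => X y 0)) x ^ 2 + pd 1 (pd 0 (fun y => X y 0)) x ^ 2) + (pd 0 (pd 1 (fun y => X y 0)) x ^ 2 + pd 1 (pd 1 (fun y => X y 0)) x ^ 2))
    + ((pd 0 (pd 0 (fun y => X y 1)) x ^ 2 + pd 1 (pd 0 (fun y => X y 1)) x ^ 2) + (pd 0 (pd 1 (fun y => X y 1)) x ^ 2 + pd 1 (pd 1 (fun y => X y 1)) x ^ 2)) := by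
  simp [g2nsq, Fin.sum_univ_two]

/-- estimate (i) -/
lemma part_one (D : Dom Ω φ) (hp : 2 ≤ p) : ∃ K ≥ 0, ∀ X : V2 → V2, (∀ i, Sm (fun y => X y i)) → (∀ x ∈ Ω, div2 X x = 0) →
    (∀ x ∈ frontier Ω, pd 0 φ x * X x 0 + pd 1 φ x * X x 1 = 0) → LpG p Ω X ≤ K * LpS p Ω (curl2 X) := by
  obtain ⟨K, hK, hE⟩ := D.first_est hp
  refine ⟨(2 ^ p * 2 ^ p * K) ^ (1 / p), by positivity, fun X sX dX tX => ?_⟩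
  let A : Adm Ω φ := ⟨fun y => X y 0, fun y => X y 1, curl2 X, ⟨sX 0, sX 1, ((sX 1).pd 0).sub ((sX 0).pd 1), fun x hx => by
    have := dX x hx
    simpa [div2, Fin.sum_univ_two] using this, fun x hx => rfl⟩, tX⟩
  have h := hE A
  have h2 := gnsq_int D hp ((sX 0).pd 0).cont ((sX 0).pd 1).cont ((sX 1).pd 0).cont ((sX 1).pd 1).cont
  simp only [← gnsq_eq] at h2
  have h3 : ∫ x in Ω, gnsq X x ^ (p / 2) ≤ (2 ^ p * 2 ^ p * K) * S p Ω (curl2 X) := by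
    refine h2.trans ?_
    rw [mul_assoc (2 ^ p * 2 ^ p)]
    exact mul_le_mul_of_nonneg_left h (by positivity)
  have n0 : 0 ≤ ∫ x in Ω, gnsq X x ^ (p / 2) := integral_nonneg fun x => Real.rpow_nonneg (by rw [gnsq_eq]; positivity) _
  unfold LpG LpS
  refine (Real.rpow_le_rpow n0 h3 (by positivity)).trans ?_
  rw [Real.mul_rpow (by positivity) (S_nonneg _ _ _)]
  exact le_rfl

/-- estimate (ii) on the level of abstract data -/
lemma part_two (D : Dom Ω φ) (hp : 2 ≤ p) {μ : ℝ} (hμ : 0 < μ) : ∃ K ≥ 0, ∀ (c : Cfg Ω φ μ) (W E U v : V2 → V2) (F : V2 → ℝ),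
    (∀ i, c.W i = fun y => W y i) → (∀ i, c.E i = fun y => E y i) → (∀ i, c.U i = fun y => U y i) →
    c.A.X0 = (fun y => v y 0) → c.A.X1 = (fun y => v y 1) →
    (∀ x ∈ Ω, pd 0 F x = c.W 0 x - c.E 0 x + μ * pd 1 c.om x) → (∀ x ∈ Ω, pd 1 F x = c.W 1 x - c.E 1 x - μ * pd 0 c.om x) →
    LpV p Ω (grad F) + LpG2 p Ω v + LpV p Ω (grad c.om) ≤ K * (LpV p Ω W + LpG p Ω U + LpV p Ω E) := by
  obtain ⟨K, hK, hE⟩ := D.cfg hp hμ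
  have q1 : (1:ℝ) ≤ 2 ^ p := Real.one_le_rpow (by norm_num) (by linarith)
  refine ⟨3 * (2 ^ p * (2 ^ p * 2 ^ p) * (8 * K) * 4) ^ (1 / p), by positivity, fun c W E U v F eW eE eU e0 e1 f0 f1 => ?_⟩
  obtain ⟨ho, hz0, hz1, hs⟩ := hE c
  set J1 := ∫ x in Ω, nsq (W x) ^ (p / 2) with hJ1
  set J2 := ∫ x in Ω, gnsq U x ^ (p / 2) with hJ2
  set J3 := ∫ x in Ω, nsq (E x) ^ (p / 2) with hJ3
  have cW : ∀ i, Continuous (fun y => W y i) := fun i => by rw [← eW i]; exact (c.sW i).cont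
  have cE : ∀ i, Continuous (fun y => E y i) := fun i => by rw [← eE i]; exact (c.sE i).cont
  have cU : ∀ i j, Continuous (pd j (fun y => U y i)) := fun i j => by rw [← eU i]; exact ((c.sU i).pd j).cont
  have cnW : Continuous (fun x => nsq (W x)) := by
    have := cW 0; have := cW 1
    simp only [nsq_two]; fun_prop
  have cnE : Continuous (fun x => nsq (E x)) := by
    have := cE 0; have := cE 1
    simp only [nsq_two]; fun_prop
  have cnU : Continuous (fun x => gnsq U x) := by
    have := cU 0 0; have := cU 0 1; have := cU 1 0; have := cU 1 1
    simp only [gnsq_eq]; fun_prop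
  have j1 : ∀ i, S p Ω (c.W i) ≤ J1 := fun i => S_le_of D hp (c.sW i).cont cnW fun x => by
    rw [eW i, nsq_two]
    have := sq_nonneg (W x 0); have := sq_nonneg (W x 1)
    fin_cases i <;> simp only [Fin.zero_eta, Fin.mk_one] <;> linarith
  have j3 : ∀ i, S p Ω (c.E i) ≤ J3 := fun i => S_le_of D hp (c.sE i).cont cnE fun x => by
    rw [eE i, nsq_two]
    have := sq_nonneg (E x 0); have := sq_nonneg (E x 1)
    fin_cases i <;> simp only [Fin.zero_eta, Fin.mk_one] <;> linarith
  have j2 : ∀ i j, S p Ω (pd j (c.U i)) ≤ J2 := fun i j => S_le_of D hp ((c.sU i).pd j).cont cnU fun x => by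
    rw [eU i, gnsq_eq]
    have := sq_nonneg (pd 0 (fun y => U y 0) x); have := sq_nonneg (pd 1 (fun y => U y 0) x)
    have := sq_nonneg (pd 0 (fun y => U y 1) x); have := sq_nonneg (pd 1 (fun y => U y 1) x)
    fin_cases i <;> fin_cases j <;> simp only [Fin.zero_eta, Fin.mk_one] <;> linarith
  have p1 : 0 ≤ J1 := (S_nonneg _ _ _).trans (j1 0)
  have p2 : 0 ≤ J2 := (S_nonneg _ _ _).trans (j2 0 0)
  have p3 : 0 ≤ J3 := (S_nonneg _ _ _).trans (j3 0)
  have nn : c.nn p ≤ 4 * (J1 + J2 + J3) := by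
    unfold Cfg.nn
    linarith [j1 0, j1 1, j3 0, j3 1, j2 0 0, j2 0 1, j2 1 0, j2 1 1]
  have kn : K * c.nn p ≤ K * (4 * (J1 + J2 + J3)) := mul_le_mul_of_nonneg_left nn hK
  have kn0 : 0 ≤ K * (4 * (J1 + J2 + J3)) := by positivity
  have q2 : (2:ℝ) ^ p ≤ 2 ^ p * (2 ^ p * 2 ^ p) := by
    have : (1:ℝ) ≤ 2 ^ p * 2 ^ p := by nlinarith
    nlinarith
  have two : ∀ {I y : ℝ}, I ≤ 2 ^ p * y → y ≤ 8 * (K * (4 * (J1 + J2 + J3))) → I ≤ (2 ^ p * (2 ^ p * 2 ^ p) * (8 * K) * 4) * (J1 + J2 + J3) := by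
    intro I y h1 h2
    have a : (2:ℝ) ^ p * y ≤ 2 ^ p * (8 * (K * (4 * (J1 + J2 + J3)))) := mul_le_mul_of_nonneg_left h2 (by positivity)
    have b : (2:ℝ) ^ p * (8 * (K * (4 * (J1 + J2 + J3)))) ≤ (2 ^ p * (2 ^ p * 2 ^ p)) * (8 * (K * (4 * (J1 + J2 + J3)))) := mul_le_mul_of_nonneg_right q2 (by positivity)
    refine h1.trans (a.trans (b.trans (le_of_eq ?_)))
    ring
  have I1 : ∫ x in Ω, nsq (grad F x) ^ (p / 2) ≤ (2 ^ p * (2 ^ p * 2 ^ p) * (8 * K) * 4) * (J1 + J2 + J3) := by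
    have e : ∫ x in Ω, nsq (grad F x) ^ (p / 2) = ∫ x in Ω, ((c.W 0 x - c.E 0 x + μ * pd 1 c.om x) ^ 2 + (c.W 1 x - c.E 1 x - μ * pd 0 c.om x) ^ 2) ^ (p / 2) := by
      refine setIntegral_congr_fun D.op.measurableSet fun x hx => ?_
      simp only [nsq_two, grad]
      rw [f0 x hx, f1 x hx]
    have a0 := (c.sW 0).cont; have a1 := (c.sW 1).cont; have a2 := (c.sE 0).cont; have a3 := (c.sE 1).cont
    have a4 := (c.so.pd 0).cont; have a5 := (c.so.pd 1).cont
    rw [e]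
    exact two (int_le2 D hp (by fun_prop) (by fun_prop)) (by linarith)
  have I3 : ∫ x in Ω, nsq (grad c.om x) ^ (p / 2) ≤ (2 ^ p * (2 ^ p * 2 ^ p) * (8 * K) * 4) * (J1 + J2 + J3) := by
    simp only [nsq_two, grad]
    have := ho 0; have := ho 1
    exact two (int_le2 D hp (c.so.pd 0).cont (c.so.pd 1).cont) (by linarith)
  have I2 : ∫ x in Ω, g2nsq v x ^ (p / 2) ≤ (2 ^ p * (2 ^ p * 2 ^ p) * (8 * K) * 4) * (J1 + J2 + J3) := by
    have s0 : Sm (fun y => v y 0) := e0 ▸ c.A.pr.s0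
    have s1 : Sm (fun y => v y 1) := e1 ▸ c.A.pr.s1
    have k0 := fun j k => ((s0.pd k).pd j).cont
    have k1 := fun j k => ((s1.pd k).pd j).cont
    rw [e0, e1] at hs
    have t0 := gnsq_int D hp (k0 0 0) (k0 1 0) (k0 0 1) (k0 1 1)
    have t1 := gnsq_int D hp (k1 0 0) (k1 1 0) (k1 0 1) (k1 1 1)
    have := k0 0 0; have := k0 0 1; have := k0 1 0; have := k0 1 1
    have := k1 0 0; have := k1 0 1; have := k1 1 0; have := k1 1 1
    simp only [g2nsq_eq]
    refine (int_add_le D hp (by fun_prop) (by fun_prop) (fun x => by positivity) (fun x => by positivity)).trans ?_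
    have b : ∀ {y : ℝ}, y ≤ 4 * (K * (4 * (J1 + J2 + J3))) → (2:ℝ) ^ p * 2 ^ p * y ≤ 2 ^ p * 2 ^ p * (4 * (K * (4 * (J1 + J2 + J3)))) :=
      fun h => mul_le_mul_of_nonneg_left h (by positivity)
    have t0' := t0.trans (b (by linarith [(hs 0 0).1, (hs 0 1).1, (hs 1 0).1, (hs 1 1).1]))
    have t1' := t1.trans (b (by linarith [(hs 0 0).2, (hs 0 1).2, (hs 1 0).2, (hs 1 1).2]))
    refine (mul_le_mul_of_nonneg_left (add_le_add t0' t1') (by positivity)).trans (le_of_eq ?_)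
    ring
  have r1 := root_le hp (integral_nonneg fun x => Real.rpow_nonneg (by rw [nsq_two]; positivity) _) (by positivity) p1 p2 p3 I1
  have r2 := root_le hp (integral_nonneg fun x => Real.rpow_nonneg (by rw [g2nsq_eq]; positivity) _) (by positivity) p1 p2 p3 I2
  have r3 := root_le hp (integral_nonneg fun x => Real.rpow_nonneg (by rw [nsq_two]; positivity) _) (by positivity) p1 p2 p3 I3
  unfold LpV LpG2 LpG
  linarith

lemma const_up {K C x y : ℝ} (h : x ≤ K * y) (hy : 0 ≤ y) (hKC : K ≤ C) : x ≤ C * y := h.trans (mul_le_mul_of_nonneg_right hKC hy)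

theorem final
    (Ω : Set V2) (n : V2 → V2) (hΩ : SmoothDomain Ω n) (hconv : Convex ℝ Ω)
    (μ : ℝ) (hμ : 0 < μ) (p : ℝ) (hp : 2 ≤ p) :
    ∃ C > (0:ℝ), ∀ (a γ lam ν T : ℝ) (ρ : ℝ → V2 → ℝ) (u B : ℝ → V2 → V2),
      0 < a → 1 < γ → 0 ≤ μ + lam → 0 < ν → 0 < T →
      Smooth2 ρ → Smooth2V u → Smooth2V B →
      IsMHDSol Ω n a γ μ lam ν (Ioc 0 T) ρ u B →
      ∀ t ∈ Ioc 0 T,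
        (LpG p Ω (B t) ≤ C * LpS p Ω (curl2 (B t))) ∧
        (∀ (v : V2 → V2) (q : V2 → ℝ),
          (∀ i, ContDiff ℝ (⊤ : ℕ∞) fun y => v y i) → ContDiff ℝ (⊤ : ℕ∞) q →
          (∀ x ∈ Ω, u t x = v x + grad q x) →
          (∀ x ∈ Ω, div2 v x = 0) →
          (∀ x ∈ frontier Ω, dot (v x) (n x) = 0) →
          LpV p Ω (grad (Fflux Ω a γ μ lam ρ u B t)) + LpG2 p Ω v
              + LpV p Ω (grad (curl2 (u t)))
            ≤ C * (LpV p Ω (fun x k => ρ t x * matD u t x k)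
                + LpG p Ω (u t)
                + LpV p Ω (fun x k => dot (B t x) (grad (fun y => B t y k) x)))) := by
  obtain ⟨φ, D, htan⟩ := hΩ.dom hconv
  obtain ⟨K1, hK1, h1⟩ := part_one D hp
  obtain ⟨K2, hK2, h2⟩ := part_two D hp hμ
  refine ⟨1 + K1 + K2, by positivity, fun a γ lam ν T ρ u B ha hγ hl hν hT hρ hu hB hs t ht => ⟨?_, fun v q sv sq hdec hdv htv => ?_⟩⟩
  · refine const_up (h1 (B t) (fun i => (hB i).slice t) (hs.divB t ht) fun x hx => htan x hx _ (hs.slipB t ht x hx).1) ?_ (by linarith)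
    exact Real.rpow_nonneg (S_nonneg _ _ _) _
  · have sq' : Sm q := sq
    have sE := fun i => Sm.dot (fun j => (hB j).slice t) ((hB i).slice t)
    let A : Adm Ω φ := ⟨fun y => v y 0, fun y => v y 1, curl2 (u t), ⟨sv 0, sv 1, scurl hu t, fun x hx => by
      have := hdv x hx
      simpa [div2, Fin.sum_univ_two] using this, fun x hx => by
        have e : ∀ i k, pd k (fun y => u t y i) x = pd k (fun y => v y i) x + pd k (pd i q) x := by
          intro i k
          have : Sm (fun y => v y i) := sv i
          rw [← this.pdadd (sq'.pd i)]
          exact pd_congr_on D.op hx k fun y hy => by rw [hdec y hy]; rfl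
        have k := pd_comm sq'.two 0 1 x
        unfold curl2
        rw [e, e]; linarith⟩, fun x hx => htan x hx _ (htv x hx)⟩
    let c : Cfg Ω φ μ := ⟨fun i x => ρ t x * matD u t x i, fun i x => dot (B t x) (grad (fun y => B t y i) x), fun i y => u t y i, curl2 (u t),
      fun i => sW hρ hu t i, sE, fun i => (hu i).slice t, scurl hu t, fun x => rfl, fun x hx => (hs.slipU t ht x hx).2,
      fun x hx => omega_eq D hγ hρ hu hB hs ht hx, A, rfl⟩
    refine const_up (h2 c (fun x k => ρ t x * matD u t x k) (fun x k => dot (B t x) (grad (fun y => B t y k) x)) (u t) v (Fflux Ω a γ μ lam ρ u B t)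
      (fun i => rfl) (fun i => rfl) (fun i => rfl) rfl rfl (fun x hx => (gradF hγ hρ hu hB hs ht hx).1) (fun x hx => (gradF hγ hρ hu hB hs ht hx).2)) ?_ (by linarith)
    have nonneg : ∀ {f : V2 → ℝ}, (∀ x, 0 ≤ f x) → 0 ≤ (∫ x in Ω, f x ^ (p / 2)) ^ (1 / p) := fun hf =>
      Real.rpow_nonneg (integral_nonneg fun x => Real.rpow_nonneg (hf x) _) _
    unfold LpV LpG
    refine add_nonneg (add_nonneg (nonneg fun x => ?_) (nonneg fun x => ?_)) (nonneg fun x => ?_)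
    · rw [nsq_two]; positivity
    · rw [gnsq_eq]; positivity
    · rw [nsq_two]; positivity
end

/-- Lemma 2.7, estimates (2.3)–(2.4).
For smooth solutions of compressible MHD with Navier-slip boundary conditions and
`2 ≤ p < ∞`, with `C = C(p, μ, Ω)`:
(i) `‖∇B‖_{L^p} ≤ C‖curl B‖_{L^p}`;
(ii) `‖∇F‖_{L^p} + ‖∇²𝒫u‖_{L^p} + ‖∇ω‖_{L^p} ≤ C(‖ρu̇‖_{L^p} + ‖∇u‖_{L^p} + ‖B·∇B‖_{L^p})`,
where `𝒫u` is expressed through an (arbitrary) Helmholtz decomposition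
`u = v + ∇q` with `div v = 0` in `Ω` and `v·n = 0` on `∂Ω`. -/
theorem stmt_8
    (Ω : Set V2) (n : V2 → V2) (hΩ : SmoothDomain Ω n) (hconv : Convex ℝ Ω)
    (μ : ℝ) (hμ : 0 < μ) (p : ℝ) (hp : 2 ≤ p) :
    ∃ C > (0:ℝ), ∀ (a γ lam ν T : ℝ) (ρ : ℝ → V2 → ℝ) (u B : ℝ → V2 → V2),
      0 < a → 1 < γ → 0 ≤ μ + lam → 0 < ν → 0 < T →
      Smooth2 ρ → Smooth2V u → Smooth2V B →
      IsMHDSol Ω n a γ μ lam ν (Ioc 0 T) ρ u B →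
      ∀ t ∈ Ioc 0 T,
        (LpG p Ω (B t) ≤ C * LpS p Ω (curl2 (B t))) ∧
        (∀ (v : V2 → V2) (q : V2 → ℝ),
          (∀ i, ContDiff ℝ (⊤ : ℕ∞) fun y => v y i) → ContDiff ℝ (⊤ : ℕ∞) q →
          (∀ x ∈ Ω, u t x = v x + grad q x) →
          (∀ x ∈ Ω, div2 v x = 0) →
          (∀ x ∈ frontier Ω, dot (v x) (n x) = 0) →
          LpV p Ω (grad (Fflux Ω a γ μ lam ρ u B t)) + LpG2 p Ω v
              + LpV p Ω (grad (curl2 (u t)))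
            ≤ C * (LpV p Ω (fun x k => ρ t x * matD u t x k)
                + LpG p Ω (u t)
                + LpV p Ω (fun x k => dot (B t x) (grad (fun y => B t y k) x)))) := by
  exact final Ω n hΩ hconv μ hμ p hp

end MHD
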